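/- Suppose v = 1, i.e. all θ_k are rational. If t lies in Z ∩ 𝔻, where Z is the set of accumulation points of the zeros of the sequence (Φ_n), then there exist integers 0 ≤ s_k < q_k for k = 1,…,m such that Σ_{k=1}^m (β_k ϑ_k/(a_k − t)) e^{2πi s_k/q_k} = 0. -/

import Mathlib

open scoped Real Topology
open Filter MeasureTheory Metric Set Polynomial Complex
open Finset (mul_sum sum_le_sum sum_congr sum_mul sum_sub_distrib sum_nonneg sum_add_distrib abs_sum_le_sum_abs sum_div sum_range_succ sum_Ico_succ_top single_le_sum sum_const ne_of_mem_erase sum_neg_distrib prod_congr sum_Ico_sub prod_nonneg sum_insert sum_eq_zero sum_eq_single sum_Ico_consecutive sum_Ico_eq_sub mul_prod_erase add_sum_erase prod_eq_one card_range card_univ)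
open Real (norm_of_nonneg norm_eq_abs rpow_le_rpow_of_nonpos pi_pos rpow_mul rpow_add rpow_neg rpow_natCast one_le_exp add_one_le_exp exp_pos)

set_option linter.unusedSectionVars false

local notation "conj" => starRingEnd ℂ

/-- The point of the unit circle with argument `θ`. -/
noncomputable def cpt (θ : ℝ) : ℂ := exp (θ * I)

/-- Integration over the unit circle against a measure on the arguments. -/
noncomputable def cI (ν : Measure ℝ) (f : ℂ → ℂ) : ℂ := ∫ θ, f (cpt θ) ∂ν


@[simp] lemma norm_cpt (θ : ℝ) : ‖cpt θ‖ = 1 := norm_exp_ofReal_mul_I θ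

@[fun_prop] lemma continuous_cpt : Continuous cpt := by unfold cpt; fun_prop

lemma cpt_mem (θ : ℝ) : cpt θ ∈ sphere (0 : ℂ) 1 := by simp

lemma conj_eq_inv_of_norm_one {z : ℂ} (hz : ‖z‖ = 1) : conj z = z⁻¹ := by
  rw [inv_def, normSq_eq_norm_sq, hz]; simp

lemma mul_conj_of_norm_one {z : ℂ} (hz : ‖z‖ = 1) : z * conj z = 1 := by
  rw [mul_conj, normSq_eq_norm_sq, hz]; simp

lemma conj_mul_of_norm_one {z : ℂ} (hz : ‖z‖ = 1) : conj z * z = 1 := by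
  rw [mul_comm, mul_conj_of_norm_one hz]

section circleIntegral

variable {ν : Measure ℝ} [IsFiniteMeasure ν]

lemma integrable_of_continuousOn_sphere {E : Type*} [NormedAddCommGroup E]
    [SecondCountableTopologyEither ℝ E] {f : ℂ → E}
    (hf : ContinuousOn f (sphere (0 : ℂ) 1)) : Integrable (fun θ => f (cpt θ)) ν := by
  obtain ⟨C, hC⟩ := (isCompact_sphere (0 : ℂ) 1).exists_bound_of_continuousOn hf
  have hc : Continuous (fun θ => f (cpt θ)) := hf.comp_continuous continuous_cpt cpt_mem
  exact Integrable.of_bound hc.aestronglyMeasurable C (.of_forall fun θ => hC _ (cpt_mem θ))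

lemma cI_add {f g : ℂ → ℂ} (hf : ContinuousOn f (sphere (0 : ℂ) 1))
    (hg : ContinuousOn g (sphere (0 : ℂ) 1)) :
    cI ν (fun z => f z + g z) = cI ν f + cI ν g :=
  integral_add (integrable_of_continuousOn_sphere hf) (integrable_of_continuousOn_sphere hg)

lemma cI_sub {f g : ℂ → ℂ} (hf : ContinuousOn f (sphere (0 : ℂ) 1))
    (hg : ContinuousOn g (sphere (0 : ℂ) 1)) :
    cI ν (fun z => f z - g z) = cI ν f - cI ν g :=
  integral_sub (integrable_of_continuousOn_sphere hf) (integrable_of_continuousOn_sphere hg)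

omit [IsFiniteMeasure ν] in
lemma cI_const_mul (c : ℂ) (f : ℂ → ℂ) : cI ν (fun z => c * f z) = c * cI ν f :=
  integral_const_mul _ _

omit [IsFiniteMeasure ν] in
lemma cI_conj (f : ℂ → ℂ) : cI ν (fun z => conj (f z)) = conj (cI ν f) := integral_conj

omit [IsFiniteMeasure ν] in
lemma cI_congr {f g : ℂ → ℂ} (h : ∀ z, ‖z‖ = 1 → f z = g z) : cI ν f = cI ν g :=
  integral_congr_ae (.of_forall fun θ => h _ (norm_cpt θ))

lemma cI_sum {ι : Type*} (s : Finset ι) {f : ι → ℂ → ℂ}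
    (hf : ∀ i ∈ s, ContinuousOn (f i) (sphere (0 : ℂ) 1)) :
    cI ν (fun z => ∑ i ∈ s, f i z) = ∑ i ∈ s, cI ν (f i) :=
  integral_finsetSum _ fun i hi => integrable_of_continuousOn_sphere (hf i hi)

/-- Expanding the inner product with a polynomial coefficientwise. -/
lemma cI_mul_conj_eval {f : ℂ → ℂ} (hf : ContinuousOn f (sphere (0 : ℂ) 1)) (P : ℂ[X]) :
    cI ν (fun z => f z * conj (P.eval z)) =
      ∑ j ∈ Finset.range (P.natDegree + 1), conj (P.coeff j) * cI ν (fun z => f z * conj z ^ j) := by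
  have : ∀ z, f z * conj (P.eval z) =
      ∑ j ∈ Finset.range (P.natDegree + 1), conj (P.coeff j) * (f z * conj z ^ j) := by
    intro z
    rw [eval_eq_sum_range, map_sum, mul_sum]
    refine sum_congr rfl fun j _ => ?_
    rw [map_mul, map_pow]; ring
  simp_rw [this]
  rw [cI_sum]
  · exact sum_congr rfl fun j _ => cI_const_mul _ _
  · intro j _; fun_prop

end circleIntegral

/-- Monic orthogonal polynomials on the unit circle for the measure `ν`. -/
structure IsOPUC (ν : Measure ℝ) (Φ : ℕ → ℂ[X]) : Prop where
  nondeg : ∀ P : ℂ[X], cI ν (fun z => P.eval z * conj (P.eval z)) = 0 → P = 0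
  monic : ∀ n, (Φ n).Monic
  natDegree : ∀ n, (Φ n).natDegree = n
  orth : ∀ n, ∀ j < n, cI ν (fun z => (Φ n).eval z * conj z ^ j) = 0

/-- Verblunsky coefficients. -/
noncomputable def vb (Φ : ℕ → ℂ[X]) (n : ℕ) : ℂ := - conj ((Φ (n + 1)).eval 0)

/-- Reversed polynomials, through the Szegő recursion. -/
noncomputable def rv (Φ : ℕ → ℂ[X]) : ℕ → ℂ[X]
  | 0 => 1
  | n + 1 => rv Φ n - C (vb Φ n) * (X * Φ n)

/-- Squared norms. -/
noncomputable def opN (ν : Measure ℝ) (Φ : ℕ → ℂ[X]) (n : ℕ) : ℝ :=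
  (cI ν (fun z => (Φ n).eval z * conj ((Φ n).eval z))).re

namespace IsOPUC

variable {ν : Measure ℝ} [IsFiniteMeasure ν] {Φ : ℕ → ℂ[X]}

lemma orth_poly (H : IsOPUC ν Φ) {n : ℕ} {P : ℂ[X]} (hP : P.natDegree < n) :
    cI ν (fun z => (Φ n).eval z * conj (P.eval z)) = 0 := by
  rw [cI_mul_conj_eval (by fun_prop)]
  refine sum_eq_zero fun j hj => ?_
  rw [H.orth n j (by grind), mul_zero]

lemma orth_rv_aux (H : IsOPUC ν Φ) {n : ℕ}
    (hn : ∀ z : ℂ, ‖z‖ = 1 → (rv Φ n).eval z = z ^ n * conj ((Φ n).eval z)) {j : ℕ}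
    (hj : 1 ≤ j) (hjn : j ≤ n) : cI ν (fun z => (rv Φ n).eval z * conj z ^ j) = 0 := by
  have : cI ν (fun z => (rv Φ n).eval z * conj z ^ j) =
      cI ν (fun z => conj ((Φ n).eval z * conj z ^ (n - j))) := by
    refine cI_congr fun z hz => ?_
    have h1 : z ^ n = z ^ (n - j) * z ^ j := by rw [← pow_add]; congr 1; omega
    rw [hn z hz, map_mul, map_pow, conj_conj, h1]
    have h2 : z ^ j * conj z ^ j = 1 := by rw [← mul_pow, mul_conj_of_norm_one hz, one_pow]
    linear_combination z ^ (n - j) * conj ((Φ n).eval z) * h2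
  rw [this, cI_conj, H.orth n (n - j) (by omega), map_zero]

lemma rec_aux (H : IsOPUC ν Φ) (n : ℕ) :
    (∀ z : ℂ, ‖z‖ = 1 → (rv Φ n).eval z = z ^ n * conj ((Φ n).eval z)) ∧
    (rv Φ n).natDegree ≤ n ∧ (rv Φ n).eval 0 = 1 ∧
    Φ (n + 1) = X * Φ n - C (conj (vb Φ n)) * rv Φ n := by
  have key : ∀ n, (∀ z : ℂ, ‖z‖ = 1 → (rv Φ n).eval z = z ^ n * conj ((Φ n).eval z)) →
      (rv Φ n).natDegree ≤ n → (rv Φ n).eval 0 = 1 →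
      Φ (n + 1) = X * Φ n - C (conj (vb Φ n)) * rv Φ n := by
    intro n h1 h2 h3
    set Q := Φ (n + 1) - X * Φ n + C (conj (vb Φ n)) * rv Φ n with hQ
    have hQ0 : Q.coeff 0 = 0 := by
      rw [coeff_zero_eq_eval_zero, hQ]
      simp [h3, vb]
    have hdeg : Q.natDegree ≤ n := by
      rw [hQ, natDegree_le_iff_coeff_eq_zero]
      intro N hN
      obtain ⟨N, rfl⟩ : ∃ M, N = M + 1 := ⟨N - 1, by omega⟩
      rw [coeff_add, coeff_sub, coeff_X_mul, coeff_C_mul,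
        coeff_eq_zero_of_natDegree_lt (p := rv Φ n) (by omega)]
      rcases (Nat.lt_succ_iff_lt_or_eq.mp hN) with h | h
      · rw [coeff_eq_zero_of_natDegree_lt (by rw [H.natDegree]; omega),
          coeff_eq_zero_of_natDegree_lt (by rw [H.natDegree]; omega)]; simp
      · have e1 : (Φ (n + 1)).coeff (N + 1) = 1 := by
          have := (H.monic (n + 1)).coeff_natDegree
          rw [H.natDegree] at this; rwa [← h]
        have e2 : (Φ n).coeff N = 1 := by
          have := (H.monic n).coeff_natDegree
          rw [H.natDegree] at this; rwa [show N = n by omega]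
        rw [e1, e2]; simp
    have horth : ∀ j, 1 ≤ j → j ≤ n → cI ν (fun z => Q.eval z * conj z ^ j) = 0 := by
      intro j hj hjn
      have : cI ν (fun z => Q.eval z * conj z ^ j) =
          cI ν (fun z => (Φ (n + 1)).eval z * conj z ^ j) -
          cI ν (fun z => (Φ n).eval z * conj z ^ (j - 1)) +
          conj (vb Φ n) * cI ν (fun z => (rv Φ n).eval z * conj z ^ j) := by
        rw [← cI_const_mul, ← cI_sub (by fun_prop) (by fun_prop),
          ← cI_add (by fun_prop) (by fun_prop)]
        refine cI_congr fun z hz => ?_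
        have h1 : conj z ^ j = conj z * conj z ^ (j - 1) := by
          rw [← pow_succ']; congr 1; omega
        rw [hQ]; simp only [eval_add, eval_sub, eval_mul, eval_X, eval_C]
        have := mul_conj_of_norm_one hz
        rw [h1]
        linear_combination (-(Φ n).eval z * conj z ^ (j - 1)) * this
      rw [this, H.orth _ _ (by omega), H.orth _ _ (by omega), H.orth_rv_aux h1 hj hjn]
      simp
    have hQz : Q = 0 := by
      apply H.nondeg
      rw [cI_mul_conj_eval (by fun_prop)]
      refine sum_eq_zero fun j hj => ?_
      rcases Nat.eq_zero_or_pos j with rfl | h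
      · rw [hQ0]; simp
      · rw [horth j h (by grind), mul_zero]
    linear_combination hQz
  suffices h : (∀ z : ℂ, ‖z‖ = 1 → (rv Φ n).eval z = z ^ n * conj ((Φ n).eval z)) ∧
    (rv Φ n).natDegree ≤ n ∧ (rv Φ n).eval 0 = 1 from ⟨h.1, h.2.1, h.2.2, key n h.1 h.2.1 h.2.2⟩
  induction n with
  | zero =>
    have : Φ 0 = 1 := (H.monic 0).natDegree_eq_zero.mp (H.natDegree 0)
    simp [rv, this]
  | succ n ih =>
    obtain ⟨h1, h2, h3⟩ := ih
    refine ⟨fun z hz => ?_, ?_, by simp [rv, h3]⟩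
    · rw [key n h1 h2 h3, rv]
      simp only [eval_sub, eval_mul, eval_X, eval_C, map_sub, map_mul, conj_conj]
      rw [h1 z hz, map_mul, map_pow, conj_conj]
      have h4 := mul_conj_of_norm_one hz
      have h5 : z ^ n * conj z ^ n = 1 := by rw [← mul_pow, h4, one_pow]
      linear_combination (-z ^ n * conj ((Φ n).eval z)) * h4 + (vb Φ n * z * (Φ n).eval z) * h5
    · rw [rv]
      refine (natDegree_sub_le _ _).trans (max_le (by omega) ?_)
      refine natDegree_mul_le.trans ?_
      have := natDegree_mul_le (p := (X : ℂ[X])) (q := Φ n)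
      rw [H.natDegree n, natDegree_X] at this
      rw [natDegree_C]; omega

lemma phi_zero (H : IsOPUC ν Φ) : Φ 0 = 1 := (H.monic 0).natDegree_eq_zero.mp (H.natDegree 0)

lemma rv_eval (H : IsOPUC ν Φ) (n : ℕ) {z : ℂ} (hz : ‖z‖ = 1) :
    (rv Φ n).eval z = z ^ n * conj ((Φ n).eval z) := (H.rec_aux n).1 z hz

lemma natDegree_rv (H : IsOPUC ν Φ) (n : ℕ) : (rv Φ n).natDegree ≤ n := (H.rec_aux n).2.1

lemma rv_zero (H : IsOPUC ν Φ) (n : ℕ) : (rv Φ n).eval 0 = 1 := (H.rec_aux n).2.2.1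

lemma phi_succ (H : IsOPUC ν Φ) (n : ℕ) :
    Φ (n + 1) = X * Φ n - C (conj (vb Φ n)) * rv Φ n := (H.rec_aux n).2.2.2

lemma orth_rv (H : IsOPUC ν Φ) {n j : ℕ} (hj : 1 ≤ j) (hjn : j ≤ n) :
    cI ν (fun z => (rv Φ n).eval z * conj z ^ j) = 0 :=
  H.orth_rv_aux (fun _ hz => H.rv_eval n hz) hj hjn

lemma orth_rv_poly (H : IsOPUC ν Φ) {n : ℕ} {P : ℂ[X]} (h0 : P.eval 0 = 0)
    (hP : P.natDegree ≤ n) : cI ν (fun z => (rv Φ n).eval z * conj (P.eval z)) = 0 := by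
  rw [cI_mul_conj_eval (by fun_prop)]
  refine sum_eq_zero fun j hj => ?_
  rcases Nat.eq_zero_or_pos j with rfl | h
  · rw [coeff_zero_eq_eval_zero, h0]; simp
  · rw [H.orth_rv h (by grind), mul_zero]

lemma opN_eq (n : ℕ) : cI ν (fun z => (Φ n).eval z * conj ((Φ n).eval z)) = (opN ν Φ n : ℂ) := by
  apply Complex.ext
  · simp [opN]
  · have : conj (cI ν (fun z => (Φ n).eval z * conj ((Φ n).eval z))) =
        cI ν (fun z => (Φ n).eval z * conj ((Φ n).eval z)) := by
      rw [← cI_conj]; refine cI_congr fun z _ => ?_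
      simp [mul_comm]
    simpa using conj_eq_iff_im.mp this

lemma cI_mul_conj_self (P : ℂ[X]) : cI ν (fun z => P.eval z * conj (P.eval z)) =
    ((∫ θ, ‖P.eval (cpt θ)‖ ^ 2 ∂ν : ℝ) : ℂ) := by
  rw [cI, ← integral_complex_ofReal]
  refine integral_congr_ae (.of_forall fun θ => ?_)
  simp [mul_conj, normSq_eq_norm_sq]

lemma opN_eq_integral (n : ℕ) : opN ν Φ n = ∫ θ, ‖(Φ n).eval (cpt θ)‖ ^ 2 ∂ν := by
  exact_mod_cast (opN_eq n).symm.trans (cI_mul_conj_self (Φ n))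

lemma opN_pos (H : IsOPUC ν Φ) (n : ℕ) : 0 < opN ν Φ n := by
  have h0 : 0 ≤ opN ν Φ n := by rw [opN_eq_integral]; positivity
  refine lt_of_le_of_ne h0 fun h => (H.monic n).ne_zero (H.nondeg _ ?_)
  rw [opN_eq, ← h]; simp

/-- Pairing with a polynomial of degree at most `n` sees only the leading coefficient. -/
lemma cI_phi_conj (H : IsOPUC ν Φ) {n : ℕ} {P : ℂ[X]} (hP : P.natDegree ≤ n) :
    cI ν (fun z => (Φ n).eval z * conj (P.eval z)) = conj (P.coeff n) * opN ν Φ n := by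
  have h1 : (Φ n).coeff n = 1 := by
    have := (H.monic n).coeff_natDegree; rwa [H.natDegree] at this
  have h : cI ν (fun z => (Φ n).eval z * conj ((P - C (P.coeff n) * Φ n).eval z)) = 0 := by
    rcases Nat.eq_zero_or_pos n with rfl | hn
    · rw [eq_C_of_natDegree_le_zero hP, H.phi_zero]
      simp [cI]
    · apply H.orth_poly
      have : (P - C (P.coeff n) * Φ n).natDegree ≤ n - 1 := by
        rw [natDegree_le_iff_coeff_eq_zero]
        intro N hN
        rcases Nat.lt_or_ge n N with h | h
        · rw [coeff_sub, coeff_C_mul, coeff_eq_zero_of_natDegree_lt (p := P) (by omega),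
            coeff_eq_zero_of_natDegree_lt (p := Φ n) (by rw [H.natDegree]; omega)]; simp
        · obtain rfl : N = n := by omega
          simp [h1]
      omega
  rw [← opN_eq, ← cI_const_mul, ← sub_eq_zero, ← cI_sub (by fun_prop) (by fun_prop), ← h]
  refine cI_congr fun z _ => ?_
  simp; ring

lemma coeff_rv (H : IsOPUC ν Φ) (n : ℕ) : (rv Φ n).coeff n = conj ((Φ n).eval 0) := by
  cases n with
  | zero => simp [rv, H.phi_zero]
  | succ n =>
    have h1 : (Φ n).coeff n = 1 := by
      have := (H.monic n).coeff_natDegree; rwa [H.natDegree] at this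
    rw [rv, coeff_sub, coeff_C_mul, coeff_X_mul, h1,
      coeff_eq_zero_of_natDegree_lt (Nat.lt_succ_of_le (H.natDegree_rv n)), vb]
    simp

lemma opN_succ (H : IsOPUC ν Φ) (n : ℕ) :
    opN ν Φ (n + 1) = (1 - ‖vb Φ n‖ ^ 2) * opN ν Φ n := by
  have h1 : cI ν (fun z => (Φ (n + 1)).eval z * conj ((Φ (n + 1)).eval z)) =
      cI ν (fun z => (Φ (n + 1)).eval z * conj ((X * Φ n).eval z)) -
      vb Φ n * cI ν (fun z => (Φ (n + 1)).eval z * conj ((rv Φ n).eval z)) := by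
    rw [← cI_const_mul, ← cI_sub (by fun_prop) (by fun_prop)]
    refine cI_congr fun z _ => ?_
    conv_lhs => rw [H.phi_succ n]
    conv_rhs => rw [H.phi_succ n]
    simp; ring
  rw [H.orth_poly (Nat.lt_succ_of_le (H.natDegree_rv n)), mul_zero, sub_zero] at h1
  have h2 : cI ν (fun z => (Φ (n + 1)).eval z * conj ((X * Φ n).eval z)) =
      (opN ν Φ n : ℂ) - conj (vb Φ n) * cI ν (fun z => (rv Φ n).eval z * conj ((X * Φ n).eval z)) := by
    rw [← opN_eq, ← cI_const_mul, ← cI_sub (by fun_prop) (by fun_prop)]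
    refine cI_congr fun z hz => ?_
    rw [H.phi_succ n]
    simp only [eval_sub, eval_mul, eval_X, eval_C, map_mul]
    linear_combination ((Φ n).eval z * conj ((Φ n).eval z)) * mul_conj_of_norm_one hz
  have h3 : cI ν (fun z => (rv Φ n).eval z * conj ((X * Φ n).eval z)) =
      vb Φ n * (opN ν Φ n : ℂ) := by
    have e : cI ν (fun z => (rv Φ (n+1)).eval z * conj ((X * Φ n).eval z)) = 0 :=
      H.orth_rv_poly (by simp) (by
        refine natDegree_mul_le.trans ?_
        rw [H.natDegree, natDegree_X]; omega)
    have e2 : cI ν (fun z => (rv Φ (n+1)).eval z * conj ((X * Φ n).eval z)) =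
      cI ν (fun z => (rv Φ n).eval z * conj ((X * Φ n).eval z)) - vb Φ n * (opN ν Φ n : ℂ) := by
      rw [← opN_eq, ← cI_const_mul, ← cI_sub (by fun_prop) (by fun_prop)]
      refine cI_congr fun z hz => ?_
      simp only [rv, eval_sub, eval_mul, eval_X, eval_C, map_mul]
      linear_combination (- vb Φ n * (Φ n).eval z * conj ((Φ n).eval z)) * mul_conj_of_norm_one hz
    rw [e] at e2; linear_combination -e2
  rw [opN_eq, h2, h3] at h1
  have : (opN ν Φ (n + 1) : ℂ) = ((1 - ‖vb Φ n‖ ^ 2) * opN ν Φ n : ℝ) := by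
    rw [h1]; push_cast
    linear_combination (-(opN ν Φ n : ℂ)) * (conj_mul' (vb Φ n))
  exact_mod_cast this

lemma norm_vb_lt (H : IsOPUC ν Φ) (n : ℕ) : ‖vb Φ n‖ < 1 := by
  have h1 := H.opN_pos (n + 1)
  rw [H.opN_succ] at h1
  have := pos_of_mul_pos_left h1 (H.opN_pos n).le
  nlinarith [norm_nonneg (vb Φ n)]

lemma opN_antitone (H : IsOPUC ν Φ) : Antitone (opN ν Φ) := by
  refine antitone_nat_of_succ_le fun n => ?_
  rw [H.opN_succ]
  nlinarith [H.opN_pos n, sq_nonneg ‖vb Φ n‖]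

lemma cI_phi_conj_rv (H : IsOPUC ν Φ) (n : ℕ) :
    cI ν (fun z => (Φ n).eval z * conj ((rv Φ n).eval z)) = (Φ n).eval 0 * opN ν Φ n := by
  rw [H.cI_phi_conj (H.natDegree_rv n), H.coeff_rv]; simp

end IsOPUC

lemma contDiff_eval (P : ℂ[X]) {n : WithTop ℕ∞} : ContDiff ℝ n (fun z => P.eval z) := by
  have : ContDiff ℂ n (fun z => P.eval z) := by
    simpa [Polynomial.aeval_def, eval₂_eq_eval_map] using P.contDiff_aeval (𝕜 := ℂ) n
  exact this.restrict_scalars ℝ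

lemma contDiff_conj {f : ℂ → ℂ} {n : WithTop ℕ∞} (hf : ContDiff ℝ n f) :
    ContDiff ℝ n (fun z => conj (f z)) := conjCLE.contDiff.comp hf

lemma ContDiff.lipschitz_on_disc {f : ℂ → ℂ} (hf : ContDiff ℝ 1 f) :
    ∃ K : ℝ, 0 ≤ K ∧ ∀ z w : ℂ, ‖z‖ ≤ 1 → ‖w‖ ≤ 1 → ‖f z - f w‖ ≤ K * ‖z - w‖ := by
  obtain ⟨K, hK⟩ := (isCompact_closedBall (0 : ℂ) 1).exists_bound_of_continuousOn
    (hf.continuous_fderiv one_ne_zero).continuousOn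
  refine ⟨max K 0, le_max_right _ _, fun z w hz hw => ?_⟩
  refine (convex_closedBall (0 : ℂ) 1).norm_image_sub_le_of_norm_fderiv_le (𝕜 := ℝ)
    (fun x _ => hf.differentiable one_ne_zero x) (fun x hx => (hK x hx).trans (le_max_left _ _)) ?_ ?_
  · simpa using hw
  · simpa using hz

lemma norm_one_sub_mul_conj {a z : ℂ} (hz : ‖z‖ = 1) :
    ‖1 - a * conj z‖ = ‖z - a‖ := by
  have : z - a = z * (1 - a * conj z) := by
    linear_combination a * mul_conj_of_norm_one hz
  rw [this, norm_mul, hz, one_mul]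

lemma one_sub_mul_conj_ne_zero {a z : ℂ} (hz : ‖z‖ = 1) (h : z ≠ a) : 1 - a * conj z ≠ 0 := by
  rwa [← norm_ne_zero_iff, norm_one_sub_mul_conj hz, norm_ne_zero_iff, sub_ne_zero]

lemma norm_radial {r : ℝ} (hr : 0 ≤ r) (θ : ℝ) : ‖(r : ℂ) * cpt θ‖ = r := by
  rw [norm_mul, norm_cpt, Complex.norm_of_nonneg hr, mul_one]

lemma norm_natCast_add_one (n : ℕ) : ‖(n : ℂ) + 1‖ = n + 1 := by
  exact_mod_cast Complex.norm_natCast (n + 1)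

lemma tendsto_const_mul_one_div (C : ℝ) :
    Tendsto (fun n : ℕ => C * (1 / ((n : ℝ) + 1))) atTop (nhds 0) := by
  simpa using tendsto_one_div_add_atTop_nhds_zero_nat.const_mul C

/-- The regularised Cauchy functional at a boundary point. -/
noncomputable def cL (ν : Measure ℝ) (a v : ℂ) (f : ℂ → ℂ) : ℂ :=
  (∫ θ, (f (cpt θ) - f a) / (1 - a * conj (cpt θ)) ∂ν) + f a * v

section cauchyFunctional

variable {ν : Measure ℝ} [IsFiniteMeasure ν] {a v : ℂ}

lemma integrable_cL (ha : ‖a‖ = 1) {f : ℂ → ℂ} (hf : ContDiff ℝ 1 f) :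
    Integrable (fun θ => (f (cpt θ) - f a) / (1 - a * conj (cpt θ))) ν := by
  obtain ⟨K, hK0, hK⟩ := hf.lipschitz_on_disc
  have hc := hf.continuous
  refine Integrable.of_bound (C := K) ?_ (.of_forall fun θ => ?_)
  · refine Measurable.aestronglyMeasurable ?_
    refine Measurable.div ?_ ?_
    · exact (by fun_prop : Continuous fun θ => f (cpt θ) - f a).measurable
    · exact (by fun_prop : Continuous fun θ => 1 - a * conj (cpt θ)).measurable
  · rw [norm_div, norm_one_sub_mul_conj (norm_cpt θ)]
    exact div_le_of_le_mul₀ (norm_nonneg _) hK0 (hK _ _ (norm_cpt θ).le ha.le)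

lemma cL_add (ha : ‖a‖ = 1) {f g : ℂ → ℂ} (hf : ContDiff ℝ 1 f) (hg : ContDiff ℝ 1 g) :
    cL ν a v (fun z => f z + g z) = cL ν a v f + cL ν a v g := by
  unfold cL
  have : ∀ θ, (f (cpt θ) + g (cpt θ) - (f a + g a)) / (1 - a * conj (cpt θ)) =
    (f (cpt θ) - f a) / (1 - a * conj (cpt θ)) + (g (cpt θ) - g a) / (1 - a * conj (cpt θ)) := by
    intro θ; ring
  simp_rw [this]
  rw [integral_add (integrable_cL ha hf) (integrable_cL ha hg)]; ring

lemma cL_const_mul (c : ℂ) (f : ℂ → ℂ) :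
    cL ν a v (fun z => c * f z) = c * cL ν a v f := by
  unfold cL
  have : ∀ θ, (c * f (cpt θ) - c * f a) / (1 - a * conj (cpt θ)) =
    c * ((f (cpt θ) - f a) / (1 - a * conj (cpt θ))) := by intro θ; ring
  simp_rw [this]
  rw [integral_const_mul]; ring

lemma cL_sub (ha : ‖a‖ = 1) {f g : ℂ → ℂ} (hf : ContDiff ℝ 1 f) (hg : ContDiff ℝ 1 g) :
    cL ν a v (fun z => f z - g z) = cL ν a v f - cL ν a v g := by
  have := cL_add (ν := ν) (v := v) ha hf (g := fun z => (-1 : ℂ) * g z) (by fun_prop)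
  rw [cL_const_mul] at this
  simpa [sub_eq_add_neg] using this

lemma cL_congr (ha : ‖a‖ = 1) {f g : ℂ → ℂ} (h : ∀ z, ‖z‖ = 1 → f z = g z) :
    cL ν a v f = cL ν a v g := by
  unfold cL
  rw [h a ha]
  congr 1
  exact integral_congr_ae (.of_forall fun θ => by simp only [h _ (norm_cpt θ)])

lemma cL_mul_one_sub (ha : ‖a‖ = 1) (hν : ∀ᵐ θ ∂ν, cpt θ ≠ a) (f : ℂ → ℂ) :
    cL ν a v (fun z => f z * (1 - a * conj z)) = cI ν f := by
  unfold cL cI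
  beta_reduce
  rw [mul_conj_of_norm_one ha]
  simp only [sub_self, mul_zero, sub_zero, zero_mul, add_zero]
  refine integral_congr_ae ?_
  filter_upwards [hν] with θ hθ
  exact mul_div_cancel_right₀ _ (one_sub_mul_conj_ne_zero (norm_cpt θ) hθ)

lemma cL_add_conj (ha : ‖a‖ = 1) (hν : ∀ᵐ θ ∂ν, cpt θ ≠ a)
    (hv : v + conj v = cI ν (fun _ => 1)) {f : ℂ → ℂ} (hf : ContDiff ℝ 1 f) :
    cL ν a v f + conj (cL ν a v (fun z => conj (f z))) = cI ν f := by
  have h1 : ∫ θ, (f (cpt θ) - f a) / (1 - a * conj (cpt θ)) ∂ν +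
      conj (∫ θ, (conj (f (cpt θ)) - conj (f a)) / (1 - a * conj (cpt θ)) ∂ν) =
      cI ν f - f a * cI ν (fun _ => 1) := by
    have hi2 : Integrable (fun θ => conj ((conj (f (cpt θ)) - conj (f a)) / (1 - a * conj (cpt θ)))) ν := by
      have := integrable_cL (ν := ν) ha (contDiff_conj hf)
      exact conjCLE.toContinuousLinearMap.integrable_comp this
    have hc := hf.continuous
    rw [← integral_conj, ← integral_add (integrable_cL ha hf) hi2, ← cI_const_mul,
      ← cI_sub (by fun_prop) (by fun_prop)]
    refine integral_congr_ae ?_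
    filter_upwards [hν] with θ hθ
    have h2 := one_sub_mul_conj_ne_zero (norm_cpt θ) hθ
    have h3 : 1 - conj a * cpt θ ≠ 0 := by
      have := (map_ne_zero conj).mpr h2
      simpa using this
    simp only [map_div₀, map_sub, conj_conj, map_one, map_mul, mul_one]
    rw [div_add_div _ _ h2 h3, div_eq_iff (mul_ne_zero h2 h3)]
    have e1 := mul_conj_of_norm_one ha
    have e2 := mul_conj_of_norm_one (norm_cpt θ)
    linear_combination (-(f (cpt θ) - f a)) * conj (cpt θ) * cpt θ * e1 - (f (cpt θ) - f a) * e2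
  unfold cL
  rw [map_add, map_mul, conj_conj]
  linear_combination h1 + f a * hv

end cauchyFunctional

namespace IsOPUC

variable {ν : Measure ℝ} [IsFiniteMeasure ν] {Φ : ℕ → ℂ[X]} {a v : ℂ}

lemma cL_phi_conj (H : IsOPUC ν Φ) (ha : ‖a‖ = 1) (hν : ∀ᵐ θ ∂ν, cpt θ ≠ a) {n : ℕ} {g : ℂ[X]}
    (hg : g.natDegree ≤ n) :
    cL ν a v (fun z => (Φ n).eval z * conj (g.eval z)) =
      conj (g.eval a) * cL ν a v (fun z => (Φ n).eval z) := by
  set q := g /ₘ (X - C a) with hq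
  have h1 : (X - C a) * q + C (g.eval a) = g := by
    rw [hq, ← modByMonic_X_sub_C_eq_C_eval, add_comm]
    exact modByMonic_add_div g _
  have hc := contDiff_eval (Φ n) (n := 1)
  have hcq := contDiff_conj (contDiff_eval q (n := 1))
  have h2 : cL ν a v (fun z => (Φ n).eval z * conj (g.eval z)) =
      conj (g.eval a) * cL ν a v (fun z => (Φ n).eval z) -
      conj a * cL ν a v (fun z => ((Φ n).eval z * conj (q.eval z)) * (1 - a * conj z)) := by
    have hcj := contDiff_conj (contDiff_id (𝕜 := ℝ) (E := ℂ) (n := 1))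
    simp only [id] at hcj
    rw [← cL_const_mul, ← cL_const_mul, ← cL_sub ha (by fun_prop) (by fun_prop)]
    refine cL_congr ha fun z hz => ?_
    conv_lhs => rw [← h1]
    simp only [eval_add, eval_mul, eval_sub, eval_X, eval_C, map_add, map_mul, map_sub]
    linear_combination (-(Φ n).eval z * conj (q.eval z) * conj z) * mul_conj_of_norm_one ha
  rw [h2, cL_mul_one_sub ha hν]
  rcases Nat.eq_zero_or_pos n with rfl | hn
  · have : q = 0 := by
      rw [hq, divByMonic_eq_zero_iff (monic_X_sub_C a), degree_X_sub_C]
      rw [eq_C_of_natDegree_le_zero hg]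
      exact degree_C_le.trans_lt (by norm_num)
    simp [this, cI]
  · rw [H.orth_poly, mul_zero, sub_zero]
    rw [hq, natDegree_divByMonic _ (monic_X_sub_C a), natDegree_X_sub_C]; omega

lemma cL_phi_succ (H : IsOPUC ν Φ) (ha : ‖a‖ = 1) (hν : ∀ᵐ θ ∂ν, cpt θ ≠ a)
    (hv : v + conj v = cI ν (fun _ => 1)) (n : ℕ) :
    cL ν a v (fun z => (Φ (n + 1)).eval z) = a * cL ν a v (fun z => (Φ n).eval z) +
      conj (vb Φ n) * a ^ n * conj (cL ν a v (fun z => (Φ n).eval z)) := by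
  have hcj := contDiff_conj (contDiff_id (𝕜 := ℝ) (E := ℂ) (n := 1))
  simp only [id] at hcj
  have hc := contDiff_eval (Φ n) (n := 1)
  have hcr := contDiff_eval (rv Φ n) (n := 1)
  have h1 : cL ν a v (fun z => (Φ (n + 1)).eval z) =
      a * cL ν a v (fun z => (Φ n).eval z) +
      cL ν a v (fun z => (z * (Φ n).eval z) * (1 - a * conj z)) -
      conj (vb Φ n) * cL ν a v (fun z => (rv Φ n).eval z) := by
    rw [← cL_const_mul, ← cL_const_mul, ← cL_add ha (by fun_prop) (by fun_prop),
      ← cL_sub ha (by fun_prop) (by fun_prop)]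
    refine cL_congr ha fun z hz => ?_
    rw [H.phi_succ]
    simp only [eval_mul, eval_sub, eval_X, eval_C]
    linear_combination (a * (Φ n).eval z) * mul_conj_of_norm_one hz
  have h2 : cL ν a v (fun z => (rv Φ n).eval z) =
      cI ν (fun z => (rv Φ n).eval z) - a ^ n * conj (cL ν a v (fun z => (Φ n).eval z)) := by
    rw [← cL_add_conj ha hν hv hcr]
    have h3 := H.cL_phi_conj (v := v) ha hν (n := n) (g := X ^ n) (by simp)
    have h4 : cL ν a v (fun z => conj ((rv Φ n).eval z)) =
        cL ν a v (fun z => (Φ n).eval z * conj ((X ^ n : ℂ[X]).eval z)) := by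
      refine cL_congr ha fun z hz => ?_
      rw [H.rv_eval n hz]; simp [mul_comm]
    rw [h4, h3]; simp
  have h5 : cI ν (fun z => z * (Φ n).eval z) - conj (vb Φ n) * cI ν (fun z => (rv Φ n).eval z) = 0 := by
    rw [← cI_const_mul, ← cI_sub (by fun_prop) (by fun_prop), ← H.orth (n + 1) 0 (by omega)]
    refine cI_congr fun z _ => ?_
    rw [H.phi_succ]; simp
  rw [h1, cL_mul_one_sub ha hν, h2]
  linear_combination h5

lemma re_cL (H : IsOPUC ν Φ) (ha : ‖a‖ = 1) (hν : ∀ᵐ θ ∂ν, cpt θ ≠ a)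
    (hv : v + conj v = cI ν (fun _ => 1)) (n : ℕ) :
    (conj ((Φ n).eval a) * cL ν a v (fun z => (Φ n).eval z)).re = opN ν Φ n / 2 := by
  have hc := contDiff_eval (Φ n) (n := 1)
  have hc' := contDiff_conj hc
  have h := cL_add_conj ha hν hv (f := fun z => (Φ n).eval z * conj ((Φ n).eval z)) (by fun_prop)
  have h2 : cL ν a v (fun z => conj ((Φ n).eval z * conj ((Φ n).eval z))) =
      cL ν a v (fun z => (Φ n).eval z * conj ((Φ n).eval z)) :=
    cL_congr ha fun z _ => by simp [mul_comm]
  rw [h2, H.cL_phi_conj ha hν (H.natDegree n).le, opN_eq] at h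
  have := congrArg Complex.re h
  simp only [add_re, conj_re, ofReal_re] at this
  linarith

/-- Cauchy-Schwarz in the form needed below. -/
lemma norm_cI_le (f g : ℂ → ℂ) (hf : ContinuousOn f (sphere (0 : ℂ) 1))
    (hg : ContinuousOn g (sphere (0 : ℂ) 1)) :
    ‖cI ν (fun z => f z * g z)‖ ≤
      ((∫ θ, ‖f (cpt θ)‖ ^ 2 ∂ν) + ∫ θ, ‖g (cpt θ)‖ ^ 2 ∂ν) / 2 := by
  have h1 := integrable_of_continuousOn_sphere (ν := ν) (f := fun z => ‖f z‖ ^ 2) (by fun_prop)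
  have h2 := integrable_of_continuousOn_sphere (ν := ν) (f := fun z => ‖g z‖ ^ 2) (by fun_prop)
  rw [← integral_add h1 h2, ← integral_div]
  refine norm_integral_le_of_norm_le ((h1.add h2).div_const 2) (.of_forall fun θ => ?_)
  rw [norm_mul]
  nlinarith [sq_nonneg (‖f (cpt θ)‖ - ‖g (cpt θ)‖)]

lemma norm_cI_phi_phi_le (H : IsOPUC ν Φ) (i n : ℕ) (f g : ℂ → ℂ)
    (hf : ContinuousOn f (sphere (0 : ℂ) 1)) (hg : ContinuousOn g (sphere (0 : ℂ) 1))
    (hfi : ∀ z, ‖z‖ = 1 → ‖f z‖ = ‖(Φ i).eval z‖) (hgn : ∀ z, ‖z‖ = 1 → ‖g z‖ = ‖(Φ n).eval z‖) :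
    ‖cI ν (fun z => f z * g z)‖ ≤ opN ν Φ 0 := by
  refine (norm_cI_le f g hf hg).trans ?_
  simp_rw [fun θ => hfi _ (norm_cpt θ), fun θ => hgn _ (norm_cpt θ), ← opN_eq_integral]
  linarith [H.opN_antitone (Nat.zero_le i), H.opN_antitone (Nat.zero_le n)]

lemma norm_rv_eval (H : IsOPUC ν Φ) (n : ℕ) {z : ℂ} (hz : ‖z‖ = 1) :
    ‖(rv Φ n).eval z‖ = ‖(Φ n).eval z‖ := by
  rw [H.rv_eval n hz]; simp [hz]

lemma rv_add (n j : ℕ) : rv Φ (n + j) = rv Φ n - ∑ i ∈ Finset.range j, C (vb Φ (n + i)) * (X * Φ (n + i)) := by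
  induction j with
  | zero => simp
  | succ j ih => rw [← add_assoc, rv, ih, sum_range_succ]; ring

lemma norm_cI_pow_le (H : IsOPUC ν Φ) (n j : ℕ) :
    ‖cI ν (fun z => z ^ j * (Φ n).eval z * conj ((rv Φ n).eval z))‖ ≤ opN ν Φ 0 :=
  H.norm_cI_phi_phi_le n n _ _ (by fun_prop) (by fun_prop)
    (fun z hz => by simp [hz]) (fun z hz => by simp [H.norm_rv_eval n hz])

lemma norm_cI_conj_pow_le (H : IsOPUC ν Φ) (n j : ℕ) :
    ‖cI ν (fun z => conj z ^ j * (Φ n).eval z * conj ((rv Φ n).eval z))‖ ≤ opN ν Φ 0 :=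
  H.norm_cI_phi_phi_le n n _ _ (by fun_prop) (by fun_prop)
    (fun z hz => by simp [hz]) (fun z hz => by simp [H.norm_rv_eval n hz])

lemma norm_cI_pow_le_sum (H : IsOPUC ν Φ) (n : ℕ) {j : ℕ} (hj : 1 ≤ j) :
    ‖cI ν (fun z => z ^ j * (Φ n).eval z * conj ((rv Φ n).eval z))‖ ≤
      (∑ i ∈ Finset.range j, ‖vb Φ (n + i)‖) * opN ν Φ 0 := by
  have h0 : cI ν (fun z => z ^ j * (Φ n).eval z * conj ((rv Φ (n + j)).eval z)) = 0 := by
    have h := H.orth_rv_poly (n := n + j) (P := X ^ j * Φ n) (by simp; omega) (by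
      refine natDegree_mul_le.trans ?_
      rw [H.natDegree, natDegree_X_pow]; omega)
    have h2 := congrArg conj h
    rw [← cI_conj, map_zero] at h2
    rw [← h2]
    refine cI_congr fun z _ => ?_
    simp [mul_comm]
  have h1 : cI ν (fun z => z ^ j * (Φ n).eval z * conj ((rv Φ n).eval z)) =
      ∑ i ∈ Finset.range j, conj (vb Φ (n + i)) *
        cI ν (fun z => (z ^ j * (Φ n).eval z) * conj (z * (Φ (n + i)).eval z)) := by
    simp_rw [← cI_const_mul]
    rw [← cI_sum _ (fun i _ => by fun_prop), ← sub_zero (cI ν _), ← h0, ← cI_sub (by fun_prop) (by fun_prop)]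
    refine cI_congr fun z _ => ?_
    rw [rv_add n j]
    simp only [eval_sub, eval_finsetSum, eval_mul, eval_C, eval_X, map_sub, map_sum, map_mul]
    rw [mul_sub, sub_sub_cancel, mul_sum]
    exact sum_congr rfl fun i _ => by ring
  rw [h1, sum_mul]
  refine (norm_sum_le _ _).trans (sum_le_sum fun i _ => ?_)
  rw [norm_mul, RCLike.norm_conj]
  refine mul_le_mul_of_nonneg_left ?_ (norm_nonneg _)
  exact H.norm_cI_phi_phi_le n (n + i) _ _ (by fun_prop) (by fun_prop)
    (fun z hz => by simp [hz]) (fun z hz => by simp [hz])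

lemma norm_cI_conj_pow_le_sum (H : IsOPUC ν Φ) (n j : ℕ) :
    ‖cI ν (fun z => conj z ^ j * (Φ (n + j + 1)).eval z * conj ((rv Φ (n + j + 1)).eval z))‖ ≤
      (∑ i ∈ Finset.range (j + 1), ‖vb Φ (n + i)‖) * opN ν Φ 0 := by
  have h0 : cI ν (fun z => conj z ^ j * (Φ (n + j + 1)).eval z * conj ((rv Φ n).eval z)) = 0 := by
    have h := H.orth_poly (n := n + j + 1) (P := X ^ j * rv Φ n) (by
      have := natDegree_mul_le (p := (X ^ j : ℂ[X])) (q := rv Φ n)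
      rw [natDegree_X_pow] at this
      have := H.natDegree_rv n
      omega)
    rw [← h]
    refine cI_congr fun z _ => ?_
    simp; ring
  have h1 : cI ν (fun z => conj z ^ j * (Φ (n + j + 1)).eval z * conj ((rv Φ (n + j + 1)).eval z)) =
      ∑ i ∈ Finset.range (j + 1), -conj (vb Φ (n + i)) *
        cI ν (fun z => (conj z ^ j * (Φ (n + j + 1)).eval z) * conj (z * (Φ (n + i)).eval z)) := by
    simp_rw [← cI_const_mul]
    rw [← cI_sum _ (fun i _ => by fun_prop), ← sub_zero (cI ν _), ← h0, ← cI_sub (by fun_prop) (by fun_prop)]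
    refine cI_congr fun z _ => ?_
    rw [show n + j + 1 = n + (j + 1) by ring, rv_add n (j + 1)]
    simp only [eval_sub, eval_finsetSum, eval_mul, eval_C, eval_X, map_sub, map_sum, map_mul]
    rw [mul_sub, sub_sub_cancel_left, mul_sum, ← sum_neg_distrib]
    exact sum_congr rfl fun i _ => by ring
  rw [h1, sum_mul]
  refine (norm_sum_le _ _).trans (sum_le_sum fun i _ => ?_)
  rw [norm_mul, norm_neg, RCLike.norm_conj]
  refine mul_le_mul_of_nonneg_left ?_ (norm_nonneg _)
  exact H.norm_cI_phi_phi_le (n + j + 1) (n + i) _ _ (by fun_prop) (by fun_prop)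
    (fun z hz => by simp [hz]) (fun z hz => by simp [hz])

end IsOPUC

/-- Normalised arc-length measure on the arguments. -/
noncomputable def arcμ : Measure ℝ :=
  ENNReal.ofReal (2 * π)⁻¹ • (volume : Measure ℝ).restrict (Ioc 0 (2 * π))

instance : IsProbabilityMeasure arcμ := by
  constructor
  have h : (0 : ℝ) < 2 * π := by positivity
  simp only [arcμ, Measure.smul_apply, Measure.restrict_apply_univ, Real.volume_Ioc, sub_zero,
    smul_eq_mul]
  rw [← ENNReal.ofReal_mul (by positivity), inv_mul_cancel₀ h.ne', ENNReal.ofReal_one]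

lemma integral_arcμ {E : Type*} [NormedAddCommGroup E] [NormedSpace ℝ E] (f : ℝ → E) :
    ∫ θ, f θ ∂arcμ = (2 * π)⁻¹ • ∫ θ in (0 : ℝ)..(2 * π), f θ := by
  rw [arcμ, integral_smul_measure, intervalIntegral.integral_of_le (by positivity),
    ENNReal.toReal_ofReal (by positivity)]

lemma integrable_arcμ {E : Type*} [NormedAddCommGroup E] {f : ℝ → E} :
    Integrable f arcμ ↔ IntervalIntegrable f volume 0 (2 * π) := by
  rw [arcμ, integrable_smul_measure, intervalIntegrable_iff_integrableOn_Ioc_of_le (by positivity)]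
  · rfl
  · simp [pi_pos]
  · exact ENNReal.ofReal_ne_top

lemma cpt_add_two_pi (θ : ℝ) : cpt (θ + 2 * π) = cpt θ := by
  unfold cpt
  push_cast
  rw [add_mul, exp_add, exp_two_pi_mul_I, mul_one]

lemma cpt_zero : cpt 0 = 1 := by simp [cpt]

lemma cpt_two_pi : cpt (2 * π) = 1 := by rw [← zero_add (2 * π), cpt_add_two_pi, cpt_zero]

lemma cpt_add (s t : ℝ) : cpt (s + t) = cpt s * cpt t := by
  unfold cpt; rw [← exp_add]; congr 1; push_cast; ring

lemma exists_cpt_eq {a : ℂ} (ha : ‖a‖ = 1) : ∃ t : ℝ, cpt t = a :=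
  ⟨a.arg, by simpa [ha, cpt] using norm_mul_exp_arg_mul_I a⟩

lemma countable_cpt_preimage_singleton (a : ℂ) : {θ : ℝ | cpt θ = a}.Countable := by
  by_cases h : ∃ t, cpt t = a
  · obtain ⟨t, rfl⟩ := h
    refine (countable_range fun n : ℤ => t + n * (2 * π)).mono fun θ hθ => ?_
    obtain ⟨n, hn⟩ := exp_eq_exp_iff_exists_int.mp hθ
    refine ⟨n, ?_⟩
    have h2 : (θ : ℂ) = t + n * (2 * π) := by
      have : (θ : ℂ) * I = (t + n * (2 * π)) * I := by rw [hn]; ring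
      exact mul_right_cancel₀ Complex.I_ne_zero this
    exact_mod_cast h2.symm
  · push Not at h
    convert countable_empty
    ext θ; simp [h θ]

lemma countable_cpt_preimage {S : Set ℂ} (hS : S.Countable) : {θ : ℝ | cpt θ ∈ S}.Countable := by
  have : {θ : ℝ | cpt θ ∈ S} = ⋃ a ∈ S, {θ : ℝ | cpt θ = a} := by ext; simp
  rw [this]
  exact hS.biUnion fun a _ => countable_cpt_preimage_singleton a

instance : NullSingletonClass arcμ := ⟨fun x => by simp [arcμ]⟩

lemma ae_cpt_notMem {S : Set ℂ} (hS : S.Countable) : ∀ᵐ θ ∂arcμ, cpt θ ∉ S := by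
  have := (countable_cpt_preimage hS).measure_zero arcμ
  rw [ae_iff]; simpa using this

lemma ae_cpt_ne (a : ℂ) : ∀ᵐ θ ∂arcμ, cpt θ ≠ a := by
  simpa using ae_cpt_notMem (countable_singleton a)

lemma two_div_pi_mul_le_norm_cpt_sub_one {s : ℝ} (hs : |s| ≤ π) :
    2 / π * |s| ≤ ‖cpt s - 1‖ := by
  have h1 : cpt s - 1 = exp (I * s) - 1 := by rw [cpt, mul_comm]
  rw [h1, norm_exp_I_mul_ofReal_sub_one, norm_mul, norm_eq_abs, norm_eq_abs, abs_two]
  have h2 := Real.mul_abs_le_abs_sin (x := s / 2) (by rw [abs_div, abs_two]; linarith)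
  rw [abs_div, abs_two] at h2
  calc 2 / π * |s| = 2 * (2 / π * (|s| / 2)) := by ring
    _ ≤ _ := by linarith

lemma lintegral_arcμ_periodic {F : ℝ → ENNReal} (hF : Function.Periodic F (2 * π)) (t : ℝ) :
    ∫⁻ θ, F θ ∂arcμ = ENNReal.ofReal (2 * π)⁻¹ * ∫⁻ s in Ioc (-π) π, F (s + t) := by
  have hT : (0 : ℝ) < 2 * π := by positivity
  have key : ∀ (G : ℝ → ENNReal), Function.Periodic G (2 * π) → ∀ u v : ℝ,
      ∫⁻ θ in Ioc u (u + 2 * π), G θ = ∫⁻ θ in Ioc v (v + 2 * π), G θ := by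
    intro G hG u v
    have : VAddInvariantMeasure (AddSubgroup.zmultiples (2 * π)) ℝ volume :=
      ⟨fun c s _ => measure_preimage_add _ _ _⟩
    refine IsAddFundamentalDomain.setLIntegral_eq (G := AddSubgroup.zmultiples (2 * π))
      (isAddFundamentalDomain_Ioc hT u) (isAddFundamentalDomain_Ioc hT v) _ fun g x => ?_
    obtain ⟨g, n, rfl⟩ := g
    simpa [AddSubgroup.vadd_def, add_comm] using hG.zsmul n x
  rw [arcμ, lintegral_smul_measure, smul_eq_mul]
  congr 1
  have h1 := key F hF 0 (-π + t)
  rw [zero_add] at h1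
  rw [h1]
  have h2 := (measurePreserving_add_right volume t).setLIntegral_comp_emb
    (measurableEmbedding_addRight t) F (Ioc (-π) π)
  rw [h2]
  rw [image_add_const_Ioc, show -π + t + 2 * π = π + t by ring]

/-- Integrals of decreasing functions of the distance to a boundary point. -/
lemma lintegral_arcμ_norm_sub_le {φ : ℝ → ENNReal} (hφ : AntitoneOn φ (Ioi 0)) {a : ℂ}
    (ha : ‖a‖ = 1) :
    ∫⁻ θ, φ ‖cpt θ - a‖ ∂arcμ ≤ ∫⁻ s in Ioc 0 π, φ (2 / π * s) := by
  obtain ⟨t, rfl⟩ := exists_cpt_eq ha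
  rw [lintegral_arcμ_periodic (F := fun θ => φ ‖cpt θ - cpt t‖)
    (fun θ => by simp only [cpt_add_two_pi]) t]
  have h1 : ∀ s, ‖cpt (s + t) - cpt t‖ = ‖cpt s - 1‖ := by
    intro s
    rw [cpt_add, ← sub_one_mul, norm_mul, norm_cpt, mul_one]
  simp_rw [h1]
  have hmono : ∀ s, s ≠ 0 → |s| ≤ π → φ ‖cpt s - 1‖ ≤ φ (2 / π * |s|) := by
    intro s hs hsp
    have h0 : 0 < 2 / π * |s| := by have := abs_pos.mpr hs; positivity
    exact hφ h0 (h0.trans_le (two_div_pi_mul_le_norm_cpt_sub_one hsp))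
      (two_div_pi_mul_le_norm_cpt_sub_one hsp)
  have h2 : ∫⁻ s in Ioc (-π) π, φ ‖cpt s - 1‖ ≤ ∫⁻ s in Ioc (-π) π, φ (2 / π * |s|) := by
    refine lintegral_mono_ae ?_
    rw [ae_restrict_iff' measurableSet_Ioc]
    have : ∀ᵐ s : ℝ, s ≠ 0 := by
      rw [ae_iff]; simp
    filter_upwards [this] with s hs0 hs
    exact hmono s hs0 (abs_le.mpr ⟨hs.1.le, hs.2⟩)
  have h3 : ∫⁻ s in Ioc (-π) π, φ (2 / π * |s|) = 2 * ∫⁻ s in Ioc 0 π, φ (2 / π * s) := by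
    have hu : Ioc (-π) π = Ioc (-π) 0 ∪ Ioc 0 π := by
      rw [Ioc_union_Ioc_eq_Ioc] <;> linarith [pi_pos]
    rw [hu, lintegral_union measurableSet_Ioc (by
      rw [Set.disjoint_left]; rintro x ⟨_, h⟩ ⟨h', _⟩; linarith), two_mul]
    congr 1
    · have h4 := (Measure.measurePreserving_neg (volume : Measure ℝ)).setLIntegral_comp_emb
        (MeasurableEquiv.neg ℝ).measurableEmbedding (fun s => φ (2 / π * |s|)) (Ioc (-π) 0)
      simp only [abs_neg] at h4
      rw [h4]
      have : (fun x : ℝ => -x) '' Ioc (-π) 0 = Ico 0 π := by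
        rw [Set.image_neg_eq_neg]; simp
      rw [this, setLIntegral_congr Ico_ae_eq_Ioc]
      exact setLIntegral_congr_fun measurableSet_Ioc fun s hs => by simp only [abs_of_pos hs.1]
    · exact setLIntegral_congr_fun measurableSet_Ioc fun s hs => by simp only [abs_of_pos hs.1]
  calc _ ≤ ENNReal.ofReal (2 * π)⁻¹ * (2 * ∫⁻ s in Ioc 0 π, φ (2 / π * s)) := by
        rw [← h3]; gcongr
    _ = ENNReal.ofReal (π)⁻¹ * ∫⁻ s in Ioc 0 π, φ (2 / π * s) := by
        rw [← mul_assoc]; congr 1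
        rw [show (2 : ENNReal) = ENNReal.ofReal 2 by simp, ← ENNReal.ofReal_mul (by positivity)]
        congr 1; field_simp
    _ ≤ 1 * ∫⁻ s in Ioc 0 π, φ (2 / π * s) := by
        gcongr
        rw [ENNReal.ofReal_le_one]
        exact inv_le_one_of_one_le₀ (by linarith [Real.pi_gt_three])
    _ = _ := one_mul _

/-- Integrability of powers of the distance to a boundary point. -/
lemma integrable_norm_sub_rpow {a : ℂ} (ha : ‖a‖ = 1) {p : ℝ} (hp : -1 < p) :
    Integrable (fun θ => ‖cpt θ - a‖ ^ p) arcμ := by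
  have hm : Measurable (fun θ => ‖cpt θ - a‖ ^ p) :=
    ((by fun_prop : Continuous fun θ => ‖cpt θ - a‖).measurable).pow_const p
  rcases le_total 0 p with h0 | h0
  · refine Integrable.of_bound (C := 2 ^ p) hm.aestronglyMeasurable (.of_forall fun θ => ?_)
    rw [norm_of_nonneg (by positivity)]
    refine Real.rpow_le_rpow (norm_nonneg _) ?_ h0
    calc ‖cpt θ - a‖ ≤ ‖cpt θ‖ + ‖a‖ := norm_sub_le _ _
      _ = 2 := by rw [norm_cpt, ha]; norm_num
  · refine ⟨hm.aestronglyMeasurable, ?_⟩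
    rw [hasFiniteIntegral_iff_ofReal (.of_forall fun θ => by positivity)]
    have h1 := lintegral_arcμ_norm_sub_le (φ := fun x => ENNReal.ofReal (x ^ p))
      (fun x hx y _ hxy => ENNReal.ofReal_le_ofReal (rpow_le_rpow_of_nonpos hx hxy h0)) ha
    refine h1.trans_lt ?_
    have h2 : IntegrableOn (fun s : ℝ => (2 / π * s) ^ p) (Ioc 0 π) := by
      have := (intervalIntegral.intervalIntegrable_rpow' (a := 0) (b := π) hp).const_mul ((2 / π) ^ p)
      rw [intervalIntegrable_iff_integrableOn_Ioc_of_le Real.pi_pos.le] at this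
      refine this.congr_fun (fun s hs => ?_) measurableSet_Ioc
      simp only
      rw [Real.mul_rpow (by positivity) hs.1.le]
    have h3 := h2.2
    rw [hasFiniteIntegral_iff_norm] at h3
    refine lt_of_le_of_lt ?_ h3
    refine lintegral_mono fun s => ?_
    exact ENNReal.ofReal_le_ofReal (le_abs_self _)

/-- Near any point at most one of finitely many distinct points is close. -/
lemma exists_sep {ι : Type*} [Finite ι] {a : ι → ℂ} (ha' : Function.Injective a) :
    ∃ d : ℝ, 0 < d ∧ d ≤ 1 ∧ ∀ z : ℂ, ∀ j k, j ≠ k → d ≤ ‖z - a j‖ ∨ d ≤ ‖z - a k‖ := by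
  have := Fintype.ofFinite ι
  classical
  obtain ⟨d, hd0, hd⟩ : ∃ d > 0, ∀ j k, j ≠ k → d ≤ ‖a j - a k‖ := by
    by_cases hne : (Finset.univ.filter fun p : ι × ι => p.1 ≠ p.2).Nonempty
    · refine ⟨Finset.inf' _ hne fun p => ‖a p.1 - a p.2‖, ?_, fun j k hjk => ?_⟩
      · rw [gt_iff_lt, Finset.lt_inf'_iff]
        intro p hp
        rw [norm_pos_iff, sub_ne_zero]
        exact fun h => (Finset.mem_filter.mp hp).2 (ha' h)
      · exact Finset.inf'_le (fun p : ι × ι => ‖a p.1 - a p.2‖) (b := (j, k)) (by simpa using hjk)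
    · refine ⟨1, one_pos, fun j k hjk => absurd ?_ hne⟩
      exact ⟨(j, k), by simpa using hjk⟩
  refine ⟨min (d / 2) 1, by positivity, min_le_right _ _, fun z j k hjk => ?_⟩
  by_contra! h
  have h1 := hd j k hjk
  have h2 : ‖a j - a k‖ ≤ ‖z - a j‖ + ‖z - a k‖ := by
    rw [show a j - a k = (z - a k) - (z - a j) by ring]
    linarith [norm_sub_le (z - a k) (z - a j)]
  linarith [h.1, h.2, min_le_left (d / 2) 1]

section weight

variable {ι : Type*} [Fintype ι] {g : ℝ → ℝ} {a : ι → ℂ} {β : ι → ℝ}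

/-- A generalised Jacobi weight on the arguments. -/
noncomputable def wtF (g : ℝ → ℝ) (a : ι → ℂ) (β : ι → ℝ) (θ : ℝ) : ℝ :=
  g θ * ∏ k, ‖cpt θ - a k‖ ^ (2 * β k)

/-- The measure with density `wtF`. -/
noncomputable def wtν (g : ℝ → ℝ) (a : ι → ℂ) (β : ι → ℝ) : Measure ℝ :=
  arcμ.withDensity fun θ => ENNReal.ofReal (wtF g a β θ)

lemma measurable_wtF (hg : Continuous g) : Measurable (wtF g a β) := by
  unfold wtF
  refine hg.measurable.mul (Finset.measurable_fun_prod _ fun k _ => ?_)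
  exact ((by fun_prop : Continuous fun θ => ‖cpt θ - a k‖).measurable).pow_const _

lemma wtF_nonneg (hg : ∀ θ, 0 < g θ) (θ : ℝ) : 0 ≤ wtF g a β θ :=
  mul_nonneg (hg θ).le (prod_nonneg fun k _ => by positivity)

lemma wtF_pos (hg : ∀ θ, 0 < g θ) {θ : ℝ} (hθ : ∀ k, cpt θ ≠ a k) : 0 < wtF g a β θ := by
  refine mul_pos (hg θ) (Finset.prod_pos fun k _ => ?_)
  have : 0 < ‖cpt θ - a k‖ := norm_pos_iff.mpr (sub_ne_zero.mpr (hθ k))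
  positivity

lemma ae_ne_all (a : ι → ℂ) : ∀ᵐ θ ∂arcμ, ∀ k, cpt θ ≠ a k :=
  ae_all_iff.mpr fun k => ae_cpt_ne (a k)

lemma rpow_le_of_mem {d x p : ℝ} (hd : 0 < d) (h1 : d ≤ x) (h2 : x ≤ 2) :
    x ^ p ≤ d ^ p + 2 ^ p := by
  rcases le_total 0 p with h | h
  · have := Real.rpow_le_rpow (hd.le.trans h1) h2 h
    have := Real.rpow_nonneg hd.le p
    linarith
  · have := rpow_le_rpow_of_nonpos hd h1 h
    have := Real.rpow_nonneg zero_le_two p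
    linarith

/-- A product with separated singularities is controlled by the sum. -/
lemma prod_norm_rpow_le (ha : ∀ k, ‖a k‖ = 1) (ha' : Function.Injective a) (p : ι → ℝ) :
    ∃ C : ℝ, 0 ≤ C ∧ ∀ z : ℂ, ‖z‖ ≤ 1 → ∏ k, ‖z - a k‖ ^ p k ≤ C * (1 + ∑ k, ‖z - a k‖ ^ p k) := by
  classical
  obtain ⟨d, hd0, hd1, hd⟩ := exists_sep ha'
  set B : ℝ := ∏ k, (1 + (d ^ p k + 2 ^ p k)) with hB
  have hB1 : ∀ s : Finset ι, ∏ k ∈ s, (1 + (d ^ p k + 2 ^ p k)) ≤ B := by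
    intro s
    refine Finset.prod_le_prod_of_subset_of_one_le (Finset.subset_univ s)
      (fun k _ => by positivity) (fun k _ _ => ?_)
    have : 0 ≤ d ^ p k + 2 ^ p k := by positivity
    linarith
  have hB0 : 0 ≤ B := prod_nonneg fun k _ => by positivity
  refine ⟨B, hB0, fun z hz => ?_⟩
  have hz2 : ∀ k, ‖z - a k‖ ≤ 2 := fun k => by
    have := norm_sub_le z (a k); rw [ha k] at this; linarith
  have hfac : ∀ s : Finset ι, (∀ k ∈ s, d ≤ ‖z - a k‖) → ∏ k ∈ s, ‖z - a k‖ ^ p k ≤ B := by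
    intro s hs
    refine (Finset.prod_le_prod (fun k _ => by positivity) fun k hk => ?_).trans (hB1 s)
    have := rpow_le_of_mem (p := p k) hd0 (hs k hk) (hz2 k)
    linarith
  have hsum0 : 0 ≤ ∑ k, ‖z - a k‖ ^ p k := sum_nonneg fun k _ => by positivity
  by_cases h : ∃ k, ‖z - a k‖ < d
  · obtain ⟨k, hk⟩ := h
    rw [← mul_prod_erase _ _ (Finset.mem_univ k)]
    have h1 := hfac (Finset.univ.erase k) fun j hj => by
      rcases hd z j k (ne_of_mem_erase hj) with h | h
      · exact h
      · linarith
    have h2 : ‖z - a k‖ ^ p k ≤ ∑ k, ‖z - a k‖ ^ p k :=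
      single_le_sum (f := fun k => ‖z - a k‖ ^ p k) (fun k _ => by positivity) (Finset.mem_univ k)
    calc _ ≤ ‖z - a k‖ ^ p k * B := by gcongr
      _ ≤ _ := by nlinarith
  · push Not at h
    refine (hfac Finset.univ fun k _ => h k).trans ?_
    nlinarith

lemma integrable_prod_rpow (ha : ∀ k, ‖a k‖ = 1) (ha' : Function.Injective a) {p : ι → ℝ}
    (hp : ∀ k, -1 < p k) : Integrable (fun θ => ∏ k, ‖cpt θ - a k‖ ^ p k) arcμ := by
  obtain ⟨C, hC0, hC⟩ := prod_norm_rpow_le ha ha' p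
  refine Integrable.mono' (g := fun θ => C * (1 + ∑ k, ‖cpt θ - a k‖ ^ p k)) ?_ ?_ ?_
  · refine ((integrable_const (1 : ℝ)).add ?_).const_mul C
    exact integrable_finsetSum _ fun k _ => integrable_norm_sub_rpow (ha k) (hp k)
  · refine (Finset.measurable_fun_prod _ fun k _ => ?_).aestronglyMeasurable
    exact ((by fun_prop : Continuous fun θ => ‖cpt θ - a k‖).measurable).pow_const _
  · refine .of_forall fun θ => ?_
    rw [norm_of_nonneg (prod_nonneg fun k _ => by positivity)]
    exact hC _ (norm_cpt θ).le

lemma arcμ_le : ∀ᵐ θ ∂arcμ, θ ∈ Icc 0 (2 * π) := by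
  unfold arcμ
  refine Measure.ae_smul_measure ?_ _
  filter_upwards [ae_restrict_mem measurableSet_Ioc] with θ hθ using ⟨hθ.1.le, hθ.2⟩

lemma integrable_bdd_arcμ {E : Type*} [NormedAddCommGroup E] {f : ℝ → E} (hf : Continuous f) :
    Integrable f arcμ :=
  integrable_arcμ.mpr (hf.intervalIntegrable _ _)

lemma integrable_continuous_mul {f h : ℝ → ℝ} (hf : Continuous f) (hh : Integrable h arcμ) :
    Integrable (fun θ => f θ * h θ) arcμ := by
  obtain ⟨C, hC⟩ := (isCompact_Icc (a := (0 : ℝ)) (b := 2 * π)).exists_bound_of_continuousOn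
    hf.continuousOn
  refine hh.bdd_mul hf.aestronglyMeasurable (c := C) ?_
  filter_upwards [arcμ_le] with θ hθ using hC θ hθ

lemma integrable_wtF (hg : Continuous g) (ha : ∀ k, ‖a k‖ = 1) (ha' : Function.Injective a)
    (hβ : ∀ k, -(1 / 2 : ℝ) < β k) : Integrable (wtF g a β) arcμ :=
  integrable_continuous_mul hg (integrable_prod_rpow ha ha' fun k => by linarith [hβ k])

lemma isFiniteMeasure_wtν (hg : Continuous g) (ha : ∀ k, ‖a k‖ = 1) (ha' : Function.Injective a)
    (hβ : ∀ k, -(1 / 2 : ℝ) < β k) : IsFiniteMeasure (wtν g a β) :=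
  isFiniteMeasure_withDensity_ofReal (integrable_wtF hg ha ha' hβ).2

lemma integral_wtν {E : Type*} [NormedAddCommGroup E] [NormedSpace ℝ E] (hg : Continuous g)
    (hg0 : ∀ θ, 0 < g θ) (f : ℝ → E) :
    ∫ θ, f θ ∂(wtν g a β) = ∫ θ, wtF g a β θ • f θ ∂arcμ := by
  rw [wtν, integral_withDensity_eq_integral_toReal_smul
    (measurable_wtF hg).ennreal_ofReal (.of_forall fun _ => ENNReal.ofReal_lt_top)]
  refine integral_congr_ae (.of_forall fun θ => ?_)
  simp only [ENNReal.toReal_ofReal (wtF_nonneg hg0 θ)]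

lemma integrable_wtν {E : Type*} [NormedAddCommGroup E] [NormedSpace ℝ E] (hg : Continuous g)
    (hg0 : ∀ θ, 0 < g θ) {f : ℝ → E} :
    Integrable f (wtν g a β) ↔ Integrable (fun θ => wtF g a β θ • f θ) arcμ := by
  rw [wtν, integrable_withDensity_iff_integrable_smul'
    (measurable_wtF hg).ennreal_ofReal (.of_forall fun _ => ENNReal.ofReal_lt_top)]
  simp only [ENNReal.toReal_ofReal (wtF_nonneg hg0 _)]

lemma wtν_ac : wtν g a β ≪ arcμ := withDensity_absolutelyContinuous _ _

lemma nondeg_wtν (hg : Continuous g) (hg0 : ∀ θ, 0 < g θ) (ha : ∀ k, ‖a k‖ = 1)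
    (ha' : Function.Injective a) (hβ : ∀ k, -(1 / 2 : ℝ) < β k) (P : ℂ[X])
    (hP : cI (wtν g a β) (fun z => P.eval z * conj (P.eval z)) = 0) : P = 0 := by
  have := isFiniteMeasure_wtν hg ha ha' hβ
  have h1 : ∫ θ, ‖P.eval (cpt θ)‖ ^ 2 ∂(wtν g a β) = 0 := by
    rw [IsOPUC.cI_mul_conj_self] at hP; exact_mod_cast hP
  have hint := integrable_of_continuousOn_sphere (ν := wtν g a β) (f := fun z => ‖P.eval z‖ ^ 2)
    (by fun_prop)
  rw [integral_wtν hg hg0] at h1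
  simp only [smul_eq_mul] at h1
  rw [integral_eq_zero_iff_of_nonneg
    (fun θ => mul_nonneg (wtF_nonneg hg0 θ) (by positivity)) ((integrable_wtν hg hg0).mp hint)] at h1
  by_contra hP0
  have h2 : ∀ᵐ θ ∂arcμ, False := by
    have hfin : {z : ℂ | P.IsRoot z}.Countable := (finite_setOfPred_isRoot hP0).countable
    filter_upwards [h1, ae_ne_all a, ae_cpt_notMem hfin] with θ hθ hθ' hr
    have := wtF_pos (β := β) hg0 hθ'
    simp only [Pi.zero_apply, mul_eq_zero, this.ne', false_or] at hθ
    exact hr (by simpa using hθ)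
  simp at h2
  exact IsProbabilityMeasure.ne_zero arcμ h2

end weight

lemma hasDerivAt_cpt (θ : ℝ) : HasDerivAt cpt (I * cpt θ) θ := by
  have h : HasDerivAt (fun t : ℝ => (t : ℂ) * I) I θ := by
    simpa using (ofRealCLM.hasDerivAt (x := θ)).mul_const I
  have := h.cexp
  rw [mul_comm] at this
  exact this

lemma contDiff_cpt : ContDiff ℝ 1 cpt := by
  have h : ContDiff ℝ 1 (fun t : ℝ => (t : ℂ)) := ofRealCLM.contDiff
  have h2 : ContDiff ℝ 1 exp := contDiff_exp
  exact h2.comp (h.mul contDiff_const)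

lemma hasDerivAt_norm_cpt_sub_rpow {a : ℂ} (ha : ‖a‖ = 1) (b : ℝ) {θ : ℝ} (hθ : cpt θ ≠ a) :
    HasDerivAt (fun θ => ‖cpt θ - a‖ ^ (2 * b))
      (‖cpt θ - a‖ ^ (2 * b) * (b * (I * (2 / (1 - a * conj (cpt θ)) - 1)).re)) θ := by
  set u := cpt θ with hu
  have hpos : 0 < ‖u - a‖ ^ 2 := by
    have := norm_pos_iff.mpr (sub_ne_zero.mpr hθ); positivity
  have h1 : HasDerivAt (fun θ => ‖cpt θ - a‖ ^ 2)
      (2 * inner ℝ (cpt θ - a) (I * cpt θ)) θ :=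
    ((hasDerivAt_cpt θ).sub_const a).norm_sq
  have h2 := h1.rpow_const (p := b) (Or.inl hpos.ne')
  have e : ∀ t, (‖cpt t - a‖ ^ 2) ^ b = ‖cpt t - a‖ ^ (2 * b) := fun t => by
    rw [rpow_mul (norm_nonneg _)]; norm_num
  simp_rw [e] at h2
  refine h2.congr_deriv ?_
  have e2 : (‖cpt θ - a‖ ^ 2) ^ (b - 1) = ‖u - a‖ ^ (2 * b) / ‖u - a‖ ^ 2 := by
    rw [Real.rpow_sub_one hpos.ne', e]
  rw [e2]
  have key : (I * (2 / (1 - a * conj u) - 1)).re * ‖u - a‖ ^ 2 =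
      2 * inner ℝ (u - a) (I * u) := by
    have hne : 1 - a * conj u ≠ 0 := one_sub_mul_conj_ne_zero (norm_cpt θ) hθ
    have hn : ((‖u - a‖ ^ 2 : ℝ) : ℂ) = (1 - a * conj u) * (1 - conj a * u) := by
      rw [← norm_one_sub_mul_conj (norm_cpt θ), ← normSq_eq_norm_sq, ← mul_conj]
      simp [hu]
    have h3 : I * (2 / (1 - a * conj u) - 1) * ((‖u - a‖ ^ 2 : ℝ) : ℂ) =
        I * (1 + a * conj u) * (1 - conj a * u) := by
      rw [hn]; field_simp; ring
    have h4 := congrArg Complex.re h3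
    rw [re_mul_ofReal] at h4
    rw [h4, Complex.inner]
    have hu1 : u.re ^ 2 + u.im ^ 2 = 1 := by
      have := norm_cpt θ; rw [← hu] at this
      have h5 := Complex.sq_norm u; rw [this, normSq_apply] at h5; nlinarith
    have ha1 : a.re ^ 2 + a.im ^ 2 = 1 := by
      have h5 := Complex.sq_norm a; rw [ha, normSq_apply] at h5; nlinarith
    simp only [mul_re, mul_im, add_re, add_im, sub_re,
      sub_im, Complex.I_re, Complex.I_im, conj_re, conj_im, one_re,
      one_im]
    ring
  rw [← hu, ← key]
  generalize ‖u - a‖ ^ 2 = S at hpos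
  field_simp

lemma re_cauchy_kernel {a z : ℂ} (hz : ‖z‖ = 1) (ha : ‖a‖ = 1) (hne : z ≠ a) :
    ((I * (2 / (1 - a * conj z) - 1)).re : ℂ) = I * (2 / (1 - a * conj z) - 1) := by
  have h2 := one_sub_mul_conj_ne_zero hz hne
  have h3 : 1 - conj a * z ≠ 0 := by
    have := (map_ne_zero conj).mpr h2
    simpa using this
  rw [← conj_eq_iff_re]
  simp only [map_mul, map_sub, map_div₀, map_one, conj_conj, conj_I, map_ofNat]
  field_simp
  linear_combination 2 * mul_conj_of_norm_one ha + 2 * a * conj a * mul_conj_of_norm_one hz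

section pearson

variable {ι : Type*} [Fintype ι] [DecidableEq ι] {g κ : ℝ → ℝ} {a : ι → ℂ} {β : ι → ℝ}

lemma hasDerivAt_wtF (hg : ∀ θ, HasDerivAt g (g θ * κ θ) θ) (ha : ∀ k, ‖a k‖ = 1) {θ : ℝ}
    (hθ : ∀ k, cpt θ ≠ a k) :
    HasDerivAt (wtF g a β) (wtF g a β θ *
      (κ θ + ∑ k, β k * (I * (2 / (1 - a k * conj (cpt θ)) - 1)).re)) θ := by
  have h1 : HasDerivAt (fun θ => ∏ k, ‖cpt θ - a k‖ ^ (2 * β k)) ((∏ k, ‖cpt θ - a k‖ ^ (2 * β k)) *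
      ∑ k, β k * (I * (2 / (1 - a k * conj (cpt θ)) - 1)).re) θ := by
    have h := HasDerivAt.fun_finsetProd (u := Finset.univ) (x := θ) fun k _ =>
      hasDerivAt_norm_cpt_sub_rpow (ha k) (β k) (hθ k)
    refine h.congr_deriv ?_
    rw [mul_sum]
    refine sum_congr rfl fun k _ => ?_
    rw [← mul_prod_erase _ _ (Finset.mem_univ k), smul_eq_mul]; ring
  have h := (hg θ).mul h1
  refine HasDerivAt.congr_deriv (f := wtF g a β) h ?_
  unfold wtF; ring

/-- A function vanishing at all singular points times the weight is continuous. -/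
lemma continuous_mul_wtF (hg : Continuous g) (ha : ∀ k, ‖a k‖ = 1)
    (ha' : Function.Injective a) (hβ : ∀ k, -(1 / 2 : ℝ) < β k) {f : ℂ → ℂ} (hf : ContDiff ℝ 1 f)
    (hfa : ∀ k, f (a k) = 0) : Continuous (fun θ => f (cpt θ) * (wtF g a β θ : ℂ)) := by
  rw [continuous_iff_continuousAt]
  intro θ
  have hfc := hf.continuous
  have hfac : ∀ k, cpt θ ≠ a k → ContinuousAt (fun θ => ‖cpt θ - a k‖ ^ (2 * β k)) θ := by
    intro k hk
    refine ContinuousAt.rpow_const (by fun_prop) (Or.inl ?_)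
    exact norm_ne_zero_iff.mpr (sub_ne_zero.mpr hk)
  by_cases h : ∃ k, cpt θ = a k
  · obtain ⟨k, hk⟩ := h
    obtain ⟨K, hK0, hK⟩ := hf.lipschitz_on_disc
    rw [ContinuousAt, hk, hfa k, zero_mul]
    have hp : 0 < 1 + 2 * β k := by linarith [hβ k]
    have hrest : ContinuousAt (fun θ => ∏ j ∈ Finset.univ.erase k, ‖cpt θ - a j‖ ^ (2 * β j)) θ := by
      refine tendsto_finsetProd _ fun j hj => ?_
      exact hfac j fun h => ne_of_mem_erase hj (ha' (h.symm.trans hk))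
    have hlim : ContinuousAt (fun t => K * (g t * (‖cpt t - a k‖ ^ (1 + 2 * β k) *
        ∏ j ∈ Finset.univ.erase k, ‖cpt t - a j‖ ^ (2 * β j)))) θ := by
      refine continuousAt_const.mul (hg.continuousAt.mul (ContinuousAt.mul ?_ hrest))
      exact ContinuousAt.rpow_const (by fun_prop) (Or.inr hp.le)
    have h0 := hlim.tendsto.norm
    rw [hk, sub_self, norm_zero, Real.zero_rpow hp.ne'] at h0
    simp only [zero_mul, mul_zero, norm_zero] at h0
    refine squeeze_zero_norm (fun t => ?_) h0
    have h1 := hK (cpt t) (a k) (norm_cpt t).le (ha k).le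
    rw [hfa, sub_zero] at h1
    rw [norm_mul, norm_real, wtF, ← mul_prod_erase _ _ (Finset.mem_univ k),
      Real.rpow_add' (norm_nonneg _) hp.ne', Real.rpow_one]
    simp only [norm_mul, norm_eq_abs, abs_norm]
    rw [abs_of_nonneg hK0]
    calc _ ≤ K * ‖cpt t - a k‖ * (|g t| * (|‖cpt t - a k‖ ^ (2 * β k)| *
          |∏ j ∈ Finset.univ.erase k, ‖cpt t - a j‖ ^ (2 * β j)|)) := by gcongr
      _ = _ := by ring
  · push Not at h
    refine ContinuousAt.mul (by fun_prop) ?_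
    refine continuous_ofReal.continuousAt.comp ?_
    refine hg.continuousAt.mul ?_
    exact tendsto_finsetProd _ fun j _ => hfac j (h j)

/-- The Pearson functional. -/
noncomputable def pears (g κ : ℝ → ℝ) (a : ι → ℂ) (β : ι → ℝ) (v : ι → ℂ) (f : ℂ → ℂ) : ℂ :=
  (∫ θ, deriv (fun t => f (cpt t)) θ ∂(wtν g a β)) + (∫ θ, f (cpt θ) * (κ θ : ℂ) ∂(wtν g a β)) +
    I * ∑ k, (β k : ℂ) * (2 * cL (wtν g a β) (a k) (v k) f - cI (wtν g a β) f)

lemma contDiff_comp_cpt {f : ℂ → ℂ} (hf : ContDiff ℝ 1 f) : ContDiff ℝ 1 (fun t => f (cpt t)) :=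
  hf.comp contDiff_cpt

lemma integrable_wtν_of_continuous (hgc : Continuous g) (hg0 : ∀ θ, 0 < g θ)
    (ha : ∀ k, ‖a k‖ = 1) (ha' : Function.Injective a) (hβ : ∀ k, -(1 / 2 : ℝ) < β k)
    {F : ℝ → ℂ} (hF : Continuous F) : Integrable F (wtν g a β) := by
  rw [integrable_wtν hgc hg0]
  obtain ⟨C, hC⟩ := (isCompact_Icc (a := (0 : ℝ)) (b := 2 * π)).exists_bound_of_continuousOn
    hF.continuousOn
  refine Integrable.smul_bdd ((integrable_wtF hgc ha ha' hβ).ofReal) C hF.aestronglyMeasurable ?_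
  filter_upwards [arcμ_le] with θ hθ using hC θ hθ

variable (hgc : Continuous g) (hg0 : ∀ θ, 0 < g θ) (hg : ∀ θ, HasDerivAt g (g θ * κ θ) θ)
  (hgp : g 0 = g (2 * π)) (hκ : Continuous κ) (ha : ∀ k, ‖a k‖ = 1) (ha' : Function.Injective a)
  (hβ : ∀ k, -(1 / 2 : ℝ) < β k)

include hgc hg0 hg hgp hκ ha ha' hβ

lemma pears_eq_zero_of_vanish (v : ι → ℂ) {f : ℂ → ℂ} (hf : ContDiff ℝ 1 f)
    (hfa : ∀ k, f (a k) = 0) : pears g κ a β v f = 0 := by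
  have := isFiniteMeasure_wtν hgc ha ha' hβ
  have hfc := hf.continuous
  have hD : Continuous (deriv fun t => f (cpt t)) :=
    (contDiff_comp_cpt hf).continuous_deriv le_rfl
  have i1 := integrable_wtν_of_continuous hgc hg0 ha ha' hβ hD
  have i2 := integrable_wtν_of_continuous hgc hg0 ha ha' hβ
    (F := fun θ => f (cpt θ) * (κ θ : ℂ)) (by fun_prop)
  have i3 : ∀ k, Integrable (fun θ => 2 * ((f (cpt θ) - f (a k)) / (1 - a k * conj (cpt θ))) -
      f (cpt θ)) (wtν g a β) := fun k =>
    ((integrable_cL (ha k) hf).const_mul 2).sub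
      (integrable_wtν_of_continuous hgc hg0 ha ha' hβ (F := fun θ => f (cpt θ)) (by fun_prop))
  set F' : ℝ → ℂ := fun θ => deriv (fun t => f (cpt t)) θ + f (cpt θ) * (κ θ : ℂ) +
      I * ∑ k, (β k : ℂ) *
        (2 * ((f (cpt θ) - f (a k)) / (1 - a k * conj (cpt θ))) - f (cpt θ)) with hF'
  have iS : Integrable (fun θ => ∑ k, (β k : ℂ) *
        (2 * ((f (cpt θ) - f (a k)) / (1 - a k * conj (cpt θ))) - f (cpt θ))) (wtν g a β) :=
    integrable_finsetSum _ fun k _ => (i3 k).const_mul _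
  have iF : Integrable F' (wtν g a β) := (i1.add i2).add (iS.const_mul _)
  have h1 : pears g κ a β v f = ∫ θ, F' θ ∂(wtν g a β) := by
    rw [hF']
    refine Eq.symm ?_
    refine (integral_add (i1.add i2) (iS.const_mul _)).trans ?_
    rw [show (∫ θ, ((deriv fun t => f (cpt t)) + fun θ => f (cpt θ) * (κ θ : ℂ)) θ ∂(wtν g a β)) = _
      from integral_add i1 i2, integral_const_mul,
      integral_finsetSum _ (fun k _ => (i3 k).const_mul _), pears]
    congr 2
    refine sum_congr rfl fun k _ => ?_
    rw [integral_const_mul, integral_sub ((integrable_cL (ha k) hf).const_mul 2)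
      (integrable_wtν_of_continuous hgc hg0 ha ha' hβ (F := fun θ => f (cpt θ)) (by fun_prop)),
      integral_const_mul, cL, hfa k]
    simp [cI]
  rw [h1, integral_wtν hgc hg0, integral_arcμ]
  have iF2 := (integrable_wtν hgc hg0).mp iF
  rw [integrable_arcμ] at iF2
  have hFTC := integral_eq_of_hasDerivAt_off_countable_of_le
    (fun θ => f (cpt θ) * (wtF g a β θ : ℂ)) (fun θ => wtF g a β θ • F' θ)
    (a := 0) (b := 2 * π) (by positivity) (countable_cpt_preimage (countable_range a))
    (continuous_mul_wtF hgc ha ha' hβ hf hfa).continuousOn (fun θ hθ => ?_) iF2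
  · rw [hFTC, cpt_two_pi, cpt_zero]
    simp [wtF, cpt_two_pi, cpt_zero, hgp]
  · have hne : ∀ k, cpt θ ≠ a k := fun k h => hθ.2 ⟨k, h.symm⟩
    have d1 : HasDerivAt (fun t => f (cpt t)) (deriv (fun t => f (cpt t)) θ) θ :=
      ((contDiff_comp_cpt hf).differentiable one_ne_zero θ).hasDerivAt
    have d2 := (hasDerivAt_wtF (β := β) hg ha hne).ofReal_comp
    refine (d1.mul d2).congr_deriv ?_
    rw [hF', real_smul]
    push_cast
    have : ∀ k, (((I * (2 / (1 - a k * conj (cpt θ)) - 1)).re : ℝ) : ℂ) =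
        I * (2 / (1 - a k * conj (cpt θ)) - 1) :=
      fun k => re_cauchy_kernel (norm_cpt θ) (ha k) (hne k)
    simp_rw [this]
    have e : ∑ k, (β k : ℂ) * (I * (2 / (1 - a k * conj (cpt θ)) - 1)) * f (cpt θ) =
        I * ∑ k, (β k : ℂ) *
        (2 * ((f (cpt θ) - f (a k)) / (1 - a k * conj (cpt θ))) - f (cpt θ)) := by
      rw [mul_sum]
      refine sum_congr rfl fun k _ => ?_
      rw [hfa k]; ring
    rw [← e, ← sum_mul]
    ring

omit hg hgp in
lemma pears_add (v : ι → ℂ) {f h : ℂ → ℂ} (hf : ContDiff ℝ 1 f) (hh : ContDiff ℝ 1 h) :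
    pears g κ a β v (fun z => f z + h z) = pears g κ a β v f + pears g κ a β v h := by
  have := isFiniteMeasure_wtν hgc ha ha' hβ
  have hfc := hf.continuous
  have hhc := hh.continuous
  have hD : Continuous (deriv fun t => f (cpt t)) :=
    (contDiff_comp_cpt hf).continuous_deriv le_rfl
  have hD' : Continuous (deriv fun t => h (cpt t)) :=
    (contDiff_comp_cpt hh).continuous_deriv le_rfl
  unfold pears
  have e1 : ∀ θ, deriv (fun t => f (cpt t) + h (cpt t)) θ =
      deriv (fun t => f (cpt t)) θ + deriv (fun t => h (cpt t)) θ := fun θ =>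
    deriv_fun_add ((contDiff_comp_cpt hf).differentiable one_ne_zero θ)
      ((contDiff_comp_cpt hh).differentiable one_ne_zero θ)
  have I := fun {F : ℝ → ℂ} (hF : Continuous F) => integrable_wtν_of_continuous hgc hg0 ha ha' hβ hF
  simp_rw [e1, fun k => cL_add (ν := wtν g a β) (v := v k) (ha k) hf hh, add_mul]
  rw [integral_add (I hD) (I hD'), integral_add (I (by fun_prop)) (I (by fun_prop)),
    cI_add (by fun_prop) (by fun_prop)]
  have : ∀ k, (β k : ℂ) * (2 * (cL (wtν g a β) (a k) (v k) f + cL (wtν g a β) (a k) (v k) h) -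
      (cI (wtν g a β) f + cI (wtν g a β) h)) =
      (β k : ℂ) * (2 * cL (wtν g a β) (a k) (v k) f - cI (wtν g a β) f) +
      (β k : ℂ) * (2 * cL (wtν g a β) (a k) (v k) h - cI (wtν g a β) h) := fun k => by ring
  simp_rw [this]
  rw [sum_add_distrib]
  ring

omit hgc hg0 hg hgp hκ ha ha' hβ in
lemma pears_const_mul [IsFiniteMeasure (wtν g a β)] (v : ι → ℂ) (c : ℂ) (f : ℂ → ℂ) :
    pears g κ a β v (fun z => c * f z) = c * pears g κ a β v f := by
  unfold pears
  simp_rw [deriv_const_mul_field, cL_const_mul, mul_assoc]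
  rw [integral_const_mul, integral_const_mul, cI_const_mul]
  have : ∀ k, (β k : ℂ) * (2 * (c * cL (wtν g a β) (a k) (v k) f) - c * cI (wtν g a β) f) =
      c * ((β k : ℂ) * (2 * cL (wtν g a β) (a k) (v k) f - cI (wtν g a β) f)) := fun k => by ring
  simp_rw [this]
  rw [← mul_sum]
  ring

/-- The Pearson identity, with suitable regularisation constants. -/
theorem exists_pearson (hβ0 : ∀ k, β k ≠ 0) : ∃ v : ι → ℂ,
    (∀ k, v k + conj (v k) = cI (wtν g a β) (fun _ => 1)) ∧
    ∀ f : ℂ → ℂ, ContDiff ℝ 1 f → pears g κ a β v f = 0 := by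
  have := isFiniteMeasure_wtν hgc ha ha' hβ
  set c1 := cI (wtν g a β) (fun _ => 1) with hc1
  have hc1r : conj c1 = c1 := by
    rw [hc1, ← cI_conj]; exact cI_congr fun z _ => map_one _
  set L : ι → ℂ → ℂ := fun k z => ∏ j ∈ Finset.univ.erase k,
    ((‖a k - a j‖ ^ 2 : ℝ) : ℂ)⁻¹ * ((z - a j) * conj (z - a j)) with hL
  have hconj : ContDiff ℝ 1 (fun z : ℂ => conj z) := conjCLE.contDiff
  have hLc : ∀ k, ContDiff ℝ 1 (L k) := by
    intro k
    refine contDiff_prod fun j _ => contDiff_const.mul ?_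
    simp only [map_sub]
    fun_prop
  have hLr : ∀ k z, conj (L k z) = L k z := by
    intro k z
    simp only [hL, map_prod, map_mul, map_inv₀, conj_ofReal, conj_conj]
    exact prod_congr rfl fun j _ => by ring
  have hLk : ∀ k, L k (a k) = 1 := by
    intro k
    refine prod_eq_one fun j hj => ?_
    have : a k - a j ≠ 0 := sub_ne_zero.mpr fun h => ne_of_mem_erase hj (ha' h).symm
    rw [mul_conj, normSq_eq_norm_sq]
    refine inv_mul_cancel₀ ?_
    have := norm_ne_zero_iff.mpr this
    exact_mod_cast pow_ne_zero 2 this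
  have hLj : ∀ k j, j ≠ k → L k (a j) = 0 := by
    intro k j hjk
    refine Finset.prod_eq_zero (i := j) (by simp [hjk]) (by simp)
  set v0 : ι → ℂ := fun _ => c1 / 2 with hv0
  have hv0r : ∀ k, v0 k + conj (v0 k) = c1 := by
    intro k; simp only [hv0, map_div₀, hc1r, map_ofNat]; ring
  set p : ι → ℂ := fun k => pears g κ a β v0 (L k) with hp
  have hpr : ∀ k, conj (p k) = p k := by
    intro k
    have hreal : ∀ θ, deriv (fun t => L k (cpt t)) θ = conj (deriv (fun t => L k (cpt t)) θ) := by
      intro θ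
      have d1 : HasDerivAt (fun t => L k (cpt t)) (deriv (fun t => L k (cpt t)) θ) θ :=
        ((contDiff_comp_cpt (hLc k)).differentiable one_ne_zero θ).hasDerivAt
      have d2 := conjCLE.toContinuousLinearMap.hasFDerivAt.comp_hasDerivAt θ d1
      refine d1.unique ?_
      refine (d2.congr_of_eventuallyEq (.of_forall fun t => ?_))
      exact (hLr k (cpt t)).symm
    have e1 : conj (∫ θ, deriv (fun t => L k (cpt t)) θ ∂(wtν g a β)) =
        ∫ θ, deriv (fun t => L k (cpt t)) θ ∂(wtν g a β) := by
      rw [← integral_conj]; exact integral_congr_ae (.of_forall fun θ => (hreal θ).symm)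
    have e2 : conj (∫ θ, L k (cpt θ) * (κ θ : ℂ) ∂(wtν g a β)) =
        ∫ θ, L k (cpt θ) * (κ θ : ℂ) ∂(wtν g a β) := by
      rw [← integral_conj]
      exact integral_congr_ae (.of_forall fun θ => by simp only [map_mul, hLr, conj_ofReal])
    have hLr' : ∀ k, (fun z => conj (L k z)) = L k := fun k => funext (hLr k)
    have e3 : ∀ j, cL (wtν g a β) (a j) (v0 j) (L k) + conj (cL (wtν g a β) (a j) (v0 j) (L k)) =
        cI (wtν g a β) (L k) := by
      intro j
      have := cL_add_conj (ν := wtν g a β) (ha j) (wtν_ac.ae_le (ae_cpt_ne (a j))) (hv0r j) (hLc k)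
      rwa [hLr'] at this
    have e4 : conj (cI (wtν g a β) (L k)) = cI (wtν g a β) (L k) := by
      rw [← cI_conj, hLr']
    simp only [hp, pears, map_add, map_mul, map_sum, map_sub, e1, e2, e4, conj_I,
      conj_ofReal, map_ofNat]
    rw [neg_mul, ← mul_neg, ← sum_neg_distrib]
    congr 2
    refine sum_congr rfl fun j _ => ?_
    linear_combination (-2 * (β j : ℂ)) * e3 j
  set v : ι → ℂ := fun k => v0 k - p k / (2 * I * β k) with hv
  have hcL : ∀ k f, cL (wtν g a β) (a k) (v k) f =
      cL (wtν g a β) (a k) (v0 k) f - f (a k) * (p k / (2 * I * β k)) := by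
    intro k f; simp only [cL, hv]; ring
  have hpv : ∀ k, pears g κ a β v (L k) = 0 := by
    intro k
    have : pears g κ a β v (L k) = pears g κ a β v0 (L k) -
        I * ∑ j, (β j : ℂ) * (2 * (L k (a j) * (p j / (2 * I * β j)))) := by
      simp only [pears, hcL]
      rw [add_sub_assoc, ← mul_sub, ← sum_sub_distrib]
      congr 2
      exact sum_congr rfl fun j _ => by ring
    rw [this, sum_eq_single k (fun j _ hj => by rw [hLj k j hj]; ring) (by simp), hLk]
    have h1 : (β k : ℂ) ≠ 0 := by exact_mod_cast hβ0 k
    have h2 := Complex.I_ne_zero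
    change p k - _ = 0
    field_simp; ring
  refine ⟨v, fun k => ?_, fun f hf => ?_⟩
  · have : conj (p k / (2 * I * β k)) = - (p k / (2 * I * β k)) := by
      simp only [map_div₀, map_mul, hpr, conj_I, conj_ofReal, map_ofNat]
      ring
    simp only [hv, map_sub, this]
    linear_combination hv0r k
  · set f0 : ℂ → ℂ := fun z => f z + ∑ k, (-f (a k)) * L k z with hf0
    have hS : ∀ s : Finset ι, ContDiff ℝ 1 (fun z => ∑ k ∈ s, (-f (a k)) * L k z) ∧
        pears g κ a β v (fun z => ∑ k ∈ s, (-f (a k)) * L k z) = 0 := by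
      intro s
      induction s using Finset.induction_on with
      | empty =>
        refine ⟨by simpa using contDiff_const, ?_⟩
        have := pears_const_mul (g := g) (κ := κ) (a := a) (β := β) v 0 f
        simpa using this
      | insert k s hk ih =>
        simp only [sum_insert hk]
        have h1 : ContDiff ℝ 1 (fun z => (-f (a k)) * L k z) := contDiff_const.mul (hLc k)
        refine ⟨h1.add ih.1, ?_⟩
        rw [pears_add hgc hg0 hκ ha ha' hβ v h1 ih.1, ih.2, pears_const_mul, hpv]; simp
    have h0 : pears g κ a β v f0 = 0 := by
      refine pears_eq_zero_of_vanish hgc hg0 hg hgp hκ ha ha' hβ v (hf.add (hS _).1) fun k => ?_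
      rw [hf0]
      simp only
      rw [sum_eq_single k (fun j _ hj => by rw [hLj j k hj.symm]; ring) (by simp), hLk]
      ring
    rw [hf0, pears_add hgc hg0 hκ ha ha' hβ v hf (hS _).1, (hS _).2, add_zero] at h0
    exact h0

end pearson

section fourierError

variable {ν : Measure ℝ} [IsFiniteMeasure ν] {Φ : ℕ → ℂ[X]} {κ : ℝ → ℝ} {d : ℕ → ℂ}

lemma hasSum_error (hd : Summable (fun j => ‖d j‖))
    (hκd : ∀ θ, HasSum (fun j => d j * cpt θ ^ j - conj (d j) * conj (cpt θ) ^ j)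
      (-I * (κ θ : ℂ))) {F : ℂ → ℂ} (hF : Continuous F) :
    HasSum (fun j => d j * cI ν (fun z => z ^ j * F z) - conj (d j) * cI ν (fun z => conj z ^ j * F z))
      (-I * ∫ θ, F (cpt θ) * (κ θ : ℂ) ∂ν) := by
  obtain ⟨C, hC⟩ := (isCompact_sphere (0 : ℂ) 1).exists_bound_of_continuousOn hF.continuousOn
  have hC0 : 0 ≤ C := (norm_nonneg _).trans (hC 1 (by simp))
  set G : ℕ → ℝ → ℂ := fun j θ =>
    F (cpt θ) * (d j * cpt θ ^ j - conj (d j) * conj (cpt θ) ^ j) with hG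
  have hGi : ∀ j, Integrable (G j) ν := fun j =>
    integrable_of_continuousOn_sphere (f := fun z => F z * (d j * z ^ j - conj (d j) * conj z ^ j))
      (by fun_prop)
  have hGb : ∀ j θ, ‖G j θ‖ ≤ C * (2 * ‖d j‖) := by
    intro j θ
    rw [hG, norm_mul]
    refine mul_le_mul (hC _ (cpt_mem θ)) ((norm_sub_le _ _).trans ?_) (norm_nonneg _) hC0
    simp; linarith
  have hs : Summable fun j => ∫ θ, ‖G j θ‖ ∂ν := by
    refine Summable.of_nonneg_of_le (fun j => by positivity) (fun j => ?_)
      (((hd.mul_left 2).mul_left C).mul_left (ν.real univ))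
    calc _ ≤ ∫ θ, C * (2 * ‖d j‖) ∂ν :=
          integral_mono (hGi j).norm (integrable_const _) (hGb j)
      _ = _ := by simp
  have h := hasSum_integral_of_summable_integral_norm hGi hs
  have e1 : ∀ j, ∫ θ, G j θ ∂ν =
      d j * cI ν (fun z => z ^ j * F z) - conj (d j) * cI ν (fun z => conj z ^ j * F z) := by
    intro j
    rw [← cI_const_mul, ← cI_const_mul, ← cI_sub (by fun_prop) (by fun_prop)]
    refine integral_congr_ae (.of_forall fun θ => ?_)
    simp only [hG]; ring
  have e2 : ∫ θ, ∑' j, G j θ ∂ν = -I * ∫ θ, F (cpt θ) * (κ θ : ℂ) ∂ν := by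
    rw [← integral_const_mul]
    refine integral_congr_ae (.of_forall fun θ => ?_)
    simp only [hG]
    rw [((hκd θ).mul_left (F (cpt θ))).tsum_eq]; ring
  simp_rw [e1] at h
  rwa [e2] at h

lemma tendsto_error (H : IsOPUC ν Φ) (hd : Summable (fun j => ‖d j‖)) (hd0 : d 0 = 0)
    (hκd : ∀ θ, HasSum (fun j => d j * cpt θ ^ j - conj (d j) * conj (cpt θ) ^ j)
      (-I * (κ θ : ℂ))) (hvb : Tendsto (vb Φ) atTop (nhds 0)) :
    Tendsto (fun n => ∫ θ, ((Φ n).eval (cpt θ) * conj ((rv Φ n).eval (cpt θ))) * (κ θ : ℂ) ∂ν)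
      atTop (nhds 0) := by
  set T : ℕ → ℕ → ℂ := fun n j =>
    d j * cI ν (fun z => z ^ j * ((Φ n).eval z * conj ((rv Φ n).eval z))) -
      conj (d j) * cI ν (fun z => conj z ^ j * ((Φ n).eval z * conj ((rv Φ n).eval z))) with hT
  have hsum : ∀ n, ∑' j, T n j = -I *
      ∫ θ, ((Φ n).eval (cpt θ) * conj ((rv Φ n).eval (cpt θ))) * (κ θ : ℂ) ∂ν := fun n =>
    (hasSum_error hd hκd (F := fun z => (Φ n).eval z * conj ((rv Φ n).eval z))
      (by fun_prop)).tsum_eq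
  have hb : ∀ n j, ‖T n j‖ ≤ ‖d j‖ * (2 * opN ν Φ 0) := by
    intro n j
    have h1 := H.norm_cI_pow_le n j
    have h2 := H.norm_cI_conj_pow_le n j
    simp only [mul_assoc] at h1 h2
    refine (norm_sub_le _ _).trans ?_
    simp only [norm_mul, RCLike.norm_conj]
    nlinarith [norm_nonneg (d j)]
  have hshift : ∀ i, Tendsto (fun n => ‖vb Φ (n + i)‖) atTop (nhds 0) := fun i => by
    simpa using ((tendsto_add_atTop_iff_nat i).mpr hvb).norm
  have hsm : ∀ j, Tendsto (fun n => (∑ i ∈ Finset.range j, ‖vb Φ (n + i)‖) * opN ν Φ 0)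
      atTop (nhds 0) := by
    intro j
    simpa using (tendsto_finsetSum (Finset.range j) fun i _ => hshift i).mul_const (opN ν Φ 0)
  have hT0 : ∀ j, Tendsto (fun n => T n j) atTop (nhds 0) := by
    intro j
    rcases j with _ | j
    · simp [hT, hd0]
    · have h1 : Tendsto (fun n => cI ν (fun z => z ^ (j + 1) * ((Φ n).eval z *
          conj ((rv Φ n).eval z)))) atTop (nhds 0) := by
        refine squeeze_zero_norm (fun n => ?_) (hsm (j + 1))
        have := H.norm_cI_pow_le_sum n (j := j + 1) (by omega)
        simpa only [mul_assoc] using this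
      have h2 : Tendsto (fun n => cI ν (fun z => conj z ^ (j + 1) * ((Φ n).eval z *
          conj ((rv Φ n).eval z)))) atTop (nhds 0) := by
        rw [← tendsto_add_atTop_iff_nat (j + 2)]
        refine squeeze_zero_norm (fun n => ?_) (hsm (j + 2))
        have := H.norm_cI_conj_pow_le_sum n (j + 1)
        simp only [mul_assoc] at this
        exact this
      simpa using (h1.const_mul (d (j + 1))).sub (h2.const_mul (conj (d (j + 1))))
  have h := tendsto_tsum_of_dominated_convergence (f := T) (g := fun _ => 0)
    (hd.mul_right (2 * opN ν Φ 0)) hT0 (.of_forall fun n j => hb n j)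
  simp only [hsum, tsum_zero] at h
  have h2 := h.const_mul I
  simpa [← mul_assoc] using h2

end fourierError

/-- The coupled recursions satisfied by the values of orthogonal polynomials and of their Cauchy
transforms at a point of the circle. -/
structure IsSzSeq (η X Y : ℕ → ℂ) : Prop where
  norm_lt : ∀ n, ‖η n‖ < 1
  X_zero : X 0 = 1
  X_succ : ∀ n, X (n + 1) = X n - η n * conj (X n)
  Y_succ : ∀ n, (1 - ‖η n‖ ^ 2) * Y (n + 1) = Y n + η n * conj (Y n)
  re_half : ∀ n, (conj (X n) * Y n).re = 1 / 2

lemma IsOPUC.isSzSeq {ν : Measure ℝ} [IsFiniteMeasure ν] {Φ : ℕ → ℂ[X]} {a v : ℂ}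
    (H : IsOPUC ν Φ) (ha : ‖a‖ = 1) (hν : ∀ᵐ θ ∂ν, cpt θ ≠ a)
    (hv : v + conj v = cI ν (fun _ => 1)) :
    IsSzSeq (fun n => conj (vb Φ n) * conj a ^ (n + 1)) (fun n => conj a ^ n * (Φ n).eval a)
      (fun n => conj a ^ n * cL ν a v (fun z => (Φ n).eval z) / opN ν Φ n) where
  norm_lt n := by simpa [ha] using H.norm_vb_lt n
  X_zero := by simp [H.phi_zero]
  X_succ n := by
    have hpow : conj a ^ n * a ^ n = 1 := by rw [← mul_pow, conj_mul_of_norm_one ha, one_pow]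
    have h1 : conj a ^ (n + 1) * (rv Φ n).eval a = conj a * conj ((Φ n).eval a) := by
      rw [H.rv_eval n ha]
      linear_combination (conj a * conj ((Φ n).eval a)) *
        hpow
    have h2 : conj (conj a ^ n * (Φ n).eval a) * conj a ^ (n + 1) =
        conj a * conj ((Φ n).eval a) := by
      rw [map_mul, map_pow, conj_conj]
      linear_combination (conj a * conj ((Φ n).eval a)) *
        hpow
    rw [H.phi_succ]
    simp only [eval_sub, eval_mul, eval_X, eval_C]
    linear_combination conj a ^ n * (Φ n).eval a * conj_mul_of_norm_one ha -
      conj (vb Φ n) * h1 + conj (vb Φ n) * h2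
  Y_succ n := by
    have hN := (H.opN_pos n).ne'
    have hN' := (H.opN_pos (n + 1)).ne'
    have e1 : ((1 - ‖conj (vb Φ n) * conj a ^ (n + 1)‖ ^ 2 : ℝ) : ℂ) * (opN ν Φ n : ℂ) =
        (opN ν Φ (n + 1) : ℂ) := by
      rw [H.opN_succ]; push_cast; simp [ha]
    have c1 : (opN ν Φ n : ℂ) ≠ 0 := by exact_mod_cast hN
    have c2 : (opN ν Φ (n + 1) : ℂ) ≠ 0 := by exact_mod_cast hN'
    rw [H.cL_phi_succ ha hν hv]
    have e3 : (1 - ((‖conj (vb Φ n) * conj a ^ (n + 1)‖ : ℝ) : ℂ) ^ 2) =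
        (opN ν Φ (n + 1) : ℂ) / opN ν Φ n := by
      rw [eq_div_iff c1, ← e1]; push_cast; ring
    rw [e3]
    simp only [map_div₀, map_mul, map_pow, conj_conj, conj_ofReal]
    field_simp
    linear_combination (conj a ^ n * cL ν a v (fun z => (Φ n).eval z)) * conj_mul_of_norm_one ha
  re_half n := by
    have hpow : conj a ^ n * a ^ n = 1 := by rw [← mul_pow, conj_mul_of_norm_one ha, one_pow]
    have h := H.re_cL (n := n) ha hν hv
    have hN := (H.opN_pos n).ne'
    have : conj (conj a ^ n * (Φ n).eval a) * (conj a ^ n * cL ν a v (fun z => (Φ n).eval z) /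
        opN ν Φ n) = conj ((Φ n).eval a) * cL ν a v (fun z => (Φ n).eval z) / opN ν Φ n := by
      rw [map_mul, map_pow, conj_conj]
      linear_combination (conj ((Φ n).eval a) * cL ν a v (fun z => (Φ n).eval z) / opN ν Φ n) *
        hpow
    rw [this, div_ofReal_re, h]
    field_simp

section pearsonOP

variable {ι : Type*} [Fintype ι] [DecidableEq ι] {g κ : ℝ → ℝ} {a : ι → ℂ} {β : ι → ℝ}
  {Φ : ℕ → ℂ[X]} {v : ι → ℂ}

/-- The discrete Painlevé type relation between the Verblunsky coefficients and the values at the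
singular points. -/
theorem IsOPUC.pearson_rv [IsFiniteMeasure (wtν g a β)] (H : IsOPUC (wtν g a β) Φ)
    (ha : ∀ k, ‖a k‖ = 1) (hP : ∀ f : ℂ → ℂ, ContDiff ℝ 1 f → pears g κ a β v f = 0) (n : ℕ) :
    (n + ∑ k, (β k : ℂ)) * (Φ n).eval 0 =
      (∑ k, (β k : ℂ) * a k ^ n * (2 * (conj (a k) ^ n * (Φ n).eval (a k)) *
        (conj (a k) ^ n * cL (wtν g a β) (a k) (v k) (fun z => (Φ n).eval z) /
          opN (wtν g a β) Φ n))) -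
      I * (∫ θ, ((Φ n).eval (cpt θ) * conj ((rv Φ n).eval (cpt θ))) * (κ θ : ℂ)
        ∂(wtν g a β)) / opN (wtν g a β) Φ n := by
  set ν := wtν g a β with hν
  have hN : (opN ν Φ n : ℂ) ≠ 0 := by exact_mod_cast (H.opN_pos n).ne'
  have h := hP (fun z => (Φ n).eval z * conj ((rv Φ n).eval z)) (by
    exact (contDiff_eval _).mul (contDiff_conj (contDiff_eval _)))
  unfold pears at h
  have hdv : ∀ P : ℂ[X], ∀ θ, HasDerivAt (fun t => P.eval (cpt t))
      (I * (cpt θ * P.derivative.eval (cpt θ))) θ := by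
    intro P θ
    refine ((P.hasDerivAt (cpt θ)).comp_of_eq θ (hasDerivAt_cpt θ) rfl).congr_deriv ?_
    ring
  have hdv2 : ∀ θ, deriv (fun t => (Φ n).eval (cpt t) * conj ((rv Φ n).eval (cpt t))) θ =
      I * ((X * (Φ n).derivative).eval (cpt θ) * conj ((rv Φ n).eval (cpt θ)) -
      (Φ n).eval (cpt θ) * conj ((X * (rv Φ n).derivative).eval (cpt θ))) := by
    intro θ
    have d2 := conjCLE.toContinuousLinearMap.hasFDerivAt.comp_hasDerivAt θ (hdv (rv Φ n) θ)
    refine (((hdv (Φ n) θ).mul d2).deriv).trans ?_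
    simp
    ring
  have e1 : cI ν (fun z => (X * (Φ n).derivative).eval z * conj ((rv Φ n).eval z)) = 0 := by
    have h1 := H.orth_rv_poly (n := n) (P := X * (Φ n).derivative) (by simp) (by
      rcases n with _ | n
      · simp [H.phi_zero]
      · refine (natDegree_mul_le).trans ?_
        have := natDegree_derivative_le (Φ (n + 1))
        rw [H.natDegree] at this
        simp only [natDegree_X]; omega)
    have h2 := congrArg conj h1
    rw [← cI_conj, map_zero] at h2
    rw [← h2]
    exact cI_congr fun z _ => by simp; ring
  have e2 : cI ν (fun z => (Φ n).eval z * conj ((X * (rv Φ n).derivative).eval z)) =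
      n * (Φ n).eval 0 * opN ν Φ n := by
    rw [H.cI_phi_conj]
    · congr 1
      rcases n with _ | n
      · simp
      · rw [coeff_X_mul, coeff_derivative, H.coeff_rv]; simp; ring
    · rcases n with _ | n
      · simp [rv]
      · refine (natDegree_mul_le).trans ?_
        have := natDegree_derivative_le (rv Φ (n + 1))
        have := H.natDegree_rv (n + 1)
        simp only [natDegree_X]; omega
  have e3 : (∫ θ, deriv (fun t => (Φ n).eval (cpt t) * conj ((rv Φ n).eval (cpt t))) θ ∂ν) =
      I * (0 - n * (Φ n).eval 0 * opN ν Φ n) := by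
    rw [← e2, ← e1, ← cI_sub (by fun_prop) (by fun_prop), ← cI_const_mul]
    exact integral_congr_ae (.of_forall fun θ => hdv2 θ)
  have haen : ∀ k, ∀ᵐ θ ∂ν, cpt θ ≠ a k := fun k => wtν_ac.ae_le (ae_cpt_ne (a k))
  have e4 : ∀ k, cL ν (a k) (v k) (fun z => (Φ n).eval z * conj ((rv Φ n).eval z)) =
      conj (a k) ^ n * (Φ n).eval (a k) * cL ν (a k) (v k) (fun z => (Φ n).eval z) := by
    intro k
    rw [H.cL_phi_conj (ha k) (haen k) (H.natDegree_rv n), H.rv_eval n (ha k)]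
    simp
  simp only [← hν] at h
  rw [e3, H.cI_phi_conj_rv] at h
  simp only [e4] at h
  set S := ∑ k, (β k : ℂ) * a k ^ n * (2 * (conj (a k) ^ n * (Φ n).eval (a k)) *
        (conj (a k) ^ n * cL ν (a k) (v k) (fun z => (Φ n).eval z) / opN ν Φ n)) with hS
  have e5 : S *
        opN ν Φ n - (∑ k, (β k : ℂ)) * ((Φ n).eval 0 * opN ν Φ n) =
      ∑ k, (β k : ℂ) * (2 * (conj (a k) ^ n * (Φ n).eval (a k) *
        cL ν (a k) (v k) (fun z => (Φ n).eval z)) - (Φ n).eval 0 * opN ν Φ n) := by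
    rw [hS, sum_mul, sum_mul, ← sum_sub_distrib]
    refine sum_congr rfl fun k _ => ?_
    have : a k ^ n * conj (a k) ^ n = 1 := by
      rw [← mul_pow, mul_conj_of_norm_one (ha k), one_pow]
    field_simp
    linear_combination ((β k : ℂ) * 2 * ((conj (a k)) ^ n * eval (a k) (Φ n) *
      cL ν (a k) (v k) (fun z => eval z (Φ n)))) * this
  rw [← e5] at h
  clear_value S
  field_simp
  linear_combination I * h - (S - (n + ∑ k, (β k : ℂ)) * (Φ n).eval 0) * opN ν Φ n *
    Complex.I_mul_I

end pearsonOP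

namespace IsSzSeq

variable {η X Y : ℕ → ℂ}

lemma X_ne (H : IsSzSeq η X Y) (n : ℕ) : X n ≠ 0 := by
  intro h
  have := H.re_half n
  simp [h] at this

lemma norm_phase (H : IsSzSeq η X Y) (n : ℕ) : ‖X n / conj (X n)‖ = 1 := by
  have := norm_ne_zero_iff.mpr (H.X_ne n)
  simp [this]

lemma conj_mul_eq (H : IsSzSeq η X Y) (n : ℕ) :
    2 * (conj (X n) * Y n) = 1 + 2 * ((conj (X n) * Y n).im : ℂ) * I := by
  apply Complex.ext
  · have := H.re_half n
    simp at this ⊢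
    linarith
  · simp

lemma prod_eq (H : IsSzSeq η X Y) (n : ℕ) :
    2 * X n * Y n = X n / conj (X n) * (1 + 2 * ((conj (X n) * Y n).im : ℂ) * I) := by
  have h := (map_ne_zero conj).mpr (H.X_ne n)
  rw [← H.conj_mul_eq]
  field_simp

lemma norm_prod (H : IsSzSeq η X Y) (n : ℕ) :
    ‖2 * X n * Y n‖ = ‖(1 + 2 * ((conj (X n) * Y n).im : ℂ) * I : ℂ)‖ := by
  rw [H.prod_eq, norm_mul, H.norm_phase, one_mul]

lemma abs_im_le (H : IsSzSeq η X Y) (n : ℕ) :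
    2 * |(conj (X n) * Y n).im| ≤ ‖2 * X n * Y n‖ := by
  rw [H.norm_prod]
  have := abs_im_le_norm (1 + 2 * ((conj (X n) * Y n).im : ℂ) * I : ℂ)
  refine le_trans (le_of_eq ?_) this
  simp [abs_mul]

lemma prod_succ (H : IsSzSeq η X Y) (n : ℕ) :
    (1 - ‖η n‖ ^ 2) * (2 * X (n + 1) * Y (n + 1)) = 2 * X n * Y n -
      4 * I * ((conj (X n) * Y n).im : ℂ) * η n - η n ^ 2 * conj (2 * X n * Y n) := by
  have h1 : 2 * I * ((conj (X n) * Y n).im : ℂ) =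
      conj (X n) * Y n - X n * conj (Y n) := by
    have h2 := sub_conj (conj (X n) * Y n)
    simp only [map_mul, conj_conj] at h2
    rw [h2]; push_cast; ring
  have h3 : (1 - ‖η n‖ ^ 2) * (2 * X (n + 1) * Y (n + 1)) =
      2 * X (n + 1) * ((1 - ‖η n‖ ^ 2) * Y (n + 1)) := by ring
  rw [h3, H.Y_succ, H.X_succ]
  simp only [map_mul, map_ofNat]
  linear_combination (2 * η n) * h1

lemma im_succ (H : IsSzSeq η X Y) (n : ℕ) :
    (1 - ‖η n‖ ^ 2) * (conj (X (n + 1)) * Y (n + 1)).im =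
      (1 + ‖η n‖ ^ 2) * (conj (X n) * Y n).im - (conj (η n) * (2 * X n * Y n)).im := by
  have h3 : ((1 - ‖η n‖ ^ 2 : ℝ) : ℂ) * (conj (X (n + 1)) * Y (n + 1)) =
      conj (X (n + 1)) * ((1 - ‖η n‖ ^ 2) * Y (n + 1)) := by push_cast; ring
  have h4 := congrArg Complex.im h3
  rw [im_ofReal_mul] at h4
  rw [h4, H.Y_succ, H.X_succ]
  have h5 : ‖η n‖ ^ 2 = (η n).re ^ 2 + (η n).im ^ 2 := by
    rw [Complex.sq_norm, normSq_apply]; ring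
  rw [h5]
  simp
  ring

lemma norm_prod_succ_sub_le (H : IsSzSeq η X Y) {n : ℕ} (hn : ‖η n‖ ≤ 1 / 2) :
    ‖2 * X (n + 1) * Y (n + 1) - 2 * X n * Y n‖ ≤ 4 * ‖η n‖ * ‖2 * X n * Y n‖ := by
  have h1 := H.prod_succ n
  have h2 : ((1 - ‖η n‖ ^ 2 : ℝ) : ℂ) * (2 * X (n + 1) * Y (n + 1) - 2 * X n * Y n) =
      ((‖η n‖ ^ 2 : ℝ) : ℂ) * (2 * X n * Y n) -
      4 * I * ((conj (X n) * Y n).im : ℂ) * η n - η n ^ 2 * conj (2 * X n * Y n) := by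
    push_cast; linear_combination h1
  have h3 := congrArg norm h2
  rw [norm_mul, Complex.norm_of_nonneg (by nlinarith [norm_nonneg (η n)])] at h3
  have h4 : ‖((‖η n‖ ^ 2 : ℝ) : ℂ) * (2 * X n * Y n) -
      4 * I * ((conj (X n) * Y n).im : ℂ) * η n - η n ^ 2 * conj (2 * X n * Y n)‖ ≤
      ‖η n‖ ^ 2 * ‖2 * X n * Y n‖ + 2 * (2 * |(conj (X n) * Y n).im|) * ‖η n‖ +
        ‖η n‖ ^ 2 * ‖2 * X n * Y n‖ := by
    refine (norm_sub_le _ _).trans (add_le_add ((norm_sub_le _ _).trans (add_le_add ?_ ?_)) ?_)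
    · rw [norm_mul, Complex.norm_of_nonneg (by positivity)]
    · simp only [norm_mul, norm_I, norm_real, norm_eq_abs,
        norm_ofNat, mul_one]
      exact le_of_eq (by ring)
    · rw [norm_mul, norm_pow, RCLike.norm_conj]
  have h5 := H.abs_im_le n
  have h6 := norm_nonneg (η n)
  have h7 := norm_nonneg (2 * X n * Y n)
  rw [← h3] at h4
  set x := ‖η n‖
  set P := ‖2 * X n * Y n‖
  have h8 : (1 - x ^ 2) * ‖2 * X (n + 1) * Y (n + 1) - 2 * X n * Y n‖ ≤ (1 - x ^ 2) * (4 * x * P) := by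
    refine h4.trans ?_
    nlinarith [mul_le_mul_of_nonneg_right h5 h6, mul_nonneg h6 h7, mul_nonneg (mul_nonneg h6 h7) h6]
  exact le_of_mul_le_mul_left h8 (by nlinarith)

end IsSzSeq

lemma IsSzSeq.norm_prod_succ_le {η X Y : ℕ → ℂ} (H : IsSzSeq η X Y) {n : ℕ} (hn : ‖η n‖ ≤ 1 / 2) :
    ‖2 * X (n + 1) * Y (n + 1)‖ ≤ (1 + 4 * ‖η n‖) * ‖2 * X n * Y n‖ := by
  have h := H.norm_prod_succ_sub_le hn
  have h2 := norm_le_norm_add_norm_sub' (2 * X (n + 1) * Y (n + 1)) (2 * X n * Y n)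
  linarith

lemma exists_vandermonde {ι : Type*} [Fintype ι] [DecidableEq ι] {a : ι → ℂ}
    (ha' : Function.Injective a) : ∃ l : ι → ℕ → ℂ, ∀ k j,
    ∑ i ∈ Finset.range (Fintype.card ι), l k i * a j ^ i = if j = k then 1 else 0 := by
  refine ⟨fun k i => (Lagrange.basis Finset.univ a k).coeff i, fun k j => ?_⟩
  have hdeg : (Lagrange.basis Finset.univ a k).natDegree < Fintype.card ι := by
    have h := Lagrange.degree_basis (s := Finset.univ) (v := a) ha'.injOn (Finset.mem_univ k)
    have hc : 0 < Fintype.card ι := Fintype.card_pos_iff.mpr ⟨k⟩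
    rw [natDegree_lt_iff_degree_lt (Lagrange.basis_ne_zero ha'.injOn (Finset.mem_univ k)), h,
      card_univ]
    exact_mod_cast Nat.sub_lt hc one_pos
  rw [← eval_eq_sum_range' hdeg]
  split_ifs with h
  · rw [h, Lagrange.eval_basis_self ha'.injOn (Finset.mem_univ k)]
  · rw [Lagrange.eval_basis_of_ne (Ne.symm h) (Finset.mem_univ j)]

/-- Finitely many coupled sequences `IsSzSeq` driven by the same coefficients, which are in turn
determined by the sequences up to a small error. -/
structure IsSzSystem {ι : Type*} [Fintype ι] (a : ι → ℂ) (β : ι → ℝ) (α : ℕ → ℂ)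
    (X Y : ι → ℕ → ℂ) (ε : ℕ → ℂ) : Prop where
  norm_a : ∀ k, ‖a k‖ = 1
  inj : Function.Injective a
  ne_zero : ∀ k, β k ≠ 0
  sz : ∀ k, IsSzSeq (fun n => conj (α n) * conj (a k) ^ (n + 1)) (X k) (Y k)
  main : ∀ n : ℕ, -(((n : ℂ) + 1) + ∑ k, (β k : ℂ)) * conj (α n) =
    (∑ k, (β k : ℂ) * a k ^ (n + 1) * (2 * X k (n + 1) * Y k (n + 1))) + ε n
  eps : Tendsto ε atTop (nhds 0)
  block : ∃ C : ℝ, 0 ≤ C ∧ ∀ n N : ℕ, ∑ i ∈ Finset.Ico n N, ‖α i‖ ^ 2 ≤ C / (n + 1)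

namespace IsSzSystem

variable {ι : Type*} [Fintype ι] [DecidableEq ι] {a : ι → ℂ} {β : ι → ℝ} {α : ℕ → ℂ}
    {X Y : ι → ℕ → ℂ} {ε : ℕ → ℂ}

lemma tendsto_alpha (H : IsSzSystem a β α X Y ε) : Tendsto (fun n => ‖α n‖) atTop (nhds 0) := by
  obtain ⟨C, hC0, hC⟩ := H.block
  have h2 : Tendsto (fun n => ‖α n‖ ^ 2) atTop (nhds 0) := by
    refine squeeze_zero (fun n => by positivity) (fun n => ?_) (tendsto_const_mul_one_div C)
    have := hC n (n + 1)
    simp at this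
    rw [mul_one_div]; exact this
  have h3 := h2.sqrt
  simpa using h3

lemma norm_eta (H : IsSzSystem a β α X Y ε) (k : ι) (n : ℕ) :
    ‖conj (α n) * conj (a k) ^ (n + 1)‖ = ‖α n‖ := by simp [H.norm_a k]

/-- Total size of the sequences. -/
noncomputable def tot (X Y : ι → ℕ → ℂ) (n : ℕ) : ℝ := ∑ k, ‖2 * X k n * Y k n‖

omit [DecidableEq ι] in
lemma tot_nonneg (n : ℕ) : 0 ≤ tot X Y n := by unfold tot; positivity

omit [DecidableEq ι] in
lemma norm_le_tot (k : ι) (n : ℕ) : ‖2 * X k n * Y k n‖ ≤ tot X Y n :=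
  single_le_sum (f := fun k => ‖2 * X k n * Y k n‖) (fun _ _ => norm_nonneg _)
    (Finset.mem_univ k)

lemma tot_succ_le (H : IsSzSystem a β α X Y ε) {n : ℕ} (hn : ‖α n‖ ≤ 1 / 2) :
    tot X Y (n + 1) ≤ (1 + 4 * ‖α n‖) * tot X Y n := by
  unfold tot
  rw [mul_sum]
  refine sum_le_sum fun k _ => ?_
  have := (H.sz k).norm_prod_succ_le (n := n) (by rw [H.norm_eta]; exact hn)
  rwa [H.norm_eta] at this

lemma tot_le_exp (H : IsSzSystem a β α X Y ε) {n : ℕ} (hn : ∀ i ≥ n, ‖α i‖ ≤ 1 / 2) {N : ℕ}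
    (hN : n ≤ N) :
    tot X Y N ≤ tot X Y n * rexp (4 * ∑ i ∈ Finset.Ico n N, ‖α i‖) := by
  induction N, hN using Nat.le_induction with
  | base => simp
  | succ N hN ih =>
    rw [sum_Ico_succ_top hN, mul_add, Real.exp_add]
    calc _ ≤ (1 + 4 * ‖α N‖) * tot X Y N := H.tot_succ_le (hn N hN)
      _ ≤ rexp (4 * ‖α N‖) * (tot X Y n * rexp (4 * ∑ i ∈ Finset.Ico n N, ‖α i‖)) := by
        have := add_one_le_exp (4 * ‖α N‖)
        have := tot_nonneg (X := X) (Y := Y) N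
        exact mul_le_mul (by linarith) ih (by positivity) (by positivity)
      _ = _ := by ring

lemma norm_sub_le_sum (H : IsSzSystem a β α X Y ε) {n : ℕ} (hn : ∀ i ≥ n, ‖α i‖ ≤ 1 / 2) (k : ι)
    (j : ℕ) : ‖2 * X k (n + j) * Y k (n + j) - 2 * X k n * Y k n‖ ≤
      4 * 3 ^ j * (∑ i ∈ Finset.range j, ‖α (n + i)‖) * tot X Y n := by
  have h3 : ∀ j, tot X Y (n + j) ≤ 3 ^ j * tot X Y n := by
    intro j
    induction j with
    | zero => simp
    | succ j ih =>
      have h1 := H.tot_succ_le (hn (n + j) (by omega))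
      have h2 := hn (n + j) (by omega)
      have h4 := tot_nonneg (X := X) (Y := Y) (n + j)
      rw [← add_assoc, pow_succ]
      nlinarith
  induction j with
  | zero => simp
  | succ j ih =>
    have h1 := (H.sz k).norm_prod_succ_sub_le (n := n + j)
      (by rw [H.norm_eta]; exact hn _ (by omega))
    rw [H.norm_eta] at h1
    have h2 := (norm_le_tot (X := X) (Y := Y) k (n + j)).trans (h3 j)
    have h4 := tot_nonneg (X := X) (Y := Y) n
    have h5 : 0 ≤ ∑ i ∈ Finset.range j, ‖α (n + i)‖ := by positivity
    rw [sum_range_succ, pow_succ, ← add_assoc]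
    have h6 : ‖2 * X k (n + j + 1) * Y k (n + j + 1) - 2 * X k n * Y k n‖ ≤
      ‖2 * X k (n + j + 1) * Y k (n + j + 1) - 2 * X k (n + j) * Y k (n + j)‖ +
      ‖2 * X k (n + j) * Y k (n + j) - 2 * X k n * Y k n‖ := norm_sub_le_norm_sub_add_norm_sub _ _ _
    have h7 : 4 * ‖α (n + j)‖ * ‖2 * X k (n + j) * Y k (n + j)‖ ≤
      4 * ‖α (n + j)‖ * (3 ^ j * tot X Y n) := by gcongr
    have h8 : 0 ≤ ‖α (n + j)‖ * (3 ^ j * tot X Y n) := by positivity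
    have h9 : 0 ≤ (∑ i ∈ Finset.range j, ‖α (n + i)‖) * (3 ^ j * tot X Y n) := by positivity
    nlinarith

lemma tot_le_window (H : IsSzSystem a β α X Y ε) : ∃ C : ℝ, 0 ≤ C ∧ ∀ᶠ n : ℕ in atTop,
    tot X Y (n + 1) ≤
      C * ((n + 1) * (∑ i ∈ Finset.range (Fintype.card ι), ‖α (n + i)‖) + 1) := by
  obtain ⟨l, hl⟩ := exists_vandermonde H.inj
  set m := Fintype.card ι with hm
  set Λ : ℝ := ∑ k, ∑ i ∈ Finset.range m, ‖l k i‖ with hΛ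
  set b : ℝ := ∑ k, |β k| with hb
  set K : ℝ := (∑ k, |β k|⁻¹) * Λ with hK
  have hΛ0 : 0 ≤ Λ := by positivity
  have hb0 : 0 ≤ b := by positivity
  have hK0 : 0 ≤ K := by positivity
  set S : ℕ → ℝ := fun n => ∑ i ∈ Finset.range m, ‖α (n + i)‖ with hS
  have hS0 : ∀ n, 0 ≤ S n := fun n => by positivity
  have hSlim : Tendsto S atTop (nhds 0) := by
    simpa using tendsto_finsetSum (Finset.range m) fun i _ =>
      (tendsto_add_atTop_iff_nat i).mpr H.tendsto_alpha
  have hSlim1 := (tendsto_add_atTop_iff_nat 1).mpr hSlim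
  have ev1 : ∀ᶠ n in atTop, ∀ i ≥ n, ‖α i‖ ≤ 1 / 2 :=
    eventually_forall_ge_atTop.mpr (H.tendsto_alpha.eventually_le_const (by norm_num))
  have ev2 : ∀ᶠ n in atTop, ∀ i ≥ n, ‖ε i‖ ≤ 1 := by
    have := H.eps.norm.eventually_le_const (u := 1) (by simp)
    exact eventually_forall_ge_atTop.mpr this
  have ev3 : ∀ᶠ n in atTop, K * (b * (4 * 3 ^ m)) * S (n + 1) ≤ 1 / 2 := by
    have := hSlim1.const_mul (K * (b * (4 * 3 ^ m)))
    rw [mul_zero] at this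
    exact this.eventually_le_const (by norm_num)
  refine ⟨2 * K * (m + b + 1), by positivity, ?_⟩
  filter_upwards [ev1, ev2, ev3] with n h1 h2 h3
  set T := tot X Y (n + 1) with hT
  have hT0 : 0 ≤ T := tot_nonneg _
  set Q : ℝ := (n + m + b) * S n + 1 + b * (4 * 3 ^ m) * S (n + 1) * T with hQ
  have hα : ∀ i ∈ Finset.range m, ‖α (n + i)‖ ≤ S n := fun i hi =>
    single_le_sum (f := fun i => ‖α (n + i)‖) (fun _ _ => norm_nonneg _) hi
  have hrow : ∀ i ∈ Finset.range m, ‖∑ j, (β j : ℂ) * a j ^ (n + 1 + i) *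
      (2 * X j (n + 1) * Y j (n + 1))‖ ≤ Q := by
    intro i hi
    have him := Finset.mem_range.mp hi
    have e : ∑ j, (β j : ℂ) * a j ^ (n + 1 + i) * (2 * X j (n + 1) * Y j (n + 1)) =
        (-((((n + i : ℕ) : ℂ) + 1) + ∑ k, (β k : ℂ)) * conj (α (n + i)) - ε (n + i)) -
        ∑ j, (β j : ℂ) * a j ^ (n + 1 + i) * (2 * X j (n + 1 + i) * Y j (n + 1 + i) -
          2 * X j (n + 1) * Y j (n + 1)) := by
      rw [H.main, show n + i + 1 = n + 1 + i by omega]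
      simp only [mul_sub, sum_sub_distrib]; ring
    rw [e, hQ]
    refine (norm_sub_le _ _).trans (add_le_add ((norm_sub_le _ _).trans (add_le_add ?_ ?_)) ?_)
    · rw [norm_mul, norm_neg, RCLike.norm_conj]
      refine mul_le_mul ?_ (hα i hi) (norm_nonneg _) (by positivity)
      refine (norm_add_le _ _).trans (add_le_add ?_ ?_)
      · rw [norm_natCast_add_one]
        have : n + i + 1 ≤ n + m := by omega
        exact_mod_cast this
      · refine (norm_sum_le _ _).trans (le_of_eq ?_)
        simp [hb]
    · exact h2 _ (by omega)
    · refine (norm_sum_le _ _).trans ?_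
      rw [hb, sum_mul, sum_mul, sum_mul]
      refine sum_le_sum fun j _ => ?_
      rw [norm_mul, norm_mul, norm_pow, H.norm_a, one_pow, mul_one, norm_real,
        norm_eq_abs]
      have hs := H.norm_sub_le_sum (n := n + 1) (fun i hi => h1 i (by omega)) j i
      have hs2 : 4 * 3 ^ i * (∑ i ∈ Finset.range i, ‖α (n + 1 + i)‖) * tot X Y (n + 1) ≤
          4 * 3 ^ m * S (n + 1) * T := by
        refine mul_le_mul_of_nonneg_right ?_ hT0
        refine mul_le_mul ?_ ?_ (by positivity) (by positivity)
        · have := pow_le_pow_right₀ (show (1 : ℝ) ≤ 3 by norm_num) him.le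
          linarith
        · exact Finset.sum_le_sum_of_subset_of_nonneg (Finset.range_mono him.le)
            fun _ _ _ => norm_nonneg _
      calc _ ≤ |β j| * (4 * 3 ^ m * S (n + 1) * T) :=
            mul_le_mul_of_nonneg_left (hs.trans hs2) (abs_nonneg _)
        _ = _ := by ring
  have hk : ∀ k, |β k| * ‖2 * X k (n + 1) * Y k (n + 1)‖ ≤ Λ * Q := by
    intro k
    have hQ0 : 0 ≤ Q := by positivity
    have e : (β k : ℂ) * a k ^ (n + 1) * (2 * X k (n + 1) * Y k (n + 1)) =
        ∑ i ∈ Finset.range m, l k i * ∑ j, (β j : ℂ) * a j ^ (n + 1 + i) *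
          (2 * X j (n + 1) * Y j (n + 1)) := by
      simp_rw [mul_sum]
      rw [Finset.sum_comm]
      rw [sum_eq_single k]
      · have := hl k k
        simp only [if_true] at this
        rw [← mul_one (_ * _ * _), ← this, mul_sum]
        exact sum_congr rfl fun i _ => by rw [pow_add]; ring
      · intro j _ hj
        have := hl k j
        rw [if_neg hj] at this
        rw [← mul_zero ((β j : ℂ) * a j ^ (n + 1) * (2 * X j (n + 1) * Y j (n + 1))), ← this,
          mul_sum]
        exact sum_congr rfl fun i _ => by rw [pow_add]; ring
      · simp
    have e2 := congrArg norm e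
    rw [norm_mul, norm_mul, norm_pow, H.norm_a, one_pow, mul_one, norm_real,
      norm_eq_abs] at e2
    rw [e2]
    refine (norm_sum_le _ _).trans ?_
    calc _ ≤ ∑ i ∈ Finset.range m, ‖l k i‖ * Q := by
          refine sum_le_sum fun i hi => ?_
          rw [norm_mul]
          exact mul_le_mul_of_nonneg_left (hrow i hi) (norm_nonneg _)
      _ = (∑ i ∈ Finset.range m, ‖l k i‖) * Q := by rw [sum_mul]
      _ ≤ Λ * Q := by
        refine mul_le_mul_of_nonneg_right ?_ hQ0
        exact single_le_sum (f := fun k => ∑ i ∈ Finset.range m, ‖l k i‖)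
          (fun _ _ => by positivity) (Finset.mem_univ k)
  have hTK : T ≤ K * Q := by
    rw [hT, tot, hK, mul_assoc, sum_mul]
    refine sum_le_sum fun k _ => ?_
    have hp : 0 < |β k| := abs_pos.mpr (H.ne_zero k)
    rw [inv_mul_eq_div, le_div_iff₀ hp, mul_comm]
    exact hk k
  have h4 : K * (b * (4 * 3 ^ m) * S (n + 1) * T) ≤ 1 / 2 * T := by
    calc _ = K * (b * (4 * 3 ^ m)) * S (n + 1) * T := by ring
      _ ≤ _ := mul_le_mul_of_nonneg_right h3 hT0
  have h5 : T ≤ 2 * K * ((n + m + b) * S n + 1) := by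
    rw [hQ] at hTK
    nlinarith
  refine h5.trans ?_
  have hm0 : (0 : ℝ) ≤ m := by positivity
  have hn0 : (0 : ℝ) ≤ n := by positivity
  calc 2 * K * ((n + m + b) * S n + 1) ≤ 2 * K * ((m + b + 1) * ((n + 1) * S n + 1)) := by
        refine mul_le_mul_of_nonneg_left ?_ (by positivity)
        have : (n + m + b) * S n ≤ ((m + b + 1) * (n + 1)) * S n := by
          refine mul_le_mul_of_nonneg_right ?_ (hS0 n)
          nlinarith
        nlinarith
    _ = _ := by ring

end IsSzSystem

lemma exists_bound_of_eventually_le {u : ℕ → ℝ} {C : ℝ} (h : ∀ᶠ n in atTop, u n ≤ C) :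
    ∃ B, ∀ n, u n ≤ B := by
  have h2 : IsBoundedUnder (· ≤ ·) atTop u := ⟨C, by simpa using h⟩
  obtain ⟨B, hB⟩ := h2.bddAbove_range
  exact ⟨B, fun n => hB ⟨n, rfl⟩⟩

namespace IsSzSystem

variable {ι : Type*} [Fintype ι] [DecidableEq ι] {a : ι → ℂ} {β : ι → ℝ} {α : ℕ → ℂ}
    {X Y : ι → ℕ → ℂ} {ε : ℕ → ℂ}

omit [DecidableEq ι] in
lemma exists_window_le (H : IsSzSystem a β α X Y ε) (m : ℕ) : ∃ C : ℝ, 0 ≤ C ∧ ∀ n : ℕ, 1 ≤ n →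
    ∃ i ∈ Finset.Ico n (2 * n),
      ((i : ℝ) + 1) * ∑ l ∈ Finset.range m, ‖α (i + l)‖ ≤ C := by
  obtain ⟨C, hC0, hC⟩ := H.block
  refine ⟨2 * m * √C, by positivity, fun n hn => ?_⟩
  set S : ℕ → ℝ := fun i => ∑ l ∈ Finset.range m, ‖α (i + l)‖ with hS
  have hS0 : ∀ i, 0 ≤ S i := fun i => by positivity
  have hn' : (1 : ℝ) ≤ n := by exact_mod_cast hn
  have h1 : ∑ i ∈ Finset.Ico n (2 * n), S i ^ 2 ≤
      ∑ i ∈ Finset.Ico n (2 * n), m ^ 2 * C / ((n + 1) * n) := by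
    rw [sum_const, Nat.card_Ico, show 2 * n - n = n by omega, nsmul_eq_mul]
    calc ∑ i ∈ Finset.Ico n (2 * n), S i ^ 2
        ≤ ∑ i ∈ Finset.Ico n (2 * n), m * ∑ l ∈ Finset.range m, ‖α (i + l)‖ ^ 2 := by
          refine sum_le_sum fun i _ => ?_
          have := sq_sum_le_card_mul_sum_sq (s := Finset.range m) (f := fun l => ‖α (i + l)‖)
          rwa [card_range] at this
      _ = m * ∑ l ∈ Finset.range m, ∑ i ∈ Finset.Ico (n + l) (2 * n + l), ‖α i‖ ^ 2 := by
          rw [← mul_sum, Finset.sum_comm]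
          refine congrArg _ (sum_congr rfl fun l _ => ?_)
          rw [Finset.sum_Ico_add' (fun i => ‖α i‖ ^ 2)]
      _ ≤ m * ∑ l ∈ Finset.range m, C / (n + 1) := by
          gcongr with l _
          refine (hC _ _).trans ?_
          push_cast
          gcongr
          linarith [Nat.cast_nonneg (α := ℝ) l]
      _ = _ := by
          rw [sum_const, card_range, nsmul_eq_mul]
          field_simp
  obtain ⟨i, hi, h2⟩ := Finset.exists_le_of_sum_le (Finset.nonempty_Ico.mpr (by omega)) h1
  refine ⟨i, hi, ?_⟩
  have h3 : (i : ℝ) + 1 ≤ 2 * n := by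
    have := (Finset.mem_Ico.mp hi).2
    exact_mod_cast this
  have h4 : (((i : ℝ) + 1) * S i) ^ 2 ≤ (2 * m * √C) ^ 2 := by
    calc (((i : ℝ) + 1) * S i) ^ 2 = ((i : ℝ) + 1) ^ 2 * S i ^ 2 := by ring
      _ ≤ (2 * n) ^ 2 * (m ^ 2 * C / ((n + 1) * n)) := by gcongr
      _ = 4 * m ^ 2 * C * (n / (n + 1)) := by field_simp; ring
      _ ≤ 4 * m ^ 2 * C * 1 := by
        gcongr
        rw [div_le_one (by linarith)]; linarith
      _ = _ := by rw [mul_pow, Real.sq_sqrt hC0]; ring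
  exact abs_le_of_sq_le_sq' h4 (by positivity) |>.2

omit [DecidableEq ι] in
lemma sum_norm_alpha_le (H : IsSzSystem a β α X Y ε) : ∃ C : ℝ, 0 ≤ C ∧ ∀ n : ℕ,
    ∑ i ∈ Finset.Ico n (2 * n + 1), ‖α i‖ ≤ C := by
  obtain ⟨C, hC0, hC⟩ := H.block
  refine ⟨(1 + C) / 2, by positivity, fun n => ?_⟩
  have hn : (0 : ℝ) < n + 1 := by positivity
  have h1 : ∀ i ∈ Finset.Ico n (2 * n + 1), ‖α i‖ ≤
      (1 / ((n : ℝ) + 1) + (n + 1) * ‖α i‖ ^ 2) / 2 := by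
    intro i _
    have e : (1 / ((n : ℝ) + 1) + (n + 1) * ‖α i‖ ^ 2) / 2 - ‖α i‖ =
        (1 - (n + 1) * ‖α i‖) ^ 2 / (2 * (n + 1)) := by field_simp; ring
    have : 0 ≤ (1 - ((n : ℝ) + 1) * ‖α i‖) ^ 2 / (2 * (n + 1)) := by positivity
    linarith
  refine (sum_le_sum h1).trans ?_
  rw [← sum_div, sum_add_distrib, ← mul_sum, sum_const, Nat.card_Ico,
    show 2 * n + 1 - n = n + 1 by omega, nsmul_eq_mul]
  have h2 := mul_le_mul_of_nonneg_left (hC n (2 * n + 1)) hn.le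
  rw [mul_div_cancel₀ _ hn.ne'] at h2
  push_cast
  rw [mul_one_div_cancel hn.ne']
  linarith

lemma exists_bound (H : IsSzSystem a β α X Y ε) : ∃ C : ℝ, 0 ≤ C ∧
    (∀ k n, ‖2 * X k n * Y k n‖ ≤ C) ∧ ∀ n : ℕ, ‖α n‖ ≤ C / (n + 1) := by
  obtain ⟨C₁, hC₁, h1⟩ := H.tot_le_window
  obtain ⟨C₂, hC₂, h2⟩ := H.exists_window_le (Fintype.card ι)
  obtain ⟨C₃, hC₃, h3⟩ := H.sum_norm_alpha_le
  have ev1 : ∀ᶠ n in atTop, ∀ i ≥ n, ‖α i‖ ≤ 1 / 2 :=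
    eventually_forall_ge_atTop.mpr (H.tendsto_alpha.eventually_le_const (by norm_num))
  obtain ⟨n₀, hn₀⟩ := eventually_atTop.mp ((eventually_forall_ge_atTop.mpr h1).and
    (ev1.and (eventually_ge_atTop 1)))
  have h4 : ∀ᶠ N in atTop, tot X Y N ≤ C₁ * (C₂ + 1) * rexp (4 * C₃) := by
    filter_upwards [eventually_ge_atTop (2 * n₀ + 2)] with N hN
    set n := N / 2 with hn
    obtain ⟨hw, hα, hn1⟩ := hn₀ n (by omega)
    obtain ⟨i, hi, hi2⟩ := h2 n hn1
    rw [Finset.mem_Ico] at hi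
    have h5 := H.tot_le_exp (n := i + 1) (fun j hj => hα j (by omega)) (N := N) (by omega)
    have h6 := hw i hi.1
    have h7 : ∑ j ∈ Finset.Ico (i + 1) N, ‖α j‖ ≤ C₃ := by
      refine (Finset.sum_le_sum_of_subset_of_nonneg ?_ fun _ _ _ => norm_nonneg _).trans (h3 n)
      exact Finset.Ico_subset_Ico (by omega) (by omega)
    refine h5.trans (mul_le_mul (h6.trans ?_) (Real.exp_le_exp.mpr (by linarith)) (by positivity)
      (by positivity))
    gcongr
  obtain ⟨B, hB⟩ := exists_bound_of_eventually_le h4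
  have hb1 : ∀ n, ‖∑ k, (β k : ℂ) * a k ^ (n + 1) * (2 * X k (n + 1) * Y k (n + 1))‖ ≤
      ∑ k, |β k| * B := by
    intro n
    refine (norm_sum_le _ _).trans (sum_le_sum fun k _ => ?_)
    rw [norm_mul, norm_mul, norm_pow, H.norm_a, one_pow, mul_one, norm_real,
      norm_eq_abs]
    exact mul_le_mul_of_nonneg_left ((norm_le_tot k _).trans (hB _)) (abs_nonneg _)
  have h5 : ∀ᶠ n : ℕ in atTop, ((n : ℝ) + 1) * ‖α n‖ ≤ 2 * (∑ k, |β k| * B + 1) := by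
    have e1 := H.eps.norm.eventually_le_const (u := 1) (by simp)
    obtain ⟨n₁, hn₁⟩ := exists_nat_ge (2 * ‖∑ k, (β k : ℂ)‖)
    filter_upwards [e1, eventually_ge_atTop n₁] with n he hn
    have hm := congrArg norm (H.main n)
    rw [norm_mul, norm_neg, RCLike.norm_conj] at hm
    have h6 := hm.le.trans ((norm_add_le _ _).trans (add_le_add (hb1 n) he))
    have h7 : ((n : ℝ) + 1) / 2 ≤ ‖((n : ℂ) + 1) + ∑ k, (β k : ℂ)‖ := by
      have h8 := norm_sub_le_norm_add ((n : ℂ) + 1) (∑ k, (β k : ℂ))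
      have : (n₁ : ℝ) ≤ n := by exact_mod_cast hn
      rw [norm_natCast_add_one] at h8
      linarith
    have := mul_le_mul_of_nonneg_right h7 (norm_nonneg (α n))
    linarith
  obtain ⟨B', hB'⟩ := exists_bound_of_eventually_le h5
  refine ⟨max 0 (max B B'), le_max_left _ _, fun k n => ?_, fun n => ?_⟩
  · exact (norm_le_tot k n).trans ((hB n).trans ((le_max_left _ _).trans (le_max_right _ _)))
  · rw [le_div_iff₀ (by positivity), mul_comm]
    exact (hB' n).trans ((le_max_right _ _).trans (le_max_right _ _))

end IsSzSystem

/-- Blocks of the harmonic series. -/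
noncomputable def harm (n N : ℕ) : ℝ := ∑ i ∈ Finset.Ico n N, 1 / ((i : ℝ) + 1)

lemma harm_nonneg (n N : ℕ) : 0 ≤ harm n N := by unfold harm; positivity

lemma harm_add {n m N : ℕ} (h1 : n ≤ m) (h2 : m ≤ N) : harm n m + harm m N = harm n N :=
  sum_Ico_consecutive _ h1 h2

lemma harm_self (n : ℕ) : harm n n = 0 := by simp [harm]

lemma harm_succ {n N : ℕ} (h : n ≤ N) : harm n (N + 1) = harm n N + 1 / ((N : ℝ) + 1) :=
  sum_Ico_succ_top h _

/-- A sequence varying slowly on the block `[n, N]`. -/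
def IsSlow (A : ℝ) (n N : ℕ) (s : ℕ → ℂ) : Prop :=
  (∀ i, n ≤ i → i ≤ N → ‖s i‖ ≤ A) ∧ ∀ i : ℕ, n ≤ i → i < N → ‖s (i + 1) - s i‖ ≤ A / (i + 1)

lemma IsSlow.nonneg {A : ℝ} {n N : ℕ} {s : ℕ → ℂ} (h : IsSlow A n N s) (hn : n ≤ N) : 0 ≤ A :=
  (norm_nonneg _).trans (h.1 n le_rfl hn)

lemma IsSlow.mono {A : ℝ} {n N n' N' : ℕ} {s : ℕ → ℂ} (h : IsSlow A n N s) (h1 : n ≤ n')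
    (h2 : N' ≤ N) : IsSlow A n' N' s :=
  ⟨fun i a b => h.1 i (h1.trans a) (b.trans h2), fun i a b => h.2 i (h1.trans a) (b.trans_le h2)⟩

lemma IsSlow.mul {A B : ℝ} {n N : ℕ} {s t : ℕ → ℂ} (hs : IsSlow A n N s) (ht : IsSlow B n N t) :
    IsSlow (2 * A * B) n N (fun i => s i * t i) := by
  refine ⟨fun i h1 h2 => ?_, fun i h1 h2 => ?_⟩
  · have hA := hs.nonneg (h1.trans h2)
    have hB := ht.nonneg (h1.trans h2)
    rw [norm_mul]
    have := mul_le_mul (hs.1 i h1 h2) (ht.1 i h1 h2) (norm_nonneg _) hA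
    nlinarith [mul_nonneg hA hB]
  · have hA := hs.nonneg (h1.trans h2.le)
    have e : s (i + 1) * t (i + 1) - s i * t i =
      s (i + 1) * (t (i + 1) - t i) + (s (i + 1) - s i) * t i := by ring
    rw [e]
    refine (norm_add_le _ _).trans ?_
    rw [norm_mul, norm_mul]
    have a1 := mul_le_mul (hs.1 (i + 1) (by omega) (by omega)) (ht.2 i h1 h2) (norm_nonneg _) hA
    have a2 := mul_le_mul (hs.2 i h1 h2) (ht.1 i h1 h2.le) (norm_nonneg _) (by positivity)
    refine (add_le_add a1 a2).trans (le_of_eq ?_)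
    ring

lemma IsSlow.conj {A : ℝ} {n N : ℕ} {s : ℕ → ℂ} (hs : IsSlow A n N s) :
    IsSlow A n N (fun i => conj (s i)) :=
  ⟨fun i h1 h2 => by rw [RCLike.norm_conj]; exact hs.1 i h1 h2, fun i h1 h2 => by
    rw [← map_sub, RCLike.norm_conj]; exact hs.2 i h1 h2⟩

lemma IsSlow.add {A B : ℝ} {n N : ℕ} {s t : ℕ → ℂ} (hs : IsSlow A n N s) (ht : IsSlow B n N t) :
    IsSlow (A + B) n N (fun i => s i + t i) := by
  refine ⟨fun i h1 h2 => (norm_add_le _ _).trans (add_le_add (hs.1 i h1 h2) (ht.1 i h1 h2)),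
    fun i h1 h2 => ?_⟩
  rw [add_div, add_sub_add_comm]
  exact (norm_add_le _ _).trans (add_le_add (hs.2 i h1 h2) (ht.2 i h1 h2))

lemma isSlow_const (c : ℂ) (n N : ℕ) : IsSlow ‖c‖ n N (fun _ => c) :=
  ⟨fun _ _ _ => le_rfl, fun i _ _ => by simp; positivity⟩

/-- Weighted sums of `f` against slow sequences are negligible relative to the harmonic series. -/
def NullSum (f : ℕ → ℂ) : Prop := ∀ A : ℝ, ∀ ε > 0, ∃ n₀ : ℕ, ∀ n ≥ n₀, ∀ N ≥ n, ∀ s : ℕ → ℂ,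
  IsSlow A n N s → ‖∑ i ∈ Finset.Ico n N, f i * s i‖ ≤ ε * (1 + harm n N)

lemma NullSum.add {f g : ℕ → ℂ} (hf : NullSum f) (hg : NullSum g) :
    NullSum (fun i => f i + g i) := by
  intro A ε hε
  obtain ⟨n₁, h1⟩ := hf A (ε / 2) (by positivity)
  obtain ⟨n₂, h2⟩ := hg A (ε / 2) (by positivity)
  refine ⟨max n₁ n₂, fun n hn N hN s hs => ?_⟩
  simp only [add_mul, sum_add_distrib]
  refine (norm_add_le _ _).trans ((add_le_add (h1 n (le_of_max_le_left hn) N hN s hs)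
    (h2 n (le_of_max_le_right hn) N hN s hs)).trans (le_of_eq ?_))
  ring

lemma NullSum.mul_slow {f g : ℕ → ℂ} {B : ℝ} (hf : NullSum f) (hg : ∀ n N, IsSlow B n N g) :
    NullSum (fun i => f i * g i) := by
  intro A ε hε
  obtain ⟨n₁, h1⟩ := hf (2 * B * A) ε hε
  refine ⟨n₁, fun n hn N hN s hs => ?_⟩
  have := h1 n hn N hN _ ((hg n N).mul hs)
  simpa only [mul_assoc] using this

lemma NullSum.const_mul {f : ℕ → ℂ} (hf : NullSum f) (c : ℂ) : NullSum (fun i => c * f i) := by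
  have := hf.mul_slow (fun n N => isSlow_const c n N)
  simpa only [mul_comm] using this

lemma nullSum_of_tendsto {f : ℕ → ℂ} (hf : Tendsto (fun n : ℕ => ((n : ℝ) + 1) * ‖f n‖) atTop
    (nhds 0)) : NullSum f := by
  intro A ε hε
  have := hf.mul_const A
  rw [zero_mul] at this
  obtain ⟨n₀, hn₀⟩ := eventually_atTop.mp (this.eventually_le_const hε)
  refine ⟨n₀, fun n hn N hN s hs => ?_⟩
  calc _ ≤ ∑ i ∈ Finset.Ico n N, ε * (1 / ((i : ℝ) + 1)) := by
        refine norm_sum_le_of_le _ fun i hi => ?_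
        rw [Finset.mem_Ico] at hi
        have h1 := hn₀ i (by omega)
        have h2 := hs.1 i hi.1 hi.2.le
        rw [norm_mul, mul_one_div, le_div_iff₀ (by positivity)]
        refine le_trans ?_ h1
        have := mul_le_mul_of_nonneg_left h2 (show 0 ≤ ((i : ℝ) + 1) * ‖f i‖ by positivity)
        linarith
    _ = ε * harm n N := by rw [← mul_sum, harm]
    _ ≤ _ := by linarith

lemma NullSum.sum {κ : Type*} {t : Finset κ} {f : κ → ℕ → ℂ} (hf : ∀ k ∈ t, NullSum (f k)) :
    NullSum (fun i => ∑ k ∈ t, f k i) := by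
  classical
  induction t using Finset.induction_on with
  | empty => exact nullSum_of_tendsto (by simp)
  | insert k t hk ih =>
    simp only [sum_insert hk]
    exact (hf k (by simp)).add (ih fun j hj => hf j (by simp [hj]))

lemma nullSum_osc {ω : ℂ} (h1 : ‖ω‖ = 1) (hω : ω ≠ 1) :
    NullSum (fun n : ℕ => ω ^ (n + 1) / ((n : ℂ) + 1)) := by
  intro A ε hε
  have hd : 0 < ‖ω - 1‖ := norm_pos_iff.mpr (sub_ne_zero.mpr hω)
  obtain ⟨n₀, hn₀⟩ := exists_nat_ge (4 * |A| / (‖ω - 1‖ * ε))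
  refine ⟨n₀, fun n hn N hN s hs => ?_⟩
  have hA := hs.nonneg hN
  rw [abs_of_nonneg hA] at hn₀
  set t : ℕ → ℂ := fun i => s i / ((i : ℂ) + 1) with ht
  have hc := norm_natCast_add_one
  have hc0 : ∀ i : ℕ, ((i : ℂ) + 1) ≠ 0 := fun i => by exact_mod_cast Nat.succ_ne_zero i
  have ht1 : ∀ i, n ≤ i → i ≤ N → ‖t i‖ ≤ A / (n + 1) := by
    intro i hi hi2
    rw [ht, norm_div, hc]
    have : (n : ℝ) ≤ i := by exact_mod_cast hi
    exact div_le_div₀ hA (hs.1 i hi hi2) (by positivity) (by linarith)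
  have ht2 : ∀ i ∈ Finset.Ico n N, ‖ω ^ (i + 1 + 1) * (t (i + 1) - t i)‖ ≤
      2 * A / (n + 1) * (1 / ((i : ℝ) + 1)) := by
    intro i hi
    rw [Finset.mem_Ico] at hi
    have hin : (n : ℝ) ≤ i := by exact_mod_cast hi.1
    have e : t (i + 1) - t i =
        ((s (i + 1) - s i) - s i / ((i : ℂ) + 1)) / ((i + 1 : ℕ) + 1 : ℂ) := by
      have := hc0 (i + 1)
      have := hc0 i
      simp only [ht]
      push_cast at *
      field_simp
      ring
    rw [norm_mul, norm_pow, h1, one_pow, one_mul, e, norm_div, hc]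
    have a1 : ‖s (i + 1) - s i - s i / ((i : ℂ) + 1)‖ ≤ 2 * A * (1 / ((i : ℝ) + 1)) := by
      refine (norm_sub_le _ _).trans ?_
      rw [norm_div, hc]
      have := hs.2 i hi.1 hi.2
      have := div_le_div_of_nonneg_right (hs.1 i hi.1 hi.2.le) (show 0 ≤ (i : ℝ) + 1 by positivity)
      have e : 2 * A * (1 / ((i : ℝ) + 1)) = A / (i + 1) + A / (i + 1) := by ring
      linarith
    rw [div_mul_eq_mul_div]
    refine div_le_div₀ (by positivity) a1 (by positivity) ?_
    push_cast; linarith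
  have e : (ω - 1) * ∑ i ∈ Finset.Ico n N, ω ^ (i + 1) / ((i : ℂ) + 1) * s i =
      ω ^ (N + 1) * t N - ω ^ (n + 1) * t n -
        ∑ i ∈ Finset.Ico n N, ω ^ (i + 1 + 1) * (t (i + 1) - t i) := by
    rw [← sum_Ico_sub (fun i => ω ^ (i + 1) * t i) hN, ← sum_sub_distrib,
      mul_sum]
    refine sum_congr rfl fun i _ => ?_
    simp only [ht]; ring
  have h2 : ‖ω - 1‖ * ‖∑ i ∈ Finset.Ico n N, ω ^ (i + 1) / ((i : ℂ) + 1) * s i‖ ≤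
      A / (n + 1) + A / (n + 1) + 2 * A / (n + 1) * harm n N := by
    rw [← norm_mul, e]
    refine (norm_sub_le _ _).trans (add_le_add ((norm_sub_le _ _).trans (add_le_add ?_ ?_)) ?_)
    · rw [norm_mul, norm_pow, h1, one_pow, one_mul]; exact ht1 N hN le_rfl
    · rw [norm_mul, norm_pow, h1, one_pow, one_mul]; exact ht1 n le_rfl hN
    · rw [harm, mul_sum]; exact norm_sum_le_of_le _ ht2
  have h3 : 4 * A / (n + 1) ≤ ‖ω - 1‖ * ε := by
    rw [div_le_iff₀ (by positivity)] at hn₀ ⊢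
    have : (n₀ : ℝ) ≤ n := by exact_mod_cast hn
    have := mul_le_mul_of_nonneg_right this (mul_nonneg hd.le hε.le)
    nlinarith [mul_pos hd hε]
  have h4 := harm_nonneg n N
  have h5 : A / (n + 1) + A / (n + 1) + 2 * A / (n + 1) * harm n N ≤
      (4 * A / (n + 1)) * (1 + harm n N) := by
    have : 0 ≤ A / ((n : ℝ) + 1) := by positivity
    have : 0 ≤ A / ((n : ℝ) + 1) * harm n N := by positivity
    have e : (4 * A / ((n : ℝ) + 1)) * (1 + harm n N) =
      4 * (A / (n + 1)) + 4 * (A / (n + 1) * harm n N) := by ring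
    have e' : 2 * A / ((n : ℝ) + 1) * harm n N = 2 * (A / (n + 1) * harm n N) := by ring
    linarith
  have h6 := h2.trans (h5.trans (mul_le_mul_of_nonneg_right h3 (by linarith : 0 ≤ 1 + harm n N)))
  rw [mul_assoc] at h6
  exact le_of_mul_le_mul_left h6 hd

lemma exists_isSlow {s : ℕ → ℂ} {A : ℝ} (h1 : ∀ n, ‖s n‖ ≤ A)
    (h2 : ∀ᶠ n : ℕ in atTop, ((n : ℝ) + 1) * ‖s (n + 1) - s n‖ ≤ A) :
    ∃ B, ∀ n N, IsSlow B n N s := by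
  obtain ⟨B, hB⟩ := exists_bound_of_eventually_le h2
  refine ⟨max A B, fun n N => ⟨fun i _ _ => (h1 i).trans (le_max_left _ _), fun i _ _ => ?_⟩⟩
  rw [le_div_iff₀ (by positivity), mul_comm]
  exact (hB i).trans (le_max_right _ _)

lemma isSlow_shift {s : ℕ → ℂ} {B : ℝ} (h : ∀ n N, IsSlow B n N s) (n N : ℕ) :
    IsSlow B n N (fun i => s (i + 1)) := by
  have hB : 0 ≤ B := (h 0 0).nonneg le_rfl
  refine ⟨fun i _ _ => (h 0 (i + 1)).1 (i + 1) (by omega) le_rfl, fun i _ _ => ?_⟩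
  refine ((h 0 (i + 2)).2 (i + 1) (by omega) (by omega)).trans ?_
  gcongr
  linarith

/-- The phase of a sequence. -/
noncomputable def phase (X : ℕ → ℂ) (n : ℕ) : ℂ := X n / conj (X n)

/-- The normalised imaginary part of the product sequence. -/
noncomputable def tau (X Y : ℕ → ℂ) (n : ℕ) : ℝ := (conj (X n) * Y n).im

/-- A `IsSzSeq` whose driving coefficients are asymptotically `-β (1 + 2 i τ) / n`. -/
structure IsSzPhase (β : ℝ) (η X Y : ℕ → ℂ) : Prop extends IsSzSeq η X Y where
  bound : ∃ C : ℝ, 0 ≤ C ∧ (∀ n, ‖2 * X n * Y n‖ ≤ C) ∧ ∀ n : ℕ, ‖η n‖ ≤ C / (n + 1)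
  null : NullSum (fun n => η n * conj (phase X n) +
    (β : ℂ) / ((n : ℂ) + 1) * (1 + 2 * (tau X Y n : ℂ) * I))

namespace IsSzSeq

variable {η X Y : ℕ → ℂ}

lemma conj_X_ne (H : IsSzSeq η X Y) (n : ℕ) : conj (X n) ≠ 0 := (map_ne_zero conj).mpr (H.X_ne n)

lemma phase_mul_conj (H : IsSzSeq η X Y) (n : ℕ) : phase X n * conj (phase X n) = 1 := by
  have := H.X_ne n
  have := H.conj_X_ne n
  simp only [phase, map_div₀, conj_conj]
  field_simp

lemma prod_mul_conj_phase (H : IsSzSeq η X Y) (n : ℕ) :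
    2 * X n * Y n * conj (phase X n) = 1 + 2 * (tau X Y n : ℂ) * I := by
  rw [H.prod_eq, tau]
  change phase X n * _ * _ = _
  linear_combination (1 + 2 * ((conj (X n) * Y n).im : ℂ) * I) * H.phase_mul_conj n

lemma norm_e (H : IsSzSeq η X Y) (n : ℕ) : ‖η n * conj (phase X n)‖ = ‖η n‖ := by
  rw [norm_mul, RCLike.norm_conj, phase, H.norm_phase, mul_one]

lemma X_succ_eq (H : IsSzSeq η X Y) (n : ℕ) :
    X (n + 1) = X n * (1 - η n * conj (phase X n)) := by
  have := H.X_ne n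
  have := H.conj_X_ne n
  rw [H.X_succ]
  simp only [phase, map_div₀, conj_conj]
  field_simp

lemma phase_succ (H : IsSzSeq η X Y) (n : ℕ) :
    phase X (n + 1) = phase X n * ((1 - η n * conj (phase X n)) /
      (1 - conj (η n * conj (phase X n)))) := by
  conv_lhs => rw [phase, H.X_succ_eq, map_mul, map_sub, map_one]
  rw [mul_div_mul_comm]
  rfl

lemma norm_phase_succ_sub_le (H : IsSzSeq η X Y) {n : ℕ} (hn : ‖η n‖ ≤ 1 / 2) :
    ‖phase X (n + 1) - phase X n‖ ≤ 4 * ‖η n‖ := by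
  rw [H.phase_succ]
  set e := η n * conj (phase X n) with he
  have hen : ‖e‖ = ‖η n‖ := H.norm_e n
  have h1 : 1 / 2 ≤ ‖1 - conj e‖ := by
    have := norm_sub_norm_le (1 : ℂ) (conj e)
    rw [norm_one, RCLike.norm_conj, hen] at this
    linarith
  have h0 : 1 - conj e ≠ 0 := norm_pos_iff.mp (by linarith)
  have e2 : phase X n * ((1 - e) / (1 - conj e)) - phase X n =
      phase X n * ((conj e - e) / (1 - conj e)) := by field_simp; ring
  rw [e2, norm_mul, phase, H.norm_phase, one_mul, norm_div, div_le_iff₀ (by linarith)]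
  have h2 := norm_sub_le (conj e) e
  rw [RCLike.norm_conj, hen] at h2
  nlinarith [norm_nonneg (η n)]

variable {C : ℝ}

lemma eventually_norm_eta_le (h2 : ∀ n : ℕ, ‖η n‖ ≤ C / (n + 1)) {c : ℝ} (hc : 0 < c) :
    ∀ᶠ n in atTop, ‖η n‖ ≤ c := by
  filter_upwards [(tendsto_const_mul_one_div C).eventually_le_const hc] with n hn
  refine (h2 n).trans ?_
  rwa [mul_one_div] at hn

lemma exists_isSlow_phase (H : IsSzSeq η X Y) (h2 : ∀ n : ℕ, ‖η n‖ ≤ C / (n + 1)) :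
    ∃ B, ∀ n N, IsSlow B n N (phase X) := by
  refine exists_isSlow (A := max 1 (4 * C)) (fun n => ?_) ?_
  · rw [phase, H.norm_phase]; exact le_max_left _ _
  · filter_upwards [eventually_norm_eta_le h2 (c := 1 / 2) (by norm_num)] with n hn
    have h3 := H.norm_phase_succ_sub_le hn
    have h4 := h2 n
    rw [le_div_iff₀ (by positivity)] at h4
    refine le_trans ?_ (le_max_right _ _)
    have := mul_le_mul_of_nonneg_left h3 (show 0 ≤ (n : ℝ) + 1 by positivity)
    linarith

lemma exists_isSlow_prod (H : IsSzSeq η X Y) (h1 : ∀ n, ‖2 * X n * Y n‖ ≤ C)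
    (h2 : ∀ n : ℕ, ‖η n‖ ≤ C / (n + 1)) : ∃ B, ∀ n N, IsSlow B n N (fun n => 2 * X n * Y n) := by
  refine exists_isSlow (A := max C (4 * (C * C))) (fun n => ?_) ?_
  · exact (h1 n).trans (le_max_left _ _)
  · filter_upwards [eventually_norm_eta_le h2 (c := 1 / 2) (by norm_num)] with n hn
    have h3 := H.norm_prod_succ_sub_le hn
    have h4 := h2 n
    rw [le_div_iff₀ (by positivity)] at h4
    refine le_trans ?_ (le_max_right _ _)
    have h5 := mul_le_mul_of_nonneg_left h3 (show 0 ≤ (n : ℝ) + 1 by positivity)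
    have h6 := mul_le_mul h4 (h1 n) (norm_nonneg _) (le_trans (by positivity) h4)
    linarith

lemma exists_isSlow_tau (H : IsSzSeq η X Y) (h1 : ∀ n, ‖2 * X n * Y n‖ ≤ C)
    (h2 : ∀ n : ℕ, ‖η n‖ ≤ C / (n + 1)) :
    ∃ B, ∀ n N, IsSlow B n N (fun n => (1 + 2 * (tau X Y n : ℂ) * I)) := by
  obtain ⟨B₁, hB₁⟩ := H.exists_isSlow_phase h2
  obtain ⟨B₂, hB₂⟩ := H.exists_isSlow_prod h1 h2
  refine ⟨2 * B₂ * B₁, fun n N => ?_⟩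
  simp only [← H.prod_mul_conj_phase]
  exact (hB₂ n N).mul (hB₁ n N).conj

end IsSzSeq

lemma tendsto_mul_norm_of_slow {s : ℕ → ℂ} {B : ℝ} (h : ∀ n N, IsSlow B n N s) :
    Tendsto (fun n => ‖s (n + 1) - s n‖) atTop (nhds 0) := by
  refine squeeze_zero (fun _ => norm_nonneg _) (fun n => ?_) (tendsto_const_mul_one_div B)
  rw [mul_one_div]
  exact (h n (n + 1)).2 n le_rfl (by omega)

lemma IsSzSystem.isSzPhase {ι : Type*} [Fintype ι] [DecidableEq ι] {a : ι → ℂ} {β : ι → ℝ}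
    {α : ℕ → ℂ} {X Y : ι → ℕ → ℂ} {ε : ℕ → ℂ} (H : IsSzSystem a β α X Y ε) (k : ι) :
    IsSzPhase (β k) (fun n => conj (α n) * conj (a k) ^ (n + 1)) (X k) (Y k) := by
  obtain ⟨C, hC0, hC1, hC2⟩ := H.exists_bound
  have hη : ∀ j (n : ℕ), ‖conj (α n) * conj (a j) ^ (n + 1)‖ ≤ C / (n + 1) := fun j n => by
    rw [H.norm_eta]; exact hC2 n
  refine ⟨H.sz k, ⟨C, hC0, hC1 k, hη k⟩, ?_⟩
  set b : ℂ := ∑ k, (β k : ℂ) with hb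
  obtain ⟨Bψ, hψ⟩ := (H.sz k).exists_isSlow_phase (hη k)
  have hh := fun j => (H.sz j).exists_isSlow_prod (hC1 j) (hη j)
  choose Bh hh using hh
  set r : ℕ → ℂ := fun n => -b * (conj (α n) * conj (a k) ^ (n + 1) * conj (phase (X k) n)) -
    ε n * conj (a k) ^ (n + 1) * conj (phase (X k) n) -
    β k * (2 * X k (n + 1) * Y k (n + 1) - 2 * X k n * Y k n) * conj (phase (X k) n) with hr
  have hψn : ∀ n, ‖phase (X k) n‖ = 1 := fun n => (H.sz k).norm_phase n
  have hr0 : Tendsto (fun n => ‖r n‖) atTop (nhds 0) := by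
    have l1 := H.tendsto_alpha.const_mul ‖b‖
    have l2 := H.eps.norm
    have l3 := (tendsto_mul_norm_of_slow (hh k)).const_mul |β k|
    have l4 := (l1.add l2).add l3
    simp only [mul_zero, norm_zero, add_zero] at l4
    refine squeeze_zero (fun _ => norm_nonneg _) (fun n => ?_) l4
    refine (norm_sub_le _ _).trans (add_le_add ((norm_sub_le _ _).trans (add_le_add ?_ ?_)) ?_)
    · simp [H.norm_a, hψn]
    · simp [H.norm_a, hψn]
    · simp only [norm_mul (_ * (_ - _)), norm_mul (β k : ℂ), RCLike.norm_conj, hψn, mul_one,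
        norm_real, norm_eq_abs]
      exact le_rfl
  have hc0 : ∀ i : ℕ, ((i : ℂ) + 1) ≠ 0 := fun i => by exact_mod_cast Nat.succ_ne_zero i
  have key : (fun n => conj (α n) * conj (a k) ^ (n + 1) * conj (phase (X k) n) +
      (β k : ℂ) / ((n : ℂ) + 1) * (1 + 2 * (tau (X k) (Y k) n : ℂ) * I)) =
      fun n => r n / ((n : ℂ) + 1) + ∑ j ∈ Finset.univ.erase k,
        (-(β j : ℂ)) * ((a j * conj (a k)) ^ (n + 1) / ((n : ℂ) + 1) *
          (2 * X j (n + 1) * Y j (n + 1)) * conj (phase (X k) n)) := by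
    funext n
    have hm := H.main n
    rw [← hb, ← add_sum_erase _ _ (Finset.mem_univ k)] at hm
    have ha1 : a k ^ (n + 1) * conj (a k) ^ (n + 1) = 1 := by
      rw [← mul_pow, mul_conj_of_norm_one (H.norm_a k), one_pow]
    have e2 : ∑ j ∈ Finset.univ.erase k,
        (-(β j : ℂ)) * ((a j * conj (a k)) ^ (n + 1) / ((n : ℂ) + 1) *
          (2 * X j (n + 1) * Y j (n + 1)) * conj (phase (X k) n)) =
        -(∑ j ∈ Finset.univ.erase k, (β j : ℂ) * a j ^ (n + 1) * (2 * X j (n + 1) * Y j (n + 1))) *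
          conj (a k) ^ (n + 1) * conj (phase (X k) n) / ((n : ℂ) + 1) := by
      rw [neg_mul, neg_mul, neg_div, sum_mul, sum_mul, sum_div,
        ← sum_neg_distrib]
      refine sum_congr rfl fun j _ => ?_
      rw [mul_pow]; ring
    rw [e2, ← (H.sz k).prod_mul_conj_phase n]
    simp only [hr]
    set S := ∑ j ∈ Finset.univ.erase k, (β j : ℂ) * a j ^ (n + 1) *
      (2 * X j (n + 1) * Y j (n + 1))
    clear_value S
    have := hc0 n
    field_simp
    linear_combination (-conj (a k) ^ (n + 1) * conj (phase (X k) n)) * hm +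
      (-(β k : ℂ) * X k (n + 1) * Y k (n + 1) * 2 * conj (phase (X k) n)) * ha1
  rw [key]
  refine NullSum.add (nullSum_of_tendsto ?_) (NullSum.sum fun j hj => ?_)
  · refine hr0.congr fun n => ?_
    rw [norm_div, norm_natCast_add_one]
    field_simp
  · refine NullSum.const_mul ?_ _
    refine NullSum.mul_slow (NullSum.mul_slow (nullSum_osc ?_ ?_) (isSlow_shift (hh j)))
      (fun n N => (hψ n N).conj)
    · simp [H.norm_a]
    · intro h
      have h1 : a j = a k := by
        have := congrArg (· * a k) h
        simpa [mul_assoc, conj_mul_of_norm_one (H.norm_a k)] using this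
      exact (Finset.mem_erase.mp hj).1 (H.inj h1)

lemma NullSum.conj {f : ℕ → ℂ} (hf : NullSum f) : NullSum (fun i => conj (f i)) := by
  intro A ε hε
  obtain ⟨n₁, h1⟩ := hf A ε hε
  refine ⟨n₁, fun n hn N hN s hs => ?_⟩
  have := h1 n hn N hN _ hs.conj
  rw [← RCLike.norm_conj, map_sum] at this
  simpa only [map_mul, conj_conj] using this

lemma NullSum.re {f : ℕ → ℂ} (hf : NullSum f) : NullSum (fun i => ((f i).re : ℂ)) := by
  have := (hf.add hf.conj).const_mul (1 / 2)
  refine (congrArg NullSum (funext fun i => ?_)).mp this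
  rw [add_conj]; push_cast; ring

lemma NullSum.im {f : ℕ → ℂ} (hf : NullSum f) : NullSum (fun i => ((f i).im : ℂ)) := by
  have := (hf.const_mul (-I)).re
  simpa using this

lemma exists_sum_le {u : ℕ → ℂ} (n₀ : ℕ) {E : ℕ → ℕ → ℝ}
    (h : ∀ n ≥ n₀, ∀ N ≥ n, ‖∑ i ∈ Finset.Ico n N, u i‖ ≤ E n N)
    (hE0 : ∀ n N, 0 ≤ E n N) (hE : ∀ n m N, n ≤ m → m ≤ N → E m N ≤ E n N) :
    ∃ D, 0 ≤ D ∧ ∀ n N, n ≤ N → ‖∑ i ∈ Finset.Ico n N, u i‖ ≤ E n N + D := by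
  refine ⟨∑ i ∈ Finset.range n₀, ‖u i‖, by positivity, fun n N hnN => ?_⟩
  rcases le_total n₀ n with h1 | h1
  · have : 0 ≤ ∑ i ∈ Finset.range n₀, ‖u i‖ := by positivity
    linarith [h n h1 N hnN]
  · have key : ∀ K, K ≤ n₀ → ‖∑ i ∈ Finset.Ico n K, u i‖ ≤ ∑ i ∈ Finset.range n₀, ‖u i‖ := by
      intro K hK
      refine (norm_sum_le _ _).trans
        (Finset.sum_le_sum_of_subset_of_nonneg ?_ fun _ _ _ => norm_nonneg _)
      intro i hi
      simp at hi ⊢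
      omega
    rcases le_total n₀ N with h2 | h2
    · rw [← sum_Ico_consecutive _ h1 h2]
      refine (norm_add_le _ _).trans ?_
      rw [add_comm (E n N)]
      exact add_le_add (key n₀ le_rfl) ((h n₀ le_rfl N h2).trans (hE n n₀ N h1 h2))
    · linarith [key N h2, hE0 n N]

lemma harm_anti {n m N : ℕ} (h1 : n ≤ m) (h2 : m ≤ N) : harm m N ≤ harm n N := by
  rw [← harm_add h1 h2]; linarith [harm_nonneg n m]

lemma NullSum.exists_le {f : ℕ → ℂ} (hf : NullSum f) {δ : ℝ} (hδ : 0 < δ) :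
    ∃ D, 0 ≤ D ∧ ∀ n N, n ≤ N → ‖∑ i ∈ Finset.Ico n N, f i‖ ≤ δ * harm n N + D := by
  obtain ⟨n₀, h0⟩ := hf 1 δ hδ
  obtain ⟨D, hD, h⟩ := exists_sum_le (u := f) n₀ (E := fun n N => δ * (1 + harm n N))
    (fun n hn N hN => by
      have := h0 n hn N hN (fun _ => 1) (by simpa using isSlow_const 1 n N)
      simpa using this)
    (fun n N => by have := harm_nonneg n N; positivity)
    (fun n m N h1 h2 => by gcongr; exact harm_anti h1 h2)
  exact ⟨δ + D, by positivity, fun n N hN => (h n N hN).trans (le_of_eq (by ring))⟩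

lemma sum_inv_sq_le (n N : ℕ) (hn : n ≤ N) :
    ∑ i ∈ Finset.Ico n N, 1 / ((i : ℝ) + 1) ^ 2 ≤ 2 / ((n : ℝ) + 1) := by
  have : ∑ i ∈ Finset.Ico n N, 1 / ((i : ℝ) + 1) ^ 2 ≤
      ∑ i ∈ Finset.Ico n N, ((-2 / ((i + 1 : ℕ) + 1 : ℝ)) - (-2 / ((i : ℝ) + 1))) := by
    refine sum_le_sum fun i _ => ?_
    have h1 : (0 : ℝ) < i + 1 := by positivity
    have e : (-2 / ((i + 1 : ℕ) + 1 : ℝ)) - (-2 / ((i : ℝ) + 1)) = 2 / ((i + 1) * (i + 2)) := by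
      push_cast; field_simp; ring
    rw [e, div_le_div_iff₀ (by positivity) (by positivity)]
    nlinarith [Nat.cast_nonneg (α := ℝ) i]
  refine this.trans ?_
  rw [sum_Ico_sub (fun i : ℕ => -2 / ((i : ℝ) + 1)) hn]
  have : (0 : ℝ) ≤ 2 / (N + 1) := by positivity
  have e : ∀ x : ℝ, -2 / x = -(2 / x) := fun x => by ring
  rw [e, e]; linarith

lemma harm_mul_le_log {m L : ℕ} (hm : 1 ≤ m) (hL : 1 ≤ L) : harm m (L * m) ≤ Real.log L := by
  have hm' : (0 : ℝ) < m := by exact_mod_cast hm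
  have hL' : (0 : ℝ) < L := by exact_mod_cast hL
  have h : harm m (L * m) ≤ ∑ i ∈ Finset.Ico m (L * m),
      (Real.log ((i + 1 : ℕ) : ℝ) - Real.log i) := by
    refine sum_le_sum fun i hi => ?_
    have hi' : (0 : ℝ) < i := by
      have := (Finset.mem_Ico.mp hi).1
      exact_mod_cast (by omega : 0 < i)
    have h2 := Real.log_le_sub_one_of_pos (x := (i : ℝ) / (i + 1)) (by positivity)
    rw [Real.log_div (by positivity) (by positivity)] at h2
    have e : (i : ℝ) / (i + 1) - 1 = -(1 / (i + 1)) := by field_simp; ring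
    push_cast
    linarith
  refine h.trans ?_
  rw [sum_Ico_sub (fun i : ℕ => Real.log (i : ℝ)) (by nlinarith)]
  push_cast
  rw [Real.log_mul hL'.ne' hm'.ne']
  linarith

/-- The Schur iterates along a radius, in the rotating frame of the boundary point. -/
noncomputable def schurB (e : ℕ → ℂ) (r : ℝ) : ℕ → ℂ
  | 0 => 1
  | n + 1 => (r * schurB e r n - e n) * (1 - conj (e n)) /
      ((1 - conj (e n) * (r * schurB e r n)) * (1 - e n))

/-- Accumulated argument of the reversed polynomials. -/
noncomputable def gam (e : ℕ → ℂ) (r : ℝ) (n : ℕ) : ℝ :=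
  ∑ i ∈ Finset.range n, arg (1 - conj (e i) * (r * schurB e r i))

lemma norm_moebius_le {w e : ℂ} (hw : ‖w‖ ≤ 1) (he : ‖e‖ < 1) :
    ‖w - e‖ ≤ ‖1 - conj e * w‖ := by
  refine abs_le_of_sq_le_sq' ?_ (norm_nonneg _) |>.2
  have h1 : ‖1 - conj e * w‖ ^ 2 - ‖w - e‖ ^ 2 = (1 - ‖w‖ ^ 2) * (1 - ‖e‖ ^ 2) := by
    simp only [Complex.sq_norm, normSq_apply]
    simp
    ring
  nlinarith [norm_nonneg w, norm_nonneg e, mul_nonneg (show 0 ≤ 1 - ‖w‖ ^ 2 by nlinarith [norm_nonneg w])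
    (show 0 ≤ 1 - ‖e‖ ^ 2 by nlinarith [norm_nonneg e])]

section Schur

variable {e : ℕ → ℂ} {r : ℝ}

lemma one_sub_ne_zero_of_norm_lt {z : ℂ} (hz : ‖z‖ < 1) : 1 - z ≠ 0 := by
  intro h
  have : z = 1 := (sub_eq_zero.mp h).symm
  simp [this] at hz

lemma norm_schurB_le (he : ∀ n, ‖e n‖ < 1) (h0 : 0 ≤ r) (h1 : r ≤ 1) (n : ℕ) :
    ‖schurB e r n‖ ≤ 1 := by
  induction n with
  | zero => simp [schurB]
  | succ n ih =>
    have hw : ‖(r : ℂ) * schurB e r n‖ ≤ 1 := by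
      rw [norm_mul, Complex.norm_of_nonneg h0]
      exact mul_le_one₀ h1 (norm_nonneg _) ih
    have h2 := norm_moebius_le hw (he n)
    have h3 : ‖1 - conj (e n)‖ = ‖1 - e n‖ := by
      rw [← RCLike.norm_conj (1 - e n), map_sub, map_one]
    have h4 := norm_pos_iff.mpr (one_sub_ne_zero_of_norm_lt (he n))
    rw [schurB, norm_div, norm_mul, norm_mul, h3]
    refine div_le_one_of_le₀ (mul_le_mul_of_nonneg_right h2 h4.le) (by positivity)

lemma norm_mul_schurB_le (he : ∀ n, ‖e n‖ < 1) (h0 : 0 ≤ r) (h1 : r ≤ 1) (n : ℕ) :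
    ‖(r : ℂ) * schurB e r n‖ ≤ r := by
  rw [norm_mul, Complex.norm_of_nonneg h0]
  exact mul_le_of_le_one_right h0 (norm_schurB_le he h0 h1 n)

lemma norm_conj_mul_schurB_le (he : ∀ n, ‖e n‖ < 1) (h0 : 0 ≤ r) (h1 : r ≤ 1) (n : ℕ) :
    ‖conj (e n) * ((r : ℂ) * schurB e r n)‖ ≤ ‖e n‖ := by
  rw [norm_mul, RCLike.norm_conj]
  exact mul_le_of_le_one_right (norm_nonneg _) ((norm_mul_schurB_le he h0 h1 n).trans h1)

/-- The defect `1 - r B`. -/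
noncomputable def schurU (e : ℕ → ℂ) (r : ℝ) (n : ℕ) : ℂ := 1 - r * schurB e r n

lemma schurU_zero : schurU e r 0 = 1 - r := by simp [schurU, schurB]

lemma schurU_den (n : ℕ) : 1 - conj (e n) * (r * schurB e r n) =
    1 - conj (e n) + conj (e n) * schurU e r n := by
  rw [schurU]; ring

lemma schurU_succ (he : ∀ n, ‖e n‖ < 1) (h0 : 0 ≤ r) (h1 : r ≤ 1) (n : ℕ) :
    schurU e r (n + 1) = (1 - r) + r * (schurU e r n * (1 - ‖e n‖ ^ 2)) /
      ((1 - e n) * (1 - conj (e n) * (r * schurB e r n))) := by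
  have a1 := one_sub_ne_zero_of_norm_lt ((norm_conj_mul_schurB_le he h0 h1 n).trans_lt (he n))
  have a2 := one_sub_ne_zero_of_norm_lt (he n)
  have a3 : (‖e n‖ : ℂ) ^ 2 = e n * conj (e n) := by rw [mul_conj']
  rw [schurU, schurB, a3, schurU]
  generalize (r : ℂ) * schurB e r n = w at *
  have e1 : (r : ℂ) * ((w - e n) * (1 - conj (e n)) / ((1 - conj (e n) * w) * (1 - e n))) =
      r * ((w - e n) * (1 - conj (e n))) / ((1 - conj (e n) * w) * (1 - e n)) := by ring
  rw [e1, mul_comm (1 - e n)]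
  have hd : (1 - conj (e n) * w) * (1 - e n) ≠ 0 := mul_ne_zero a1 a2
  rw [eq_comm, ← eq_sub_iff_add_eq', div_eq_iff hd]
  have e2 := div_mul_cancel₀ (r * ((w - e n) * (1 - conj (e n)))) hd
  linear_combination e2

lemma schurB_one (he : ∀ n, ‖e n‖ < 1) (n : ℕ) : schurB e 1 n = 1 := by
  induction n with
  | zero => rfl
  | succ n ih =>
    have a2 := one_sub_ne_zero_of_norm_lt (he n)
    have a1 : 1 - conj (e n) ≠ 0 := one_sub_ne_zero_of_norm_lt (by rw [RCLike.norm_conj]; exact he n)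
    rw [schurB, ih]
    simp only [ofReal_one, mul_one]
    field_simp

end Schur

/-- Driving coefficients whose real part averages to `-β / n`. -/
structure IsDrive (β : ℝ) (e : ℕ → ℂ) : Prop where
  norm_lt : ∃ c < 1, ∀ n, ‖e n‖ ≤ c
  norm_le : ∃ C : ℝ, 0 ≤ C ∧ ∀ n : ℕ, ‖e n‖ ≤ C / (n + 1)
  null_re : NullSum (fun n : ℕ => (((e n).re + β / ((n : ℝ) + 1) : ℝ) : ℂ))

lemma sum_exp_harm_le {κ : ℝ} (hκ : κ < 1) : ∃ C : ℝ, 0 ≤ C ∧ ∀ m : ℕ,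
    ∑ j ∈ Finset.range (m + 1), rexp (κ * harm j m) ≤ C * (m + 1) := by
  set T : ℕ → ℝ := fun m => ∑ j ∈ Finset.range (m + 1), rexp (κ * harm j m) with hT
  have hTs : ∀ m : ℕ, T (m + 1) = 1 + T m * rexp (κ / (m + 1)) := by
    intro m
    simp only [hT]
    rw [sum_range_succ, harm_self, mul_zero, Real.exp_zero, add_comm, sum_mul]
    refine congrArg _ (sum_congr rfl fun j hj => ?_)
    rw [harm_succ (by simp at hj; omega), mul_add, Real.exp_add, mul_one_div]
  obtain ⟨n₀, hn₀⟩ := exists_nat_ge (max |κ| (2 * κ ^ 2 / (1 - κ)))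
  have h1 : ∀ m : ℕ, n₀ ≤ m → rexp (κ / (m + 1)) ≤ 1 + (1 + κ) / 2 / (m + 1) := by
    intro m hm
    have hm' : max |κ| (2 * κ ^ 2 / (1 - κ)) ≤ (m : ℝ) + 1 := by
      have : (n₀ : ℝ) ≤ m := by exact_mod_cast hm
      linarith
    have hm0 : (0 : ℝ) < m + 1 := by positivity
    have a1 : |κ / (m + 1)| ≤ 1 := by
      rw [abs_div, abs_of_pos hm0, div_le_one hm0]
      exact (le_max_left _ _).trans hm'
    have a2 := (le_max_right _ _).trans hm'
    rw [div_le_iff₀ (by linarith)] at a2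
    have a3 := Real.abs_exp_sub_one_sub_id_le a1
    have a4 := (abs_le.mp a3).2
    have a5 : (κ / ((m : ℝ) + 1)) ^ 2 ≤ (1 - κ) / 2 / (m + 1) := by
      rw [div_pow, div_le_div_iff₀ (by positivity) (by positivity)]
      nlinarith
    have e : (1 + κ) / 2 / ((m : ℝ) + 1) = κ / (m + 1) + (1 - κ) / 2 / (m + 1) := by ring
    linarith
  set C : ℝ := max (T n₀) (2 / (1 - κ)) with hC
  have hC2 : 2 / (1 - κ) ≤ C := le_max_right _ _
  have hC0 : 0 < C := lt_of_lt_of_le (by have : 0 < 1 - κ := by linarith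
                                         positivity) hC2
  have h2 : ∀ m, n₀ ≤ m → T m ≤ C * (m + 1) := by
    intro m hm
    induction m, hm using Nat.le_induction with
    | base =>
      have : T n₀ ≤ C := le_max_left _ _
      nlinarith [Nat.cast_nonneg (α := ℝ) n₀]
    | succ m hm ih =>
      rw [hTs]
      have hm0 : (0 : ℝ) < m + 1 := by positivity
      have a1 := mul_le_mul ih (h1 m hm) (exp_pos _).le (by positivity)
      rw [div_le_iff₀ (by linarith)] at hC2
      have e : C * (m + 1) * (1 + (1 + κ) / 2 / ((m : ℝ) + 1)) = C * (m + 1) + C * ((1 + κ) / 2) := by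
        field_simp
      push_cast
      nlinarith
  obtain ⟨B, hB⟩ := exists_bound_of_eventually_le (u := fun m : ℕ => T m / (m + 1)) (C := C) (by
    filter_upwards [eventually_ge_atTop n₀] with m hm
    rw [div_le_iff₀ (by positivity)]
    exact h2 m hm)
  refine ⟨max B 0, le_max_right _ _, fun m => ?_⟩
  have := (hB m).trans (le_max_left B 0)
  rwa [div_le_iff₀ (by positivity)] at this

lemma abs_log_norm_add_re_le {e : ℂ} {c : ℝ} (hc : c < 1) (he : ‖e‖ ≤ c) :
    |Real.log ‖1 - e‖ + e.re| ≤ ‖e‖ ^ 2 / (1 - c) := by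
  have h1 := norm_log_one_add_sub_self_le (z := -e) (by rw [norm_neg]; linarith)
  rw [norm_neg] at h1
  have h2 : |Real.log ‖1 - e‖ + e.re| ≤ ‖log (1 + -e) - -e‖ := by
    refine le_trans (le_of_eq ?_) (abs_re_le_norm _)
    simp [log_re, sub_eq_add_neg]
  refine h2.trans (h1.trans ?_)
  have h3 : (1 - ‖e‖)⁻¹ ≤ (1 - c)⁻¹ := inv_anti₀ (by linarith) (by linarith)
  have h4 := mul_le_mul_of_nonneg_left h3 (sq_nonneg ‖e‖)
  have h5 : 0 ≤ ‖e‖ ^ 2 * (1 - ‖e‖)⁻¹ := mul_nonneg (sq_nonneg _) (inv_nonneg.mpr (by linarith))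
  rw [div_eq_mul_inv (‖e‖ ^ 2)]
  linarith

namespace IsDrive

variable {β : ℝ} {e : ℕ → ℂ}

lemma lt_one (H : IsDrive β e) (n : ℕ) : ‖e n‖ < 1 := by
  obtain ⟨c, hc, h⟩ := H.norm_lt
  exact (h n).trans_lt hc

lemma sum_sq_le (H : IsDrive β e) : ∃ D : ℝ, 0 ≤ D ∧ ∀ n N, n ≤ N →
    ∑ i ∈ Finset.Ico n N, ‖e i‖ ^ 2 ≤ D / (n + 1) := by
  obtain ⟨C, hC0, hC⟩ := H.norm_le
  refine ⟨C ^ 2 * 2, by positivity, fun n N hN => ?_⟩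
  have h1 : ∀ i ∈ Finset.Ico n N, ‖e i‖ ^ 2 ≤ C ^ 2 * (1 / ((i : ℝ) + 1) ^ 2) := by
    intro i _
    have := pow_le_pow_left₀ (norm_nonneg _) (hC i) 2
    rw [div_pow] at this
    rwa [mul_one_div]
  refine (sum_le_sum h1).trans ?_
  rw [← mul_sum, mul_div_assoc]
  exact mul_le_mul_of_nonneg_left (sum_inv_sq_le n N hN) (by positivity)

/-- Squared modulus of the boundary values. -/
noncomputable def growth (e : ℕ → ℂ) (n : ℕ) : ℝ := ∏ i ∈ Finset.range n, ‖1 - e i‖ ^ 2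

lemma growth_pos (H : IsDrive β e) (n : ℕ) : 0 < growth e n := by
  refine Finset.prod_pos fun i _ => ?_
  have := norm_pos_iff.mpr (one_sub_ne_zero_of_norm_lt (H.lt_one i))
  positivity

lemma growth_le (H : IsDrive β e) {δ : ℝ} (hδ : 0 < δ) : ∃ D : ℝ, 0 ≤ D ∧ ∀ n N, n ≤ N →
    growth e n ≤ D * rexp ((-2 * β + δ) * harm n N) * growth e N := by
  obtain ⟨D₁, hD₁, h1⟩ := H.null_re.exists_le (δ := δ / 2) (by positivity)
  obtain ⟨D₂, hD₂, h2⟩ := H.sum_sq_le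
  obtain ⟨c, hc, hec⟩ := H.norm_lt
  refine ⟨rexp (2 * D₁ + 2 * (D₂ / (1 - c))), (exp_pos _).le, fun n N hN => ?_⟩
  have hpos : ∀ i, 0 < ‖1 - e i‖ := fun i =>
    norm_pos_iff.mpr (one_sub_ne_zero_of_norm_lt (H.lt_one i))
  have h3 : growth e N = growth e n * rexp (∑ i ∈ Finset.Ico n N, 2 * Real.log ‖1 - e i‖) := by
    rw [growth, growth, ← Finset.prod_range_mul_prod_Ico _ hN, Real.exp_sum]
    refine congrArg _ (prod_congr rfl fun i _ => ?_)
    rw [mul_comm, Real.exp_mul, Real.exp_log (hpos i)]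
    norm_cast
  have h4 : -(∑ i ∈ Finset.Ico n N, 2 * Real.log ‖1 - e i‖) ≤
      2 * D₁ + 2 * (D₂ / (1 - c)) + (-2 * β + δ) * harm n N := by
    have a1 := h1 n N hN
    rw [← ofReal_sum, norm_real, norm_eq_abs] at a1
    have a1' := (abs_le.mp a1).2
    rw [sum_add_distrib] at a1'
    have e1 : ∑ i ∈ Finset.Ico n N, β / ((i : ℝ) + 1) = β * harm n N := by
      rw [harm, mul_sum]; exact sum_congr rfl fun i _ => by ring
    rw [e1] at a1'
    have a2 : ∑ i ∈ Finset.Ico n N, -(2 * Real.log ‖1 - e i‖) ≤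
        ∑ i ∈ Finset.Ico n N, (2 * (e i).re + 2 * (‖e i‖ ^ 2 / (1 - c))) := by
      refine sum_le_sum fun i _ => ?_
      have := (abs_le.mp (abs_log_norm_add_re_le hc (hec i))).1
      linarith
    rw [sum_neg_distrib, sum_add_distrib, ← mul_sum, ← mul_sum,
      ← mul_sum, ← sum_div] at a2
    rw [← mul_sum]
    have a3 : (∑ i ∈ Finset.Ico n N, ‖e i‖ ^ 2) / (1 - c) ≤ D₂ / (1 - c) := by
      refine div_le_div_of_nonneg_right ((h2 n N hN).trans ?_) (by linarith)
      exact div_le_self hD₂ (by linarith [Nat.cast_nonneg (α := ℝ) n])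
    linarith
  have h5 : 1 ≤ rexp (2 * D₁ + 2 * (D₂ / (1 - c))) * rexp ((-2 * β + δ) * harm n N) *
      rexp (∑ i ∈ Finset.Ico n N, 2 * Real.log ‖1 - e i‖) := by
    rw [← Real.exp_add, ← Real.exp_add]
    exact one_le_exp (by linarith)
  rw [h3]
  have := mul_le_mul_of_nonneg_left h5 (H.growth_pos n).le
  linarith

lemma sum_growth_le (H : IsDrive β e) (hβ : -(1 / 2) < β) : ∃ C : ℝ, 0 < C ∧ ∀ m : ℕ,
    ∑ j ∈ Finset.range (m + 1), growth e j ≤ C * (m + 1) * growth e m := by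
  obtain ⟨D, hD, h1⟩ := H.growth_le (δ := (1 + 2 * β) / 2) (by linarith)
  obtain ⟨C, hC, h2⟩ := sum_exp_harm_le (κ := -2 * β + (1 + 2 * β) / 2) (by linarith)
  refine ⟨D * C + 1, by positivity, fun m => ?_⟩
  have hm := H.growth_pos m
  calc ∑ j ∈ Finset.range (m + 1), growth e j
      ≤ ∑ j ∈ Finset.range (m + 1),
        D * rexp ((-2 * β + (1 + 2 * β) / 2) * harm j m) * growth e m := by
        refine sum_le_sum fun j hj => h1 j m (by simp at hj; omega)
    _ = D * (∑ j ∈ Finset.range (m + 1), rexp ((-2 * β + (1 + 2 * β) / 2) * harm j m)) *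
        growth e m := by rw [← sum_mul, ← mul_sum]
    _ ≤ D * (C * (m + 1)) * growth e m := by gcongr; exact h2 m
    _ ≤ (D * C + 1) * (m + 1) * growth e m := by
      refine mul_le_mul_of_nonneg_right ?_ hm.le
      nlinarith [Nat.cast_nonneg (α := ℝ) m]

lemma norm_schurU_le (H : IsDrive β e) (hβ : -(1 / 2) < β) : ∃ A c₀ : ℝ, 0 < A ∧ 0 < c₀ ∧
    ∀ r : ℝ, 0 ≤ r → r ≤ 1 → ∀ m : ℕ, m * (1 - r) ≤ c₀ →
      ‖schurU e r m‖ ≤ A * ((m : ℝ) + 1) * (1 - r) := by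
  obtain ⟨C, hC, hS⟩ := H.sum_growth_le hβ
  obtain ⟨c, hc, hec⟩ := H.norm_lt
  obtain ⟨E, hE, heE⟩ := H.norm_le
  set K : ℝ := E / (1 - c) with hK
  have hc1 : 0 < 1 - c := by linarith
  have hK0 : 0 ≤ K := by positivity
  set A : ℝ := 2 * C with hA
  refine ⟨A, Real.log 2 / (K * A + 1), by positivity, div_pos (Real.log_pos (by norm_num))
    (by positivity), fun r h0 h1 => ?_⟩
  have he := H.lt_one
  have hr : 0 ≤ 1 - r := by linarith
  have key : ∀ m : ℕ, ‖schurU e r m‖ * growth e m ≤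
      (1 - r) * (∑ j ∈ Finset.range (m + 1), growth e j) * rexp (K * A * (1 - r) * m) →
      m * (1 - r) ≤ Real.log 2 / (K * A + 1) →
      ‖schurU e r m‖ ≤ A * ((m : ℝ) + 1) * (1 - r) := by
    intro m h2 h3
    have hg := H.growth_pos m
    rw [le_div_iff₀ (by positivity)] at h3
    have h4 : rexp (K * A * (1 - r) * m) ≤ 2 := by
      rw [← Real.exp_log (show (0 : ℝ) < 2 by norm_num)]
      refine Real.exp_le_exp.mpr (le_trans ?_ h3)
      have : 0 ≤ m * (1 - r) := by positivity
      nlinarith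
    have hs0 : 0 ≤ ∑ j ∈ Finset.range (m + 1), growth e j :=
      sum_nonneg fun j _ => (H.growth_pos j).le
    have h5 : ‖schurU e r m‖ * growth e m ≤ (A * ((m : ℝ) + 1) * (1 - r)) * growth e m := by
      calc _ ≤ (1 - r) * (∑ j ∈ Finset.range (m + 1), growth e j) * 2 := h2.trans (by gcongr)
        _ ≤ (1 - r) * (C * (m + 1) * growth e m) * 2 := by gcongr; exact hS m
        _ = _ := by rw [hA]; ring
    exact le_of_mul_le_mul_right h5 hg
  have main : ∀ m : ℕ, m * (1 - r) ≤ Real.log 2 / (K * A + 1) → ‖schurU e r m‖ * growth e m ≤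
      (1 - r) * (∑ j ∈ Finset.range (m + 1), growth e j) * rexp (K * A * (1 - r) * m) := by
    intro m
    induction m with
    | zero =>
      intro _
      rw [schurU_zero]
      have : ‖(1 - (r : ℂ))‖ = 1 - r := by
        rw [← ofReal_one, ← ofReal_sub, Complex.norm_of_nonneg hr]
      simp [this]
    | succ m ih =>
      intro hm
      have hm' : m * (1 - r) ≤ Real.log 2 / (K * A + 1) := by
        refine le_trans ?_ hm
        push_cast; nlinarith
      have ih' := ih hm'
      have hU := key m ih' hm'
      have hg := H.growth_pos m
      have hg1 : growth e (m + 1) = growth e m * ‖1 - e m‖ ^ 2 := Finset.prod_range_succ _ _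
      set d : ℂ := 1 - conj (e m) * (r * schurB e r m) with hd
      have hden : 1 - c ≤ ‖d‖ := by
        have a1 := norm_sub_norm_le (1 : ℂ) (conj (e m) * (r * schurB e r m))
        have a2 := norm_conj_mul_schurB_le he h0 h1 m
        rw [norm_one] at a1
        linarith [hec m]
      have hd0 : 0 < ‖d‖ := by linarith
      have he1 := norm_pos_iff.mpr (one_sub_ne_zero_of_norm_lt (he m))
      have hrat : ‖1 - e m‖ ≤ ‖d‖ * (1 + K * A * (1 - r)) := by
        have a1 : (1 - conj (e m)) = d - conj (e m) * schurU e r m := by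
          rw [hd, schurU_den]; ring
        have a2 : ‖1 - e m‖ = ‖1 - conj (e m)‖ := by
          rw [← RCLike.norm_conj (1 - e m), map_sub, map_one]
        rw [a2, a1]
        refine (norm_sub_le _ _).trans ?_
        rw [norm_mul, RCLike.norm_conj]
        have a3 : ‖e m‖ * ‖schurU e r m‖ ≤ E / (m + 1) * (A * ((m : ℝ) + 1) * (1 - r)) :=
          mul_le_mul (heE m) hU (norm_nonneg _) (by positivity)
        have a4 : E / ((m : ℝ) + 1) * (A * ((m : ℝ) + 1) * (1 - r)) = (1 - c) * (K * A * (1 - r)) := by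
          rw [hK]; field_simp
        have a5 : 0 ≤ K * A * (1 - r) := by positivity
        nlinarith
      have hstep : ‖schurU e r (m + 1)‖ * growth e (m + 1) ≤ (1 - r) * growth e (m + 1) +
          ‖schurU e r m‖ * growth e m * (1 + K * A * (1 - r)) := by
        rw [schurU_succ he h0 h1]
        have b1 : ‖(1 - (r : ℂ))‖ = 1 - r := by
          rw [← ofReal_one, ← ofReal_sub, Complex.norm_of_nonneg hr]
        have b2 : ‖(1 - (‖e m‖ : ℂ) ^ 2)‖ ≤ 1 := by
          rw [← ofReal_one, ← ofReal_pow, ← ofReal_sub, norm_real,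
            norm_of_nonneg (by nlinarith [norm_nonneg (e m), he m])]
          nlinarith [sq_nonneg ‖e m‖]
        have b3 : ‖(r : ℂ) * (schurU e r m * (1 - ‖e m‖ ^ 2)) / ((1 - e m) * d)‖ ≤
            ‖schurU e r m‖ / (‖1 - e m‖ * ‖d‖) := by
          rw [norm_div, norm_mul, norm_mul, norm_mul, Complex.norm_of_nonneg h0]
          gcongr
          calc r * (‖schurU e r m‖ * ‖(1 - (‖e m‖ : ℂ) ^ 2)‖) ≤ 1 * (‖schurU e r m‖ * 1) := by
                gcongr
            _ = _ := by ring
        have b4 := (norm_add_le (1 - (r : ℂ))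
          ((r : ℂ) * (schurU e r m * (1 - ‖e m‖ ^ 2)) / ((1 - e m) * d))).trans
          (add_le_add b1.le b3)
        have hg10 := H.growth_pos (m + 1)
        refine (mul_le_mul_of_nonneg_right b4 hg10.le).trans ?_
        rw [add_mul]
        refine add_le_add le_rfl ?_
        rw [hg1, div_mul_eq_mul_div, div_le_iff₀ (by positivity)]
        have b5 := mul_le_mul_of_nonneg_left hrat
          (show 0 ≤ ‖schurU e r m‖ * growth e m * ‖1 - e m‖ by positivity)
        nlinarith
      rw [sum_range_succ _ (m + 1)]
      set Sm := ∑ j ∈ Finset.range (m + 1), growth e j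
      have hSm : 0 ≤ Sm := sum_nonneg fun j _ => (H.growth_pos j).le
      have hx : 0 ≤ K * A * (1 - r) := by positivity
      have c1 : 1 + K * A * (1 - r) ≤ rexp (K * A * (1 - r)) := by
        linarith [add_one_le_exp (K * A * (1 - r))]
      have c2 : rexp (K * A * (1 - r) * ((m + 1 : ℕ) : ℝ)) =
          rexp (K * A * (1 - r) * m) * rexp (K * A * (1 - r)) := by
        rw [← Real.exp_add]; push_cast; ring_nf
      have c3 : 1 ≤ rexp (K * A * (1 - r) * ((m + 1 : ℕ) : ℝ)) :=
        one_le_exp (by positivity)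
      have hg10 := H.growth_pos (m + 1)
      refine hstep.trans ?_
      have d1 := mul_le_mul ih' c1 (by positivity) (by positivity)
      have d2 := mul_le_mul_of_nonneg_left c3 (show 0 ≤ (1 - r) * growth e (m + 1) by positivity)
      calc _ ≤ (1 - r) * growth e (m + 1) * rexp (K * A * (1 - r) * ((m + 1 : ℕ) : ℝ)) +
            (1 - r) * Sm * rexp (K * A * (1 - r) * m) * rexp (K * A * (1 - r)) := by
              linarith
        _ = _ := by rw [c2]; ring
  exact fun m hm => key m (main m hm) hm

end IsDrive

lemma norm_log_one_sub_sub_le {c : ℝ} (hc : c < 1) {x y : ℂ} (hx : ‖x‖ ≤ c) (hy : ‖y‖ ≤ c) :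
    ‖log (1 - x) - log (1 - y)‖ ≤ ‖x - y‖ / (1 - c) := by
  have hd : ∀ z ∈ closedBall (0 : ℂ) c, HasDerivWithinAt (fun z => log (1 - z))
      (-1 / (1 - z)) (closedBall (0 : ℂ) c) z := by
    intro z hz
    rw [mem_closedBall_zero_iff] at hz
    refine (((hasDerivAt_id z).const_sub 1).clog ?_).hasDerivWithinAt
    refine mem_slitPlane_iff.mpr (Or.inl ?_)
    have := (abs_re_le_norm z).trans hz
    simp
    linarith [le_abs_self z.re]
  have hb : ∀ z ∈ closedBall (0 : ℂ) c, ‖-1 / (1 - z)‖ ≤ 1 / (1 - c) := by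
    intro z hz
    rw [mem_closedBall_zero_iff] at hz
    rw [norm_div, norm_neg, norm_one]
    have := norm_sub_norm_le (1 : ℂ) z
    rw [norm_one] at this
    exact one_div_le_one_div_of_le (by linarith) (by linarith)
  have := (convex_closedBall (0 : ℂ) c).norm_image_sub_le_of_norm_hasDerivWithin_le hd hb
    (mem_closedBall_zero_iff.mpr hy) (mem_closedBall_zero_iff.mpr hx)
  rwa [one_div_mul_eq_div] at this

lemma abs_arg_one_sub_sub_le {c : ℝ} (hc : c < 1) {x y : ℂ} (hx : ‖x‖ ≤ c) (hy : ‖y‖ ≤ c) :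
    |arg (1 - x) - arg (1 - y)| ≤ ‖x - y‖ / (1 - c) := by
  refine le_trans (le_of_eq ?_) ((abs_im_le_norm _).trans (norm_log_one_sub_sub_le hc hx hy))
  simp [log_im]

lemma abs_arg_one_sub_le {c : ℝ} (hc : c < 1) {x : ℂ} (hx : ‖x‖ ≤ c) :
    |arg (1 - x)| ≤ ‖x‖ / (1 - c) := by
  have := abs_arg_one_sub_sub_le hc hx (y := 0) (by simpa using (norm_nonneg x).trans hx)
  simpa using this

lemma abs_arg_add_im_le {x : ℂ} {c : ℝ} (hc : c < 1) (hx : ‖x‖ ≤ c) :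
    |arg (1 - x) + x.im| ≤ ‖x‖ ^ 2 / (1 - c) := by
  have h1 := norm_log_one_add_sub_self_le (z := -x) (by rw [norm_neg]; linarith)
  rw [norm_neg] at h1
  have h2 : |arg (1 - x) + x.im| ≤ ‖log (1 + -x) - -x‖ := by
    refine le_trans (le_of_eq ?_) (abs_im_le_norm _)
    simp [log_im, sub_eq_add_neg]
  refine h2.trans (h1.trans ?_)
  have h3 : (1 - ‖x‖)⁻¹ ≤ (1 - c)⁻¹ := inv_anti₀ (by linarith) (by linarith)
  have h4 := mul_le_mul_of_nonneg_left h3 (sq_nonneg ‖x‖)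
  have h5 : 0 ≤ ‖x‖ ^ 2 * (1 - ‖x‖)⁻¹ := mul_nonneg (sq_nonneg _) (inv_nonneg.mpr (by linarith))
  rw [div_eq_mul_inv (‖x‖ ^ 2)]
  linarith

lemma exists_harm (n : ℕ) {L : ℝ} (hL : 0 < L) : ∃ N, n ≤ N ∧ L ≤ harm n N ∧ harm n N ≤ L + 1 := by
  have hex : ∃ N, n ≤ N ∧ L ≤ harm n N := by
    have h1 : Tendsto (fun N : ℕ => ∑ i ∈ Finset.range N, 1 / ((i : ℝ) + 1)) atTop atTop :=
      Real.tendsto_sum_range_one_div_nat_succ_atTop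
    obtain ⟨N, hN1, hN2⟩ := ((eventually_ge_atTop n).and
      (h1.eventually_ge_atTop (L + ∑ i ∈ Finset.range n, 1 / ((i : ℝ) + 1)))).exists
    refine ⟨N, hN1, ?_⟩
    rw [← Finset.sum_range_add_sum_Ico _ hN1] at hN2
    rw [harm]; linarith
  classical
  obtain ⟨h1, h2⟩ := Nat.find_spec hex
  refine ⟨Nat.find hex, h1, h2, ?_⟩
  set N := Nat.find hex with hN
  rcases h1.eq_or_lt with h | h
  · rw [← h, harm_self] at h2; linarith
  · obtain ⟨M, hM⟩ : ∃ M, N = M + 1 := ⟨N - 1, by omega⟩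
    have h3 : ¬ (n ≤ M ∧ L ≤ harm n M) := Nat.find_min hex (by omega)
    have h4 : harm n M < L := by
      by_contra h5
      exact h3 ⟨by omega, not_lt.mp h5⟩
    rw [hM, harm_succ (by omega)]
    have h5 : 1 / ((M : ℝ) + 1) ≤ 1 := by
      rw [div_le_one (by positivity)]
      linarith [Nat.cast_nonneg (α := ℝ) M]
    linarith

namespace IsDrive

variable {β : ℝ} {e : ℕ → ℂ}

lemma abs_gam_sub_le (H : IsDrive β e) (hβ : -(1 / 2) < β) : ∃ A c₀ : ℝ, 0 < A ∧ 0 < c₀ ∧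
    ∀ r : ℝ, 0 ≤ r → r ≤ 1 → ∀ m : ℕ, m * (1 - r) ≤ c₀ →
      |gam e 1 m - gam e r m| ≤ A * (m * (1 - r)) := by
  obtain ⟨A, c₀, hA, hc₀, hU⟩ := H.norm_schurU_le hβ
  obtain ⟨c, hc, hec⟩ := H.norm_lt
  obtain ⟨E, hE, heE⟩ := H.norm_le
  have hc1 : 0 < 1 - c := by linarith
  refine ⟨E * A / (1 - c) + 1, c₀, by positivity, hc₀, fun r h0 h1 m hm => ?_⟩
  have hr : 0 ≤ 1 - r := by linarith
  rw [gam, gam, ← sum_sub_distrib]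
  have key : ∀ i ∈ Finset.range m, |arg (1 - conj (e i) * ((1 : ℝ) * schurB e 1 i)) -
      arg (1 - conj (e i) * (r * schurB e r i))| ≤ E * A / (1 - c) * (1 - r) := by
    intro i hi
    have hi' : (i : ℝ) ≤ m := by exact_mod_cast (Finset.mem_range.mp hi).le
    refine (abs_arg_one_sub_sub_le hc
      ((norm_conj_mul_schurB_le H.lt_one zero_le_one le_rfl i).trans (hec i))
      ((norm_conj_mul_schurB_le H.lt_one h0 h1 i).trans (hec i))).trans ?_
    have e1 : conj (e i) * ((1 : ℝ) * schurB e 1 i) - conj (e i) * (r * schurB e r i) =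
        conj (e i) * schurU e r i := by
      rw [schurB_one H.lt_one, schurU]; push_cast; ring
    rw [e1, norm_mul, RCLike.norm_conj, mul_comm _ (1 - r), mul_div_assoc', mul_comm (1 - r)]
    refine div_le_div_of_nonneg_right ?_ hc1.le
    have h2 := hU r h0 h1 i ((mul_le_mul_of_nonneg_right hi' hr).trans hm)
    refine (mul_le_mul (heE i) h2 (norm_nonneg _) (by positivity)).trans (le_of_eq ?_)
    field_simp
  refine (abs_sum_le_sum_abs _ _).trans ((sum_le_sum key).trans ?_)
  rw [sum_const, card_range, nsmul_eq_mul]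
  have : 0 ≤ m * (1 - r) := by positivity
  nlinarith

lemma abs_gam_sub_gam_le (H : IsDrive β e) : ∃ A : ℝ, 0 ≤ A ∧
    ∀ r : ℝ, 0 ≤ r → r ≤ 1 → ∀ m N, m ≤ N → |gam e r N - gam e r m| ≤ A * harm m N := by
  obtain ⟨c, hc, hec⟩ := H.norm_lt
  obtain ⟨E, hE, heE⟩ := H.norm_le
  have hc1 : 0 < 1 - c := by linarith
  refine ⟨E / (1 - c), by positivity, fun r h0 h1 m N hmN => ?_⟩
  rw [gam, gam, ← sum_Ico_eq_sub _ hmN, harm, mul_sum]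
  refine (abs_sum_le_sum_abs _ _).trans (sum_le_sum fun i _ => ?_)
  have h2 := norm_conj_mul_schurB_le H.lt_one h0 h1 i
  refine (abs_arg_one_sub_le hc (h2.trans (hec i))).trans ?_
  rw [div_mul_div_comm, mul_one, mul_comm (1 - c), ← div_div]
  exact div_le_div_of_nonneg_right (h2.trans (heE i)) hc1.le

/-- Matching condition between the boundary arguments and an interior phase `-λ`. -/
structure Match (e : ℕ → ℂ) (ℓ : ℝ → ℝ) (lam : ℝ) : Prop where
  tendsto : Tendsto ℓ (𝓝[<] 1) (nhds lam)
  le : ∃ M₀ C : ℝ, 0 < M₀ ∧ 0 ≤ C ∧ ∀ (m : ℕ) (r : ℝ), 0 ≤ r → r < 1 → M₀ ≤ m * (1 - r) →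
    |gam e r m + ℓ r| ≤ C / √(m * (1 - r))

lemma exists_abs_gam_le (H : IsDrive β e) (hβ : -(1 / 2) < β) {ℓ : ℝ → ℝ} {lam : ℝ}
    (hM : Match e ℓ lam) : ∃ G, 0 ≤ G ∧ ∀ n, |gam e 1 n| ≤ G := by
  obtain ⟨A, c₀, hA, hc₀, h1⟩ := H.abs_gam_sub_le hβ
  obtain ⟨A', hA', h2⟩ := H.abs_gam_sub_gam_le
  obtain ⟨M₀, C, hM₀, hC, h3⟩ := hM.le
  obtain ⟨K, hK⟩ := exists_nat_ge (max 1 (M₀ / c₀))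
  have hK1 : 1 ≤ K := by exact_mod_cast (le_max_left _ _).trans hK
  have hK2 : M₀ ≤ K * c₀ := by
    have := (le_max_right _ _).trans hK
    rwa [div_le_iff₀ hc₀] at this
  have hr : Tendsto (fun n : ℕ => 1 - c₀ / (n : ℝ)) atTop (𝓝[<] 1) := by
    refine tendsto_nhdsWithin_iff.mpr ⟨?_, ?_⟩
    · have := (tendsto_const_div_atTop_nhds_zero_nat c₀).const_sub 1
      simpa using this
    · filter_upwards [eventually_gt_atTop 0] with n hn
      have : (0 : ℝ) < n := by exact_mod_cast hn
      have : 0 < c₀ / n := by positivity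
      simp only [mem_Iio]; linarith
  have hl := ((hM.tendsto.comp hr).abs).eventually_le_const (show |lam| < |lam| + 1 by linarith)
  have hev : ∀ᶠ n in atTop, |gam e 1 n| ≤ A * c₀ + A' * Real.log K + C / √M₀ + (|lam| + 1) := by
    filter_upwards [hl, eventually_gt_atTop 0, eventually_ge_atTop ⌈c₀⌉₊] with n hn hn0 hn1
    have hn0' : (0 : ℝ) < n := by exact_mod_cast hn0
    set r : ℝ := 1 - c₀ / n with hrd
    have hr0 : 0 ≤ r := by
      rw [hrd, sub_nonneg, div_le_one hn0']
      exact Nat.ceil_le.mp hn1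
    have hr1 : r < 1 := by
      have : 0 < c₀ / n := by positivity
      linarith
    have e1 : n * (1 - r) = c₀ := by rw [hrd]; field_simp; ring
    have e2 : ((K * n : ℕ) : ℝ) * (1 - r) = K * c₀ := by push_cast; rw [mul_assoc, e1]
    have g1 := h1 r hr0 hr1.le n e1.le
    rw [e1] at g1
    have g2 := (h2 r hr0 hr1.le n (K * n) (by nlinarith)).trans
      (mul_le_mul_of_nonneg_left (harm_mul_le_log hn0 hK1) hA')
    have g3 := h3 (K * n) r hr0 hr1 (by rw [e2]; exact hK2)
    rw [e2] at g3
    have g4 : C / √(K * c₀) ≤ C / √M₀ :=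
      div_le_div_of_nonneg_left hC (Real.sqrt_pos.mpr hM₀) (Real.sqrt_le_sqrt hK2)
    have g5 : |ℓ r| ≤ |lam| + 1 := hn
    rw [abs_le] at *
    constructor <;> linarith [g1.1, g1.2, g2.1, g2.2, g3.1, g3.2, g5.1, g5.2]
  obtain ⟨G, hG⟩ := exists_bound_of_eventually_le hev
  exact ⟨G, (abs_nonneg _).trans (hG 0), hG⟩

end IsDrive

lemma tendsto_mul_of_le_inv_sq {u : ℕ → ℝ} {C : ℝ} (h0 : ∀ n, 0 ≤ u n)
    (h : ∀ n : ℕ, u n ≤ C / ((n : ℝ) + 1) ^ 2) :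
    Tendsto (fun n : ℕ => ((n : ℝ) + 1) * u n) atTop (nhds 0) := by
  refine squeeze_zero (fun n => mul_nonneg (by positivity) (h0 n)) (fun n => ?_)
    (tendsto_const_mul_one_div C)
  have := mul_le_mul_of_nonneg_left (h n) (show (0 : ℝ) ≤ (n : ℝ) + 1 by positivity)
  refine this.trans (le_of_eq ?_)
  field_simp

namespace IsSzPhase

variable {β : ℝ} {η X Y : ℕ → ℂ}

/-- The driving coefficients in the rotating frame. -/
noncomputable def drv (η X : ℕ → ℂ) (n : ℕ) : ℂ := η n * conj (phase X n)

lemma exists_norm_le (H : IsSzPhase β η X Y) : ∃ c < 1, ∀ n, ‖η n‖ ≤ c := by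
  obtain ⟨C, hC, -, h2⟩ := H.bound
  obtain ⟨n₀, h0⟩ := eventually_atTop.mp
    (IsSzSeq.eventually_norm_eta_le h2 (c := 1 / 2) (by norm_num))
  have : ∀ N : ℕ, ∃ c < 1, 1 / 2 ≤ c ∧ ∀ n < N, ‖η n‖ ≤ c := by
    intro N
    induction N with
    | zero => exact ⟨1 / 2, by norm_num, le_rfl, by simp⟩
    | succ N ih =>
      obtain ⟨c, h1, h2, h3⟩ := ih
      refine ⟨max c ‖η N‖, max_lt h1 (H.norm_lt N), h2.trans (le_max_left _ _), fun n hn => ?_⟩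
      rcases Nat.lt_succ_iff_lt_or_eq.mp hn with h | rfl
      · exact (h3 n h).trans (le_max_left _ _)
      · exact le_max_right _ _
  obtain ⟨c, h1, h2, h3⟩ := this n₀
  refine ⟨c, h1, fun n => ?_⟩
  rcases lt_or_ge n n₀ with h | h
  · exact h3 n h
  · exact (h0 n h).trans h2

lemma isDrive (H : IsSzPhase β η X Y) : IsDrive β (drv η X) := by
  obtain ⟨c, hc, h1⟩ := H.exists_norm_le
  obtain ⟨C, hC, -, h2⟩ := H.bound
  refine ⟨⟨c, hc, fun n => by rw [drv, H.norm_e]; exact h1 n⟩,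
    ⟨C, hC, fun n => by rw [drv, H.norm_e]; exact h2 n⟩, ?_⟩
  refine (congrArg NullSum (funext fun n => ?_)).mp H.null.re
  rw [drv]
  congr 1
  have e : (β : ℂ) / ((n : ℂ) + 1) * (1 + 2 * (tau X Y n : ℂ) * I) =
      ((β / ((n : ℝ) + 1) : ℝ) : ℂ) + ((β / ((n : ℝ) + 1) * 2 * tau X Y n : ℝ) : ℂ) * I := by
    push_cast; ring
  rw [e]
  simp only [add_re, ofReal_re, re_ofReal_mul, Complex.I_re, mul_zero,
    add_zero]

lemma nullSum_tau_diff (H : IsSzPhase β η X Y) :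
    NullSum (fun n => ((tau X Y (n + 1) - tau X Y n : ℝ) : ℂ)) := by
  obtain ⟨C, hC, h1, h2⟩ := H.bound
  obtain ⟨B, hB⟩ := H.exists_isSlow_tau h1 h2
  set f : ℕ → ℂ := fun n => η n * conj (phase X n) +
    (β : ℂ) / ((n : ℂ) + 1) * (1 + 2 * (tau X Y n : ℂ) * I) with hf
  have n1 := ((H.null.conj.mul_slow hB).im).const_mul (-1)
  have hτ : ∀ n, |tau X Y n| ≤ C := fun n => by
    have := (H.abs_im_le n).trans (h1 n)
    have h3 := abs_nonneg (tau X Y n)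
    change 2 * |tau X Y n| ≤ C at this
    linarith
  have n2 : NullSum (fun n => ((‖η n‖ ^ 2 * (tau X Y (n + 1) + tau X Y n) : ℝ) : ℂ)) := by
    refine nullSum_of_tendsto (tendsto_mul_of_le_inv_sq (C := C ^ 2 * (2 * C))
      (fun _ => norm_nonneg _) fun n => ?_)
    rw [norm_real, norm_eq_abs, abs_mul, abs_of_nonneg (sq_nonneg ‖η n‖)]
    have a1 := pow_le_pow_left₀ (norm_nonneg _) (h2 n) 2
    have a2 : |tau X Y (n + 1) + tau X Y n| ≤ 2 * C := by
      have := abs_add_le (tau X Y (n + 1)) (tau X Y n)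
      linarith [hτ n, hτ (n + 1)]
    refine (mul_le_mul a1 a2 (abs_nonneg _) (by positivity)).trans (le_of_eq ?_)
    field_simp
  refine (congrArg NullSum (funext fun n => ?_)).mp (n2.add n1)
  have h3 := H.im_succ n
  change (1 - ‖η n‖ ^ 2) * tau X Y (n + 1) = (1 + ‖η n‖ ^ 2) * tau X Y n - _ at h3
  have h4 : conj (η n) * (2 * X n * Y n) =
      conj (η n * conj (phase X n)) * (1 + 2 * (tau X Y n : ℂ) * I) := by
    rw [← H.prod_mul_conj_phase, map_mul, conj_conj]
    linear_combination -(conj (η n) * (2 * X n * Y n)) * H.phase_mul_conj n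
  have h5 : (conj (η n) * (2 * X n * Y n)).im =
      (conj (f n) * (1 + 2 * (tau X Y n : ℂ) * I)).im := by
    rw [h4, hf]
    simp only [map_add (starRingEnd ℂ), add_mul, add_im]
    have e : conj ((β : ℂ) / ((n : ℂ) + 1) * (1 + 2 * (tau X Y n : ℂ) * I)) *
        (1 + 2 * (tau X Y n : ℂ) * I) =
        ((β / ((n : ℝ) + 1) * (1 + 4 * tau X Y n ^ 2) : ℝ) : ℂ) := by
      simp only [map_mul, map_add, map_div₀, map_one, conj_ofReal, conj_I,
        map_natCast, map_ofNat]
      push_cast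
      linear_combination -((β : ℂ) / ((n : ℂ) + 1)) * 4 * (tau X Y n : ℂ) ^ 2 * Complex.I_sq
    simp only [map_mul, map_add, map_div₀, map_one, conj_ofReal, conj_I,
        map_natCast, map_ofNat] at e ⊢
    rw [e, ofReal_im, add_zero]
  rw [h5] at h3
  push_cast
  have h6 : (((1 - ‖η n‖ ^ 2) * tau X Y (n + 1) : ℝ) : ℂ) = _ := congrArg ofReal h3
  push_cast at h6
  linear_combination -h6

lemma tau_tendsto (H : IsSzPhase β η X Y) (hβ : β ≠ 0) {G : ℝ}
    (hG : ∀ n, |gam (drv η X) 1 n| ≤ G) : Tendsto (tau X Y) atTop (nhds 0) := by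
  have hD := H.isDrive
  obtain ⟨c, hc, hec⟩ := hD.norm_lt
  obtain ⟨D, hD0, hsq⟩ := hD.sum_sq_le
  have hc1 : 0 < 1 - c := by linarith
  have hb : 0 < 2 * |β| := by positivity
  have hG0 : 0 ≤ G := (abs_nonneg _).trans (hG 0)
  rw [Metric.tendsto_atTop]
  intro ε hε
  set B : ℝ := 2 * G + D / (1 - c) with hB
  have hB0 : 0 ≤ B := by positivity
  set L : ℝ := (B + 1) * 4 / (2 * |β| * ε) + 1 with hL
  have hL0 : 0 < L := by positivity
  set δ : ℝ := ε / (4 * (L + 2)) with hδ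
  have hδ0 : 0 < δ := by positivity
  set ε' : ℝ := 2 * |β| * ε / (8 * (L + 2)) with hε'
  have hε'0 : 0 < ε' := by positivity
  obtain ⟨n₁, h1⟩ := H.nullSum_tau_diff 1 δ hδ0
  obtain ⟨n₂, h2⟩ := H.null.im 1 ε' hε'0
  refine ⟨max n₁ n₂, fun n hn => ?_⟩
  obtain ⟨N, hnN, hN1, hN2⟩ := exists_harm n hL0
  set h := harm n N with hh
  have s1 : ∀ a b, IsSlow 1 a b (fun _ => 1) := fun a b => by simpa using isSlow_const 1 a b
  have d1 : ∀ i ∈ Finset.Ico n N, |tau X Y n - tau X Y i| ≤ ε / 4 := by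
    intro i hi
    rw [Finset.mem_Ico] at hi
    have a1 := h1 n ((le_max_left _ _).trans hn) i hi.1 _ (s1 _ _)
    simp only [mul_one] at a1
    rw [← ofReal_sum, norm_real, norm_eq_abs, sum_Ico_sub _ hi.1] at a1
    rw [abs_sub_comm]
    have a2 : harm n i ≤ h := by
      rw [hh, ← harm_add hi.1 hi.2.le]; linarith [harm_nonneg i N]
    refine a1.trans ?_
    have a3 : δ * (1 + harm n i) ≤ δ * (L + 2) := mul_le_mul_of_nonneg_left (by linarith) hδ0.le
    refine a3.trans (le_of_eq ?_)
    rw [hδ]; field_simp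
  have d2 := h2 n ((le_max_right _ _).trans hn) N hnN _ (s1 _ _)
  simp only [mul_one] at d2
  rw [← ofReal_sum, norm_real, norm_eq_abs] at d2
  have d3 : |∑ i ∈ Finset.Ico n N, (arg (1 - conj (drv η X i)) - (drv η X i).im)| ≤
      D / (1 - c) := by
    refine (abs_sum_le_sum_abs _ _).trans ?_
    have a1 : ∀ i ∈ Finset.Ico n N, |arg (1 - conj (drv η X i)) - (drv η X i).im| ≤
        ‖drv η X i‖ ^ 2 / (1 - c) := by
      intro i _
      have := abs_arg_add_im_le hc (x := conj (drv η X i)) (by rw [RCLike.norm_conj]; exact hec i)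
      rwa [RCLike.norm_conj, conj_im, ← sub_eq_add_neg] at this
    refine (sum_le_sum a1).trans ?_
    rw [← sum_div]
    refine div_le_div_of_nonneg_right ((hsq n N hnN).trans ?_) hc1.le
    exact div_le_self hD0 (by linarith [Nat.cast_nonneg (α := ℝ) n])
  have d4 : |∑ i ∈ Finset.Ico n N, arg (1 - conj (drv η X i))| ≤ 2 * G := by
    have e : ∑ i ∈ Finset.Ico n N, arg (1 - conj (drv η X i)) =
        gam (drv η X) 1 N - gam (drv η X) 1 n := by
      rw [gam, gam, ← sum_Ico_eq_sub _ hnN]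
      refine sum_congr rfl fun i _ => ?_
      rw [schurB_one hD.lt_one]; simp
    rw [e]
    have a1 := abs_le.mp (hG n)
    have a2 := abs_le.mp (hG N)
    rw [abs_le]
    constructor <;> linarith
  have d5 : ∀ i, (η i * conj (phase X i) +
      (β : ℂ) / ((i : ℂ) + 1) * (1 + 2 * (tau X Y i : ℂ) * I)).im =
      (drv η X i).im + 2 * β * (tau X Y i * (1 / ((i : ℝ) + 1))) := by
    intro i
    have e : (β : ℂ) / ((i : ℂ) + 1) * (1 + 2 * (tau X Y i : ℂ) * I) =
      ((β / ((i : ℝ) + 1) : ℝ) : ℂ) + ((2 * β * (tau X Y i * (1 / ((i : ℝ) + 1))) : ℝ) : ℂ) *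
        I := by
      push_cast; ring
    rw [e, drv]
    simp only [add_im, ofReal_im, im_ofReal_mul, Complex.I_im, mul_one,
      zero_add]
  simp only [d5] at d2
  rw [sum_add_distrib, ← mul_sum] at d2
  have d6 : |∑ i ∈ Finset.Ico n N, (tau X Y n - tau X Y i) * (1 / ((i : ℝ) + 1))| ≤ ε / 4 * h := by
    refine (abs_sum_le_sum_abs _ _).trans ?_
    rw [hh, harm, mul_sum]
    refine sum_le_sum fun i hi => ?_
    rw [abs_mul, abs_of_nonneg (show (0 : ℝ) ≤ 1 / ((i : ℝ) + 1) by positivity)]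
    exact mul_le_mul_of_nonneg_right (d1 i hi) (by positivity)
  simp only [sub_mul] at d6
  rw [sum_sub_distrib, ← mul_sum] at d6
  change |tau X Y n * h - _| ≤ _ at d6
  rw [sum_sub_distrib] at d3
  set S := ∑ i ∈ Finset.Ico n N, tau X Y i * (1 / ((i : ℝ) + 1))
  set P := ∑ i ∈ Finset.Ico n N, (drv η X i).im
  set Q := ∑ i ∈ Finset.Ico n N, arg (1 - conj (drv η X i))
  have f1 : 2 * |β| * |S| ≤ B + ε' * (1 + h) := by
    have : |2 * β * S| ≤ B + ε' * (1 + h) := by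
      rw [abs_le] at *
      constructor <;> linarith [d2.1, d2.2, d3.1, d3.2, d4.1, d4.2]
    rwa [abs_mul, abs_mul, abs_two] at this
  have hh0 : 0 < h := by linarith
  have f2 : |tau X Y n| * h ≤ |S| + ε / 4 * h := by
    have := abs_sub_abs_le_abs_sub (tau X Y n * h) S
    rw [abs_mul, abs_of_pos hh0] at this
    linarith
  have f3 : ε' * (1 + h) ≤ 2 * |β| * ε / 8 := by
    have : ε' * (1 + h) ≤ ε' * (L + 2) := mul_le_mul_of_nonneg_left (by linarith) hε'0.le
    refine this.trans (le_of_eq ?_)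
    rw [hε']; field_simp
  have f4 : B + 1 ≤ 2 * |β| * ε / 4 * h := by
    have : (B + 1) * 4 / (2 * |β| * ε) ≤ h := by linarith
    rw [div_le_iff₀ (by positivity)] at this
    linarith
  have f5 : 1 ≤ h := by
    have : 0 ≤ (B + 1) * 4 / (2 * |β| * ε) := by positivity
    linarith
  have f6 : 2 * |β| * |S| ≤ 2 * |β| * (3 * ε / 8 * h) := by
    have hbe : 0 < 2 * |β| * ε := by positivity
    nlinarith
  have f7 := le_of_mul_le_mul_left f6 hb
  rw [Real.dist_eq, sub_zero]
  have f8 : |tau X Y n| * h ≤ (5 * ε / 8) * h := by linarith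
  linarith [le_of_mul_le_mul_right f8 hh0]

lemma nullSum_drv (H : IsSzPhase β η X Y) (hτ : Tendsto (tau X Y) atTop (nhds 0)) :
    NullSum (fun n : ℕ => drv η X n + (β : ℂ) / ((n : ℂ) + 1)) := by
  have n1 : NullSum (fun n : ℕ => -((β : ℂ) / ((n : ℂ) + 1) * (2 * (tau X Y n : ℂ) * I))) := by
    refine nullSum_of_tendsto ?_
    have := (hτ.abs).const_mul (2 * |β|)
    rw [abs_zero, mul_zero] at this
    refine this.congr fun n => ?_
    rw [norm_neg, norm_mul, norm_div, norm_mul, norm_mul, norm_natCast_add_one, norm_I, norm_real,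
      norm_real]
    simp only [norm_eq_abs, norm_ofNat, mul_one]
    field_simp
  refine (congrArg NullSum (funext fun n => ?_)).mp (H.null.add n1)
  rw [drv]
  ring

end IsSzPhase

lemma IsSlow.re {A : ℝ} {n N : ℕ} {s : ℕ → ℂ} (hs : IsSlow A n N s) :
    IsSlow A n N (fun i => ((s i).re : ℂ)) := by
  have h : ∀ z : ℂ, ‖(z.re : ℂ)‖ ≤ ‖z‖ := fun z => by
    rw [norm_real]; exact abs_re_le_norm z
  refine ⟨fun i h1 h2 => (h _).trans (hs.1 i h1 h2), fun i h1 h2 => ?_⟩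
  rw [← ofReal_sub, ← sub_re]
  exact (h _).trans (hs.2 i h1 h2)

section Schur

variable {e : ℕ → ℂ} {r : ℝ}

lemma norm_one_sub_schurU_le (he : ∀ n, ‖e n‖ < 1) (h0 : 0 ≤ r) (h1 : r ≤ 1) (n : ℕ) :
    ‖1 - schurU e r n‖ ≤ r := by
  rw [schurU, sub_sub_cancel]; exact norm_mul_schurB_le he h0 h1 n

lemma norm_schurU_le_two (he : ∀ n, ‖e n‖ < 1) (h0 : 0 ≤ r) (h1 : r ≤ 1) (n : ℕ) :
    ‖schurU e r n‖ ≤ 2 := by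
  have := norm_sub_le (1 : ℂ) (1 - schurU e r n)
  rw [sub_sub_cancel, norm_one] at this
  linarith [norm_one_sub_schurU_le he h0 h1 n]

lemma abs_one_sub_re_le (he : ∀ n, ‖e n‖ < 1) (h0 : 0 ≤ r) (h1 : r ≤ 1) (n : ℕ) :
    |1 - (schurU e r n).re| ≤ 1 := by
  have := (abs_re_le_norm _).trans ((norm_one_sub_schurU_le he h0 h1 n).trans h1)
  simpa using this

/-- First-order error of the Schur recursion for the defect. -/
noncomputable def schurErr (e : ℕ → ℂ) (r : ℝ) (n : ℕ) : ℂ := schurU e r (n + 1) -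
  ((1 - r) + r * schurU e r n * (1 + 2 * ((e n).re : ℂ) - conj (e n) * schurU e r n))

lemma norm_schurErr_le {c : ℝ} (hc : c < 1) (he : ∀ n, ‖e n‖ ≤ c) (h0 : 0 ≤ r) (h1 : r ≤ 1)
    (n : ℕ) : ‖schurErr e r n‖ ≤ 44 / (1 - c) ^ 2 * ‖e n‖ ^ 2 := by
  have he' : ∀ n, ‖e n‖ < 1 := fun n => (he n).trans_lt hc
  have hc1 : 0 < 1 - c := by linarith
  have hU := norm_schurU_le_two he' h0 h1 n
  have hU1 := (norm_one_sub_schurU_le he' h0 h1 n).trans h1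
  have hw := (norm_conj_mul_schurB_le he' h0 h1 n).trans (he n)
  have ha1 : 1 - c ≤ ‖1 - e n‖ := by
    have := norm_sub_norm_le (1 : ℂ) (e n)
    rw [norm_one] at this; linarith [he n]
  have ha2 : 1 - c ≤ ‖1 - conj (e n) * (r * schurB e r n)‖ := by
    have := norm_sub_norm_le (1 : ℂ) (conj (e n) * (r * schurB e r n))
    rw [norm_one] at this; linarith
  have hE := he' n
  have a2 : (1 - e n) * (1 - conj (e n) * (r * schurB e r n)) ≠ 0 :=
    mul_ne_zero (norm_pos_iff.mp (by linarith)) (norm_pos_iff.mp (by linarith))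
  have a3 : (‖e n‖ : ℂ) ^ 2 = e n * conj (e n) := by rw [mul_conj']
  have a4 : (2 * ((e n).re : ℂ)) = e n + conj (e n) := by rw [add_conj]; push_cast; ring
  have hP : (1 - c) ^ 2 ≤ ‖(1 - e n) * (1 - conj (e n) * (r * schurB e r n))‖ := by
    rw [norm_mul, sq]
    exact mul_le_mul ha1 ha2 hc1.le (norm_nonneg _)
  have hPU : (1 - e n) * (1 - conj (e n) * (r * schurB e r n)) =
      (1 - e n) * (1 - conj (e n) + conj (e n) * schurU e r n) := by rw [schurU_den]
  rw [schurErr, schurU_succ he' h0 h1, a3, a4]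
  rw [hPU] at a2 hP ⊢
  generalize schurU e r n = U at *
  set x := e n
  set P := (1 - x) * (1 - conj x + conj x * U) with hPd
  have key : (1 - (r : ℂ)) + r * (U * (1 - x * conj x)) / P -
      ((1 - r) + r * U * (1 + (x + conj x) - conj x * U)) =
      r * U * ((x + conj x - conj x * U) ^ 2 - x * conj x -
        (1 + (x + conj x - conj x * U)) * (x * conj x) * (1 - U)) / P := by
    rw [eq_div_iff a2, sub_mul, add_mul, div_mul_cancel₀ _ a2, hPd]
    ring
  rw [key, norm_div, div_mul_eq_mul_div, norm_mul, norm_mul, norm_real,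
    norm_of_nonneg h0]
  have hx0 := norm_nonneg x
  have b1 : ‖x + conj x - conj x * U‖ ≤ 4 * ‖x‖ := by
    refine (norm_sub_le _ _).trans ?_
    have := norm_add_le x (conj x)
    rw [norm_mul, RCLike.norm_conj] at *
    nlinarith
  have b2 : ‖x * conj x‖ = ‖x‖ ^ 2 := by rw [norm_mul, RCLike.norm_conj, sq]
  have b3 : ‖(x + conj x - conj x * U) ^ 2 - x * conj x -
        (1 + (x + conj x - conj x * U)) * (x * conj x) * (1 - U)‖ ≤ 22 * ‖x‖ ^ 2 := by
    refine (norm_sub_le _ _).trans ?_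
    have c1 := norm_sub_le ((x + conj x - conj x * U) ^ 2) (x * conj x)
    rw [norm_pow, b2] at c1
    have c2 := pow_le_pow_left₀ (norm_nonneg _) b1 2
    have c3 := norm_add_le (1 : ℂ) (x + conj x - conj x * U)
    rw [norm_one] at c3
    have c4 : ‖(1 + (x + conj x - conj x * U)) * (x * conj x) * (1 - U)‖ ≤ 5 * ‖x‖ ^ 2 * 1 := by
      rw [norm_mul, norm_mul, b2]
      gcongr
      linarith
    nlinarith
  have b4 : r * ‖U‖ ≤ 2 := by nlinarith [norm_nonneg U]
  refine div_le_div₀ (by positivity) ?_ (by positivity) hP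
  have b5 := mul_le_mul b4 b3 (norm_nonneg _) (by norm_num)
  linarith

lemma norm_schurU_succ_sub_le {c : ℝ} (hc : c < 1) (he : ∀ n, ‖e n‖ ≤ c) (h0 : 0 ≤ r)
    (h1 : r ≤ 1) (n : ℕ) : ‖schurU e r (n + 1) - schurU e r n‖ ≤
      (44 / (1 - c) ^ 2 + 8) * ‖e n‖ + (1 - r) := by
  have he' : ∀ n, ‖e n‖ < 1 := fun n => (he n).trans_lt hc
  have h2 := norm_schurErr_le hc he h0 h1 n
  have hU := norm_schurU_le_two he' h0 h1 n
  have hU1 := (norm_one_sub_schurU_le he' h0 h1 n).trans h1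
  have e1 : schurU e r (n + 1) - schurU e r n = schurErr e r n +
      (((1 - r : ℝ) : ℂ) * (1 - schurU e r n) +
        r * schurU e r n * (2 * ((e n).re : ℂ) - conj (e n) * schurU e r n)) := by
    rw [schurErr]; push_cast; ring
  rw [e1]
  have a1 : ‖((1 - r : ℝ) : ℂ) * (1 - schurU e r n)‖ ≤ 1 - r := by
    rw [norm_mul, Complex.norm_of_nonneg (by linarith)]
    exact mul_le_of_le_one_right (by linarith) hU1
  have a2 : ‖2 * ((e n).re : ℂ) - conj (e n) * schurU e r n‖ ≤ 4 * ‖e n‖ := by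
    refine (norm_sub_le _ _).trans ?_
    rw [norm_mul, norm_mul, RCLike.norm_conj, norm_real, norm_ofNat]
    have := abs_re_le_norm (e n)
    rw [norm_eq_abs]
    nlinarith [norm_nonneg (e n)]
  have a3 : ‖r * schurU e r n * (2 * ((e n).re : ℂ) - conj (e n) * schurU e r n)‖ ≤
      8 * ‖e n‖ := by
    rw [norm_mul, norm_mul, Complex.norm_of_nonneg h0]
    have b4 : r * ‖schurU e r n‖ ≤ 2 := by nlinarith [norm_nonneg (schurU e r n)]
    have := mul_le_mul b4 a2 (norm_nonneg _) (by norm_num)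
    linarith
  have a4 : 44 / (1 - c) ^ 2 * ‖e n‖ ^ 2 ≤ 44 / (1 - c) ^ 2 * ‖e n‖ := by
    refine mul_le_mul_of_nonneg_left ?_ (by positivity)
    nlinarith [norm_nonneg (e n), he' n]
  have := norm_add_le (schurErr e r n) (((1 - r : ℝ) : ℂ) * (1 - schurU e r n) +
        r * schurU e r n * (2 * ((e n).re : ℂ) - conj (e n) * schurU e r n))
  have := norm_add_le (((1 - r : ℝ) : ℂ) * (1 - schurU e r n))
        (r * schurU e r n * (2 * ((e n).re : ℂ) - conj (e n) * schurU e r n))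
  linarith

lemma im_schurU_succ (n : ℕ) : (schurU e r (n + 1)).im =
    r * (1 + 2 * (e n).re * (1 - (schurU e r n).re)) * (schurU e r n).im +
      r * ((e n).im * (schurU e r n * schurU e r n).re) + (schurErr e r n).im := by
  have : schurU e r (n + 1) = schurErr e r n + ((1 - r : ℝ) : ℂ) +
      r * (schurU e r n * (1 + 2 * ((e n).re : ℂ) - conj (e n) * schurU e r n)) := by
    rw [schurErr]; push_cast; ring
  rw [this]
  simp only [add_im, ofReal_im, mul_im,
    mul_re, sub_im, sub_re, add_re, one_re, one_im,
    ofReal_re, conj_re, conj_im, re_ofNat, im_ofNat]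
  ring

end Schur

namespace IsDrive

variable {β : ℝ} {e : ℕ → ℂ}

lemma exists_isSlow_schurU (H : IsDrive β e) {M : ℝ} (hM : 0 ≤ M) : ∃ K : ℝ, 2 ≤ K ∧
    ∀ r : ℝ, 0 ≤ r → r ≤ 1 → ∀ N : ℕ, N * (1 - r) ≤ M → ∀ m, IsSlow K m N (schurU e r) := by
  obtain ⟨c, hc, hec⟩ := H.norm_lt
  obtain ⟨E, hE, heE⟩ := H.norm_le
  have hc1 : 0 < 1 - c := by linarith
  refine ⟨2 + ((44 / (1 - c) ^ 2 + 8) * E + M), by linarith [show 0 ≤ (44 / (1 - c) ^ 2 + 8) * E by positivity],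
    fun r h0 h1 N hN m => ⟨fun i _ _ => ?_, fun i _ hi => ?_⟩⟩
  · refine (norm_schurU_le_two H.lt_one h0 h1 i).trans ?_
    linarith [show 0 ≤ (44 / (1 - c) ^ 2 + 8) * E by positivity]
  · refine (norm_schurU_succ_sub_le hc hec h0 h1 i).trans ?_
    have a1 := mul_le_mul_of_nonneg_left (heE i) (show 0 ≤ 44 / (1 - c) ^ 2 + 8 by positivity)
    have hi' : (i : ℝ) + 1 ≤ N := by exact_mod_cast hi
    have a2 : 1 - r ≤ M / (i + 1) := by
      rw [le_div_iff₀ (by positivity)]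
      nlinarith
    rw [add_div, add_div, mul_div_assoc]
    have : (0 : ℝ) ≤ 2 / (i + 1) := by positivity
    linarith

end IsDrive

namespace IsDrive

variable {β : ℝ} {e : ℕ → ℂ}

lemma NullSum.abs_real_le {f : ℕ → ℝ} (hf : NullSum (fun i => (f i : ℂ))) (A : ℝ) {ε : ℝ}
    (hε : 0 < ε) : ∃ n₀ : ℕ, ∀ n ≥ n₀, ∀ N ≥ n, ∀ s : ℕ → ℂ, IsSlow A n N s →
      |∑ i ∈ Finset.Ico n N, f i * (s i).re| ≤ ε * (1 + harm n N) := by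
  obtain ⟨n₀, h⟩ := hf A ε hε
  refine ⟨n₀, fun n hn N hN s hs => ?_⟩
  have := h n hn N hN _ hs.re
  simp only [← ofReal_mul] at this
  rwa [← ofReal_sum, norm_real] at this

set_option maxHeartbeats 1000000 in
lemma abs_im_schurU_le (H : IsDrive β e) (hi : NullSum (fun n => ((e n).im : ℂ))) {M h η : ℝ}
    (hM : 0 ≤ M) (hh : 0 ≤ h) (hη : 0 < η) : ∃ m₀ : ℕ, ∀ r : ℝ, 0 ≤ r → r ≤ 1 →
    ∀ m N : ℕ, m₀ ≤ m → N * (1 - r) ≤ M → harm m N ≤ h → ∀ j, m ≤ j → j ≤ N →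
      |(schurU e r j).im| ≤ rexp (1 + ∑ i ∈ Finset.Ico m j,
        (-2 * β) * (1 - (schurU e r i).re) * (1 / ((i : ℝ) + 1))) * |(schurU e r m).im| + η := by
  obtain ⟨c, hc, hec⟩ := H.norm_lt
  obtain ⟨E, hE, heE⟩ := H.norm_le
  obtain ⟨K, hK, hslow⟩ := H.exists_isSlow_schurU hM
  have hc1 : 0 < 1 - c := by linarith
  set K₁ : ℝ := 44 / (1 - c) ^ 2 with hK₁
  have hK₁0 : 0 ≤ K₁ := by positivity
  set P : ℝ := rexp (2 * |β| * h + 1) with hP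
  have hP1 : 1 ≤ P := one_le_exp (by positivity)
  have hP0 : 0 < P := by linarith
  set ε : ℝ := η / (2 * (1 + h) * (P * P * (M + 2 * E) * h + 1)) with hε
  have hε0 : 0 < ε := by positivity
  obtain ⟨n₁, h1⟩ := NullSum.abs_real_le H.null_re (2 + 2 * K) (ε := 1 / (1 + h)) (by positivity)
  obtain ⟨n₂, h2⟩ := NullSum.abs_real_le hi (2 * K * K) hε0
  obtain ⟨n₃, h3⟩ := exists_nat_ge (max (2 * E) (4 * P * P * K₁ * E ^ 2 / η))
  refine ⟨max n₁ (max n₂ n₃), fun r h0 hr1 m N hm hN hmN j hj hjN => ?_⟩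
  have hmn1 : n₁ ≤ m := (le_max_left _ _).trans hm
  have hmn2 : n₂ ≤ m := ((le_max_left _ _).trans (le_max_right _ _)).trans hm
  have hmn3 : max (2 * E) (4 * P * P * K₁ * E ^ 2 / η) ≤ (m : ℝ) := h3.trans (by
    exact_mod_cast ((le_max_right _ _).trans (le_max_right _ _)).trans hm)
  have he := H.lt_one
  have hrr : 0 ≤ 1 - r := by linarith
  have hU := hslow r h0 hr1 N hN m
  have hE1 : ∀ i, m ≤ i → ‖e i‖ ≤ 1 / 2 := by
    intro i hi
    refine (heE i).trans ?_
    rw [div_le_iff₀ (by positivity)]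
    have := (le_max_left _ _).trans hmn3
    have : (m : ℝ) ≤ i := by exact_mod_cast hi
    linarith
  have hharm : ∀ j, m ≤ j → j ≤ N → harm m j ≤ h := fun j h1 h2 => by
    have := harm_add h1 h2
    linarith [harm_nonneg j N]
  set F : ℕ → ℝ := fun j => ∑ i ∈ Finset.Ico m j,
    2 * ((e i).re + β / ((i : ℝ) + 1)) * (1 - (schurU e r i).re) with hF
  set S : ℕ → ℝ := fun j => ∑ i ∈ Finset.Ico m j,
    (-2 * β) * (1 - (schurU e r i).re) * (1 / ((i : ℝ) + 1)) with hS
  set G : ℕ → ℝ := fun j => ∑ i ∈ Finset.Ico m j,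
    (e i).im * (schurU e r i * schurU e r i).re with hG
  have hF1 : ∀ j, m ≤ j → j ≤ N → |F j| ≤ 1 := by
    intro j hmj hjN
    have hs : IsSlow (2 + 2 * K) m j (fun i => 2 + (-2) * schurU e r i) := by
      have a1 := (isSlow_const 2 m j)
      have a2 : IsSlow (2 * K) m j (fun i => (-2) * schurU e r i) := by
        have b := hU.mono (le_refl m) hjN
        refine ⟨fun i c1 c2 => ?_, fun i c1 c2 => ?_⟩
        · rw [norm_mul, norm_neg, norm_ofNat]
          linarith [b.1 i c1 c2]
        · rw [← mul_sub, norm_mul, norm_neg, norm_ofNat, mul_div_assoc]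
          linarith [b.2 i c1 c2]
      simpa using a1.add a2
    have a1 := h1 m hmn1 j hmj _ hs
    have a2 : F j = ∑ i ∈ Finset.Ico m j,
        ((e i).re + β / ((i : ℝ) + 1)) * (2 + (-2) * schurU e r i).re := by
      refine sum_congr rfl fun i _ => ?_
      simp
      ring
    rw [a2]
    refine a1.trans ?_
    rw [one_div_mul_eq_div, div_le_one (by positivity)]
    linarith [hharm j hmj hjN]
  have hG1 : ∀ j, m ≤ j → j ≤ N → |G j| ≤ ε * (1 + h) := by
    intro j hmj hjN
    refine (h2 m hmn2 j hmj _ ((hU.mul hU).mono (le_refl m) hjN)).trans ?_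
    exact mul_le_mul_of_nonneg_left (by linarith [hharm j hmj hjN]) hε0.le
  have hS1 : ∀ j, m ≤ j → j ≤ N → |S j| ≤ 2 * |β| * h := by
    intro j hmj hjN
    refine (abs_sum_le_sum_abs _ _).trans ?_
    have : ∀ i ∈ Finset.Ico m j, |(-2 * β) * (1 - (schurU e r i).re) * (1 / ((i : ℝ) + 1))| ≤
        2 * |β| * (1 / ((i : ℝ) + 1)) := by
      intro i _
      rw [abs_mul, abs_mul, abs_mul, abs_neg, abs_two,
        abs_of_nonneg (show (0 : ℝ) ≤ 1 / ((i : ℝ) + 1) by positivity)]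
      refine mul_le_mul_of_nonneg_right ?_ (by positivity)
      exact mul_le_of_le_one_right (by positivity) (abs_one_sub_re_le he h0 hr1 i)
    refine (sum_le_sum this).trans ?_
    rw [← mul_sum]
    exact mul_le_mul_of_nonneg_left (hharm j hmj hjN) (by positivity)
  set err : ℕ → ℝ := fun i => (M + 2 * E) * (ε * (1 + h)) * (1 / ((i : ℝ) + 1)) +
    K₁ * E ^ 2 * (1 / ((i : ℝ) + 1) ^ 2) with herr
  have herr0 : ∀ i, 0 ≤ err i := fun i => by positivity
  have main : ∀ j, m ≤ j → j ≤ N → |(schurU e r j).im - r * G j| ≤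
      rexp (S j + F j) * (|(schurU e r m).im| + ∑ i ∈ Finset.Ico m j, P * err i) := by
    intro j hmj
    induction j, hmj using Nat.le_induction with
    | base => intro _; simp [S, F, G]
    | succ j hmj ih =>
      intro hjN
      have ih' := ih (by omega)
      set J := (schurU e r j).im
      set u := (schurU e r j).re
      set y : ℝ := 2 * (e j).re * (1 - u) with hy
      have hj1 : (j : ℝ) + 1 ≤ N := by exact_mod_cast hjN
      have hy1 : |y| ≤ 2 * ‖e j‖ := by
        rw [hy, abs_mul, abs_mul, abs_two]
        refine mul_le_of_le_one_right (by positivity) (abs_one_sub_re_le he h0 hr1 j) |>.trans ?_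
        linarith [abs_re_le_norm (e j)]
      have hy2 : -1 ≤ y := by
        have := (abs_le.mp hy1).1
        linarith [hE1 j hmj]
      have hGs : G (j + 1) = G j + (e j).im * (schurU e r j * schurU e r j).re :=
        sum_Ico_succ_top hmj _
      have hSs : S (j + 1) + F (j + 1) = S j + F j + y := by
        simp only [hS, hF]
        rw [sum_Ico_succ_top hmj, sum_Ico_succ_top hmj, hy]
        change _ + -2 * β * (1 - u) * (1 / ((j : ℝ) + 1)) +
          (_ + 2 * ((e j).re + β / ((j : ℝ) + 1)) * (1 - u)) = _
        ring
      have e1 : (schurU e r (j + 1)).im - r * G (j + 1) = r * (1 + y) * (J - r * G j) +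
          ((r * (1 + y) - 1) * (r * G j) + (schurErr e r j).im) := by
        rw [im_schurU_succ, hGs]
        change r * (1 + 2 * (e j).re * (1 - u)) * J + _ + _ - _ = _
        rw [hy]
        ring
      have b1 : |r * (1 + y) * (J - r * G j)| ≤ rexp y * |J - r * G j| := by
        rw [abs_mul, abs_of_nonneg (mul_nonneg h0 (by linarith))]
        refine mul_le_mul_of_nonneg_right ?_ (abs_nonneg _)
        have := add_one_le_exp y
        nlinarith
      have hej := heE j
      have b2 : |r * (1 + y) - 1| ≤ (M + 2 * E) * (1 / ((j : ℝ) + 1)) := by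
        have c1 : r * (1 + y) - 1 = -(1 - r) + r * y := by ring
        have c2 : |r * y| ≤ 2 * ‖e j‖ := by
          rw [abs_mul, abs_of_nonneg h0]
          exact (mul_le_of_le_one_left (abs_nonneg _) hr1).trans hy1
        have c3 : 1 - r ≤ M / (j + 1) := by
          rw [le_div_iff₀ (by positivity)]
          nlinarith
        rw [c1, mul_one_div, add_div, mul_div_assoc]
        refine (abs_add_le _ _).trans ?_
        rw [abs_neg, abs_of_nonneg hrr]
        linarith
      have b3 : |r * G j| ≤ ε * (1 + h) := by
        rw [abs_mul, abs_of_nonneg h0]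
        exact (mul_le_of_le_one_left (abs_nonneg _) hr1).trans (hG1 j hmj (by omega))
      have b4 : |(schurErr e r j).im| ≤ K₁ * E ^ 2 * (1 / ((j : ℝ) + 1) ^ 2) := by
        refine (abs_im_le_norm _).trans ((norm_schurErr_le hc hec h0 hr1 j).trans ?_)
        rw [mul_assoc, mul_one_div, ← div_pow]
        exact mul_le_mul_of_nonneg_left (pow_le_pow_left₀ (norm_nonneg _) hej 2) hK₁0
      have b5 : |(r * (1 + y) - 1) * (r * G j) + (schurErr e r j).im| ≤ err j := by
        refine (abs_add_le _ _).trans ?_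
        rw [abs_mul]
        have := mul_le_mul b2 b3 (abs_nonneg _) (by positivity)
        simp only [herr]
        linarith
      have b6 : 1 ≤ rexp (S (j + 1) + F (j + 1)) * P := by
        rw [hP, ← Real.exp_add]
        refine one_le_exp ?_
        have := (abs_le.mp (hS1 (j + 1) (by omega) hjN)).1
        have := (abs_le.mp (hF1 (j + 1) (by omega) hjN)).1
        linarith
      rw [e1, sum_Ico_succ_top hmj]
      refine (abs_add_le _ _).trans ?_
      have b7 := mul_le_mul_of_nonneg_left ih' (exp_pos y).le
      have b8 : rexp (S (j + 1) + F (j + 1)) = rexp y * rexp (S j + F j) := by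
        rw [hSs, Real.exp_add, mul_comm]
      have b9 := mul_le_mul_of_nonneg_right b6 (herr0 j)
      rw [one_mul] at b9
      have b10 : rexp (S (j + 1) + F (j + 1)) *
          (|(schurU e r m).im| + (∑ i ∈ Finset.Ico m j, P * err i + P * err j)) =
          rexp y * (rexp (S j + F j) * (|(schurU e r m).im| + ∑ i ∈ Finset.Ico m j, P * err i)) +
          rexp (S (j + 1) + F (j + 1)) * P * err j := by
        rw [b8]; ring
      rw [b10]
      linarith
  have hfin := main j hj hjN
  have hF' := abs_le.mp (hF1 j hj hjN)
  have hS' := abs_le.mp (hS1 j hj hjN)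
  have c1 : rexp (S j + F j) ≤ rexp (1 + S j) := Real.exp_le_exp.mpr (by linarith)
  have c2 : rexp (S j + F j) ≤ P := Real.exp_le_exp.mpr (by linarith)
  have c3 : ∑ i ∈ Finset.Ico m j, P * err i ≤ P * ((M + 2 * E) * (ε * (1 + h)) * h +
      K₁ * E ^ 2 * (2 / ((m : ℝ) + 1))) := by
    rw [← mul_sum]
    refine mul_le_mul_of_nonneg_left ?_ hP0.le
    simp only [herr]
    rw [sum_add_distrib, ← mul_sum, ← mul_sum]
    exact add_le_add (mul_le_mul_of_nonneg_left (hharm j hj hjN) (by positivity))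
      (mul_le_mul_of_nonneg_left (sum_inv_sq_le m j hj) (by positivity))
  have c3' : 0 ≤ ∑ i ∈ Finset.Ico m j, P * err i :=
    sum_nonneg fun i _ => mul_nonneg hP0.le (herr0 i)
  have c4 : rexp (S j + F j) * (|(schurU e r m).im| + ∑ i ∈ Finset.Ico m j, P * err i) ≤
      rexp (1 + S j) * |(schurU e r m).im| + P * (P * ((M + 2 * E) * (ε * (1 + h)) * h +
      K₁ * E ^ 2 * (2 / ((m : ℝ) + 1)))) := by
    rw [mul_add]
    refine add_le_add (mul_le_mul_of_nonneg_right c1 (abs_nonneg _)) ?_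
    exact mul_le_mul c2 c3 c3' hP0.le
  have c5 : |r * G j| ≤ ε * (1 + h) := by
    rw [abs_mul, abs_of_nonneg h0]
    exact (mul_le_of_le_one_left (abs_nonneg _) hr1).trans (hG1 j hj hjN)
  have c6 : P * P * (K₁ * E ^ 2 * (2 / ((m : ℝ) + 1))) ≤ η / 2 := by
    have := (le_max_right _ _).trans hmn3
    rw [div_le_iff₀ hη] at this
    have e : P * P * (K₁ * E ^ 2 * (2 / ((m : ℝ) + 1))) =
      (2 * P * P * K₁ * E ^ 2) / (m + 1) := by ring
    rw [e, div_le_iff₀ (by positivity)]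
    nlinarith
  have c7 : (P * P * (M + 2 * E) * h + 1) * (ε * (1 + h)) = η / 2 := by
    rw [hε]; field_simp
  have c8 := abs_sub_abs_le_abs_sub (schurU e r j).im (r * G j)
  have c9 : P * (P * ((M + 2 * E) * (ε * (1 + h)) * h + K₁ * E ^ 2 * (2 / ((m : ℝ) + 1)))) =
      (P * P * (M + 2 * E) * h + 1) * (ε * (1 + h)) - ε * (1 + h) +
        P * P * (K₁ * E ^ 2 * (2 / ((m : ℝ) + 1))) := by ring
  rw [c9, c7] at c4
  linarith

lemma abs_gam_window_le (H : IsDrive β e) (hi : NullSum (fun n => ((e n).im : ℂ))) : ∃ C : ℝ,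
    0 ≤ C ∧ ∀ M h η : ℝ, 0 ≤ M → 0 ≤ h → 0 < η → ∃ m₀ : ℕ, ∀ r : ℝ, 0 ≤ r → r ≤ 1 →
    ∀ m N : ℕ, m₀ ≤ m → m ≤ N → N * (1 - r) ≤ M → harm m N ≤ h → ∀ J : ℝ,
    (∀ j, m ≤ j → j ≤ N → |(schurU e r j).im| ≤ J) →
      |gam e r N - gam e r m| ≤ C * h * J + η := by
  obtain ⟨c, hc, hec⟩ := H.norm_lt
  obtain ⟨E, hE, heE⟩ := H.norm_le
  obtain ⟨D, hD, hsq⟩ := H.sum_sq_le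
  have hc1 : 0 < 1 - c := by linarith
  refine ⟨E, hE, fun M h η hM hh hη => ?_⟩
  obtain ⟨K, hK, hslow⟩ := H.exists_isSlow_schurU hM
  obtain ⟨n₁, h1⟩ := NullSum.abs_real_le hi (1 + K) (ε := η / (2 * (1 + h))) (by positivity)
  obtain ⟨n₂, h2⟩ := exists_nat_ge (2 * D / (1 - c) / η)
  refine ⟨max n₁ n₂, fun r h0 hr1 m N hm hmN hN hmh J hJ => ?_⟩
  have hm2 : 2 * D / (1 - c) / η ≤ m := h2.trans (by exact_mod_cast (le_max_right _ _).trans hm)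
  have he := H.lt_one
  have hU := hslow r h0 hr1 N hN m
  have a1 : |∑ i ∈ Finset.Ico m N, (e i).im * (1 - (schurU e r i).re)| ≤ η / 2 := by
    have hs : IsSlow (1 + K) m N (fun i => 1 + (-1) * schurU e r i) := by
      have b2 : IsSlow K m N (fun i => (-1) * schurU e r i) := by
        refine ⟨fun i c1 c2 => ?_, fun i c1 c2 => ?_⟩
        · beta_reduce; rw [neg_one_mul, norm_neg]; exact hU.1 i c1 c2
        · beta_reduce; rw [← mul_sub, neg_one_mul, norm_neg]; exact hU.2 i c1 c2
      simpa using (isSlow_const 1 m N).add b2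
    have := h1 m ((le_max_left _ _).trans hm) N hmN _ hs
    simp only [neg_one_mul, ← sub_eq_add_neg, sub_re, one_re] at this
    refine this.trans ?_
    rw [div_mul_eq_mul_div, div_le_div_iff₀ (by positivity) (by norm_num)]
    nlinarith
  have a2 : |∑ i ∈ Finset.Ico m N, (e i).re * (schurU e r i).im| ≤ E * h * J := by
    have hJ0 : 0 ≤ J := (abs_nonneg _).trans (hJ m le_rfl hmN)
    refine (abs_sum_le_sum_abs _ _).trans ?_
    have : ∀ i ∈ Finset.Ico m N, |(e i).re * (schurU e r i).im| ≤ E * J * (1 / ((i : ℝ) + 1)) := by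
      intro i hi
      rw [Finset.mem_Ico] at hi
      rw [abs_mul]
      refine (mul_le_mul ((abs_re_le_norm _).trans (heE i)) (hJ i hi.1 hi.2.le)
        (abs_nonneg _) (by positivity)).trans (le_of_eq (by ring))
    refine (sum_le_sum this).trans ?_
    rw [← mul_sum]
    have : E * J * harm m N ≤ E * J * h := mul_le_mul_of_nonneg_left hmh (by positivity)
    refine this.trans (le_of_eq (by ring))
  have a3 : |∑ i ∈ Finset.Ico m N, (arg (1 - conj (e i) * (r * schurB e r i)) -
      ((e i).re * (schurU e r i).im + (e i).im * (1 - (schurU e r i).re)))| ≤ η / 2 := by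
    refine (abs_sum_le_sum_abs _ _).trans ?_
    have : ∀ i ∈ Finset.Ico m N, |arg (1 - conj (e i) * (r * schurB e r i)) -
      ((e i).re * (schurU e r i).im + (e i).im * (1 - (schurU e r i).re))| ≤
        ‖e i‖ ^ 2 / (1 - c) := by
      intro i _
      have b1 := norm_conj_mul_schurB_le he h0 hr1 i
      have b2 := abs_arg_add_im_le hc (b1.trans (hec i))
      have b3 : (conj (e i) * (r * schurB e r i)).im =
          -((e i).re * (schurU e r i).im + (e i).im * (1 - (schurU e r i).re)) := by
        have : (r : ℂ) * schurB e r i = 1 - schurU e r i := by rw [schurU]; ring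
        rw [this]
        simp only [mul_im, conj_re, conj_im, sub_im, sub_re,
          one_re, one_im]
        ring
      rw [b3, ← sub_eq_add_neg] at b2
      refine b2.trans (div_le_div_of_nonneg_right ?_ hc1.le)
      exact pow_le_pow_left₀ (norm_nonneg _) b1 2
    refine (sum_le_sum this).trans ?_
    rw [← sum_div]
    refine (div_le_div_of_nonneg_right (hsq m N hmN) hc1.le).trans ?_
    rw [div_le_iff₀ hη, div_le_iff₀ hc1] at hm2
    rw [div_div, div_le_div_iff₀ (by positivity) (by norm_num)]
    nlinarith [mul_pos hη hc1]
  have e1 : ∑ i ∈ Finset.Ico m N, arg (1 - conj (e i) * (r * schurB e r i)) =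
      gam e r N - gam e r m := by
    rw [gam, gam, ← sum_Ico_eq_sub _ hmN]
  rw [sum_sub_distrib, sum_add_distrib, e1] at a3
  rw [abs_le] at *
  constructor <;> linarith [a1.1, a1.2, a2.1, a2.2, a3.1, a3.2]

end IsDrive

lemma exists_log_mul_rpow_le {κ : ℝ} (h1 : κ < 1) {K : ℝ} (hK : 1 ≤ K) (B : ℝ)
    {ε : ℝ} (hε : 0 < ε) : ∀ᶠ q : ℕ in atTop,
      B * Real.log (K * q) * ((q : ℝ) ^ κ * (1 / q)) ≤ ε := by
  set s : ℝ := (1 - κ) / 2 with hs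
  have hs0 : 0 < s := by rw [hs]; linarith
  have hlim : Tendsto (fun q : ℕ => |B| * (K ^ s / s) * (q : ℝ) ^ (-s)) atTop (nhds 0) := by
    have := ((tendsto_rpow_neg_atTop hs0).comp tendsto_natCast_atTop_atTop).const_mul
      (|B| * (K ^ s / s))
    rwa [mul_zero] at this
  filter_upwards [hlim.eventually_le_const hε, eventually_gt_atTop 0] with q hq hq0
  have hq0' : (0 : ℝ) < q := by exact_mod_cast hq0
  have hq1 : (1 : ℝ) ≤ q := by exact_mod_cast hq0
  refine le_trans ?_ hq
  have e1 : (q : ℝ) ^ κ * (1 / q) = (q : ℝ) ^ (-s) * (q : ℝ) ^ (-s) := by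
    rw [← rpow_add hq0', one_div, ← Real.rpow_neg_one, ← rpow_add hq0']
    congr 1
    simp only [hs]; ring
  have h2 : Real.log (K * q) ≤ K ^ s / s * (q : ℝ) ^ s := by
    refine (Real.log_le_rpow_div (by positivity) hs0).trans (le_of_eq ?_)
    rw [Real.mul_rpow (by linarith) hq0'.le]; ring
  have h3 : 0 ≤ Real.log (K * q) := Real.log_nonneg (one_le_mul_of_one_le_of_one_le hK hq1)
  have h4 : B * Real.log (K * q) ≤ |B| * (K ^ s / s * (q : ℝ) ^ s) :=
    mul_le_mul (le_abs_self B) h2 h3 (abs_nonneg _)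
  have h5 : (q : ℝ) ^ s * (q : ℝ) ^ (-s) = 1 := by
    rw [← rpow_add hq0']; simp
  rw [e1]
  refine (mul_le_mul_of_nonneg_right h4 (by positivity)).trans (le_of_eq ?_)
  linear_combination |B| * (K ^ s / s) * (q : ℝ) ^ (-s) * h5

namespace IsDrive

variable {β : ℝ} {e : ℕ → ℂ}

set_option maxHeartbeats 800000 in
lemma tendsto_gam (H : IsDrive β e) (hβ : -(1 / 2) < β)
    (hi : NullSum (fun n => ((e n).im : ℂ))) {ℓ : ℝ → ℝ} {lam : ℝ} (hM : Match e ℓ lam) :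
    Tendsto (gam e 1) atTop (nhds (-lam)) := by
  obtain ⟨A, c₀, hA, hc₀, hU⟩ := H.norm_schurU_le hβ
  obtain ⟨A', c₀', hA', hc₀', hg⟩ := H.abs_gam_sub_le hβ
  obtain ⟨C, hC, hwin⟩ := H.abs_gam_window_le hi
  obtain ⟨M₀, C', hM₀, hC', hmatch⟩ := hM.le
  rw [Metric.tendsto_atTop']
  intro ε hε
  obtain ⟨M, hMb⟩ := exists_nat_ge (M₀ + 1 + (10 * C' / ε) ^ 2)
  have hM0 : M₀ ≤ M := by nlinarith [sq_nonneg (10 * C' / ε)]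
  have hM1' : (1 : ℝ) ≤ M := by nlinarith [sq_nonneg (10 * C' / ε)]
  have hM1 : 1 ≤ M := by exact_mod_cast hM1'
  have hMC : C' / √M ≤ ε / 10 := by
    have h1 : 10 * C' / ε ≤ √M := Real.le_sqrt_of_sq_le (by linarith)
    have h2 : 0 < √(M : ℝ) := Real.sqrt_pos.mpr (by linarith)
    rw [div_le_iff₀ hε] at h1
    rw [div_le_iff₀ h2]
    linarith
  obtain ⟨q₁, hq₁b⟩ := exists_nat_ge (1 + A + 1 / c₀ + 1 / c₀')
  have i1 : 0 < 1 / c₀ := by positivity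
  have i2 : 0 < 1 / c₀' := by positivity
  have hq₁1' : (1 : ℝ) ≤ q₁ := by linarith
  have hq₁1 : 1 ≤ q₁ := by exact_mod_cast hq₁1'
  have hq₁c : 1 ≤ q₁ * c₀ := by rw [← div_le_iff₀ hc₀]; linarith
  have hq₁c' : 1 ≤ q₁ * c₀' := by rw [← div_le_iff₀ hc₀']; linarith
  set κ : ℝ := max 0 (-2 * β) with hκ
  have hκ0 : 0 ≤ κ := le_max_left _ _
  have hκ1 : κ < 1 := max_lt one_pos (by linarith)
  have hMq : (1 : ℝ) ≤ M * q₁ := one_le_mul_of_one_le_of_one_le hM1' hq₁1'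
  set K₀ : ℝ := rexp (1 + 2 * |β| * Real.log (M * q₁)) with hK₀
  obtain ⟨q₂, hq₂, hq₂1, hq₂A⟩ := ((exists_log_mul_rpow_le hκ1 hMq (C * K₀ * (2 * A / q₁))
    (show 0 < ε / 10 by positivity)).and ((eventually_ge_atTop 1).and
    (tendsto_natCast_atTop_atTop.eventually_ge_atTop (10 * A' / ε)))).exists
  have hq₂1' : (1 : ℝ) ≤ q₂ := by exact_mod_cast hq₂1
  set h : ℝ := Real.log (M * q₁ * q₂) with hh
  have hh0 : 0 ≤ h := Real.log_nonneg (one_le_mul_of_one_le_of_one_le hMq hq₂1')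
  have hMnn : (0 : ℝ) ≤ M := by linarith
  set η : ℝ := ε / (10 * (C * h + 1)) with hη
  have hη0 : 0 < η := by positivity
  obtain ⟨m₁, hm₁⟩ := H.abs_im_schurU_le hi hMnn hh0 hη0
  obtain ⟨m₂, hm₂⟩ := hwin M h (ε / 10) hMnn hh0 (by positivity)
  set Q : ℝ := q₁ * q₂ with hQ
  have hQ1 : 1 ≤ Q := one_le_mul_of_one_le_of_one_le hq₁1' hq₂1'
  have hQ0 : 0 < Q := by linarith
  have hr : Tendsto (fun n : ℕ => 1 - 1 / Q / (n : ℝ)) atTop (𝓝[<] 1) := by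
    refine tendsto_nhdsWithin_iff.mpr ⟨?_, ?_⟩
    · have := (tendsto_const_div_atTop_nhds_zero_nat (1 / Q)).const_sub 1
      simpa using this
    · filter_upwards [eventually_gt_atTop 0] with n hn
      have : (0 : ℝ) < n := by exact_mod_cast hn
      have : 0 < 1 / Q / n := by positivity
      simp only [mem_Iio]; linarith
  have hl := (hM.tendsto.comp hr).eventually (Metric.ball_mem_nhds lam (show 0 < ε / 10 by positivity))
  obtain ⟨m₃, hm₃⟩ := eventually_atTop.mp hl
  refine ⟨max 1 (max m₁ (max m₂ m₃)), fun m hm => ?_⟩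
  have hmm : 1 ≤ m ∧ m₁ ≤ m ∧ m₂ ≤ m ∧ m₃ ≤ m := by omega
  obtain ⟨hm1, hmm1, hmm2, hmm3⟩ := hmm
  have hl' := hm₃ m hmm3
  simp only [Function.comp_apply, Real.dist_eq] at hl'
  have hm0' : (1 : ℝ) ≤ m := by exact_mod_cast hm1
  set r : ℝ := 1 - 1 / Q / m with hrd
  have er : 1 - r = 1 / (Q * m) := by rw [hrd, div_div]; ring
  have hr1 : r < 1 := by
    have : 0 < 1 / (Q * m) := by positivity
    linarith
  have hr0 : 0 ≤ r := by
    have : 1 / (Q * m) ≤ 1 := by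
      rw [div_le_one (by positivity)]
      exact one_le_mul_of_one_le_of_one_le hQ1 hm0'
    linarith
  set N : ℕ := M * q₁ * q₂ * m with hN
  have hNr : N * (1 - r) = M := by
    rw [er, hN, hQ]; push_cast; field_simp
  have hmr : m * (1 - r) = 1 / Q := by rw [er]; field_simp
  have hL1 : 1 ≤ M * q₁ * q₂ := Nat.one_le_iff_ne_zero.mpr (by positivity)
  have hmN : m ≤ N := Nat.le_mul_of_pos_left m hL1
  have hharm : harm m N ≤ h := by
    refine (harm_mul_le_log hm1 hL1).trans (le_of_eq ?_)
    rw [hh]; push_cast; rfl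
  have hcc : 1 / Q ≤ c₀ ∧ 1 / Q ≤ c₀' := by
    have h1 := mul_le_mul hq₁c hq₂1' zero_le_one (by positivity)
    have h2 := mul_le_mul hq₁c' hq₂1' zero_le_one (by positivity)
    constructor <;> rw [div_le_iff₀ hQ0, hQ] <;> linarith
  have hUm : ‖schurU e r m‖ ≤ 2 * A / Q := by
    refine (hU r hr0 hr1.le m (by rw [hmr]; exact hcc.1)).trans ?_
    rw [er, mul_one_div, div_le_div_iff₀ (by positivity) hQ0]
    have := mul_le_mul_of_nonneg_right hm0' (mul_pos hA hQ0).le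
    linarith
  have hmid : q₂ * m ≤ N := by
    rw [hN, mul_assoc]
    exact Nat.le_mul_of_pos_left _ (by positivity)
  have hmm' : m ≤ q₂ * m := Nat.le_mul_of_pos_left _ hq₂1
  have hlow : ∀ i, i < q₂ * m → (schurU e r i).re ≤ 1 := by
    intro i hi
    have hi' : (i : ℝ) + 1 ≤ q₂ * m := by exact_mod_cast hi
    refine (re_le_norm _).trans ((hU r hr0 hr1.le i ?_).trans ?_)
    · rw [er, mul_one_div, div_le_iff₀ (by positivity), hQ]
      have : 0 ≤ (q₁ * c₀ - 1) * (q₂ * m) := mul_nonneg (by linarith) (by positivity)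
      linarith
    · rw [er, mul_one_div, div_le_one (by positivity), hQ]
      have h1 : A * ((i : ℝ) + 1) ≤ A * (q₂ * m) := mul_le_mul_of_nonneg_left hi' hA.le
      have h2 : A * (q₂ * m) ≤ q₁ * (q₂ * m) := mul_le_mul_of_nonneg_right (by linarith) (by positivity)
      linarith
  have hexp : ∀ j, m ≤ j → j ≤ N → ∑ i ∈ Finset.Ico m j,
      (-2 * β) * (1 - (schurU e r i).re) * (1 / ((i : ℝ) + 1)) ≤
      κ * Real.log q₂ + 2 * |β| * Real.log (M * q₁) := by
    intro j hmj hjN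
    set bd : ℕ → ℝ := fun i => if i < q₂ * m then κ * (1 / ((i : ℝ) + 1))
      else 2 * |β| * (1 / ((i : ℝ) + 1)) with hbd
    have hbd0 : ∀ i, 0 ≤ bd i := fun i => by simp only [hbd]; split_ifs <;> positivity
    have b1 : ∀ i, (-2 * β) * (1 - (schurU e r i).re) * (1 / ((i : ℝ) + 1)) ≤ bd i := by
      intro i
      have c1 := abs_one_sub_re_le H.lt_one hr0 hr1.le i
      simp only [hbd]
      split_ifs with hi
      · refine mul_le_mul_of_nonneg_right ?_ (by positivity)
        have c2 := hlow i hi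
        have c3 := (abs_le.mp c1).2
        have c4 : -2 * β ≤ κ := le_max_right _ _
        nlinarith
      · refine mul_le_mul_of_nonneg_right ?_ (by positivity)
        refine (le_abs_self _).trans ?_
        rw [abs_mul, abs_mul, abs_neg, abs_two]
        exact mul_le_of_le_one_right (by positivity) c1
    refine (sum_le_sum fun i _ => b1 i).trans ?_
    refine (Finset.sum_le_sum_of_subset_of_nonneg (Finset.Ico_subset_Ico_right hjN)
      fun i _ _ => hbd0 i).trans ?_
    rw [← sum_Ico_consecutive _ hmm' hmid]
    have s1 : ∑ i ∈ Finset.Ico m (q₂ * m), bd i = κ * harm m (q₂ * m) := by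
      rw [harm, mul_sum]
      refine sum_congr rfl fun i hi => ?_
      simp only [hbd]
      rw [if_pos (Finset.mem_Ico.mp hi).2]
    have s2 : ∑ i ∈ Finset.Ico (q₂ * m) N, bd i = 2 * |β| * harm (q₂ * m) N := by
      rw [harm, mul_sum]
      refine sum_congr rfl fun i hi => ?_
      simp only [hbd]
      rw [if_neg (by have := (Finset.mem_Ico.mp hi).1; omega)]
    rw [s1, s2]
    have s3 := harm_mul_le_log hm1 hq₂1
    have s4 := harm_mul_le_log (m := q₂ * m) (L := M * q₁) (by omega)
      (Nat.one_le_iff_ne_zero.mpr (by positivity))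
    rw [← mul_assoc (M * q₁) q₂ m] at s4
    push_cast at s4
    exact add_le_add (mul_le_mul_of_nonneg_left s3 hκ0)
      (mul_le_mul_of_nonneg_left s4 (by positivity))
  set J : ℝ := K₀ * (q₂ : ℝ) ^ κ * (2 * A / Q) + η with hJ
  have hJb : ∀ j, m ≤ j → j ≤ N → |(schurU e r j).im| ≤ J := by
    intro j hmj hjN
    refine (hm₁ r hr0 hr1.le m N hmm1 hNr.le hharm j hmj hjN).trans ?_
    rw [hJ]
    refine add_le_add (mul_le_mul ?_ ((abs_im_le_norm _).trans hUm) (abs_nonneg _)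
      (by positivity)) le_rfl
    rw [hK₀, Real.rpow_def_of_pos (by linarith), ← Real.exp_add]
    refine Real.exp_le_exp.mpr ?_
    linarith [hexp j hmj hjN]
  have g1 := hg r hr0 hr1.le m (by rw [hmr]; exact hcc.2)
  have g2 := hm₂ r hr0 hr1.le m N hmm2 hmN hNr.le hharm J hJb
  have g3 := hmatch N r hr0 hr1 (by rw [hNr]; exact hM0)
  rw [hNr] at g3
  have g4 : A' * (m * (1 - r)) ≤ ε / 10 := by
    rw [hmr, mul_one_div, div_le_iff₀ hQ0]
    rw [div_le_iff₀ hε] at hq₂A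
    have h1 : (q₂ : ℝ) ≤ Q := le_mul_of_one_le_left (by linarith) hq₁1'
    have h2 := mul_le_mul_of_nonneg_right h1 hε.le
    linarith
  have g5 : C * h * J ≤ ε / 5 := by
    have c1 : C * h * η ≤ ε / 10 := by
      rw [hη, mul_div_assoc', div_le_div_iff₀ (by positivity) (by norm_num)]
      have h1 : C * h * (C * h) ≥ 0 := mul_self_nonneg _
      linarith [mul_nonneg (mul_nonneg hC hh0) hε.le]
    have c2 : C * h * (K₀ * (q₂ : ℝ) ^ κ * (2 * A / Q)) ≤ ε / 10 := by
      refine le_trans (le_of_eq ?_) hq₂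
      rw [hQ, hh]
      field_simp
    rw [hJ, mul_add]
    linarith
  clear_value J r N Q h η κ K₀
  clear hJb hexp hlow hm₁ hm₂ hwin hg hmatch hU hm₃
  rw [Real.dist_eq]
  rw [abs_le] at g1 g2 g3
  rw [abs_lt] at hl' ⊢
  obtain ⟨g1a, g1b⟩ := g1
  obtain ⟨g2a, g2b⟩ := g2
  obtain ⟨g3a, g3b⟩ := g3
  obtain ⟨g6a, g6b⟩ := hl'
  constructor <;> linarith

end IsDrive

lemma IsSzPhase.tendsto_prod {β : ℝ} {η X Y : ℕ → ℂ} (H : IsSzPhase β η X Y) (hβ : -(1 / 2) < β)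
    (hβ0 : β ≠ 0) {ℓ : ℝ → ℝ} {lam : ℝ} (hM : IsDrive.Match (drv η X) ℓ lam) :
    Tendsto (fun n => 2 * X n * Y n) atTop (nhds (exp (2 * lam * I))) := by
  have hD := H.isDrive
  have he := hD.lt_one
  obtain ⟨G, hG0, hG⟩ := hD.exists_abs_gam_le hβ hM
  have hτ := H.tau_tendsto hβ0 hG
  have hi : NullSum (fun n => ((drv η X n).im : ℂ)) := by
    refine (congrArg NullSum (funext fun n => ?_)).mp (H.nullSum_drv hτ).im
    have : (β : ℂ) / ((n : ℂ) + 1) = ((β / ((n : ℝ) + 1) : ℝ) : ℂ) := by push_cast; ring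
    rw [this, add_im, ofReal_im, add_zero]
  have hg := hD.tendsto_gam hβ hi hM
  have hph : ∀ n, phase X n = exp (-2 * gam (drv η X) 1 n * I) := by
    intro n
    induction n with
    | zero => simp [phase, gam, H.X_zero]
    | succ n ih =>
      have e0 : gam (drv η X) 1 (n + 1) = gam (drv η X) 1 n +
          arg (1 - conj (drv η X n) * ((1 : ℝ) * schurB (drv η X) 1 n)) :=
        sum_range_succ _ _
      rw [H.phase_succ, e0, schurB_one he]
      change _ * ((1 - drv η X n) / (1 - conj (drv η X n))) = _
      rw [ih]
      set d := drv η X n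
      have hd : 1 - conj d ≠ 0 := one_sub_ne_zero_of_norm_lt (by rw [RCLike.norm_conj]; exact he n)
      simp only [ofReal_one, mul_one]
      set φ := arg (1 - conj d) with hφ
      have h1 : (‖1 - conj d‖ : ℂ) * exp (φ * I) = 1 - conj d :=
        norm_mul_exp_arg_mul_I _
      have h2 : (‖1 - conj d‖ : ℂ) * exp (-φ * I) = 1 - d := by
        have := congrArg conj h1
        rw [map_mul, conj_ofReal, ← exp_conj] at this
        simpa using this
      have h3 : (‖1 - conj d‖ : ℂ) ≠ 0 := by exact_mod_cast norm_ne_zero_iff.mpr hd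
      rw [← h1, ← h2]
      set R : ℂ := (‖1 - conj d‖ : ℂ)
      rw [mul_div_mul_left _ _ h3, ← exp_sub, ← exp_add]
      congr 1
      push_cast
      ring
  have e1 : ∀ n, 2 * X n * Y n = exp (-2 * gam (drv η X) 1 n * I) *
      (1 + 2 * (tau X Y n : ℂ) * I) := by
    intro n
    rw [← hph]
    linear_combination phase X n * H.prod_mul_conj_phase n -
      (2 * X n * Y n) * H.phase_mul_conj n
  simp only [e1]
  have t1 : Tendsto (fun n => (gam (drv η X) 1 n : ℂ)) atTop (nhds ((-lam : ℝ) : ℂ)) :=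
    (continuous_ofReal.tendsto _).comp hg
  have t2 : Tendsto (fun n => (tau X Y n : ℂ)) atTop (nhds ((0 : ℝ) : ℂ)) :=
    (continuous_ofReal.tendsto _).comp hτ
  have t3 : Tendsto (fun n => exp (-2 * gam (drv η X) 1 n * I)) atTop
      (nhds (exp (-2 * ((-lam : ℝ) : ℂ) * I))) :=
    (continuous_exp.tendsto _).comp ((t1.const_mul (-2)).mul_const I)
  have t4 := t3.mul (((t2.const_mul 2).mul_const I).const_add 1)
  convert t4 using 2
  push_cast
  ring_nf

section Link

variable {ν : Measure ℝ} [IsFiniteMeasure ν] {Φ : ℕ → ℂ[X]} {a : ℂ} {X Y : ℕ → ℂ}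

lemma IsOPUC.schur_link (H : IsOPUC ν Φ) (ha : ‖a‖ = 1)
    (hS : IsSzSeq (fun n => conj (vb Φ n) * conj a ^ (n + 1)) X Y) {e : ℕ → ℂ}
    (he : ∀ n, e n = conj (vb Φ n) * conj a ^ (n + 1) * conj (phase X n)) {r : ℝ} (h0 : 0 ≤ r)
    (h1 : r ≤ 1) (m : ℕ) :
    (Φ m).eval (r * a) = a ^ m * phase X m * schurB e r m * (rv Φ m).eval (r * a) ∧
    (rv Φ (m + 1)).eval (r * a) = (rv Φ m).eval (r * a) * (1 - conj (e m) * (r * schurB e r m)) := by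
  have aa : ∀ n, a ^ n * conj a ^ n = 1 := fun n => by
    rw [← mul_pow, mul_conj_of_norm_one ha, one_pow]
  have he1 : ∀ n, ‖e n‖ < 1 := fun n => by
    rw [he, hS.norm_e]; exact hS.norm_lt n
  have step : ∀ m, (Φ m).eval (r * a) = a ^ m * phase X m * schurB e r m * (rv Φ m).eval (r * a) →
      (rv Φ (m + 1)).eval (r * a) =
        (rv Φ m).eval (r * a) * (1 - conj (e m) * (r * schurB e r m)) := by
    intro m hm
    have : conj (e m) = vb Φ m * a ^ (m + 1) * phase X m := by
      rw [he]; simp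
    rw [rv, eval_sub, eval_mul, eval_mul, eval_C, eval_X, hm, this]
    ring
  have main : (Φ m).eval (r * a) = a ^ m * phase X m * schurB e r m * (rv Φ m).eval (r * a) := by
    induction m with
    | zero => simp [H.phi_zero, phase, hS.X_zero, schurB, rv]
    | succ m ih =>
      have c0 := step m ih
      have c1 : conj (vb Φ m) = e m * phase X m * a ^ (m + 1) := by
        rw [he]
        linear_combination -(conj (vb Φ m)) * aa (m + 1) -
          (conj (vb Φ m) * (a ^ (m + 1) * conj a ^ (m + 1))) * hS.phase_mul_conj m
      have n1 : 1 - e m ≠ 0 := one_sub_ne_zero_of_norm_lt (he1 m)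
      have n2 : 1 - conj (e m) ≠ 0 :=
        one_sub_ne_zero_of_norm_lt (by rw [RCLike.norm_conj]; exact he1 m)
      have n3 : 1 - conj (e m) * (r * schurB e r m) ≠ 0 :=
        one_sub_ne_zero_of_norm_lt ((norm_conj_mul_schurB_le he1 h0 h1 m).trans_lt (he1 m))
      rw [H.phi_succ, eval_sub, eval_mul, eval_mul, eval_C, eval_X, ih, c1, c0, hS.phase_succ,
        ← he, schurB]
      rw [show (r : ℂ) * a * (a ^ m * phase X m * schurB e r m * (rv Φ m).eval (r * a)) =
        a ^ (m + 1) * phase X m * (r * schurB e r m) * (rv Φ m).eval (r * a) by ring]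
      generalize (r : ℂ) * schurB e r m = b at *
      generalize (rv Φ m).eval (r * a) = R at *
      generalize phase X m = ph at *
      generalize a ^ (m + 1) = A at *
      generalize 1 - conj (e m) * b = D at *
      generalize 1 - conj (e m) = D' at *
      generalize hD : 1 - e m = D'' at *
      field_simp
  exact ⟨main, step m main⟩

lemma rv_eval_eq_exp_gam (H : IsOPUC ν Φ) (ha : ‖a‖ = 1)
    (hS : IsSzSeq (fun n => conj (vb Φ n) * conj a ^ (n + 1)) X Y) {e : ℕ → ℂ}
    (he : ∀ n, e n = conj (vb Φ n) * conj a ^ (n + 1) * conj (phase X n)) {r : ℝ} (h0 : 0 ≤ r)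
    (h1 : r ≤ 1) (m : ℕ) : ∃ R : ℝ, 0 < R ∧
      (rv Φ m).eval (r * a) = R * exp (gam e r m * I) := by
  have he1 : ∀ n, ‖e n‖ < 1 := fun n => by
    rw [he, hS.norm_e]; exact hS.norm_lt n
  induction m with
  | zero => exact ⟨1, one_pos, by simp [rv, gam]⟩
  | succ m ih =>
    obtain ⟨R, hR, h⟩ := ih
    have n3 : 1 - conj (e m) * (r * schurB e r m) ≠ 0 :=
      one_sub_ne_zero_of_norm_lt ((norm_conj_mul_schurB_le he1 h0 h1 m).trans_lt (he1 m))
    refine ⟨R * ‖1 - conj (e m) * (r * schurB e r m)‖, mul_pos hR (norm_pos_iff.mpr n3), ?_⟩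
    have e0 : gam e r (m + 1) = gam e r m + arg (1 - conj (e m) * (r * schurB e r m)) :=
      sum_range_succ _ _
    rw [(H.schur_link ha hS he h0 h1 m).2, h, e0]
    conv_lhs => rw [← norm_mul_exp_arg_mul_I (1 - conj (e m) * (r * schurB e r m))]
    push_cast
    rw [add_mul, exp_add]
    ring

lemma continuousOn_schurB {e : ℕ → ℂ} (he : ∀ n, ‖e n‖ < 1) (n : ℕ) :
    ContinuousOn (fun r : ℝ => schurB e r n) (Icc 0 1) := by
  induction n with
  | zero => exact continuousOn_const
  | succ n ih =>
    have h : ContinuousOn (fun r : ℝ => (r : ℂ) * schurB e r n) (Icc 0 1) :=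
      continuous_ofReal.continuousOn.mul ih
    refine ((h.sub continuousOn_const).mul continuousOn_const).div
      ((continuousOn_const.sub (continuousOn_const.mul h)).mul continuousOn_const) ?_
    intro r hr
    exact mul_ne_zero (one_sub_ne_zero_of_norm_lt
      ((norm_conj_mul_schurB_le he hr.1 hr.2 n).trans_lt (he n))) (one_sub_ne_zero_of_norm_lt (he n))

lemma continuousOn_gam {e : ℕ → ℂ} (he : ∀ n, ‖e n‖ < 1) (n : ℕ) :
    ContinuousOn (fun r : ℝ => gam e r n) (Icc 0 1) := by
  refine continuousOn_finsetSum _ fun i _ => ?_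
  have h : ContinuousOn (fun r : ℝ => 1 - conj (e i) * ((r : ℂ) * schurB e r i)) (Icc 0 1) :=
    continuousOn_const.sub (continuousOn_const.mul
      (continuous_ofReal.continuousOn.mul (continuousOn_schurB he i)))
  intro r hr
  refine (continuousAt_arg (Or.inl ?_)).comp_continuousWithinAt (h r hr)
  have h1 := (norm_conj_mul_schurB_le he hr.1 hr.2 i).trans_lt (he i)
  have h2 := (re_le_norm _).trans_lt h1
  simp only [sub_re, one_re]
  linarith

lemma abs_le_of_norm_exp_sub_one_le {φ ρ : ℝ} (hφ : |φ| ≤ π / 2) :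
    |φ| ≤ π / 2 * ‖ρ * exp (φ * I) - 1‖ := by
  have h1 : 2 / π * |φ| ≤ |Real.sin φ| := by
    rcases le_or_gt 0 φ with h | h
    · rw [abs_of_nonneg h] at *
      exact (Real.mul_le_sin h hφ).trans (le_abs_self _)
    · rw [abs_of_neg h] at *
      rw [← abs_neg, ← Real.sin_neg]
      exact (Real.mul_le_sin (by linarith) hφ).trans (le_abs_self _)
  have h2 : 0 ≤ Real.cos φ := Real.cos_nonneg_of_mem_Icc (abs_le.mp hφ |> fun h => ⟨by linarith, h.2⟩)
  have h3 : |Real.sin φ| ≤ ‖ρ * exp (φ * I) - 1‖ := by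
    refine abs_le_of_sq_le_sq ?_ (norm_nonneg _)
    rw [Complex.sq_norm, normSq_apply, exp_mul_I, ← ofReal_cos,
      ← ofReal_sin]
    simp only [sub_re, sub_im, re_ofReal_mul, im_ofReal_mul,
      add_re, add_im, ofReal_re, ofReal_im, Complex.I_re,
      Complex.I_im, one_re, one_im, mul_zero, mul_one]
    have := Real.sin_sq_add_cos_sq φ
    nlinarith [sq_nonneg (ρ - Real.cos φ)]
  have hp := pi_pos
  have h4 := h1.trans h3
  rw [div_mul_eq_mul_div, div_le_iff₀ hp] at h4
  linarith

lemma IsOPUC.isDrive_match (H : IsOPUC ν Φ) (ha : ‖a‖ = 1)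
    (hS : IsSzSeq (fun n => conj (vb Φ n) * conj a ^ (n + 1)) X Y) {L : ℝ → ℂ}
    (hL0 : L 0 = 0) (hLc : ContinuousOn L (Ico 0 1)) {lam : ℝ}
    (hLt : Tendsto (fun r => (L r).im) (𝓝[<] 1) (nhds lam)) {C : ℝ} (hC : 0 < C)
    (hL : ∀ m : ℕ, 0 < m → ∀ r : ℝ, 0 ≤ r → r < 1 →
      ‖(rv Φ m).eval (r * a) * exp (L r) - 1‖ ≤ C / √(m * (1 - r))) :
    IsDrive.Match (IsSzPhase.drv (fun n => conj (vb Φ n) * conj a ^ (n + 1)) X)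
      (fun r => (L r).im) lam where
  tendsto := hLt
  le := by
    set e := IsSzPhase.drv (fun n => conj (vb Φ n) * conj a ^ (n + 1)) X with he
    have he' : ∀ n, e n = conj (vb Φ n) * conj a ^ (n + 1) * conj (phase X n) := fun n => rfl
    have he1 : ∀ n, ‖e n‖ < 1 := fun n => by
      rw [he', hS.norm_e]; exact hS.norm_lt n
    refine ⟨4 * C ^ 2, π / 2 * C, by positivity, by positivity, fun m r h0 h1 hm => ?_⟩
    have hm0 : 0 < m := by
      rcases Nat.eq_zero_or_pos m with rfl | h
      · have : 0 < 4 * C ^ 2 := by positivity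
        simp at hm; linarith
      · exact h
    have hm0' : (0 : ℝ) < m := by exact_mod_cast hm0
    set φ : ℝ → ℝ := fun s => gam e s m + (L s).im with hφ
    have key : ∀ s, 0 ≤ s → s ≤ r → ∃ ρ : ℝ, 0 < ρ ∧
        ‖(ρ : ℂ) * exp (φ s * I) - 1‖ ≤ C / √(m * (1 - s)) := by
      intro s hs0 hs1
      obtain ⟨R, hR, h⟩ := rv_eval_eq_exp_gam H ha hS he' hs0 (hs1.trans h1.le) m
      refine ⟨R * rexp (L s).re, by positivity, ?_⟩
      have := hL m hm0 s hs0 (hs1.trans_lt h1)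
      rw [h] at this
      refine le_trans (le_of_eq (congrArg norm ?_)) this
      congr 1
      conv_rhs => rw [← re_add_im (L s)]
      simp only [hφ]
      push_cast
      rw [add_mul, exp_add, exp_add]
      ring
    have half : ∀ s, 0 ≤ s → s ≤ r → C / √(m * (1 - s)) ≤ 1 / 2 := by
      intro s _ hs1
      have : 2 * C ≤ √(m * (1 - s)) := Real.le_sqrt_of_sq_le (by nlinarith)
      rw [div_le_iff₀ (by linarith)]
      linarith
    have hcos : ∀ s, 0 ≤ s → s ≤ r → |φ s| ≠ π / 2 := by
      intro s hs0 hs1 h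
      obtain ⟨ρ, hρ, hρ1⟩ := key s hs0 hs1
      have h2 := abs_le_of_norm_exp_sub_one_le (ρ := ρ) h.le
      have h3 := hρ1.trans (half s hs0 hs1)
      rw [h] at h2
      nlinarith [pi_pos]
    have hcont : ContinuousOn (fun s => |φ s|) (Icc 0 r) := by
      refine ((continuousOn_gam he1 m).mono (Icc_subset_Icc le_rfl h1.le)).add ?_ |>.abs
      exact continuous_im.comp_continuousOn (hLc.mono fun s hs => ⟨hs.1, hs.2.trans_lt h1⟩)
    have hφ0 : φ 0 = 0 := by simp [hφ, gam, hL0]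
    have hlt : |φ r| ≤ π / 2 := by
      by_contra! hgt
      obtain ⟨s, hs, hs'⟩ := intermediate_value_Icc h0 hcont
        (show π / 2 ∈ Icc (|φ 0|) (|φ r|) from ⟨by rw [hφ0, abs_zero]; positivity, hgt.le⟩)
      exact hcos s hs.1 hs.2 hs'
    obtain ⟨ρ, hρ, hρ1⟩ := key r h0 le_rfl
    have h2 := abs_le_of_norm_exp_sub_one_le (ρ := ρ) hlt
    refine h2.trans ?_
    rw [mul_div_assoc]
    exact mul_le_mul_of_nonneg_left hρ1 (by positivity)

end Link

section Boundary

variable {F : ℂ → ℂ} {G : ℝ → ℝ}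

lemma one_sub_mul_conj_cpt_ne_zero {z : ℂ} (hz : ‖z‖ < 1) (θ : ℝ) : 1 - z * conj (cpt θ) ≠ 0 :=
  one_sub_ne_zero_of_norm_lt (by rwa [norm_mul, RCLike.norm_conj, norm_cpt, mul_one])

lemma continuous_cauchyKernel {z : ℂ} (hz : ‖z‖ < 1) :
    Continuous fun θ => (1 - z * conj (cpt θ))⁻¹ := by
  refine Continuous.inv₀ ?_ (one_sub_mul_conj_cpt_ne_zero hz)
  exact continuous_const.sub (continuous_const.mul (continuous_conj.comp continuous_cpt))

lemma norm_cauchyKernel_le {z : ℂ} (hz : ‖z‖ < 1) (θ : ℝ) :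
    ‖(1 - z * conj (cpt θ))⁻¹‖ ≤ (1 - ‖z‖)⁻¹ := by
  rw [norm_inv]
  refine inv_anti₀ (by linarith) ?_
  have := norm_sub_norm_le (1 : ℂ) (z * conj (cpt θ))
  rwa [norm_one, norm_mul, RCLike.norm_conj, norm_cpt, mul_one] at this

lemma tendsto_radial {E : Type*} [TopologicalSpace E] {F : ℂ → E} {z : ℂ} (h : ContinuousAt F z) :
    Tendsto (fun r : ℝ => F (r * z)) (𝓝[<] 1) (nhds (F z)) := by
  have : Continuous fun r : ℝ => (r : ℂ) * z := by fun_prop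
  exact h.tendsto.comp (by simpa using (this.tendsto 1).mono_left nhdsWithin_le_nhds)

lemma eventually_mem_Ico : ∀ᶠ r : ℝ in 𝓝[<] 1, 0 ≤ r ∧ r < 1 := by
  filter_upwards [self_mem_nhdsWithin, nhdsWithin_le_nhds (lt_mem_nhds (zero_lt_one' ℝ))]
    with r h1 h2 using ⟨le_of_lt h2, h1⟩

lemma continuous_radial (hF : DifferentiableOn ℂ F (ball 0 1)) {r : ℝ} (h0 : 0 ≤ r) (h1 : r < 1) :
    Continuous fun θ => F (r * cpt θ) := by
  refine hF.continuousOn.comp_continuous (by fun_prop) fun θ => ?_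
  rw [mem_ball_zero_iff, norm_radial h0]
  exact h1

/-- Cauchy's formula on the unit circle for boundary values attained in a dominated manner. -/
lemma cauchy_of_dominated (hF : DifferentiableOn ℂ F (ball 0 1)) (hG : Integrable G arcμ)
    (hb : ∀ r : ℝ, 0 ≤ r → r < 1 → ∀ᵐ θ ∂arcμ, ‖F (r * cpt θ)‖ ≤ G θ)
    (hl : ∀ᵐ θ ∂arcμ, ContinuousAt F (cpt θ)) {z : ℂ} (hz : ‖z‖ < 1) :
    ∫ θ, F (cpt θ) * (1 - z * conj (cpt θ))⁻¹ ∂arcμ = F z := by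
  have hz' : z ∈ ball (0 : ℂ) 1 := mem_ball_zero_iff.mpr hz
  have key : ∀ r : ℝ, 0 ≤ r → r < 1 →
      ∫ θ, F (r * cpt θ) * (1 - z * conj (cpt θ))⁻¹ ∂arcμ = F (r * z) := by
    intro r h0 h1
    have hd : DiffContOnCl ℂ (fun u => F (r * u)) (ball 0 |1|) := by
      refine DifferentiableOn.diffContOnCl ?_
      rw [abs_one, closure_ball (0 : ℂ) one_ne_zero]
      refine hF.comp (by fun_prop) fun u hu => ?_
      rw [mem_ball_zero_iff, norm_mul, Complex.norm_of_nonneg h0]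
      have := mem_closedBall_zero_iff.mp hu
      nlinarith
    have := hd.circleAverage_smul_div (by rwa [abs_one])
    rw [← this, Real.circleAverage, integral_arcμ]
    congr 1
    refine intervalIntegral.integral_congr fun θ _ => ?_
    have hc : circleMap 0 1 θ = cpt θ := by simp [circleMap, cpt]
    have hn := one_sub_mul_conj_cpt_ne_zero hz θ
    have hm := mul_conj_of_norm_one (norm_cpt θ)
    have hne : cpt θ - z ≠ 0 := by
      intro h
      apply hn
      rw [← sub_eq_zero.mp h, hm, sub_self]
    simp only [hc, sub_zero, smul_eq_mul]
    rw [mul_comm]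
    congr 1
    rw [inv_eq_one_div, div_eq_div_iff hn hne]
    linear_combination z * hm
  have t1 : Tendsto (fun r : ℝ => ∫ θ, F (r * cpt θ) * (1 - z * conj (cpt θ))⁻¹ ∂arcμ)
      (𝓝[<] 1) (nhds (∫ θ, F (cpt θ) * (1 - z * conj (cpt θ))⁻¹ ∂arcμ)) := by
    refine tendsto_integral_filter_of_dominated_convergence (fun θ => G θ * (1 - ‖z‖)⁻¹) ?_ ?_
      (hG.mul_const _) ?_
    · filter_upwards [eventually_mem_Ico] with r hr
      exact ((continuous_radial hF hr.1 hr.2).mul (continuous_cauchyKernel hz)).aestronglyMeasurable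
    · filter_upwards [eventually_mem_Ico] with r hr
      filter_upwards [hb r hr.1 hr.2] with θ hθ
      rw [norm_mul]
      exact mul_le_mul hθ (norm_cauchyKernel_le hz θ) (norm_nonneg _) ((norm_nonneg _).trans hθ)
    · filter_upwards [hl] with θ hθ
      exact (tendsto_radial hθ).mul_const _
  have t2 : Tendsto (fun r : ℝ => F (r * z)) (𝓝[<] 1) (nhds (F z)) :=
    tendsto_radial (hF.differentiableAt (isOpen_ball.mem_nhds hz')).continuousAt
  refine tendsto_nhds_unique t1 (t2.congr' ?_)
  filter_upwards [eventually_mem_Ico] with r hr using (key r hr.1 hr.2).symm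

lemma integrable_of_dominated (hF : DifferentiableOn ℂ F (ball 0 1)) (hG : Integrable G arcμ)
    (hb : ∀ r : ℝ, 0 ≤ r → r < 1 → ∀ᵐ θ ∂arcμ, ‖F (r * cpt θ)‖ ≤ G θ)
    (hl : ∀ᵐ θ ∂arcμ, ContinuousAt F (cpt θ)) : Integrable (fun θ => F (cpt θ)) arcμ := by
  have hr : ∀ n : ℕ, (0 : ℝ) ≤ 1 - 1 / ((n : ℝ) + 1) ∧ (1 : ℝ) - 1 / ((n : ℝ) + 1) < 1 := fun n => by
    have h : (0 : ℝ) < n + 1 := by positivity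
    have : 1 / ((n : ℝ) + 1) ≤ 1 := by rw [div_le_one h]; linarith [n.cast_nonneg (α := ℝ)]
    have h2 : 0 < 1 / ((n : ℝ) + 1) := by positivity
    constructor <;> linarith
  have ht : Tendsto (fun n : ℕ => (1 : ℝ) - 1 / ((n : ℝ) + 1)) atTop (𝓝[<] 1) := by
    refine tendsto_nhdsWithin_iff.mpr ⟨?_, .of_forall fun n => (hr n).2⟩
    simpa using (tendsto_const_nhds (x := (1 : ℝ))).sub (tendsto_one_div_add_atTop_nhds_zero_nat (𝕜 := ℝ))
  have hlim : ∀ᵐ θ ∂arcμ, Tendsto (fun n : ℕ => F (((1 - 1 / ((n : ℝ) + 1) : ℝ) : ℂ) * cpt θ)) atTop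
      (nhds (F (cpt θ))) := by
    filter_upwards [hl] with θ hθ using (tendsto_radial hθ).comp ht
  refine hG.mono' (aestronglyMeasurable_of_tendsto_ae atTop
    (fun n => (continuous_radial hF (hr n).1 (hr n).2).aestronglyMeasurable) hlim) ?_
  have hall : ∀ᵐ θ ∂arcμ, ∀ n : ℕ, ‖F (((1 - 1 / ((n : ℝ) + 1) : ℝ) : ℂ) * cpt θ)‖ ≤ G θ :=
    ae_all_iff.mpr fun n => hb _ (hr n).1 (hr n).2
  filter_upwards [hlim, hall] with θ h1 h2
  exact le_of_tendsto h1.norm (.of_forall h2)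

lemma mean_of_dominated (hF : DifferentiableOn ℂ F (ball 0 1)) (hG : Integrable G arcμ)
    (hb : ∀ r : ℝ, 0 ≤ r → r < 1 → ∀ᵐ θ ∂arcμ, ‖F (r * cpt θ)‖ ≤ G θ)
    (hl : ∀ᵐ θ ∂arcμ, ContinuousAt F (cpt θ)) : ∫ θ, F (cpt θ) ∂arcμ = F 0 := by
  simpa using cauchy_of_dominated hF hG hb hl (z := 0) (by simp)

lemma integral_norm_cauchyKernel_sq {z : ℂ} (hz : ‖z‖ < 1) :
    ∫ θ, ‖(1 - z * conj (cpt θ))⁻¹‖ ^ 2 ∂arcμ = (1 - ‖z‖ ^ 2)⁻¹ := by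
  have hne : ∀ u : ℂ, ‖u‖ ≤ 1 → 1 - conj z * u ≠ 0 := fun u hu => by
    refine one_sub_ne_zero_of_norm_lt ?_
    rw [norm_mul, RCLike.norm_conj]
    nlinarith [norm_nonneg z, norm_nonneg u]
  have h1 : DifferentiableOn ℂ (fun u => (1 - conj z * u)⁻¹) (ball 0 1) := by
    refine DifferentiableOn.inv (by fun_prop) fun u hu => hne u ?_
    exact (mem_ball_zero_iff.mp hu).le
  have h2 := cauchy_of_dominated h1 (G := fun _ => (1 - ‖z‖)⁻¹) (integrable_const _) (fun r h0 h1 =>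
    .of_forall fun θ => ?_) (.of_forall fun θ => ?_) hz
  · have e : ∀ θ, ((‖(1 - z * conj (cpt θ))⁻¹‖ ^ 2 : ℝ) : ℂ) =
        (1 - conj z * cpt θ)⁻¹ * (1 - z * conj (cpt θ))⁻¹ := fun θ => by
      rw [ofReal_pow, ← conj_mul']
      simp
    have h3 : ((∫ θ, ‖(1 - z * conj (cpt θ))⁻¹‖ ^ 2 ∂arcμ : ℝ) : ℂ) = ((1 - ‖z‖ ^ 2)⁻¹ : ℝ) := by
      rw [← integral_complex_ofReal]
      simp_rw [e]
      rw [h2, conj_mul']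
      push_cast
      rfl
    exact_mod_cast h3
  · rw [norm_inv]
    refine inv_anti₀ (by linarith) ?_
    have := norm_sub_norm_le (1 : ℂ) (conj z * (r * cpt θ))
    rw [norm_one, norm_mul, RCLike.norm_conj, norm_mul, norm_cpt, mul_one, norm_real,
      norm_of_nonneg h0] at this
    nlinarith [norm_nonneg z]
  · refine ContinuousAt.inv₀ (by fun_prop) (hne _ (norm_cpt θ).le)

/-- Point evaluations in the Hardy space of square integrable boundary values. -/
lemma norm_sq_le_of_dominated (hF : DifferentiableOn ℂ F (ball 0 1)) (hG : Integrable G arcμ)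
    (hb : ∀ r : ℝ, 0 ≤ r → r < 1 → ∀ᵐ θ ∂arcμ, ‖F (r * cpt θ)‖ ≤ G θ)
    (hl : ∀ᵐ θ ∂arcμ, ContinuousAt F (cpt θ))
    (h2 : Integrable (fun θ => ‖F (cpt θ)‖ ^ 2) arcμ) {z : ℂ} (hz : ‖z‖ < 1) :
    ‖F z‖ ^ 2 ≤ (∫ θ, ‖F (cpt θ)‖ ^ 2 ∂arcμ) * (1 - ‖z‖ ^ 2)⁻¹ := by
  set K : ℝ → ℂ := fun θ => (1 - z * conj (cpt θ))⁻¹ with hK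
  have hB := integral_norm_cauchyKernel_sq hz
  have hC := cauchy_of_dominated hF hG hb hl hz
  set A := ∫ θ, ‖F (cpt θ)‖ ^ 2 ∂arcμ
  have hpos : 0 < 1 - ‖z‖ ^ 2 := by nlinarith [norm_nonneg z]
  have hKi : Integrable (fun θ => ‖K θ‖ ^ 2) arcμ :=
    integrable_bdd_arcμ ((continuous_cauchyKernel hz).norm.pow 2)
  have key : ∀ s : ℝ, 0 < s → ‖F z‖ ≤ (s * A + s⁻¹ * (1 - ‖z‖ ^ 2)⁻¹) / 2 := by
    intro s hs
    rw [← hC, ← hB]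
    refine (norm_integral_le_integral_norm _).trans ?_
    rw [← integral_const_mul, ← integral_const_mul, ← integral_add (h2.const_mul s)
      (hKi.const_mul _), ← integral_div]
    refine integral_mono_of_nonneg (.of_forall fun θ => norm_nonneg _)
      (((h2.const_mul s).add (hKi.const_mul _)).div_const 2) (.of_forall fun θ => ?_)
    change ‖F (cpt θ) * K θ‖ ≤ (s * ‖F (cpt θ)‖ ^ 2 + s⁻¹ * ‖K θ‖ ^ 2) / 2
    rw [norm_mul]
    have e : s * ‖F (cpt θ)‖ ^ 2 + s⁻¹ * ‖K θ‖ ^ 2 - 2 * (‖F (cpt θ)‖ * ‖K θ‖) =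
        s⁻¹ * (s * ‖F (cpt θ)‖ - ‖K θ‖) ^ 2 := by
      field_simp
      ring
    have : 0 ≤ s⁻¹ * (s * ‖F (cpt θ)‖ - ‖K θ‖) ^ 2 := by positivity
    linarith
  have hA : 0 ≤ A := integral_nonneg fun θ => by positivity
  rw [← div_eq_mul_inv, le_div_iff₀ hpos]
  rcases eq_or_lt_of_le (norm_nonneg (F z)) with h0 | h0
  · rw [← h0]; simpa using hA
  have h3 := key ((1 - ‖z‖ ^ 2)⁻¹ * ‖F z‖⁻¹) (by positivity)
  rw [mul_inv, inv_inv, inv_inv] at h3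
  set x := ‖F z‖
  set b := 1 - ‖z‖ ^ 2
  have e : b * x * b⁻¹ = x := by field_simp
  rw [e] at h3
  have h4 : x ≤ b⁻¹ * x⁻¹ * A := by linarith
  have h5 := mul_le_mul_of_nonneg_left h4 (show 0 ≤ b * x by positivity)
  have e2 : b * x * (b⁻¹ * x⁻¹ * A) = A := by field_simp
  rw [e2] at h5
  linarith

end Boundary

section SzegoFunction

variable {ι : Type*} [Fintype ι] {Γ : ℂ → ℂ} {a : ι → ℂ} {β : ι → ℝ} {R : ℝ}

/-- Logarithm of the interior Szegő function. -/
noncomputable def szH (Γ : ℂ → ℂ) (a : ι → ℂ) (β : ι → ℝ) (z : ℂ) : ℂ :=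
  Γ z + ∑ k, (β k : ℂ) * log (1 - conj (a k) * z)

/-- Interior Szegő function. -/
noncomputable def szD (Γ : ℂ → ℂ) (a : ι → ℂ) (β : ι → ℝ) (z : ℂ) : ℂ :=
  exp (szH Γ a β z)

lemma norm_one_sub_conj_mul {a : ℂ} (ha : ‖a‖ = 1) (z : ℂ) : ‖1 - conj a * z‖ = ‖z - a‖ := by
  have : 1 - conj a * z = -(conj a * (z - a)) := by
    linear_combination -(conj_mul_of_norm_one ha)
  rw [this, norm_neg, norm_mul, RCLike.norm_conj, ha, one_mul]

lemma one_sub_conj_mul_re_pos {a z : ℂ} (ha : ‖a‖ = 1) (hz : ‖z‖ ≤ 1) (hne : z ≠ a) :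
    0 < (1 - conj a * z).re := by
  have h1 : ‖conj a * z‖ ≤ 1 := by rwa [norm_mul, RCLike.norm_conj, ha, one_mul]
  have h2 := (re_le_norm _).trans h1
  rw [sub_re, one_re, sub_pos]
  refine lt_of_le_of_ne h2 fun h => hne ?_
  have h3 : ‖conj a * z‖ ^ 2 ≤ 1 := pow_le_one₀ (norm_nonneg _) h1
  rw [Complex.sq_norm, normSq_apply, h] at h3
  have h4 : (conj a * z).im = 0 := by nlinarith
  have h5 : conj a * z = 1 := Complex.ext h h4
  linear_combination a * h5 - z * mul_conj_of_norm_one ha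

lemma one_sub_conj_mul_mem_slitPlane {a z : ℂ} (ha : ‖a‖ = 1) (hz : ‖z‖ ≤ 1) (hne : z ≠ a) :
    1 - conj a * z ∈ slitPlane := Or.inl (one_sub_conj_mul_re_pos ha hz hne)

lemma ne_of_norm_lt_one {a z : ℂ} (ha : ‖a‖ = 1) (hz : ‖z‖ < 1) : z ≠ a := by
  rintro rfl; linarith

lemma norm_sub_le_two_mul {a ζ : ℂ} (ha : ‖a‖ = 1) (hζ : ‖ζ‖ = 1) {r : ℝ} (h0 : 0 ≤ r)
    (h1 : r < 1) : ‖ζ - a‖ ≤ 2 * ‖r * ζ - a‖ := by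
  have e1 : ‖ζ - r * ζ‖ = 1 - r := by
    rw [show ζ - r * ζ = ((1 - r : ℝ) : ℂ) * ζ by push_cast; ring, norm_mul, hζ, mul_one,
      Complex.norm_of_nonneg (by linarith)]
  have e2 : 1 - r ≤ ‖r * ζ - a‖ := by
    have := norm_sub_norm_le a (r * ζ)
    rw [norm_mul, hζ, ha, mul_one, Complex.norm_of_nonneg h0, norm_sub_rev] at this
    exact this
  have e3 : ‖ζ - a‖ ≤ ‖ζ - r * ζ‖ + ‖r * ζ - a‖ := by
    refine le_trans (le_of_eq (congrArg norm ?_)) (norm_add_le _ _); ring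
  linarith

lemma differentiableAt_szH (ha : ∀ k, ‖a k‖ = 1) {z : ℂ} (hΓ : DifferentiableAt ℂ Γ z)
    (hz : ‖z‖ ≤ 1) (hne : ∀ k, z ≠ a k) : DifferentiableAt ℂ (szH Γ a β) z := by
  refine hΓ.add (DifferentiableAt.fun_sum fun k _ => ?_)
  have h : DifferentiableAt ℂ (fun z => 1 - conj (a k) * z) z := by fun_prop
  exact (h.clog (one_sub_conj_mul_mem_slitPlane (ha k) hz (hne k))).const_mul _

lemma differentiableAt_of_ball (hΓ : DifferentiableOn ℂ Γ (ball 0 R)) (hR : 1 < R) {z : ℂ}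
    (hz : ‖z‖ ≤ 1) : DifferentiableAt ℂ Γ z :=
  hΓ.differentiableAt (isOpen_ball.mem_nhds (mem_ball_zero_iff.mpr (hz.trans_lt hR)))

lemma differentiableOn_szH (ha : ∀ k, ‖a k‖ = 1) (hΓ : DifferentiableOn ℂ Γ (ball 0 R))
    (hR : 1 < R) : DifferentiableOn ℂ (szH Γ a β) (ball 0 1) := fun z hz => by
  have hz := mem_ball_zero_iff.mp hz
  exact (differentiableAt_szH ha (differentiableAt_of_ball hΓ hR hz.le) hz.le
    fun k => ne_of_norm_lt_one (ha k) hz).differentiableWithinAt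

lemma exists_norm_le_of_ball (hΓ : DifferentiableOn ℂ Γ (ball 0 R)) (hR : 1 < R) :
    ∃ C, 0 ≤ C ∧ ∀ z, ‖z‖ ≤ 1 → ‖Γ z‖ ≤ C := by
  obtain ⟨C, hC⟩ := (isCompact_closedBall (0 : ℂ) 1).exists_bound_of_continuousOn
    (f := Γ) (hΓ.continuousOn.mono (closedBall_subset_ball hR))
  exact ⟨C, (norm_nonneg _).trans (hC 0 (by simp)), fun z hz => hC z (mem_closedBall_zero_iff.mpr hz)⟩

lemma norm_szD (ha : ∀ k, ‖a k‖ = 1) {z : ℂ} (hne : ∀ k, z ≠ a k) :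
    ‖szD Γ a β z‖ = rexp (Γ z).re * ∏ k, ‖z - a k‖ ^ β k := by
  rw [szD, norm_exp, szH, add_re, Real.exp_add, re_sum, Real.exp_sum]
  congr 1
  refine prod_congr rfl fun k _ => ?_
  have : 0 < ‖z - a k‖ := norm_pos_iff.mpr (sub_ne_zero.mpr (hne k))
  rw [re_ofReal_mul, log_re, norm_one_sub_conj_mul (ha k),
    Real.rpow_def_of_pos this, mul_comm]

lemma norm_szD_sq (ha : ∀ k, ‖a k‖ = 1) {g : ℝ → ℝ}
    (hg : ∀ θ, g θ = rexp (2 * (Γ (cpt θ)).re)) {θ : ℝ} (hne : ∀ k, cpt θ ≠ a k) :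
    ‖szD Γ a β (cpt θ)‖ ^ 2 = wtF g a β θ := by
  rw [norm_szD ha hne, mul_pow, ← Finset.prod_pow, wtF, hg, ← Real.exp_nat_mul]
  congr 1
  refine prod_congr rfl fun k _ => ?_
  rw [← rpow_natCast, ← rpow_mul (norm_nonneg _), mul_comm]
  rfl

lemma exists_norm_szD_le (ha : ∀ k, ‖a k‖ = 1) (hΓ : DifferentiableOn ℂ Γ (ball 0 R))
    (hR : 1 < R) : ∃ C : ℝ, 0 ≤ C ∧ ∀ r : ℝ, 0 ≤ r → r < 1 → ∀ θ, (∀ k, cpt θ ≠ a k) →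
      ‖szD Γ a β (r * cpt θ)‖ ≤ C * ∏ k, ‖cpt θ - a k‖ ^ min (β k) 0 := by
  obtain ⟨M, -, hM⟩ := exists_norm_le_of_ball hΓ hR
  refine ⟨rexp M * ∏ k, (2 : ℝ) ^ |β k|, by positivity, fun r h0 h1 θ hne => ?_⟩
  have hr := (norm_radial h0 θ).trans_lt h1
  rw [norm_szD ha fun k => ne_of_norm_lt_one (ha k) hr, mul_assoc, ← Finset.prod_mul_distrib]
  refine mul_le_mul (Real.exp_le_exp.mpr ((re_le_norm _).trans (hM _ hr.le)))
    (Finset.prod_le_prod (fun k _ => by positivity) fun k _ => ?_)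
    (prod_nonneg fun k _ => by positivity) (exp_pos _).le
  have hp : 0 < ‖cpt θ - a k‖ := norm_pos_iff.mpr (sub_ne_zero.mpr (hne k))
  have h2 := norm_sub_le_two_mul (ha k) (norm_cpt θ) h0 h1
  rcases le_total 0 (β k) with hb | hb
  · rw [min_eq_right hb, Real.rpow_zero, mul_one, abs_of_nonneg hb]
    refine Real.rpow_le_rpow (norm_nonneg _) ?_ hb
    have := norm_sub_le ((r : ℂ) * cpt θ) (a k)
    rw [ha] at this
    linarith
  · rw [min_eq_left hb, abs_of_nonpos hb]
    have : ‖(r : ℂ) * cpt θ - a k‖ ^ β k ≤ (‖cpt θ - a k‖ / 2) ^ β k :=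
      rpow_le_rpow_of_nonpos (by positivity) (by linarith) hb
    refine this.trans (le_of_eq ?_)
    rw [Real.div_rpow hp.le zero_le_two, rpow_neg zero_le_two, div_eq_inv_mul]

lemma abs_log_le {s : ℝ} (h0 : 0 < s) (h2 : s ≤ 2) : |Real.log s| ≤ 1 + 2 * s ^ (-(1 / 2 : ℝ)) := by
  have h3 : 0 < s ^ (-(1 / 2 : ℝ)) := Real.rpow_pos_of_pos h0 _
  have h4 := Real.log_le_sub_one_of_pos h0
  have h5 := Real.log_le_sub_one_of_pos h3
  rw [Real.log_rpow h0] at h5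
  exact abs_le.mpr ⟨by linarith, by linarith⟩

lemma exists_norm_szH_le (ha : ∀ k, ‖a k‖ = 1) (hΓ : DifferentiableOn ℂ Γ (ball 0 R))
    (hR : 1 < R) : ∃ C : ℝ, 0 ≤ C ∧ ∀ r : ℝ, 0 ≤ r → r < 1 → ∀ θ, (∀ k, cpt θ ≠ a k) →
      ‖szH Γ a β (r * cpt θ)‖ ≤ C + ∑ k, |β k| * (1 + π + 4 * ‖cpt θ - a k‖ ^ (-(1 / 2 : ℝ))) := by
  obtain ⟨M, hM0, hM⟩ := exists_norm_le_of_ball hΓ hR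
  refine ⟨M, hM0, fun r h0 h1 θ hne => ?_⟩
  have hr := (norm_radial h0 θ).trans_lt h1
  refine (norm_add_le _ _).trans (add_le_add (hM _ hr.le) ((norm_sum_le _ _).trans
    (sum_le_sum fun k _ => ?_)))
  rw [norm_mul, norm_real, norm_eq_abs]
  refine mul_le_mul_of_nonneg_left ?_ (abs_nonneg _)
  have hp : 0 < ‖cpt θ - a k‖ := norm_pos_iff.mpr (sub_ne_zero.mpr (hne k))
  have h2 := norm_sub_le_two_mul (ha k) (norm_cpt θ) h0 h1
  have h3 : ‖(r : ℂ) * cpt θ - a k‖ ≤ 2 := by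
    have := norm_sub_le ((r : ℂ) * cpt θ) (a k)
    rw [ha] at this
    linarith
  have h4 := norm_le_abs_re_add_abs_im (log (1 - conj (a k) * (r * cpt θ)))
  rw [log_re, log_im, norm_one_sub_conj_mul (ha k)] at h4
  have h5 := abs_arg_le_pi (1 - conj (a k) * (r * cpt θ))
  have h6 := abs_log_le (by linarith) h3
  have h7 : ‖(r : ℂ) * cpt θ - a k‖ ^ (-(1 / 2 : ℝ)) ≤ (‖cpt θ - a k‖ / 2) ^ (-(1 / 2 : ℝ)) :=
    rpow_le_rpow_of_nonpos (by positivity) (by linarith) (by norm_num)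
  have h8 : (‖cpt θ - a k‖ / 2) ^ (-(1 / 2 : ℝ)) ≤ 2 * ‖cpt θ - a k‖ ^ (-(1 / 2 : ℝ)) := by
    rw [Real.div_rpow hp.le zero_le_two, rpow_neg zero_le_two, div_inv_eq_mul, mul_comm]
    refine mul_le_mul_of_nonneg_right ?_ (by positivity)
    have := Real.rpow_le_rpow_of_exponent_le one_le_two (show (1 / 2 : ℝ) ≤ 1 by norm_num)
    simpa using this
  linarith

end SzegoFunction

section Hardy

variable {ι : Type*} [Fintype ι] {Γ : ℂ → ℂ} {a : ι → ℂ} {β : ι → ℝ} {R : ℝ} {g : ℝ → ℝ}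

/-- The weight has the form `|szD|²` on the circle. -/
structure IsSzData (Γ : ℂ → ℂ) (a : ι → ℂ) (β : ι → ℝ) (R : ℝ) (g : ℝ → ℝ) : Prop where
  norm_a : ∀ k, ‖a k‖ = 1
  inj : Function.Injective a
  beta : ∀ k, -(1 / 2 : ℝ) < β k
  one_lt : 1 < R
  diff : DifferentiableOn ℂ Γ (ball 0 R)
  weight : ∀ θ, g θ = rexp (2 * (Γ (cpt θ)).re)

namespace IsSzData

lemma continuous_weight (S : IsSzData Γ a β R g) : Continuous g := by
  have : g = fun θ => rexp (2 * (Γ (cpt θ)).re) := funext S.weight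
  rw [this]
  have h : Continuous fun θ => Γ (cpt θ) := S.diff.continuousOn.comp_continuous continuous_cpt
    fun θ => by rw [mem_ball_zero_iff, norm_cpt]; exact S.one_lt
  exact Real.continuous_exp.comp (continuous_const.mul (continuous_re.comp h))

lemma weight_pos (S : IsSzData Γ a β R g) (θ : ℝ) : 0 < g θ := by
  rw [S.weight]; exact exp_pos _

lemma isFiniteMeasure (S : IsSzData Γ a β R g) : IsFiniteMeasure (wtν g a β) :=
  isFiniteMeasure_wtν S.continuous_weight S.norm_a S.inj S.beta

lemma integrable_bound (S : IsSzData Γ a β R g) :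
    Integrable (fun θ => ∏ k, ‖cpt θ - a k‖ ^ min (β k) 0) arcμ :=
  integrable_prod_rpow S.norm_a S.inj fun k => lt_min (by linarith [S.beta k]) (by norm_num)

lemma differentiableAt_szD (S : IsSzData Γ a β R g) {z : ℂ} (hz : ‖z‖ ≤ 1) (hne : ∀ k, z ≠ a k) :
    DifferentiableAt ℂ (szD Γ a β) z :=
  (differentiableAt_szH S.norm_a (differentiableAt_of_ball S.diff S.one_lt hz) hz hne).cexp

/-- Hypotheses of `cauchy_of_dominated` for `Q * szD - c`. -/
lemma dominated (S : IsSzData Γ a β R g) (P : ℂ[X]) (c : ℂ) :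
    DifferentiableOn ℂ (fun z => P.eval z * szD Γ a β z - c) (ball 0 1) ∧
    (∃ G : ℝ → ℝ, Integrable G arcμ ∧ ∀ r : ℝ, 0 ≤ r → r < 1 → ∀ᵐ θ ∂arcμ,
      ‖P.eval (r * cpt θ) * szD Γ a β (r * cpt θ) - c‖ ≤ G θ) ∧
    ∀ᵐ θ ∂arcμ, ContinuousAt (fun z => P.eval z * szD Γ a β z - c) (cpt θ) := by
  refine ⟨fun z hz => ?_, ?_, ?_⟩
  · have hz := mem_ball_zero_iff.mp hz
    exact ((P.differentiable z).mul (S.differentiableAt_szD hz.le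
      fun k => ne_of_norm_lt_one (S.norm_a k) hz)).sub_const c |>.differentiableWithinAt
  · obtain ⟨M, hM⟩ := (isCompact_closedBall (0 : ℂ) 1).exists_bound_of_continuousOn
      (f := fun z => P.eval z) P.continuous.continuousOn
    obtain ⟨C, hC0, hC⟩ := exists_norm_szD_le (β := β) S.norm_a S.diff S.one_lt
    refine ⟨_, ((S.integrable_bound.const_mul C).const_mul M).add (integrable_const ‖c‖),
      fun r h0 h1 => ?_⟩
    filter_upwards [ae_ne_all a] with θ hθ
    refine (norm_sub_le _ _).trans (add_le_add ?_ le_rfl)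
    rw [norm_mul]
    have hr : (r : ℂ) * cpt θ ∈ closedBall (0 : ℂ) 1 :=
      mem_closedBall_zero_iff.mpr ((norm_radial h0 θ).trans_le h1.le)
    exact mul_le_mul (hM _ hr) (hC r h0 h1 θ hθ) (norm_nonneg _) ((norm_nonneg _).trans (hM _ hr))
  · filter_upwards [ae_ne_all a] with θ hθ
    exact (((P.differentiable _).mul (S.differentiableAt_szD (norm_cpt θ).le hθ)).sub_const
      c).continuousAt

lemma integrable_mul_szD (S : IsSzData Γ a β R g) (P : ℂ[X]) :
    Integrable (fun θ => P.eval (cpt θ) * szD Γ a β (cpt θ)) arcμ := by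
  obtain ⟨h1, ⟨G, hG, hb⟩, hl⟩ := S.dominated P 0
  simpa using integrable_of_dominated h1 hG hb hl

lemma integral_mul_szD (S : IsSzData Γ a β R g) (P : ℂ[X]) :
    ∫ θ, P.eval (cpt θ) * szD Γ a β (cpt θ) ∂arcμ = P.eval 0 * szD Γ a β 0 := by
  obtain ⟨h1, ⟨G, hG, hb⟩, hl⟩ := S.dominated P 0
  simpa using mean_of_dominated h1 hG hb hl

lemma norm_sq_mul_szD (S : IsSzData Γ a β R g) (P : ℂ[X]) :
    (fun θ => ‖P.eval (cpt θ) * szD Γ a β (cpt θ)‖ ^ 2) =ᵐ[arcμ]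
      fun θ => wtF g a β θ • ‖P.eval (cpt θ)‖ ^ 2 := by
  filter_upwards [ae_ne_all a] with θ hθ
  rw [norm_mul, mul_pow, norm_szD_sq S.norm_a S.weight hθ, mul_comm, smul_eq_mul]

lemma integrable_sq_mul_szD (S : IsSzData Γ a β R g) (P : ℂ[X]) :
    Integrable (fun θ => ‖P.eval (cpt θ) * szD Γ a β (cpt θ)‖ ^ 2) arcμ := by
  have := S.isFiniteMeasure
  refine (Integrable.congr ?_ (S.norm_sq_mul_szD P).symm)
  rw [← integrable_wtν S.continuous_weight S.weight_pos]
  exact integrable_of_continuousOn_sphere (f := fun z => ‖P.eval z‖ ^ 2) (by fun_prop)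

lemma integral_sq_mul_szD (S : IsSzData Γ a β R g) (P : ℂ[X]) :
    ∫ θ, ‖P.eval (cpt θ) * szD Γ a β (cpt θ)‖ ^ 2 ∂arcμ =
      ∫ θ, ‖P.eval (cpt θ)‖ ^ 2 ∂(wtν g a β) := by
  rw [integral_wtν S.continuous_weight S.weight_pos, integral_congr_ae (S.norm_sq_mul_szD P)]

lemma sub_sq_aux (S : IsSzData Γ a β R g) (P : ℂ[X]) :
    Integrable (fun θ => ‖P.eval (cpt θ) * szD Γ a β (cpt θ) - P.eval 0 * szD Γ a β 0‖ ^ 2) arcμ ∧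
    ∫ θ, ‖P.eval (cpt θ) * szD Γ a β (cpt θ) - P.eval 0 * szD Γ a β 0‖ ^ 2 ∂arcμ =
      (∫ θ, ‖P.eval (cpt θ)‖ ^ 2 ∂(wtν g a β)) - ‖P.eval 0 * szD Γ a β 0‖ ^ 2 := by
  set c := P.eval 0 * szD Γ a β 0 with hc
  have e : ∀ u : ℂ, ‖u - c‖ ^ 2 = ‖u‖ ^ 2 - 2 * (conj c * u).re + ‖c‖ ^ 2 := fun u => by
    simp only [Complex.sq_norm, normSq_apply, sub_re, sub_im,
      mul_re, conj_re, conj_im]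
    ring
  simp_rw [e]
  have i1 := S.integrable_sq_mul_szD P
  have i2 : Integrable (fun θ => conj c * (P.eval (cpt θ) * szD Γ a β (cpt θ))) arcμ :=
    (S.integrable_mul_szD P).const_mul _
  have i3 : Integrable (fun θ => 2 * (conj c * (P.eval (cpt θ) * szD Γ a β (cpt θ))).re) arcμ :=
    i2.re.const_mul 2
  refine ⟨(i1.sub i3).add (integrable_const _), ?_⟩
  have h1 : ∫ θ, (conj c * (P.eval (cpt θ) * szD Γ a β (cpt θ))).re ∂arcμ = ‖c‖ ^ 2 := by
    have := integral_re i2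
    simp only [RCLike.re_to_complex] at this
    rw [this, integral_const_mul, S.integral_mul_szD, ← hc, conj_mul']
    norm_cast
  have i5 : Integrable (fun θ => ‖P.eval (cpt θ) * szD Γ a β (cpt θ)‖ ^ 2 -
      2 * (conj c * (P.eval (cpt θ) * szD Γ a β (cpt θ))).re) arcμ := i1.sub i3
  rw [integral_add i5 (integrable_const _), integral_sub i1 i3, integral_const_mul, h1,
    S.integral_sq_mul_szD]
  simp
  ring

lemma norm_sub_sq_le (S : IsSzData Γ a β R g) (P : ℂ[X]) {z : ℂ} (hz : ‖z‖ < 1) :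
    ‖P.eval z * szD Γ a β z - P.eval 0 * szD Γ a β 0‖ ^ 2 ≤
      ((∫ θ, ‖P.eval (cpt θ)‖ ^ 2 ∂(wtν g a β)) - ‖P.eval 0 * szD Γ a β 0‖ ^ 2) *
        (1 - ‖z‖ ^ 2)⁻¹ := by
  obtain ⟨h1, ⟨G, hG, hb⟩, hl⟩ := S.dominated P (P.eval 0 * szD Γ a β 0)
  rw [← (S.sub_sq_aux P).2]
  exact norm_sq_le_of_dominated h1 hG hb hl (S.sub_sq_aux P).1 hz

variable {Φ : ℕ → ℂ[X]}

lemma integral_sq_rv (H : IsOPUC (wtν g a β) Φ) [IsFiniteMeasure (wtν g a β)] (n : ℕ) :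
    ∫ θ, ‖(rv Φ n).eval (cpt θ)‖ ^ 2 ∂(wtν g a β) = opN (wtν g a β) Φ n := by
  rw [IsOPUC.opN_eq_integral]
  refine integral_congr_ae (.of_forall fun θ => ?_)
  simp only [H.norm_rv_eval _ (norm_cpt θ)]

lemma szD_zero_sq_le (S : IsSzData Γ a β R g) (H : IsOPUC (wtν g a β) Φ) (n : ℕ) :
    ‖szD Γ a β 0‖ ^ 2 ≤ opN (wtν g a β) Φ n := by
  have := S.isFiniteMeasure
  have h := (S.sub_sq_aux (rv Φ n)).2
  rw [integral_sq_rv H, H.rv_zero, one_mul] at h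
  have h0 : 0 ≤ ∫ θ, ‖(rv Φ n).eval (cpt θ) * szD Γ a β (cpt θ) - szD Γ a β 0‖ ^ 2 ∂arcμ :=
    integral_nonneg fun θ => by positivity
  linarith

lemma norm_rv_mul_szD_sub_sq_le (S : IsSzData Γ a β R g) (H : IsOPUC (wtν g a β) Φ) (n : ℕ)
    {z : ℂ} (hz : ‖z‖ < 1) : ‖(rv Φ n).eval z * szD Γ a β z - szD Γ a β 0‖ ^ 2 ≤
      (opN (wtν g a β) Φ n - ‖szD Γ a β 0‖ ^ 2) * (1 - ‖z‖ ^ 2)⁻¹ := by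
  have := S.isFiniteMeasure
  have h := S.norm_sub_sq_le (rv Φ n) hz
  rwa [integral_sq_rv H, H.rv_zero, one_mul] at h

end IsSzData

/-- Extremal property of the reversed polynomials. -/
lemma IsOPUC.opN_le_integral {ν : Measure ℝ} [IsFiniteMeasure ν] {Φ : ℕ → ℂ[X]} (H : IsOPUC ν Φ)
    {n : ℕ} {P : ℂ[X]} (hP : P.natDegree ≤ n) (h0 : P.eval 0 = 1) :
    opN ν Φ n ≤ ∫ θ, ‖P.eval (cpt θ)‖ ^ 2 ∂ν := by
  have h1 : cI ν (fun z => (rv Φ n).eval z * conj ((P - rv Φ n).eval z)) = 0 := by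
    refine H.orth_rv_poly ?_ ((natDegree_sub_le _ _).trans (max_le hP (H.natDegree_rv n)))
    rw [eval_sub, h0, H.rv_zero, sub_self]
  have i1 : Integrable (fun θ => ‖(rv Φ n).eval (cpt θ)‖ ^ 2) ν :=
    integrable_of_continuousOn_sphere (f := fun z => ‖(rv Φ n).eval z‖ ^ 2) (by fun_prop)
  have i2 : Integrable (fun θ => (rv Φ n).eval (cpt θ) * conj ((P - rv Φ n).eval (cpt θ))) ν :=
    integrable_of_continuousOn_sphere
      (f := fun z => (rv Φ n).eval z * conj ((P - rv Φ n).eval z)) (by fun_prop)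
  have i3 : Integrable (fun θ => ‖P.eval (cpt θ)‖ ^ 2) ν :=
    integrable_of_continuousOn_sphere (f := fun z => ‖P.eval z‖ ^ 2) (by fun_prop)
  have i4 : Integrable (fun θ => 2 * ((rv Φ n).eval (cpt θ) *
      conj ((P - rv Φ n).eval (cpt θ))).re) ν := i2.re.const_mul 2
  have h2 : ∫ θ, ((rv Φ n).eval (cpt θ) * conj ((P - rv Φ n).eval (cpt θ))).re ∂ν = 0 := by
    have := integral_re i2
    simp only [RCLike.re_to_complex] at this
    rw [this]
    exact congrArg Complex.re h1
  have h3 : opN ν Φ n = ∫ θ, (‖(rv Φ n).eval (cpt θ)‖ ^ 2 +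
      2 * ((rv Φ n).eval (cpt θ) * conj ((P - rv Φ n).eval (cpt θ))).re) ∂ν := by
    rw [integral_add i1 i4, integral_const_mul, h2, mul_zero, add_zero, IsOPUC.opN_eq_integral]
    refine integral_congr_ae (.of_forall fun θ => ?_)
    simp only [H.norm_rv_eval _ (norm_cpt θ)]
  rw [h3]
  refine integral_mono (i1.add i4) i3 fun θ => ?_
  simp only [eval_sub]
  set u := (rv Φ n).eval (cpt θ)
  set v := P.eval (cpt θ)
  have : ‖v‖ ^ 2 = ‖u‖ ^ 2 + 2 * (u * conj (v - u)).re + ‖v - u‖ ^ 2 := by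
    simp only [Complex.sq_norm, normSq_apply, sub_re, sub_im,
      mul_re, conj_re, conj_im]
    ring
  have h4 : 0 ≤ ‖v - u‖ ^ 2 := by positivity
  linarith

end Hardy

section Binomial

/-- `(γ + N) ⋯ γ / N!`. -/
noncomputable def binC (γ : ℝ) : ℕ → ℝ
  | 0 => γ
  | N + 1 => binC γ N * (N + 1 + γ) / (N + 1)

/-- Truncated binomial series of `(1 - X) ^ (-γ)`. -/
noncomputable def binP (γ : ℝ) : ℕ → ℂ[X]
  | 0 => 1
  | N + 1 => binP γ N + C ((binC γ N / (N + 1) : ℝ) : ℂ) * X ^ (N + 1)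

lemma natDegree_binP (γ : ℝ) (N : ℕ) : (binP γ N).natDegree ≤ N := by
  induction N with
  | zero => simp [binP]
  | succ N ih =>
    exact (natDegree_add_le _ _).trans (max_le (ih.trans N.le_succ) (natDegree_C_mul_X_pow_le _ _))

lemma binP_eval_zero (γ : ℝ) (N : ℕ) : (binP γ N).eval 0 = 1 := by
  induction N with
  | zero => simp [binP]
  | succ N ih => simp [binP, ih]

lemma binP_ode (γ : ℝ) (N : ℕ) :
    (1 - X) * derivative (binP γ N) - C (γ : ℂ) * binP γ N = -C (binC γ N : ℂ) * X ^ N := by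
  induction N with
  | zero => simp [binP, binC]
  | succ N ih =>
    have hN : (N : ℂ) + 1 ≠ 0 := by exact_mod_cast N.succ_ne_zero
    have e1 : C (((binC γ N / (N + 1) : ℝ) : ℂ)) * (C ((N : ℂ) + 1)) = C (binC γ N : ℂ) := by
      rw [← C_mul]; congr 1; push_cast; field_simp
    have e2 : C ((binC γ (N + 1) : ℝ) : ℂ) =
        C (((binC γ N / (N + 1) : ℝ) : ℂ)) * (C ((N : ℂ) + 1) + C (γ : ℂ)) := by
      rw [← C_add, ← C_mul]; congr 1; rw [binC]; push_cast; field_simp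
    rw [binP, derivative_add, derivative_C_mul_X_pow, e2]
    simp only [Nat.cast_add, Nat.cast_one, Nat.add_sub_cancel, C_mul]
    linear_combination ih + X ^ N * e1

lemma binC_eq_prod (γ : ℝ) (N : ℕ) :
    binC γ N * N.factorial = ∏ j ∈ Finset.range (N + 1), (γ + j) := by
  induction N with
  | zero => simp [binC]
  | succ N ih =>
    rw [Finset.prod_range_succ, ← ih, binC, Nat.factorial_succ]
    push_cast
    field_simp
    ring

lemma exists_abs_binC_le {γ : ℝ} (h0 : γ ≠ 0) (h1 : |γ| < 1) :
    ∃ C : ℝ, 0 ≤ C ∧ ∀ N : ℕ, 0 < N → |binC γ N| ≤ C * (N : ℝ) ^ γ := by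
  have hne : ∀ m : ℕ, γ ≠ -m := by
    intro m h
    rcases Nat.eq_zero_or_pos m with rfl | hm
    · simp at h; exact h0 h
    · have : (1 : ℝ) ≤ m := by exact_mod_cast hm
      rw [h, abs_neg, abs_of_nonneg (by linarith)] at h1
      linarith
  have ht := ((Real.GammaSeq_tendsto_Gamma γ).inv₀ (Real.Gamma_ne_zero hne)).abs
  obtain ⟨C, hC⟩ := ht.bddAbove_range
  refine ⟨C, (abs_nonneg _).trans (hC ⟨0, rfl⟩), fun N hN => ?_⟩
  have h : |(Real.GammaSeq γ N)⁻¹| ≤ C := hC ⟨N, rfl⟩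
  have hN' : (0 : ℝ) < (N : ℝ) ^ γ := Real.rpow_pos_of_pos (by exact_mod_cast hN) _
  have e : (Real.GammaSeq γ N)⁻¹ = binC γ N / (N : ℝ) ^ γ := by
    rw [Real.GammaSeq, ← binC_eq_prod, inv_div]
    have : (N.factorial : ℝ) ≠ 0 := by exact_mod_cast N.factorial_ne_zero
    field_simp
  rw [e, abs_div, abs_of_pos hN', div_le_iff₀ hN'] at h
  exact h

lemma integral_pow_mul_rpow_le {b : ℝ} (hb : 0 < b) {N : ℕ} (hN : 0 < N) :
    IntervalIntegrable (fun u : ℝ => (1 - u) ^ N * u ^ (b - 1)) volume 0 1 ∧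
    ∫ u in (0 : ℝ)..1, (1 - u) ^ N * u ^ (b - 1) ≤ Real.Gamma b * (N : ℝ) ^ (-b) := by
  have hN' : (0 : ℝ) < N := by exact_mod_cast hN
  have i0 : IntervalIntegrable (fun u : ℝ => u ^ (b - 1)) volume 0 1 :=
    intervalIntegral.intervalIntegrable_rpow' (by linarith)
  have i1 : IntervalIntegrable (fun u : ℝ => (1 - u) ^ N * u ^ (b - 1)) volume 0 1 :=
    i0.continuousOn_mul (by fun_prop)
  refine ⟨i1, ?_⟩
  have i2 : IntegrableOn (fun u : ℝ => u ^ (b - 1) * rexp (-(N * u))) (Ioi 0) := by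
    have := integrableOn_rpow_mul_exp_neg_mul_rpow (p := 1) (s := b - 1) (b := N) (by linarith)
      one_pos hN'
    simpa [neg_mul] using this
  have h1 := Real.integral_rpow_mul_exp_neg_mul_Ioi hb hN'
  have e : (1 / (N : ℝ)) ^ b = (N : ℝ) ^ (-b) := by
    rw [one_div, Real.inv_rpow hN'.le, rpow_neg hN'.le]
  rw [e, mul_comm] at h1
  rw [← h1, intervalIntegral.integral_of_le zero_le_one]
  refine (setIntegral_mono_on i1.1 (i2.mono_set Ioc_subset_Ioi_self) measurableSet_Ioc
    fun u hu => ?_).trans (setIntegral_mono_set i2 ?_ Ioc_subset_Ioi_self.eventuallyLE)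
  · rw [mul_comm]
    refine mul_le_mul_of_nonneg_left ?_ (Real.rpow_nonneg hu.1.le _)
    rw [← mul_neg, Real.exp_nat_mul]
    refine pow_le_pow_left₀ (by linarith [hu.2]) ?_ N
    have := add_one_le_exp (-u)
    linarith
  · exact (ae_restrict_iff' measurableSet_Ioi).mpr (.of_forall fun u (hu : 0 < u) => by
      simp only [Pi.zero_apply]; positivity)

lemma exists_binP_bound {γ κ : ℝ} (h0 : γ ≠ 0) (h1 : |γ| < 1) (hκ0 : 0 ≤ κ) (hκ1 : -γ < κ)
    (hκ2 : κ ≤ 1 - γ) : ∃ C : ℝ, 0 ≤ C ∧ ∀ N : ℕ, 0 < N → ∀ ζ : ℂ, ‖ζ‖ = 1 → ζ ≠ 1 →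
      ‖(binP γ N).eval ζ * exp (γ * log (1 - ζ)) - 1‖ ≤ C * (N * ‖ζ - 1‖) ^ (-κ) := by
  obtain ⟨A, hA0, hA⟩ := exists_abs_binC_le h0 h1
  have hb : 0 < γ + κ := by linarith
  have hΓ := Real.Gamma_pos_of_pos hb
  refine ⟨A * 2 ^ κ * Real.Gamma (γ + κ), by positivity, fun N hN ζ hζ hne => ?_⟩
  have hN' : (0 : ℝ) < N := by exact_mod_cast hN
  have hd : 0 < ‖ζ - 1‖ := norm_pos_iff.mpr (sub_ne_zero.mpr hne)
  have hsl : ∀ u ∈ Icc (0 : ℝ) 1, 1 - (1 - (u : ℂ)) * ζ ∈ slitPlane := by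
    intro u hu
    have h := one_sub_conj_mul_mem_slitPlane (a := 1) (z := (1 - (u : ℂ)) * ζ) (by simp) ?_ ?_
    · simpa using h
    · rw [norm_mul, hζ, mul_one, ← ofReal_one, ← ofReal_sub, norm_real,
        norm_of_nonneg (by linarith [hu.2])]
      linarith [hu.1]
    · intro h
      have h2 := congrArg norm h
      rw [norm_mul, hζ, mul_one, ← ofReal_one, ← ofReal_sub, norm_real,
        norm_of_nonneg (by linarith [hu.2]), norm_real, norm_one] at h2
      have h3 : u = 0 := by linarith
      rw [h3] at h
      exact hne (by simpa using h)
  set f : ℝ → ℂ := fun u => (binP γ N).eval ((1 - (u : ℂ)) * ζ) *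
    exp (γ * log (1 - (1 - (u : ℂ)) * ζ)) with hf
  set f' : ℝ → ℂ := fun u => binC γ N * ζ ^ (N + 1) * (1 - (u : ℂ)) ^ N *
    exp ((γ - 1) * log (1 - (1 - (u : ℂ)) * ζ)) with hf'
  have hderiv : ∀ u ∈ Icc (0 : ℝ) 1, HasDerivAt f (f' u) u := by
    intro u hu
    have hs := hsl u hu
    have d1 : HasDerivAt (fun z : ℂ => (1 - z) * ζ) (-ζ) (u : ℂ) := by
      simpa using ((hasDerivAt_id (u : ℂ)).const_sub 1).mul_const ζ
    have d2 : HasDerivAt (fun z : ℂ => (binP γ N).eval ((1 - z) * ζ))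
        ((derivative (binP γ N)).eval ((1 - u) * ζ) * (-ζ)) (u : ℂ) :=
      ((binP γ N).hasDerivAt _).comp (u : ℂ) d1
    have d3 : HasDerivAt (fun z : ℂ => log (1 - (1 - z) * ζ))
        (ζ / (1 - (1 - (u : ℂ)) * ζ)) (u : ℂ) := by
      have := (d1.const_sub 1).clog hs
      simpa using this
    have d4 := (d2.mul (d3.const_mul (γ : ℂ)).cexp).comp_ofReal
    refine d4.congr_deriv ?_
    have ho := congrArg (fun P => eval ((1 - (u : ℂ)) * ζ) P) (binP_ode γ N)
    simp only [eval_sub, eval_mul, eval_one, eval_X, eval_C, eval_neg, eval_pow] at ho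
    have hw : 1 - (1 - (u : ℂ)) * ζ ≠ 0 := slitPlane_ne_zero hs
    have hE : exp (((γ : ℂ) - 1) * log (1 - (1 - (u : ℂ)) * ζ)) =
        exp (γ * log (1 - (1 - (u : ℂ)) * ζ)) / (1 - (1 - (u : ℂ)) * ζ) := by
      rw [sub_mul, one_mul, exp_sub, exp_log hw]
    simp only [hf']
    rw [hE]
    generalize (derivative (binP γ N)).eval ((1 - (u : ℂ)) * ζ) = P' at *
    generalize (binP γ N).eval ((1 - (u : ℂ)) * ζ) = P at *
    generalize exp (γ * log (1 - (1 - (u : ℂ)) * ζ)) = E at *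
    have ho' : (1 - (1 - (u : ℂ)) * ζ) * P' - γ * P = -(binC γ N) * ((1 - u) ^ N * ζ ^ N) := by
      rw [ho, mul_pow]
    generalize 1 - (1 - (u : ℂ)) * ζ = w at *
    field_simp
    linear_combination -(E * ζ) * ho'
  have hcont : ContinuousOn f' (Icc 0 1) := by
    have hl : ContinuousOn (fun u : ℝ => log (1 - (1 - (u : ℂ)) * ζ)) (Icc 0 1) :=
      ContinuousOn.clog (by fun_prop) hsl
    refine ContinuousOn.mul (by fun_prop) ?_
    exact continuous_exp.comp_continuousOn (continuousOn_const.mul hl)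
  have hint : IntervalIntegrable f' volume 0 1 :=
    (hcont.mono (by rw [uIcc_of_le zero_le_one])).intervalIntegrable
  have hmain := intervalIntegral.integral_eq_sub_of_hasDerivAt
    (fun u hu => hderiv u (by rwa [uIcc_of_le zero_le_one] at hu)) hint
  have e1 : f 1 = 1 := by simp [hf, binP_eval_zero]
  have e0 : f 0 = (binP γ N).eval ζ * exp (γ * log (1 - ζ)) := by simp [hf]
  have e2 : ‖(binP γ N).eval ζ * exp (γ * log (1 - ζ)) - 1‖ =
      ‖∫ u in (0 : ℝ)..1, f' u‖ := by rw [hmain, e1, e0, norm_sub_rev]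
  rw [e2]
  obtain ⟨j1, j2⟩ := integral_pow_mul_rpow_le hb hN
  have hbound : ∀ u ∈ Ioc (0 : ℝ) 1, ‖f' u‖ ≤ A * (N : ℝ) ^ γ * (2 ^ κ * ‖ζ - 1‖ ^ (-κ)) *
      ((1 - u) ^ N * u ^ (γ + κ - 1)) := by
    intro u hu
    have hw : 1 - (1 - (u : ℂ)) * ζ ≠ 0 := slitPlane_ne_zero (hsl u ⟨hu.1.le, hu.2⟩)
    set w := 1 - (1 - (u : ℂ)) * ζ with hwd
    have hwp : 0 < ‖w‖ := norm_pos_iff.mpr hw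
    have hc : ((1 - u : ℝ) : ℂ) = 1 - (u : ℂ) := by push_cast; rfl
    have n1 : ‖1 - (u : ℂ)‖ = 1 - u := by
      rw [← hc, Complex.norm_of_nonneg (by linarith [hu.2])]
    have n2 : ‖exp (((γ : ℂ) - 1) * log w)‖ = ‖w‖ ^ (γ - 1) := by
      rw [norm_exp, show ((γ : ℂ) - 1) = ((γ - 1 : ℝ) : ℂ) by push_cast; rfl,
        re_ofReal_mul, log_re, Real.rpow_def_of_pos hwp, mul_comm]
    have w1 : u ≤ ‖w‖ := by
      have := norm_sub_norm_le (1 : ℂ) ((1 - (u : ℂ)) * ζ)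
      rw [norm_one, norm_mul, hζ, n1] at this
      linarith
    have w2 : ‖ζ - 1‖ / 2 ≤ ‖w‖ := by
      have := norm_sub_le_two_mul (a := 1) (by simp) hζ (r := 1 - u) (by linarith [hu.2])
        (by linarith [hu.1])
      rw [hc, ← norm_sub_rev 1 ((1 - (u : ℂ)) * ζ)] at this
      linarith
    have w3 : ‖w‖ ^ (γ - 1) ≤ 2 ^ κ * ‖ζ - 1‖ ^ (-κ) * u ^ (γ + κ - 1) := by
      rw [show γ - 1 = -κ + (γ + κ - 1) by ring, rpow_add hwp]
      refine mul_le_mul ?_ (rpow_le_rpow_of_nonpos hu.1 w1 (by linarith)) (by positivity)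
        (by positivity)
      refine (rpow_le_rpow_of_nonpos (by positivity) w2 (by linarith)).trans (le_of_eq ?_)
      rw [Real.div_rpow hd.le zero_le_two, rpow_neg zero_le_two, div_inv_eq_mul, mul_comm]
    simp only [hf']
    rw [norm_mul, norm_mul, norm_mul, norm_pow, norm_pow, hζ, one_pow, mul_one, n1, n2,
      norm_real, norm_eq_abs]
    have hp : 0 ≤ (1 - u) ^ N := pow_nonneg (by linarith [hu.2]) _
    calc |binC γ N| * (1 - u) ^ N * ‖w‖ ^ (γ - 1)
        ≤ (A * (N : ℝ) ^ γ) * (1 - u) ^ N * (2 ^ κ * ‖ζ - 1‖ ^ (-κ) * u ^ (γ + κ - 1)) :=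
          mul_le_mul (mul_le_mul_of_nonneg_right (hA N hN) hp) w3 (by positivity)
            (mul_nonneg (by positivity) hp)
      _ = _ := by ring
  refine (intervalIntegral.norm_integral_le_of_norm_le zero_le_one (.of_forall hbound)
    (j1.const_mul _)).trans ?_
  rw [intervalIntegral.integral_const_mul]
  refine (mul_le_mul_of_nonneg_left j2 (by positivity)).trans (le_of_eq ?_)
  rw [Real.mul_rpow hN'.le hd.le, show -κ = γ + -(γ + κ) by ring, rpow_add hN',
    show γ + -(γ + κ) = -κ by ring]
  ring

end Binomial

section Trial

lemma norm_prod_one_add_sub_one_le {ι : Type*} {B : ℝ} (hB : 0 ≤ B) {x : ι → ℂ} (s : Finset ι)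
    (h : ∀ j k, j ≠ k → ‖x j‖ ≤ B ∨ ‖x k‖ ≤ B) :
    ‖∏ k ∈ s, (1 + x k) - 1‖ ≤ (1 + B) ^ s.card * ∑ k ∈ s, ‖x k‖ := by
  classical
  induction s using Finset.induction_on with
  | empty => simp
  | insert k s hk ih =>
    rw [Finset.prod_insert hk, sum_insert hk, Finset.card_insert_of_notMem hk]
    set Q := ∏ k ∈ s, (1 + x k)
    set T := ∑ k ∈ s, ‖x k‖
    have hT : 0 ≤ T := sum_nonneg fun _ _ => norm_nonneg _
    have hp : 1 ≤ (1 + B) ^ s.card := one_le_pow₀ (by linarith)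
    have hx := norm_nonneg (x k)
    by_cases hs : ∀ j ∈ s, ‖x j‖ ≤ B
    · have h1 : ‖Q‖ ≤ (1 + B) ^ s.card := by
        rw [norm_prod, ← Finset.prod_const]
        refine Finset.prod_le_prod (fun _ _ => norm_nonneg _) fun j hj => ?_
        exact (norm_add_le _ _).trans (by rw [norm_one]; linarith [hs j hj])
      have e : (1 + x k) * Q - 1 = x k * Q + (Q - 1) := by ring
      rw [e]
      refine (norm_add_le _ _).trans ?_
      rw [norm_mul, pow_succ]
      have h2 := mul_le_mul_of_nonneg_left h1 hx
      have h3 : 0 ≤ (1 + B) ^ s.card * B * (‖x k‖ + T) := by positivity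
      linarith
    · push Not at hs
      obtain ⟨j, hj, hjB⟩ := hs
      have hkB : ‖x k‖ ≤ B := (h k j (by rintro rfl; exact hk hj)).resolve_right (not_le.mpr hjB)
      have e : (1 + x k) * Q - 1 = (1 + x k) * (Q - 1) + x k := by ring
      rw [e]
      refine (norm_add_le _ _).trans ?_
      rw [norm_mul, pow_succ]
      have h1 : ‖1 + x k‖ ≤ 1 + B := (norm_add_le _ _).trans (by rw [norm_one]; linarith)
      have h2 := mul_le_mul h1 ih (norm_nonneg _) (by linarith)
      have h3 : 1 ≤ (1 + B) ^ s.card * (1 + B) := by nlinarith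
      have h4 := mul_le_mul_of_nonneg_right h3 hx
      linarith

/-- Profile of the approximation error at a singularity. -/
noncomputable def errF (κ t : ℝ) : ℝ := if t ≤ 1 then t ^ (-κ) else t ^ (-(3 / 4 : ℝ))

lemma errF_nonneg {κ t : ℝ} (ht : 0 < t) : 0 ≤ errF κ t := by
  unfold errF; split_ifs <;> positivity

lemma measurable_errF (κ : ℝ) : Measurable (errF κ) :=
  Measurable.ite measurableSet_Iic (by fun_prop) (by fun_prop)

lemma antitoneOn_errF {κ : ℝ} (hκ : 0 ≤ κ) : AntitoneOn (errF κ) (Ioi 0) := by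
  intro x (hx : 0 < x) y hy hxy
  unfold errF
  split_ifs with h1 h2 h2
  · exact rpow_le_rpow_of_nonpos hx hxy (by linarith)
  · linarith
  · push Not at h1
    exact (Real.rpow_le_one_of_one_le_of_nonpos h1.le (by norm_num)).trans
      (Real.one_le_rpow_of_pos_of_le_one_of_nonpos hx h2 (by linarith))
  · exact rpow_le_rpow_of_nonpos hx hxy (by norm_num)

lemma integrableOn_errF_sq {κ : ℝ} (hκ : κ < 1 / 2) :
    IntegrableOn (fun t => errF κ t ^ 2) (Ioi 0) := by
  rw [← Ioc_union_Ioi_eq_Ioi zero_le_one, integrableOn_union]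
  constructor
  · have h : IntervalIntegrable (fun t : ℝ => t ^ (-(2 * κ))) volume 0 1 :=
      intervalIntegral.intervalIntegrable_rpow' (by linarith)
    refine h.1.congr_fun (fun t ht => ?_) measurableSet_Ioc
    simp only [errF, if_pos ht.2]
    rw [← rpow_natCast, ← rpow_mul ht.1.le]
    congr 1; push_cast; ring
  · have h : IntegrableOn (fun t : ℝ => t ^ (-(3 / 2) : ℝ)) (Ioi 1) :=
      integrableOn_Ioi_rpow_of_lt (by norm_num) one_pos
    refine h.congr_fun (fun t (ht : 1 < t) => ?_) measurableSet_Ioi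
    simp only [errF, if_neg (not_le.mpr ht)]
    rw [← rpow_natCast, ← rpow_mul (by linarith)]
    congr 1; push_cast; ring

lemma exists_integral_errF_sq_le {κ : ℝ} (hκ0 : 0 ≤ κ) (hκ : κ < 1 / 2) :
    ∃ K : ℝ, 0 ≤ K ∧ ∀ N : ℕ, 0 < N → ∀ a : ℂ, ‖a‖ = 1 →
      Integrable (fun θ => errF κ (N * ‖cpt θ - a‖) ^ 2) arcμ ∧
      ∫ θ, errF κ (N * ‖cpt θ - a‖) ^ 2 ∂arcμ ≤ K / N := by
  have hI := integrableOn_errF_sq hκ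
  set J := ∫ t in Ioi (0 : ℝ), errF κ t ^ 2 with hJ
  have hJ0 : 0 ≤ J := integral_nonneg fun t => by positivity
  refine ⟨π / 2 * J, by positivity, fun N hN a ha => ?_⟩
  have hN' : (0 : ℝ) < N := by exact_mod_cast hN
  set c : ℝ := N * (2 / π) with hc
  have hc0 : 0 < c := by positivity
  have i1 : IntegrableOn (fun s => errF κ (c * s) ^ 2) (Ioi 0) := by
    have := (integrableOn_Ioi_comp_mul_left_iff (fun t => errF κ t ^ 2) 0 hc0).mpr (by simpa using hI)
    exact this
  have e1 : ∫ s in Ioi (0 : ℝ), errF κ (c * s) ^ 2 = c⁻¹ * J := by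
    have := integral_comp_mul_left_Ioi (fun t => errF κ t ^ 2) 0 hc0
    simpa using this
  have hanti : AntitoneOn (fun t : ℝ => ENNReal.ofReal (errF κ (N * t) ^ 2)) (Ioi 0) := by
    intro x (hx : 0 < x) y (hy : 0 < y) hxy
    have hx' : (0 : ℝ) < N * x := by positivity
    have hy' : (0 : ℝ) < N * y := by positivity
    exact ENNReal.ofReal_le_ofReal (pow_le_pow_left₀ (errF_nonneg hy')
      (antitoneOn_errF hκ0 hx' hy' (mul_le_mul_of_nonneg_left hxy hN'.le)) 2)
  have hle : ∫⁻ θ, ENNReal.ofReal (errF κ (N * ‖cpt θ - a‖) ^ 2) ∂arcμ ≤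
      ENNReal.ofReal (c⁻¹ * J) := by
    refine (lintegral_arcμ_norm_sub_le hanti ha).trans ?_
    rw [← e1, ofReal_integral_eq_lintegral_ofReal i1 (.of_forall fun s => by positivity)]
    refine (lintegral_mono_set Ioc_subset_Ioi_self).trans (lintegral_mono fun s => ?_)
    rw [hc, mul_assoc]
  have hm : AEStronglyMeasurable (fun θ => errF κ (N * ‖cpt θ - a‖) ^ 2) arcμ := by
    have h1 : Continuous fun θ => (N : ℝ) * ‖cpt θ - a‖ := by fun_prop
    exact (((measurable_errF κ).comp h1.measurable).pow_const 2).aestronglyMeasurable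
  have hi : Integrable (fun θ => errF κ (N * ‖cpt θ - a‖) ^ 2) arcμ := by
    refine ⟨hm, ?_⟩
    rw [hasFiniteIntegral_iff_ofReal (.of_forall fun θ => by positivity)]
    exact hle.trans_lt ENNReal.ofReal_lt_top
  refine ⟨hi, ?_⟩
  rw [← ENNReal.ofReal_le_ofReal_iff (by positivity),
    ofReal_integral_eq_lintegral_ofReal hi (.of_forall fun s => by positivity)]
  refine hle.trans (le_of_eq ?_)
  congr 1
  rw [hc]; field_simp

lemma exists_factor_bound {β : ℝ} (hβ0 : β ≠ 0) (hβ : -(1 / 2) < β) {l : ℕ} (hl : 4 * |β| < l) :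
    ∃ κ : ℝ, 0 ≤ κ ∧ κ < 1 / 2 ∧ ∃ C : ℝ, 0 ≤ C ∧ ∀ N : ℕ, 0 < N → ∀ ζ : ℂ, ‖ζ‖ = 1 → ζ ≠ 1 →
      ‖(binP (β / l) N).eval ζ ^ l * exp (β * log (1 - ζ)) - 1‖ ≤
        C * errF κ (N * ‖ζ - 1‖) := by
  have hl0 : (0 : ℝ) < l := lt_of_le_of_lt (by positivity) hl
  have hl1 : (1 : ℝ) ≤ l := by
    have : 0 < l := by exact_mod_cast hl0
    exact_mod_cast this
  set γ := β / l with hγ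
  set κ := (max 0 (-β) + 1 / 2) / 2 with hκ
  have hm : max 0 (-β) < 1 / 2 := max_lt (by norm_num) (by linarith)
  have hm0 := le_max_left 0 (-β)
  have hm1 := le_max_right 0 (-β)
  have hγ4 : |γ| < 1 / 4 := by
    rw [hγ, abs_div, abs_of_pos hl0, div_lt_iff₀ hl0]; linarith
  obtain ⟨g1, g2⟩ := abs_lt.mp hγ4
  have hγ0 : γ ≠ 0 := div_ne_zero hβ0 hl0.ne'
  have hκl : κ / l ≤ 1 / 2 := by
    rw [div_le_iff₀ hl0]; linarith
  obtain ⟨C1, hC1, h1⟩ := exists_binP_bound (γ := γ) (κ := κ / l) hγ0 (by linarith)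
    (div_nonneg (by linarith) hl0.le) (by rw [hγ, ← neg_div]; gcongr; linarith) (by linarith)
  obtain ⟨C2, hC2, h2⟩ := exists_binP_bound (γ := γ) (κ := 3 / 4) hγ0 (by linarith)
    (by norm_num) (by linarith) (by linarith)
  have hpow : ∀ u : ℂ, ‖(1 + u) ^ l - 1‖ ≤ l * (1 + ‖u‖) ^ (l - 1) * ‖u‖ := by
    intro u
    have hgs := (Commute.all (1 + u) 1).mul_geom_sum₂ l
    have := mul_geom_sum (1 + u) l
    rw [← this, add_sub_cancel_left, norm_mul, mul_comm]
    refine mul_le_mul_of_nonneg_right ((norm_sum_le _ _).trans ?_) (norm_nonneg _)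
    have : ∀ i ∈ Finset.range l, ‖(1 + u) ^ i‖ ≤ (1 + ‖u‖) ^ (l - 1) := fun i hi => by
      rw [norm_pow]
      refine (pow_le_pow_left₀ (norm_nonneg _) ((norm_add_le _ _).trans_eq (by rw [norm_one])) i).trans ?_
      have := Finset.mem_range.mp hi
      exact pow_le_pow_right₀ (by linarith [norm_nonneg u]) (by omega)
    refine (sum_le_sum this).trans_eq ?_
    rw [sum_const, card_range, nsmul_eq_mul]
  refine ⟨κ, by linarith, by linarith, 2 * (1 + C1) ^ l + l * (1 + C2) ^ (l - 1) * C2, by positivity,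
    fun N hN ζ hζ hne => ?_⟩
  have hN' : (0 : ℝ) < N := by exact_mod_cast hN
  have hd : 0 < ‖ζ - 1‖ := norm_pos_iff.mpr (sub_ne_zero.mpr hne)
  have k1 := h1 N hN ζ hζ hne
  have k2 := h2 N hN ζ hζ hne
  have hτ : 0 < N * ‖ζ - 1‖ := by positivity
  set τ := N * ‖ζ - 1‖
  set u := (binP γ N).eval ζ * exp (γ * log (1 - ζ)) - 1 with hu
  have e : (binP γ N).eval ζ ^ l * exp (β * log (1 - ζ)) = (1 + u) ^ l := by
    rw [hu, add_sub_cancel, mul_pow, ← exp_nat_mul, ← mul_assoc]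
    congr 4
    rw [hγ]
    push_cast
    have : (l : ℂ) ≠ 0 := by exact_mod_cast hl0.ne'
    field_simp
  rw [e]
  have p1 : 0 ≤ l * (1 + C2) ^ (l - 1) * C2 := by positivity
  have p2 : 0 ≤ 2 * (1 + C1) ^ l := by positivity
  have hE := errF_nonneg (κ := κ) hτ
  rw [add_mul]
  by_cases ht : τ ≤ 1
  · have hge : 1 ≤ τ ^ (-(κ / l)) :=
      Real.one_le_rpow_of_pos_of_le_one_of_nonpos hτ ht (by
        have := div_nonneg (show 0 ≤ κ by linarith) hl0.le
        linarith)
    have h3 : 1 + ‖u‖ ≤ (1 + C1) * τ ^ (-(κ / l)) := by linarith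
    have h4 := pow_le_pow_left₀ (by positivity) h3 l
    have h5 : ((1 + C1) * τ ^ (-(κ / l))) ^ l = (1 + C1) ^ l * errF κ τ := by
      rw [mul_pow, errF, if_pos ht, ← rpow_natCast (τ ^ _), ← rpow_mul hτ.le]
      congr 2
      field_simp
    have h6 : ‖(1 + u) ^ l - 1‖ ≤ 2 * (1 + ‖u‖) ^ l := by
      refine (norm_sub_le _ _).trans ?_
      rw [norm_pow, norm_one]
      have h7 := pow_le_pow_left₀ (norm_nonneg _) ((norm_add_le 1 u).trans_eq (by rw [norm_one])) l
      have h8 : (1 : ℝ) ≤ (1 + ‖u‖) ^ l := one_le_pow₀ (by linarith [norm_nonneg u])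
      linarith
    have := mul_nonneg p1 hE
    rw [h5] at h4
    linarith
  · have h3 : errF κ τ = τ ^ (-(3 / 4) : ℝ) := by rw [errF, if_neg ht]
    rw [← h3] at k2
    push Not at ht
    have h4 : errF κ τ ≤ 1 := by
      rw [h3]; exact Real.rpow_le_one_of_one_le_of_nonpos ht.le (by norm_num)
    have h5 : ‖u‖ ≤ C2 := k2.trans (mul_le_of_le_one_right hC2 h4)
    have h6 := mul_nonneg p2 hE
    have h7 : l * (1 + ‖u‖) ^ (l - 1) * ‖u‖ ≤ l * (1 + C2) ^ (l - 1) * (C2 * errF κ τ) := by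
      refine mul_le_mul ?_ k2 (norm_nonneg _) (by positivity)
      exact mul_le_mul_of_nonneg_left (pow_le_pow_left₀ (by positivity) (by linarith) _) hl0.le
    have := hpow u
    linarith

lemma exists_hasSum_of_differentiableOn {F : ℂ → ℂ} {R : ℝ} (hR : 1 < R)
    (hF : DifferentiableOn ℂ F (ball 0 R)) :
    ∃ c : ℕ → ℂ, Summable (fun j : ℕ => (j : ℝ) * ‖c j‖) ∧ c 0 = F 0 ∧
      ∀ z, ‖z‖ ≤ 1 → HasSum (fun j => c j * z ^ j) (F z) := by
  have h1 : (1 : ℝ) < (1 + R) / 2 := by linarith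
  have h2 : (0 : ℝ) ≤ (1 + R) / 2 := by linarith
  lift (1 + R) / 2 to NNReal using h2 with R' hR'
  have hd : DifferentiableOn ℂ F (closedBall 0 R') :=
    hF.mono (closedBall_subset_ball (by rw [hR']; linarith))
  have hp := hd.hasFPowerSeriesOnBall (lt_trans one_pos (by exact_mod_cast h1))
  set p := cauchyPowerSeries F 0 R'
  have hr : ((1 : NNReal) : ENNReal) < R' := by exact_mod_cast h1
  refine ⟨p.coeff, ?_, ?_, fun z hz => ?_⟩
  · obtain ⟨q, hq, A, -, hb⟩ := p.norm_mul_pow_le_mul_pow_of_lt_radius (hr.trans_le hp.r_le)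
    refine .of_nonneg_of_le (fun j => by positivity) (fun j => ?_)
      ((summable_pow_mul_geometric_of_norm_lt_one 1
        (by rw [norm_of_nonneg hq.1.le]; exact hq.2 : ‖q‖ < 1)).mul_left A)
    rw [pow_one, mul_left_comm, ← FormalMultilinearSeries.norm_apply_eq_norm_coef]
    exact mul_le_mul_of_nonneg_left (by simpa using hb j) j.cast_nonneg
  · have := hp.coeff_zero (fun _ => (1 : ℂ))
    rwa [FormalMultilinearSeries.apply_eq_pow_smul_coeff, pow_zero, one_smul] at this
  · have := hp.hasSum (y := z) (mem_eball_zero_iff.mpr (lt_of_le_of_lt (by exact_mod_cast hz) hr))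
    rw [zero_add] at this
    refine this.congr_fun fun j => ?_
    rw [FormalMultilinearSeries.apply_eq_pow_smul_coeff, smul_eq_mul, mul_comm]

lemma exists_taylor {F : ℂ → ℂ} {R : ℝ} (hR : 1 < R) (hF : DifferentiableOn ℂ F (ball 0 R))
    (h0 : F 0 = 1) : ∃ C : ℝ, 0 ≤ C ∧ ∃ E : ℕ → ℂ[X], ∀ N : ℕ, 0 < N →
      (E N).natDegree ≤ N ∧ (E N).eval 0 = 1 ∧ ∀ z, ‖z‖ ≤ 1 → ‖F z - (E N).eval z‖ ≤ C / N := by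
  obtain ⟨c, hc, hc0, hs⟩ := exists_hasSum_of_differentiableOn hR hF
  refine ⟨∑' j : ℕ, (j : ℝ) * ‖c j‖, tsum_nonneg fun j => by positivity,
    fun N => ∑ i ∈ Finset.range (N + 1), C (c i) * X ^ i, fun N hN => ⟨?_, ?_, fun z hz => ?_⟩⟩
  · refine natDegree_sum_le_of_forall_le _ _ fun i hi => (natDegree_C_mul_X_pow_le _ _).trans ?_
    have := Finset.mem_range.mp hi
    omega
  · simp [eval_finsetSum, Finset.sum_range_succ', hc0, h0]
  · have hN' : (0 : ℝ) < N := by exact_mod_cast hN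
    simp only [eval_finsetSum, eval_mul, eval_C, eval_pow, eval_X]
    refine (((hasSum_nat_add_iff' (N + 1)).mpr (hs z hz)).norm_le_of_bounded
      (((hasSum_nat_add_iff' (N + 1)).mpr hc.hasSum).div_const (N : ℝ)) fun j => ?_).trans
      (div_le_div_of_nonneg_right (sub_le_self _ (sum_nonneg fun j _ => by positivity)) hN'.le)
    rw [norm_mul, norm_pow, le_div_iff₀ hN', mul_comm]
    refine mul_le_mul ?_ (mul_le_of_le_one_right (norm_nonneg _) (pow_le_one₀ (norm_nonneg _) hz))
      (by positivity) (by positivity)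
    exact_mod_cast (by omega : N ≤ j + (N + 1))

end Trial

section TrialBound

variable {ι : Type*} [Fintype ι] {Γ : ℂ → ℂ} {a : ι → ℂ} {β : ι → ℝ} {R : ℝ} {g : ℝ → ℝ}

lemma exists_nat_gt_four_mul_abs (β : ι → ℝ) : ∃ l : ℕ, ∀ k, 4 * |β k| < l := by
  obtain ⟨l, hl⟩ := exists_nat_gt (∑ k, 4 * |β k|)
  exact ⟨l, fun k => lt_of_le_of_lt (single_le_sum (f := fun k => 4 * |β k|)
    (fun i _ => by positivity) (Finset.mem_univ k)) hl⟩

lemma IsSzData.exists_trial (S : IsSzData Γ a β R g) (hβ0 : ∀ k, β k ≠ 0) :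
    ∃ K : ℝ, 0 ≤ K ∧ ∃ M : ℕ, 0 < M ∧ ∀ N : ℕ, 0 < N → ∃ P : ℂ[X], P.natDegree ≤ M * N ∧
      P.eval 0 = 1 ∧
      ∫ θ, ‖P.eval (cpt θ) * szD Γ a β (cpt θ) - P.eval 0 * szD Γ a β 0‖ ^ 2 ∂arcμ ≤ K / N := by
  obtain ⟨l, hl⟩ := exists_nat_gt_four_mul_abs β
  have hfac := fun k => exists_factor_bound (hβ0 k) (S.beta k) (hl k)
  choose κ hκ0 hκ1 Cx hCx hx using hfac
  choose Kx hKx hint using fun k => exists_integral_errF_sq_le (hκ0 k) (hκ1 k)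
  obtain ⟨d, hd0, -, hsep⟩ := exists_sep S.inj
  obtain ⟨G, hG0, hG⟩ := exists_norm_le_of_ball S.diff S.one_lt
  obtain ⟨A, hA, E, hE⟩ := exists_taylor (F := fun z => exp (Γ 0 - Γ z)) S.one_lt
    (by have := S.diff; fun_prop) (by simp)
  set B : ℝ := ∑ k, Cx k * errF (κ k) d with hB
  have hBk : ∀ k, Cx k * errF (κ k) d ≤ B := fun k =>
    single_le_sum (f := fun k => Cx k * errF (κ k) d)
      (fun i _ => mul_nonneg (hCx i) (errF_nonneg hd0)) (Finset.mem_univ k)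
  have hB0 : 0 ≤ B := sum_nonneg fun i _ => mul_nonneg (hCx i) (errF_nonneg hd0)
  set A' := A * rexp (2 * G) with hA'
  have hA'0 : 0 ≤ A' := by positivity
  set m := Fintype.card ι with hm
  set c1 := 2 * ((1 + A') * (1 + B) ^ m) ^ 2 * m with hc1
  set D0 := ‖szD Γ a β 0‖ with hD0
  refine ⟨D0 ^ 2 * (c1 * ∑ k, Cx k ^ 2 * Kx k + 2 * A' ^ 2), ?_, 1 + m * l, by positivity,
    fun N hN => ?_⟩
  · have : 0 ≤ ∑ k, Cx k ^ 2 * Kx k := sum_nonneg fun k _ => mul_nonneg (sq_nonneg _) (hKx k)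
    positivity
  have hN' : (0 : ℝ) < N := by exact_mod_cast hN
  have hN1 : (1 : ℝ) ≤ N := by exact_mod_cast hN
  obtain ⟨E1, E2, E3⟩ := hE N hN
  set P : ℂ[X] := E N * ∏ k, ((binP (β k / l) N).comp (C (conj (a k)) * X)) ^ l with hP
  have hP0 : P.eval 0 = 1 := by
    rw [hP, eval_mul, E2, eval_prod, one_mul]
    refine prod_eq_one fun k _ => ?_
    rw [eval_pow, eval_comp, eval_mul, eval_X, mul_zero, binP_eval_zero, one_pow]
  refine ⟨P, ?_, hP0, ?_⟩
  · have h1 : ∀ k ∈ Finset.univ, (((binP (β k / l) N).comp (C (conj (a k)) * X)) ^ l).natDegree ≤ l * N := by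
      intro k _
      refine natDegree_pow_le.trans (Nat.mul_le_mul_left l ?_)
      refine natDegree_comp_le.trans ?_
      calc _ ≤ N * 1 := Nat.mul_le_mul (natDegree_binP _ _) ((natDegree_C_mul_le _ _).trans natDegree_X_le)
        _ = N := mul_one N
    have h2 := (natDegree_prod_le Finset.univ fun k =>
      ((binP (β k / l) N).comp (C (conj (a k)) * X)) ^ l).trans (sum_le_sum h1)
    rw [sum_const, card_univ, smul_eq_mul, ← hm] at h2
    calc P.natDegree ≤ N + m * (l * N) := natDegree_mul_le.trans (add_le_add E1 h2)
      _ = (1 + m * l) * N := by ring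
  set x : ι → ℂ → ℂ := fun k ζ => (binP (β k / l) N).eval (conj (a k) * ζ) ^ l *
    exp (β k * log (1 - conj (a k) * ζ)) - 1 with hxd
  have hpt : ∀ θ, (∀ k, cpt θ ≠ a k) →
      ‖P.eval (cpt θ) * szD Γ a β (cpt θ) - P.eval 0 * szD Γ a β 0‖ ^ 2 ≤
      D0 ^ 2 * (c1 * (∑ k, Cx k ^ 2 * errF (κ k) (N * ‖cpt θ - a k‖) ^ 2) + 2 * A' ^ 2 / N) := by
    intro θ hθ
    set ζ := cpt θ with hζ
    have hζ1 : ‖ζ‖ = 1 := norm_cpt θ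
    have hne : ∀ k, conj (a k) * ζ ≠ 1 := fun k h => hθ k (by
      have := congrArg (fun z => a k * z) h
      simpa [← mul_assoc, mul_conj_of_norm_one (S.norm_a k)] using this)
    have hxk : ∀ k, ‖x k ζ‖ ≤ Cx k * errF (κ k) (N * ‖ζ - a k‖) := by
      intro k
      have h := hx k N hN (conj (a k) * ζ) (by rw [norm_mul, RCLike.norm_conj, S.norm_a, hζ1, one_mul])
        (hne k)
      rwa [norm_sub_rev (conj (a k) * ζ), norm_one_sub_conj_mul (S.norm_a k)] at h
    have hfar : ∀ k, d ≤ ‖ζ - a k‖ → ‖x k ζ‖ ≤ B := by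
      intro k hk
      refine (hxk k).trans (le_trans (mul_le_mul_of_nonneg_left ?_ (hCx k)) (hBk k))
      refine antitoneOn_errF (hκ0 k) hd0 (show (0 : ℝ) < N * ‖ζ - a k‖ by
        have := hd0.trans_le hk; positivity) ?_
      nlinarith [norm_nonneg (ζ - a k)]
    have hprod := norm_prod_one_add_sub_one_le hB0 (x := fun k => x k ζ) Finset.univ
      fun j k hjk => (hsep ζ j k hjk).imp (hfar j) (hfar k)
    rw [card_univ, ← hm] at hprod
    set Q := ∏ k, (1 + x k ζ) with hQ
    set e := (E N).eval ζ * exp (Γ ζ - Γ 0) with he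
    have hD : P.eval ζ * szD Γ a β ζ - P.eval 0 * szD Γ a β 0 = szD Γ a β 0 * (e * Q - 1) := by
      have h0 : szD Γ a β 0 = exp (Γ 0) := by simp [szD, szH]
      rw [hP0, h0, hP, eval_mul, eval_prod, szD, szH, exp_add, exp_sum, he, hQ,
        exp_sub]
      have h1 : ∏ k, (1 + x k ζ) = (∏ k, eval ζ ((binP (β k / l) N).comp (C (conj (a k)) * X) ^ l)) *
          ∏ k, exp (β k * log (1 - conj (a k) * ζ)) := by
        rw [← Finset.prod_mul_distrib]
        refine prod_congr rfl fun k _ => ?_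
        simp only [hxd]
        rw [eval_pow, eval_comp, eval_mul, eval_C, eval_X, add_sub_cancel]
      rw [h1]
      have h2 : exp (Γ 0) ≠ 0 := exp_ne_zero _
      generalize ∏ k, exp (β k * log (1 - conj (a k) * ζ)) = V
      field_simp
    have he1 : ‖e - 1‖ ≤ A' / N := by
      have h1 : e - 1 = -((exp (Γ 0 - Γ ζ) - (E N).eval ζ) * exp (Γ ζ - Γ 0)) := by
        rw [he, sub_mul, ← exp_add]
        simp
      rw [h1, norm_neg, norm_mul, hA', mul_div_right_comm]
      refine mul_le_mul (E3 ζ hζ1.le) ?_ (norm_nonneg _) (by positivity)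
      rw [norm_exp]
      refine Real.exp_le_exp.mpr ((re_le_norm _).trans ((norm_sub_le _ _).trans ?_))
      linarith [hG ζ hζ1.le, hG 0 (by simp)]
    have he2 : ‖e‖ ≤ 1 + A' := by
      have h1 := norm_le_norm_add_norm_sub' e 1
      rw [norm_one] at h1
      have h2 := div_le_self hA'0 hN1
      linarith
    set T := ∑ k, ‖x k ζ‖ with hT
    have hT0 : 0 ≤ T := sum_nonneg fun _ _ => norm_nonneg _
    have htot : ‖e * Q - 1‖ ≤ (1 + A') * (1 + B) ^ m * T + A' / N := by
      have h1 : e * Q - 1 = e * (Q - 1) + (e - 1) := by ring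
      rw [h1]
      refine (norm_add_le _ _).trans (add_le_add ?_ he1)
      rw [norm_mul, mul_assoc]
      exact mul_le_mul he2 hprod (norm_nonneg _) (by linarith)
    have hTsq : T ^ 2 ≤ m * ∑ k, Cx k ^ 2 * errF (κ k) (N * ‖ζ - a k‖) ^ 2 := by
      refine sq_sum_le_card_mul_sum_sq.trans ?_
      rw [card_univ, ← hm]
      refine mul_le_mul_of_nonneg_left (sum_le_sum fun k _ => ?_) (by positivity)
      rw [← mul_pow]
      exact pow_le_pow_left₀ (norm_nonneg _) (hxk k) 2
    rw [hD, norm_mul, mul_pow]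
    refine mul_le_mul_of_nonneg_left ?_ (sq_nonneg _)
    have h1 := pow_le_pow_left₀ (norm_nonneg _) htot 2
    have h2 : ((1 + A') * (1 + B) ^ m * T + A' / N) ^ 2 ≤
        2 * ((1 + A') * (1 + B) ^ m) ^ 2 * T ^ 2 + 2 * (A' / N) ^ 2 := by
      generalize (1 + A') * (1 + B) ^ m = u
      generalize A' / N = v
      nlinarith [sq_nonneg (u * T - v)]
    have h3 : 2 * ((1 + A') * (1 + B) ^ m) ^ 2 * T ^ 2 ≤
        c1 * ∑ k, Cx k ^ 2 * errF (κ k) (N * ‖ζ - a k‖) ^ 2 := by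
      rw [hc1, mul_assoc _ (m : ℝ)]
      exact mul_le_mul_of_nonneg_left hTsq (by positivity)
    have h4 : 2 * (A' / N) ^ 2 ≤ 2 * A' ^ 2 / N := by
      rw [div_pow, mul_div_assoc]
      refine mul_le_mul_of_nonneg_left (div_le_div_of_nonneg_left (sq_nonneg _) hN' ?_) zero_le_two
      exact le_self_pow₀ hN1 two_ne_zero
    linarith
  have hi : ∀ k, Integrable (fun θ => Cx k ^ 2 * errF (κ k) (N * ‖cpt θ - a k‖) ^ 2) arcμ :=
    fun k => (hint k N hN (a k) (S.norm_a k)).1.const_mul _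
  have hi2 : Integrable (fun θ => c1 * ∑ k, Cx k ^ 2 * errF (κ k) (N * ‖cpt θ - a k‖) ^ 2) arcμ :=
    (integrable_finsetSum _ fun k _ => hi k).const_mul _
  have hi3 : Integrable (fun _ : ℝ => 2 * A' ^ 2 / N) arcμ := integrable_const _
  have hmono := integral_mono_ae (S.sub_sq_aux P).1 ((hi2.add hi3).const_mul (D0 ^ 2))
    (by filter_upwards [ae_ne_all a] with θ hθ using hpt θ hθ)
  refine hmono.trans ?_
  rw [integral_const_mul]
  simp only [Pi.add_apply]
  rw [integral_add hi2 hi3, integral_const_mul, integral_finsetSum _ fun k _ => hi k,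
    integral_const, probReal_univ, one_smul, mul_div_assoc (D0 ^ 2), add_div, mul_div_assoc c1,
    sum_div]
  refine mul_le_mul_of_nonneg_left (add_le_add_left (mul_le_mul_of_nonneg_left
    (sum_le_sum fun k _ => ?_) (by positivity)) _) (sq_nonneg _)
  rw [integral_const_mul, mul_div_assoc]
  exact mul_le_mul_of_nonneg_left (hint k N hN (a k) (S.norm_a k)).2 (sq_nonneg _)

variable {Φ : ℕ → ℂ[X]}

lemma IsSzData.exists_opN_le (S : IsSzData Γ a β R g) (hβ0 : ∀ k, β k ≠ 0)
    (H : IsOPUC (wtν g a β) Φ) :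
    ∃ C : ℝ, 0 < C ∧ ∀ n : ℕ, opN (wtν g a β) Φ n - ‖szD Γ a β 0‖ ^ 2 ≤ C / (n + 1) := by
  have := S.isFiniteMeasure
  obtain ⟨K, hK, M, hM, hP⟩ := S.exists_trial hβ0
  have hM' : (0 : ℝ) < M := by exact_mod_cast hM
  set o := opN (wtν g a β) Φ
  have ho := H.opN_pos 0
  refine ⟨K * (2 * M) + o 0 * M, by positivity, fun n => ?_⟩
  have hn : (0 : ℝ) < n + 1 := by positivity
  rw [le_div_iff₀ hn]
  rcases lt_or_ge n M with h | h
  · have h1 : o n ≤ o 0 := H.opN_antitone n.zero_le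
    have h2 : (n : ℝ) + 1 ≤ M := by exact_mod_cast h
    have h3 : o n - ‖szD Γ a β 0‖ ^ 2 ≤ o 0 := by linarith [sq_nonneg ‖szD Γ a β 0‖]
    have h4 := mul_le_mul_of_nonneg_right h3 hn.le
    have h5 := mul_le_mul_of_nonneg_left h2 ho.le
    have h6 : 0 ≤ K * (2 * M) := by positivity
    linarith
  · set N := n / M
    have hN : 0 < N := Nat.div_pos h hM
    have hN' : (0 : ℝ) < N := by exact_mod_cast hN
    obtain ⟨P, P1, P2, P3⟩ := hP N hN
    have h1 : o n ≤ o (M * N) := H.opN_antitone (Nat.mul_div_le n M)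
    have h2 := H.opN_le_integral P1 P2
    have h3 := (S.sub_sq_aux P).2
    rw [h3, P2, one_mul] at P3
    have h4 : o n - ‖szD Γ a β 0‖ ^ 2 ≤ K / N := by linarith
    have h5 : (n : ℝ) + 1 ≤ 2 * M * N := by
      have h6 : n + 1 ≤ M * (N + 1) := Nat.lt_mul_div_succ n hM
      have h7 : M * (N + 1) ≤ 2 * M * N := by nlinarith
      exact_mod_cast h6.trans h7
    have h6 := mul_le_mul_of_nonneg_right h4 hn.le
    have h7 := mul_le_mul_of_nonneg_left h5 (show 0 ≤ K / N by positivity)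
    have h8 : K / N * (2 * M * N) = K * (2 * M) := by field_simp
    have h9 : 0 ≤ o 0 * M := by positivity
    linarith

lemma norm_szD_zero_pos : 0 < ‖szD Γ a β 0‖ := norm_pos_iff.mpr (exp_ne_zero _)

/-- Tail sums of the Verblunsky coefficients. -/
lemma IsSzData.exists_block (S : IsSzData Γ a β R g) (hβ0 : ∀ k, β k ≠ 0)
    (H : IsOPUC (wtν g a β) Φ) :
    ∃ C : ℝ, 0 ≤ C ∧ ∀ n N : ℕ, ∑ i ∈ Finset.Ico n N, ‖vb Φ i‖ ^ 2 ≤ C / (n + 1) := by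
  have := S.isFiniteMeasure
  obtain ⟨C, hC, h⟩ := S.exists_opN_le hβ0 H
  have hD : 0 < ‖szD Γ a β 0‖ ^ 2 := pow_pos norm_szD_zero_pos 2
  refine ⟨C / ‖szD Γ a β 0‖ ^ 2, by positivity, fun n N => ?_⟩
  have key : ∀ i, ‖vb Φ i‖ ^ 2 * ‖szD Γ a β 0‖ ^ 2 ≤ opN (wtν g a β) Φ i - opN (wtν g a β) Φ (i + 1) := by
    intro i
    rw [H.opN_succ i]
    have := mul_le_mul_of_nonneg_left (S.szD_zero_sq_le H i) (sq_nonneg ‖vb Φ i‖)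
    linarith
  rcases le_total N n with hn | hn
  · rw [Finset.Ico_eq_empty_of_le hn, Finset.sum_empty]; positivity
  · rw [div_right_comm, le_div_iff₀ hD, sum_mul]
    refine (sum_le_sum fun i _ => key i).trans ?_
    have e := sum_Ico_sub (fun i => opN (wtν g a β) Φ i) hn
    have e2 : ∑ i ∈ Finset.Ico n N, (opN (wtν g a β) Φ i - opN (wtν g a β) Φ (i + 1)) =
        opN (wtν g a β) Φ n - opN (wtν g a β) Φ N := by
      rw [← neg_sub (opN _ _ N), ← e, ← sum_neg_distrib]
      exact sum_congr rfl fun i _ => by ring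
    rw [e2]
    linarith [h n, S.szD_zero_sq_le H N]

lemma IsSzData.tendsto_vb (S : IsSzData Γ a β R g) (hβ0 : ∀ k, β k ≠ 0)
    (H : IsOPUC (wtν g a β) Φ) : Tendsto (vb Φ) atTop (nhds 0) := by
  obtain ⟨C, -, h⟩ := S.exists_block hβ0 H
  have h1 : Summable fun i => ‖vb Φ i‖ ^ 2 := summable_of_sum_range_le (c := C)
    (fun _ => sq_nonneg _) fun N => by simpa using h 0 N
  have h2 := h1.tendsto_atTop_zero.sqrt
  rw [tendsto_zero_iff_norm_tendsto_zero]
  simpa [Real.sqrt_sq (norm_nonneg _)] using h2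

/-- Interior asymptotics of the reversed polynomials along a radius. -/
lemma IsSzData.exists_radial_bound (S : IsSzData Γ a β R g) (hβ0 : ∀ k, β k ≠ 0)
    (H : IsOPUC (wtν g a β) Φ) : ∃ C : ℝ, 0 < C ∧ ∀ m > 0, ∀ z : ℂ, ‖z‖ < 1 →
      ‖(rv Φ m).eval z * exp (szH Γ a β z - szH Γ a β 0) - 1‖ ≤ C / √(m * (1 - ‖z‖)) := by
  obtain ⟨C, hC, h⟩ := S.exists_opN_le hβ0 H
  have hD := norm_szD_zero_pos (Γ := Γ) (a := a) (β := β)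
  have hD0 : szD Γ a β 0 ≠ 0 := norm_pos_iff.mp hD
  refine ⟨√C / ‖szD Γ a β 0‖, by positivity, fun m hm z hz => ?_⟩
  have hm' : (0 : ℝ) < m := by exact_mod_cast hm
  have hz' : 0 < 1 - ‖z‖ := by linarith
  have e : (rv Φ m).eval z * exp (szH Γ a β z - szH Γ a β 0) - 1 =
      ((rv Φ m).eval z * szD Γ a β z - szD Γ a β 0) / szD Γ a β 0 := by
    rw [exp_sub]
    unfold szD at *
    field_simp
  rw [e, norm_div, div_right_comm]
  refine div_le_div_of_nonneg_right ?_ hD.le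
  rw [← Real.sqrt_div hC.le]
  refine Real.le_sqrt_of_sq_le ((S.norm_rv_mul_szD_sub_sq_le H m hz).trans ?_)
  rw [← div_div, div_eq_mul_inv _ (1 - ‖z‖)]
  have h1 : (1 - ‖z‖ ^ 2)⁻¹ ≤ (1 - ‖z‖)⁻¹ := inv_anti₀ hz' (by nlinarith [norm_nonneg z])
  have h2 : opN (wtν g a β) Φ m - ‖szD Γ a β 0‖ ^ 2 ≤ C / m :=
    (h m).trans (div_le_div_of_nonneg_left hC.le hm' (by linarith))
  refine mul_le_mul h2 h1 (inv_nonneg.mpr ?_) (by positivity)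
  nlinarith [norm_nonneg z]

end TrialBound

section Assembly

variable {ι : Type*} [Fintype ι] [DecidableEq ι] {Γ : ℂ → ℂ} {a : ι → ℂ} {β : ι → ℝ} {R : ℝ}
  {g : ℝ → ℝ} {Φ : ℕ → ℂ[X]}

lemma IsSzData.exists_logDeriv (S : IsSzData Γ a β R g) : ∃ κ : ℝ → ℝ, Continuous κ ∧
    (∀ θ, HasDerivAt g (g θ * κ θ) θ) ∧ ∃ d : ℕ → ℂ, Summable (fun j => ‖d j‖) ∧ d 0 = 0 ∧
    ∀ θ, HasSum (fun j => d j * cpt θ ^ j - conj (d j) * conj (cpt θ) ^ j)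
      (-I * (κ θ : ℂ)) := by
  have hΓ' : DifferentiableOn ℂ (deriv Γ) (ball 0 R) := S.diff.deriv isOpen_ball
  have hF : DifferentiableOn ℂ (fun z => z * deriv Γ z) (ball 0 R) := differentiableOn_id.mul hΓ'
  obtain ⟨d, -, hd0, hs⟩ := exists_hasSum_of_differentiableOn S.one_lt hF
  have hd : Summable fun j => ‖d j‖ := by simpa using (hs 1 norm_one.le).summable.norm
  have hmem : ∀ θ, cpt θ ∈ ball (0 : ℂ) R := fun θ => by
    rw [mem_ball_zero_iff, norm_cpt]; exact S.one_lt
  refine ⟨fun θ => -2 * (cpt θ * deriv Γ (cpt θ)).im, ?_, fun θ => ?_, d, hd, by simpa using hd0,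
    fun θ => ?_⟩
  · have : Continuous fun θ => cpt θ * deriv Γ (cpt θ) :=
      hF.continuousOn.comp_continuous continuous_cpt hmem
    exact continuous_const.mul (continuous_im.comp this)
  · have h1 : HasDerivAt (fun t : ℝ => Γ (cpt t)) (deriv Γ (cpt θ) * (I * cpt θ)) θ := by
      have h2 := (S.diff.differentiableAt (isOpen_ball.mem_nhds (hmem θ))).hasDerivAt
      refine (h2.comp θ (hasDerivAt_cpt θ)).congr_deriv ?_
      ring
    have h2 : HasDerivAt (fun t : ℝ => (Γ (cpt t)).re) (deriv Γ (cpt θ) * (I * cpt θ)).re θ :=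
      reCLM.hasFDerivAt.comp_hasDerivAt θ h1
    have h3 := (h2.const_mul 2).exp
    have h4 : g = fun t => rexp (2 * (Γ (cpt t)).re) := funext S.weight
    rw [h4]
    refine h3.congr_deriv ?_
    simp only [mul_re, mul_im, Complex.I_re, Complex.I_im]
    ring
  · have h1 := hs (cpt θ) (norm_cpt θ).le
    have h2 : HasSum (fun j => conj (d j * cpt θ ^ j)) (conj (cpt θ * deriv Γ (cpt θ))) :=
      hasSum_conj'.mpr (by simpa using h1)
    have h3 := h1.sub h2
    simp only [map_mul, map_pow] at h3
    have e : -I * ((-2 * (cpt θ * deriv Γ (cpt θ)).im : ℝ) : ℂ) =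
        cpt θ * deriv Γ (cpt θ) - conj (cpt θ) * conj (deriv Γ (cpt θ)) := by
      apply Complex.ext <;> simp <;> ring
    rw [← e] at h3
    exact h3

/-- Phase of the interior Szegő function at a singularity. -/
noncomputable def szLam (Γ : ℂ → ℂ) (a : ι → ℂ) (β : ι → ℝ) (k : ι) : ℝ :=
  (Γ (a k) - Γ 0 + ∑ j ∈ Finset.univ.erase k, (β j : ℂ) * log (1 - conj (a j) * a k)).im

lemma szH_zero : szH Γ a β 0 = Γ 0 := by simp [szH]

lemma IsSzData.szH_radial (S : IsSzData Γ a β R g) (k : ι) {r : ℝ} (h1 : r < 1) :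
    (szH Γ a β (r * a k) - szH Γ a β 0).im = (Γ (r * a k) - Γ 0 +
      ∑ j ∈ Finset.univ.erase k, (β j : ℂ) * log (1 - conj (a j) * (r * a k))).im := by
  have e : 1 - conj (a k) * (r * a k) = ((1 - r : ℝ) : ℂ) := by
    rw [mul_left_comm, conj_mul_of_norm_one (S.norm_a k)]; push_cast; ring
  rw [szH_zero, szH, ← add_sum_erase _ _ (Finset.mem_univ k), e,
    ← ofReal_log (by linarith), ← ofReal_mul]
  simp only [add_im, sub_im, ofReal_im]
  ring

lemma IsSzData.continuousAt_phase (S : IsSzData Γ a β R g) (k : ι) :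
    ContinuousAt (fun z : ℂ => (Γ z - Γ 0 +
      ∑ j ∈ Finset.univ.erase k, (β j : ℂ) * log (1 - conj (a j) * z)).im) (a k) := by
  refine continuous_im.continuousAt.comp (ContinuousAt.add ?_ ?_)
  · exact (differentiableAt_of_ball S.diff S.one_lt (S.norm_a k).le).continuousAt.sub
      continuousAt_const
  · refine tendsto_finsetSum _ fun j hj => ?_
    have h : ContinuousAt (fun z => 1 - conj (a j) * z) (a k) := by fun_prop
    exact continuousAt_const.mul (h.clog (one_sub_conj_mul_mem_slitPlane (S.norm_a j)
      (S.norm_a k).le fun h => ne_of_mem_erase hj (S.inj h).symm))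

lemma IsSzData.tendsto_szH_radial (S : IsSzData Γ a β R g) (k : ι) :
    Tendsto (fun r : ℝ => (szH Γ a β (r * a k) - szH Γ a β 0).im) (𝓝[<] 1)
      (nhds (szLam Γ a β k)) := by
  refine (tendsto_radial (S.continuousAt_phase k)).congr' ?_
  filter_upwards [self_mem_nhdsWithin] with r hr
  exact (S.szH_radial k hr).symm

/-- Leading asymptotics of the Verblunsky coefficients. -/
theorem IsSzData.verblunsky (S : IsSzData Γ a β R g) (hβ0 : ∀ k, β k ≠ 0)
    (H : IsOPUC (wtν g a β) Φ) :
    Tendsto (fun n : ℕ => ((n : ℂ) + 1) * conj (vb Φ n) +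
      ∑ k, (β k : ℂ) * exp (2 * szLam Γ a β k * I) * a k ^ (n + 1)) atTop (nhds 0) := by
  have := S.isFiniteMeasure
  set ν := wtν g a β with hν
  obtain ⟨κ, hκc, hκ, d, hd, hd0, hκd⟩ := S.exists_logDeriv
  obtain ⟨v, hv, hP⟩ := exists_pearson S.continuous_weight S.weight_pos hκ
    (by rw [S.weight, S.weight, cpt_zero, cpt_two_pi]) hκc S.norm_a S.inj S.beta hβ0
  have hvb := S.tendsto_vb hβ0 H
  have hsz : ∀ k, IsSzSeq (fun n => conj (vb Φ n) * conj (a k) ^ (n + 1))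
      (fun n => conj (a k) ^ n * (Φ n).eval (a k))
      (fun n => conj (a k) ^ n * cL ν (a k) (v k) (fun z => (Φ n).eval z) / opN ν Φ n) := fun k =>
    H.isSzSeq (S.norm_a k) (by
      filter_upwards [wtν_ac.ae_le (ae_ne_all a)] with θ hθ using hθ k) (hv k)
  set X' : ι → ℕ → ℂ := fun k n => conj (a k) ^ n * (Φ n).eval (a k) with hX
  set Y' : ι → ℕ → ℂ := fun k n =>
    conj (a k) ^ n * cL ν (a k) (v k) (fun z => (Φ n).eval z) / opN ν Φ n with hY
  set er : ℕ → ℂ := fun n => -(I * (∫ θ, ((Φ (n + 1)).eval (cpt θ) *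
    conj ((rv Φ (n + 1)).eval (cpt θ))) * (κ θ : ℂ) ∂ν) / opN ν Φ (n + 1)) with her
  have hD := pow_pos (norm_szD_zero_pos (Γ := Γ) (a := a) (β := β)) 2
  have hert : Tendsto er atTop (nhds 0) := by
    have h1 := (tendsto_error H hd hd0 hκd hvb).comp (tendsto_add_atTop_nat 1)
    have h2 := (tendsto_zero_iff_norm_tendsto_zero.mp h1).div_const (‖szD Γ a β 0‖ ^ 2)
    rw [zero_div] at h2
    refine squeeze_zero_norm (fun n => ?_) h2
    simp only [her, norm_neg, norm_div, norm_mul, norm_I, one_mul, norm_real,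
      norm_of_nonneg (H.opN_pos (n + 1)).le, Function.comp_apply]
    exact div_le_div_of_nonneg_left (norm_nonneg _) hD (S.szD_zero_sq_le H (n + 1))
  have sys : IsSzSystem a β (vb Φ) X' Y' er :=
    { norm_a := S.norm_a
      inj := S.inj
      ne_zero := hβ0
      sz := hsz
      main := fun n => by
        have h := H.pearson_rv S.norm_a hP (n + 1)
        rw [vb, map_neg, conj_conj]
        simp only [hX, hY, her]
        push_cast at h
        linear_combination h
      eps := hert
      block := S.exists_block hβ0 H }
  obtain ⟨C, hC, hr⟩ := S.exists_radial_bound hβ0 H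
  have hU : ∀ k, Tendsto (fun n => 2 * X' k n * Y' k n) atTop
      (nhds (exp (2 * szLam Γ a β k * I))) := by
    intro k
    refine (sys.isSzPhase k).tendsto_prod (S.beta k) (hβ0 k)
      (H.isDrive_match (S.norm_a k) (hsz k) (L := fun r => szH Γ a β (r * a k) - szH Γ a β 0)
        (by simp) ?_ (S.tendsto_szH_radial k) hC fun m hm r h0 h1 => ?_)
    · refine ContinuousOn.sub ?_ continuousOn_const
      refine (differentiableOn_szH S.norm_a S.diff S.one_lt).continuousOn.comp (by fun_prop) ?_
      intro r hr
      rw [mem_ball_zero_iff, norm_mul, S.norm_a, Complex.norm_of_nonneg hr.1, mul_one]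
      exact hr.2
    · have h2 : ‖(r : ℂ) * a k‖ = r := by
        rw [norm_mul, S.norm_a, Complex.norm_of_nonneg h0, mul_one]
      have := hr m hm (r * a k) (by rw [h2]; exact h1)
      rwa [h2] at this
  set E : ι → ℂ := fun k => exp (2 * szLam Γ a β k * I)
  have hsum : Tendsto (fun n => ∑ k, (β k : ℂ) * a k ^ (n + 1) *
      (E k - 2 * X' k (n + 1) * Y' k (n + 1))) atTop (nhds 0) := by
    have : ∀ k ∈ Finset.univ, Tendsto (fun n => (β k : ℂ) * a k ^ (n + 1) *
        (E k - 2 * X' k (n + 1) * Y' k (n + 1))) atTop (nhds 0) := by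
      intro k _
      have h1 := ((hU k).comp (tendsto_add_atTop_nat 1)).const_sub (E k)
      rw [sub_self] at h1
      have h2 := (tendsto_zero_iff_norm_tendsto_zero.mp h1).const_mul |β k|
      rw [mul_zero] at h2
      refine squeeze_zero_norm (fun n => le_of_eq ?_) h2
      rw [norm_mul, norm_mul, norm_pow, S.norm_a, one_pow, mul_one, norm_real,
        norm_eq_abs]
      rfl
    simpa using tendsto_finsetSum Finset.univ this
  have hvc : Tendsto (fun n => (∑ k, (β k : ℂ)) * conj (vb Φ n)) atTop (nhds 0) := by
    have := (continuous_conj.tendsto 0).comp hvb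
    simpa using this.const_mul (∑ k, (β k : ℂ))
  have htot := (hsum.sub hert).sub hvc
  rw [sub_zero, sub_zero] at htot
  refine htot.congr fun n => ?_
  have hm := sys.main n
  have e1 : ∑ k, (β k : ℂ) * a k ^ (n + 1) * (E k - 2 * X' k (n + 1) * Y' k (n + 1)) =
      ∑ k, (β k : ℂ) * E k * a k ^ (n + 1) -
        ∑ k, (β k : ℂ) * a k ^ (n + 1) * (2 * X' k (n + 1) * Y' k (n + 1)) := by
    rw [← sum_sub_distrib]
    exact sum_congr rfl fun k _ => by ring
  rw [e1]
  linear_combination hm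

end Assembly

section Splitting

lemma norm_circleIntegral_zpow_le {L : ℂ → ℂ} {R M : ℝ} (h1 : 1 < R)
    (hc : ContinuousOn L (closedBall 0 R \ ball 0 1))
    (hd : ∀ z ∈ ball (0 : ℂ) R \ closedBall 0 1, DifferentiableAt ℂ L z)
    (hM : ∀ z, ‖z‖ = R → ‖L z‖ ≤ M) (j : ℕ) :
    ‖∮ z in C(0, 1), (z ^ (j + 1))⁻¹ * L z‖ ≤ 2 * π * (M * (R⁻¹) ^ j) := by
  have hR0 : 0 < R := by linarith
  have hne : ∀ z ∈ closedBall (0 : ℂ) R \ ball 0 1, z ^ (j + 1) ≠ 0 := fun z hz => by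
    refine pow_ne_zero _ fun h => hz.2 ?_
    simp [h]
  rw [← circleIntegral_eq_of_differentiable_on_annulus_off_countable one_pos h1.le
    countable_empty]
  · refine (circleIntegral.norm_integral_le_of_norm_le_const hR0.le
      (C := (R ^ (j + 1))⁻¹ * M) fun z hz => ?_).trans_eq ?_
    · rw [mem_sphere_zero_iff_norm] at hz
      rw [norm_mul, norm_inv, norm_pow, hz]
      exact mul_le_mul_of_nonneg_left (hM z hz) (by positivity)
    · rw [inv_pow, pow_succ]
      have := pow_pos hR0 j
      field_simp
  · exact ContinuousOn.mul (ContinuousOn.inv₀ (by fun_prop) hne) hc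
  · intro z hz
    have hz' : z ∈ closedBall (0 : ℂ) R \ ball 0 1 :=
      ⟨ball_subset_closedBall hz.1.1, fun h => hz.1.2 (ball_subset_closedBall h)⟩
    exact ((differentiableAt_id.pow _).inv (hne z hz')).mul (hd z hz.1)

lemma exists_re_eq_of_annulus {L : ℂ → ℂ} {R' : ℝ} (h1 : 1 < R')
    (hc : ContinuousOn L (closedBall 0 R' \ ball 0 1))
    (hd : ∀ z ∈ ball (0 : ℂ) R' \ closedBall 0 1, DifferentiableAt ℂ L z)
    (hr : ∀ z, ‖z‖ = 1 → (L z).im = 0) :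
    ∃ (Γ : ℂ → ℂ) (R : ℝ), 1 < R ∧ DifferentiableOn ℂ Γ (ball 0 R) ∧ (Γ 0).im = 0 ∧
      ∀ z, ‖z‖ = 1 → (L z).re = 2 * (Γ z).re := by
  have hR0 : 0 < R' := by linarith
  have : Fact (0 < 2 * π) := ⟨Real.two_pi_pos⟩
  have hmem : ∀ z : ℂ, ‖z‖ = 1 → z ∈ closedBall (0 : ℂ) R' \ ball 0 1 := fun z hz =>
    ⟨by rw [mem_closedBall_zero_iff, hz]; exact h1.le, by simp [hz]⟩
  let f : C(AddCircle (2 * π), ℂ) := ⟨fun x => L (AddCircle.toCircle x : ℂ),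
    hc.comp_continuous (by fun_prop) fun x => hmem _ (Circle.norm_coe _)⟩
  set c : ℤ → ℂ := fourierCoeff f with hcdef
  obtain ⟨M, hM⟩ := (isCompact_sphere (0 : ℂ) R').exists_bound_of_continuousOn
    (hc.mono fun z hz => ⟨sphere_subset_closedBall hz, by
      rw [mem_sphere_zero_iff_norm] at hz; simp [hz, h1.le]⟩)
  have hM' : ∀ z, ‖z‖ = R' → ‖L z‖ ≤ M := fun z hz => hM z (by simpa using hz)
  have hcb : ∀ j : ℕ, ‖c j‖ ≤ M * (R'⁻¹) ^ j := by
    intro j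
    have e : ∮ z in C(0, 1), (z ^ (j + 1))⁻¹ * L z = (2 * π * I) * c j := by
      rw [hcdef, fourierCoeff_eq_intervalIntegral _ _ 0, zero_add, circleIntegral,
        real_smul, mul_comm (2 * (π : ℂ)), mul_assoc, ← mul_assoc (2 * (π : ℂ))]
      have hp : (2 * (π : ℂ)) * ((1 / (2 * π) : ℝ) : ℂ) = 1 := by
        have : (π : ℂ) ≠ 0 := ofReal_ne_zero.mpr Real.pi_ne_zero
        push_cast; field_simp
      rw [hp, one_mul, ← intervalIntegral.integral_const_mul]
      refine intervalIntegral.integral_congr fun x _ => ?_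
      have e1 : circleMap 0 1 x = cpt x := by simp [circleMap, cpt]
      have e2 : ((AddCircle.toCircle (x : AddCircle (2 * π)) : Circle) : ℂ) = cpt x := by
        rw [AddCircle.toCircle_apply_mk, Circle.coe_exp, cpt, div_self Real.two_pi_pos.ne', one_mul]
      have hn : cpt x ≠ 0 := exp_ne_zero _
      have e3 : fourier (-(j : ℤ)) (x : AddCircle (2 * π)) = (cpt x ^ j)⁻¹ := by
        rw [fourier_apply, AddCircle.toCircle_zsmul, Circle.coe_zpow, e2, zpow_neg, zpow_natCast]
      simp only [deriv_circleMap, e1, smul_eq_mul, e3, f, ContinuousMap.coe_mk, e2]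
      field_simp
      ring
    have h2 := norm_circleIntegral_zpow_le h1 hc hd hM' j
    rw [e, norm_mul] at h2
    have h3 : ‖2 * (π : ℂ) * I‖ = 2 * π := by
      simp [abs_of_pos pi_pos]
    rw [h3] at h2
    exact le_of_mul_le_mul_left h2 Real.two_pi_pos
  have hcn : ∀ n : ℤ, c (-n) = conj (c n) := by
    intro n
    rw [hcdef, fourierCoeff, fourierCoeff, ← integral_conj]
    refine integral_congr_ae (Eventually.of_forall fun x => ?_)
    have : conj (f x) = f x := conj_eq_iff_im.mpr (hr _ (Circle.norm_coe _))
    simp only [smul_eq_mul, map_mul, this, fourier_neg, conj_conj]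
  have hM0 : 0 ≤ M := (norm_nonneg _).trans (by simpa using hcb 0)
  have hq0 : 0 ≤ R'⁻¹ := by positivity
  have hq1 : R'⁻¹ < 1 := inv_lt_one_of_one_lt₀ h1
  have hs1 : Summable fun j : ℕ => c j :=
    Summable.of_norm_bounded ((summable_geometric_of_lt_one hq0 hq1).mul_left M) hcb
  have hs2 : Summable fun j : ℕ => c (-(j : ℤ)) := by
    refine Summable.of_norm_bounded ((summable_geometric_of_lt_one hq0 hq1).mul_left M) fun j => ?_
    rw [hcn, RCLike.norm_conj]; exact hcb j
  have hsum := has_pointwise_sum_fourier_series_of_summable (f := f)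
    (Summable.of_nat_of_neg hs1 hs2)
  have hR1 : (1 + R') / 2 < R' := by linarith
  have hbd : ∀ (j : ℕ), ∀ z ∈ ball (0 : ℂ) ((1 + R') / 2),
      ‖c j * z ^ j‖ ≤ M * ((1 + R') / 2 * R'⁻¹) ^ j := by
    intro j z hz
    rw [mem_ball_zero_iff] at hz
    rw [norm_mul, norm_pow, mul_pow, mul_comm (_ ^ j) (R'⁻¹ ^ j), ← mul_assoc]
    exact mul_le_mul (hcb j) (pow_le_pow_left₀ (norm_nonneg _) hz.le j) (by positivity)
      (by positivity)
  have hq2 : (1 + R') / 2 * R'⁻¹ < 1 := by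
    rw [← div_eq_mul_inv, div_lt_one hR0]; exact hR1
  have hu : Summable fun j : ℕ => M * ((1 + R') / 2 * R'⁻¹) ^ j :=
    (summable_geometric_of_lt_one (by positivity) hq2).mul_left M
  have hc0 : (c 0).im = 0 := by
    have := hcn 0
    rw [neg_zero] at this
    exact conj_eq_iff_im.mp this.symm
  refine ⟨fun z => (∑' j : ℕ, c j * z ^ j) - c 0 / 2, (1 + R') / 2, by linarith, ?_, ?_,
    fun z hz => ?_⟩
  · refine DifferentiableOn.sub ?_ (differentiableOn_const _)
    exact differentiableOn_tsum_of_summable_norm hu (fun j => by fun_prop) isOpen_ball hbd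
  · have : ∑' j : ℕ, c j * (0 : ℂ) ^ j = c 0 := by
      rw [tsum_eq_single 0 fun j hj => by simp [hj]]; simp
    simp only [this]
    simp [hc0]
  · obtain ⟨x, hx⟩ := exists_cpt_eq hz
    have e2 : ((AddCircle.toCircle (x : AddCircle (2 * π)) : Circle) : ℂ) = z := by
      rw [AddCircle.toCircle_apply_mk, Circle.coe_exp, ← hx, cpt, div_self Real.two_pi_pos.ne',
        one_mul]
    have h2 := (hsum x).nat_add_neg
    have e3 : ∀ n : ℕ, c n • fourier (n : ℤ) (x : AddCircle (2 * π)) +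
        c (-(n : ℤ)) • fourier (-(n : ℤ)) (x : AddCircle (2 * π)) =
        ((2 * (c n * z ^ n).re : ℝ) : ℂ) := by
      intro n
      rw [hcn, fourier_neg, fourier_apply, AddCircle.toCircle_zsmul, Circle.coe_zpow, e2,
        zpow_natCast, smul_eq_mul, smul_eq_mul, ← map_mul, add_conj]
    have h3 : HasSum (fun n : ℕ => c n * z ^ n) (∑' j : ℕ, c j * z ^ j) :=
      (Summable.of_norm_bounded hu fun j => hbd j z (by
        rw [mem_ball_zero_iff, hz]; linarith)).hasSum
    have h4 := (hasSum_re h3).mul_left 2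
    have h5 := hasSum_re h2
    have h5' := h5.congr_fun fun n =>
      ((congrArg Complex.re (e3 n)).trans (ofReal_re _)).symm
    have h6 := h5'.unique h4
    have e4 : f (x : AddCircle (2 * π)) = L z := by
      change L _ = _
      rw [e2]
    rw [e4, fourier_zero, smul_eq_mul, mul_one, add_re] at h6
    rw [sub_re]
    have h7 : (c 0 / 2).re = (c 0).re / 2 := by simp
    rw [h7]
    linarith

/-- A positive analytic weight on an annulus is `exp (2 Re Γ)` on the circle. -/
theorem exists_szego_log {ρ : ℝ} (hρ0 : 0 < ρ) (hρ1 : ρ < 1) {w : ℂ → ℂ}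
    (hw : AnalyticOn ℂ w {z : ℂ | ρ < ‖z‖ ∧ ‖z‖ < 1 / ρ})
    (hpos : ∀ z : ℂ, ‖z‖ = 1 → 0 < (w z).re ∧ (w z).im = 0) :
    ∃ (Γ : ℂ → ℂ) (R : ℝ), 1 < R ∧ DifferentiableOn ℂ Γ (ball 0 R) ∧ (Γ 0).im = 0 ∧
      ∀ z, ‖z‖ = 1 → (w z).re = rexp (2 * (Γ z).re) := by
  have hρ2 : 1 < 1 / ρ := by rw [one_lt_div hρ0]; exact hρ1
  set A : Set ℂ := {z : ℂ | ρ < ‖z‖ ∧ ‖z‖ < 1 / ρ}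
  have hA : IsOpen A := (isOpen_lt continuous_const continuous_norm).inter
    (isOpen_lt continuous_norm continuous_const)
  have hU : IsOpen (A ∩ w ⁻¹' {z | 0 < z.re}) :=
    hw.continuousOn.isOpen_inter_preimage hA (isOpen_lt continuous_const continuous_re)
  obtain ⟨ε, hε, hsub⟩ := (isCompact_sphere (0 : ℂ) 1).exists_thickening_subset_open hU
    fun z hz => by
      rw [mem_sphere_zero_iff_norm] at hz
      exact ⟨⟨by rw [hz]; exact hρ1, by rw [hz]; exact hρ2⟩, (hpos z hz).1⟩
  have hmem : ∀ z ∈ closedBall (0 : ℂ) (1 + ε / 2) \ ball 0 1, z ∈ A ∩ w ⁻¹' {z | 0 < z.re} := by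
    intro z hz
    have h1 : 1 ≤ ‖z‖ := by simpa using hz.2
    have h2 : ‖z‖ ≤ 1 + ε / 2 := by simpa using hz.1
    refine hsub (mem_thickening_iff.mpr ⟨z / ‖z‖, ?_, ?_⟩)
    · rw [mem_sphere_zero_iff_norm, norm_div, norm_real, norm_norm,
        div_self (by linarith)]
    · have hz0 : (‖z‖ : ℂ) ≠ 0 := ofReal_ne_zero.mpr (by linarith)
      have e : z - z / ‖z‖ = z / ‖z‖ * ((‖z‖ - 1 : ℝ) : ℂ) := by
        push_cast; field_simp
      rw [dist_eq_norm, e, norm_mul, norm_div, norm_real, norm_norm,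
        div_self (by linarith), one_mul, Complex.norm_of_nonneg (by linarith)]
      linarith
  have hdw : ∀ z ∈ closedBall (0 : ℂ) (1 + ε / 2) \ ball 0 1,
      DifferentiableAt ℂ (fun z => log (w z)) z := fun z hz =>
    (hw.differentiableOn.differentiableAt (hA.mem_nhds (hmem z hz).1)).clog
      (Or.inl (hmem z hz).2)
  obtain ⟨Γ, R, h1, h2, h3, h4⟩ := exists_re_eq_of_annulus (L := fun z => log (w z))
    (R' := 1 + ε / 2) (by linarith)
    (fun z hz => (hdw z hz).continuousAt.continuousWithinAt)
    (fun z hz => hdw z ⟨ball_subset_closedBall hz.1, fun h => hz.2 (ball_subset_closedBall h)⟩)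
    (fun z hz => by
      have h := hpos z hz
      rw [log_im, arg_eq_zero_iff.mpr ⟨h.1.le, h.2⟩])
  refine ⟨Γ, R, h1, h2, h3, fun z hz => ?_⟩
  have h := hpos z hz
  have e : w z = ((w z).re : ℂ) := by apply Complex.ext <;> simp [h.2]
  rw [← h4 z hz]
  simp only [log_re]
  rw [e, Complex.norm_of_nonneg h.1.le, ofReal_re, Real.exp_log h.1]

end Splitting

section Scattering

variable {ι : Type*} [Fintype ι] {Γ : ℂ → ℂ} {a : ι → ℂ} {β : ι → ℝ} {R : ℝ} {g : ℝ → ℝ}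

/-- Hypotheses of `cauchy_of_dominated` for `szH * K`. -/
lemma IsSzData.dominated_szH (S : IsSzData Γ a β R g) {K : ℂ → ℂ}
    (hK : ∀ z, ‖z‖ ≤ 1 → DifferentiableAt ℂ K z) :
    DifferentiableOn ℂ (fun z => szH Γ a β z * K z) (ball 0 1) ∧
    (∃ G : ℝ → ℝ, Integrable G arcμ ∧ ∀ r : ℝ, 0 ≤ r → r < 1 → ∀ᵐ θ ∂arcμ,
      ‖szH Γ a β (r * cpt θ) * K (r * cpt θ)‖ ≤ G θ) ∧
    ∀ᵐ θ ∂arcμ, ContinuousAt (fun z => szH Γ a β z * K z) (cpt θ) := by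
  have hH : ∀ z, ‖z‖ ≤ 1 → (∀ k, z ≠ a k) → DifferentiableAt ℂ (szH Γ a β) z := fun z hz hne =>
    differentiableAt_szH S.norm_a (differentiableAt_of_ball S.diff S.one_lt hz) hz hne
  refine ⟨fun z hz => ?_, ?_, ?_⟩
  · have hz := mem_ball_zero_iff.mp hz
    exact ((hH z hz.le fun k => ne_of_norm_lt_one (S.norm_a k) hz).mul
      (hK z hz.le)).differentiableWithinAt
  · obtain ⟨M, hM⟩ := (isCompact_closedBall (0 : ℂ) 1).exists_bound_of_continuousOn
      (f := K) fun z hz => (hK z (by simpa using hz)).continuousAt.continuousWithinAt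
    obtain ⟨C, -, hC⟩ := exists_norm_szH_le (β := β) S.norm_a S.diff S.one_lt
    refine ⟨fun θ => (C + ∑ k, |β k| * (1 + π + 4 * ‖cpt θ - a k‖ ^ (-(1 / 2 : ℝ)))) * M,
      ((integrable_const C).add (integrable_finsetSum _ fun k _ =>
        ((integrable_const (1 + π)).add ((integrable_norm_sub_rpow (S.norm_a k)
          (by norm_num)).const_mul 4)).const_mul _)).mul_const M, fun r h0 h1 => ?_⟩
    filter_upwards [ae_ne_all a] with θ hθ
    rw [norm_mul]
    have hr : (r : ℂ) * cpt θ ∈ closedBall (0 : ℂ) 1 :=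
      mem_closedBall_zero_iff.mpr ((norm_radial h0 θ).trans_le h1.le)
    exact mul_le_mul (hC r h0 h1 θ hθ) (hM _ hr) (norm_nonneg _)
      ((norm_nonneg _).trans (hC r h0 h1 θ hθ))
  · filter_upwards [ae_ne_all a] with θ hθ
    exact ((hH _ (norm_cpt θ).le hθ).mul (hK _ (norm_cpt θ).le)).continuousAt

lemma log_wtF (S : IsSzData Γ a β R g) {θ : ℝ} (hθ : ∀ k, cpt θ ≠ a k) :
    ((Real.log (wtF g a β θ) : ℝ) : ℂ) = szH Γ a β (cpt θ) + conj (szH Γ a β (cpt θ)) := by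
  rw [← norm_szD_sq S.norm_a S.weight hθ, szD, norm_exp, Real.log_pow, Real.log_exp,
    add_conj]
  norm_cast

/-- The Schwarz integral of the logarithm of the weight. -/
lemma IsSzData.schwarz_integral (S : IsSzData Γ a β R g) (hΓ0 : (Γ 0).im = 0) {z : ℂ}
    (hz : ‖z‖ < 1) :
    ∫ θ, ((Real.log (wtF g a β θ) : ℝ) : ℂ) * ((cpt θ + z) / (cpt θ - z)) ∂arcμ =
      2 * szH Γ a β z := by
  set H := szH Γ a β with hH
  have hK : ∀ u : ℂ, ‖u‖ ≤ 1 → 1 - conj z * u ≠ 0 := fun u hu => by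
    refine one_sub_ne_zero_of_norm_lt ?_
    rw [norm_mul, RCLike.norm_conj]
    exact (mul_le_of_le_one_right (norm_nonneg _) hu).trans_lt hz
  have hK' : ∀ u : ℂ, ‖u‖ ≤ 1 →
      DifferentiableAt ℂ (fun u => (1 + conj z * u) / (1 - conj z * u)) u := fun u hu =>
    DifferentiableAt.div (by fun_prop) (by fun_prop) (hK u hu)
  obtain ⟨h1, ⟨G, hG, hb⟩, hl⟩ := S.dominated_szH hK'
  have m1 := mean_of_dominated h1 hG hb hl
  have i1 := integrable_of_dominated h1 hG hb hl
  obtain ⟨h1', ⟨G', hG', hb'⟩, hl'⟩ := S.dominated_szH (K := fun _ => 1) fun _ _ => by fun_prop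
  simp only [mul_one] at h1' hb' hl'
  have m2 := mean_of_dominated h1' hG' hb' hl'
  have i2 := integrable_of_dominated h1' hG' hb' hl'
  have m3 := cauchy_of_dominated h1' hG' hb' hl' hz
  have i3 : Integrable (fun θ => H (cpt θ) * (1 - z * conj (cpt θ))⁻¹) arcμ :=
    i2.mul_bdd (c := (1 - ‖z‖)⁻¹) (continuous_cauchyKernel hz).aestronglyMeasurable
      (.of_forall fun θ => norm_cauchyKernel_le hz θ)
  have i4 : Integrable (fun θ => conj (H (cpt θ) *
      ((1 + conj z * cpt θ) / (1 - conj z * cpt θ)))) arcμ :=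
    (LinearIsometryEquiv.integrable_comp_iff conjLIE).mpr i1
  have e : ∫ θ, ((Real.log (wtF g a β θ) : ℝ) : ℂ) * ((cpt θ + z) / (cpt θ - z)) ∂arcμ =
      ∫ θ, ((2 * (H (cpt θ) * (1 - z * conj (cpt θ))⁻¹) - H (cpt θ)) + conj (H (cpt θ) *
      ((1 + conj z * cpt θ) / (1 - conj z * cpt θ)))) ∂arcμ := by
    refine integral_congr_ae ?_
    filter_upwards [ae_ne_all a] with θ hθ
    have hc := mul_conj_of_norm_one (norm_cpt θ)
    have hne := one_sub_mul_conj_cpt_ne_zero hz θ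
    have hk : (cpt θ + z) / (cpt θ - z) = 2 * (1 - z * conj (cpt θ))⁻¹ - 1 := by
      have : cpt θ - z ≠ 0 := fun h => hne (by
        rw [← sub_eq_zero.mp h, hc, sub_self])
      rw [div_eq_iff this]
      field_simp
      linear_combination (-2 * z) * hc
    have hk2 : (cpt θ + z) / (cpt θ - z) = (1 + z * conj (cpt θ)) / (1 - z * conj (cpt θ)) := by
      rw [hk, eq_div_iff hne]
      field_simp
      ring
    rw [log_wtF S hθ, map_mul, map_div₀, map_sub, map_add, map_mul, map_one, conj_conj,
      ← hk2, add_mul]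
    congr 1
    rw [hk]; ring
  have i5 : Integrable (fun θ => 2 * (H (cpt θ) * (1 - z * conj (cpt θ))⁻¹) - H (cpt θ)) arcμ :=
    (i3.const_mul 2).sub i2
  rw [e, integral_add i5 i4, integral_sub (i3.const_mul 2) i2,
    integral_const_mul, m3, m2, integral_conj, m1]
  have h0 : conj (H 0) = H 0 := conj_eq_iff_im.mpr (by simpa [hH, szH] using hΓ0)
  simp only [hH] at h0 ⊢
  simp [h0]

lemma IsSzData.schwarz_integral_exterior (S : IsSzData Γ a β R g) (hΓ0 : (Γ 0).im = 0) {z : ℂ}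
    (hz : ‖z‖ < 1) (hz0 : z ≠ 0) :
    ∫ θ, ((Real.log (wtF g a β θ) : ℝ) : ℂ) * ((cpt θ + (conj z)⁻¹) / (cpt θ - (conj z)⁻¹)) ∂arcμ =
      -conj (2 * szH Γ a β z) := by
  rw [← S.schwarz_integral hΓ0 hz, ← integral_conj, ← integral_neg]
  refine integral_congr_ae (.of_forall fun θ => ?_)
  have h0 : conj z ≠ 0 := by simpa using hz0
  have hc := mul_conj_of_norm_one (norm_cpt θ)
  have hne : conj (cpt θ) - conj z ≠ 0 := by
    rw [← map_sub]
    simp only [ne_eq, map_eq_zero]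
    intro h
    rw [← sub_eq_zero.mp h, norm_cpt] at hz
    exact lt_irrefl _ hz
  have hne2 : cpt θ * conj z - 1 ≠ 0 := fun h => hne (by
    have h2 : cpt θ ≠ 0 := exp_ne_zero _
    have h3 : cpt θ * (conj (cpt θ) - conj z) = 0 := by linear_combination hc - h
    exact (mul_eq_zero.mp h3).resolve_left h2)
  simp only [map_mul, map_div₀, map_add, map_sub, conj_ofReal]
  rw [← mul_neg]
  congr 1
  have e1 : (cpt θ + (conj z)⁻¹) / (cpt θ - (conj z)⁻¹) =
      (cpt θ * conj z + 1) / (cpt θ * conj z - 1) := by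
    rw [← mul_div_mul_right _ _ h0, add_mul, sub_mul, inv_mul_cancel₀ h0]
  rw [e1, ← neg_div, div_eq_div_iff hne2 hne]
  linear_combination (2 * conj z) * hc

lemma exp_schwarz {f : ℝ → ℂ} {J : ℂ} (h : ∫ θ, f θ ∂arcμ = 2 * J) :
    exp (((4 * π : ℝ)⁻¹ : ℂ) * ∫ θ in (0:ℝ)..(2 * π), f θ) = exp J := by
  rw [integral_arcμ, real_smul] at h
  have hπ : (π : ℂ) ≠ 0 := ofReal_ne_zero.mpr Real.pi_ne_zero
  congr 1
  have h2 : ∫ θ in (0:ℝ)..(2 * π), f θ = (2 * π) * (2 * J) := by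
    rw [← h]; push_cast; field_simp
  rw [h2]; push_cast; field_simp; ring

lemma arg_one_sub_cpt {ε : ℝ} (h0 : 0 < ε) (h1 : ε < π) :
    arg (1 - cpt ε) = (ε - π) / 2 := by
  have hs : 0 < 2 * Real.sin (ε / 2) :=
    mul_pos two_pos (Real.sin_pos_of_pos_of_lt_pi (by linarith) (by linarith))
  rw [← arg_mul_cos_add_sin_mul_I hs (θ := (ε - π) / 2) ⟨by linarith, by linarith⟩]
  congr 1
  have e1 : (ε - π) / 2 = ε / 2 - π / 2 := by ring
  have e2 : ε = 2 * (ε / 2) := by ring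
  rw [e1, cpt, exp_mul_I]
  nth_rewrite 1 2 [e2]
  rw [← ofReal_cos, ← ofReal_sin, ← ofReal_cos, ← ofReal_sin,
    Real.cos_sub_pi_div_two, Real.sin_sub_pi_div_two, Real.cos_two_mul, Real.sin_two_mul]
  have h := Real.sin_sq_add_cos_sq (ε / 2)
  generalize Real.sin (ε / 2) = s at h ⊢
  generalize Real.cos (ε / 2) = c at h ⊢
  have h' : (s : ℂ) ^ 2 + (c : ℂ) ^ 2 = 1 := by exact_mod_cast h
  push_cast
  linear_combination -2 * h'

/-- Interior boundary values of the Szegő function off the singularities. -/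
lemma IsSzData.interior_eq (S : IsSzData Γ a β R g) {D : ℂ → ℂ} {s : Set ℂ} {z : ℂ} (hz : ‖z‖ = 1)
    (hne : ∀ k, z ≠ a k) (hD : ∀ u, ‖u‖ < 1 → D u = szD Γ a β u) (hs : ContinuousWithinAt D s z)
    (hr : ∀ᶠ r : ℝ in 𝓝[<] 1, (r : ℂ) * z ∈ s) : D z = szD Γ a β z := by
  obtain ⟨θ, rfl⟩ := exists_cpt_eq hz
  have h1 : Tendsto (fun r : ℝ => (r : ℂ) * cpt θ) (𝓝[<] 1) (nhds (cpt θ)) :=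
    tendsto_radial (F := id) continuousAt_id
  have h2 := hs.tendsto.comp (tendsto_nhdsWithin_iff.mpr ⟨h1, hr⟩)
  have h3 := tendsto_radial (S.differentiableAt_szD (norm_cpt θ).le hne).continuousAt
  refine tendsto_nhds_unique h2 (h3.congr' ?_)
  filter_upwards [eventually_mem_Ico] with r hr
  exact (hD _ ((norm_radial hr.1 θ).trans_lt hr.2)).symm

lemma IsSzData.exterior_eq (S : IsSzData Γ a β R g) {D : ℂ → ℂ} {s : Set ℂ} {z : ℂ} (hz : ‖z‖ = 1)
    (hne : ∀ k, z ≠ a k)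
    (hD : ∀ u, ‖u‖ < 1 → u ≠ 0 → D (conj u)⁻¹ = (conj (szD Γ a β u))⁻¹)
    (hs : ContinuousWithinAt D s z)
    (hr : ∀ᶠ r : ℝ in 𝓝[<] 1, ((r⁻¹ : ℝ) : ℂ) * z ∈ s) :
    D z = (conj (szD Γ a β z))⁻¹ := by
  obtain ⟨θ, rfl⟩ := exists_cpt_eq hz
  have h1 : Tendsto (fun r : ℝ => ((r⁻¹ : ℝ) : ℂ) * cpt θ) (𝓝[<] 1)
      (nhds (cpt θ)) := by
    have h : ContinuousAt (fun r : ℝ => ((r⁻¹ : ℝ) : ℂ) * cpt θ) 1 :=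
      (continuous_ofReal.continuousAt.comp (continuousAt_inv₀ one_ne_zero)).mul
        continuousAt_const
    have h' := h.tendsto
    simp only [inv_one, ofReal_one, one_mul] at h'
    exact h'.mono_left nhdsWithin_le_nhds
  have h2 := hs.tendsto.comp (tendsto_nhdsWithin_iff.mpr ⟨h1, hr⟩)
  have h3 := tendsto_radial (S.differentiableAt_szD (norm_cpt θ).le hne).continuousAt
  have h4 : conj (szD Γ a β (cpt θ)) ≠ 0 := by
    rw [szD, ← exp_conj]; exact exp_ne_zero _
  have h5 := ((continuous_conj.tendsto _).comp h3).inv₀ h4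
  refine tendsto_nhds_unique h2 (h5.congr' ?_)
  have hp : ∀ᶠ r : ℝ in 𝓝[<] 1, 0 < r :=
    nhdsWithin_le_nhds (lt_mem_nhds one_pos)
  filter_upwards [eventually_mem_Ico, hp] with r hr hp
  have e : (conj ((r : ℂ) * cpt θ))⁻¹ = ((r⁻¹ : ℝ) : ℂ) * cpt θ := by
    rw [map_mul, conj_ofReal, conj_eq_inv_of_norm_one (norm_cpt θ), mul_inv, inv_inv,
      ofReal_inv]
  have h6 := hD ((r : ℂ) * cpt θ) ((norm_radial hr.1 θ).trans_lt hr.2)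
    (mul_ne_zero (ofReal_ne_zero.mpr hp.ne') (exp_ne_zero _))
  rw [e] at h6
  exact h6.symm

lemma szD_div_conj (z : ℂ) :
    szD Γ a β z * (conj (szD Γ a β z))⁻¹ = exp (2 * (szH Γ a β z).im * I) := by
  rw [szD, ← exp_conj, ← exp_neg, ← exp_add, ← sub_eq_add_neg,
    sub_conj]
  push_cast
  rfl

variable [DecidableEq ι]

lemma tendsto_mul_cpt (z : ℂ) : Tendsto (fun ε : ℝ => z * cpt ε) (𝓝[>] 0) (nhds z) := by
  have h : Continuous fun ε : ℝ => z * cpt ε := by fun_prop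
  simpa [cpt_zero] using (h.tendsto 0).mono_left nhdsWithin_le_nhds

/-- The one-sided limit of the phase of the Szegő function at a singularity. -/
lemma IsSzData.tendsto_phase (S : IsSzData Γ a β R g) (hΓ0 : (Γ 0).im = 0) (k : ι) :
    Tendsto (fun ε : ℝ => (szH Γ a β (a k * cpt ε)).im) (𝓝[>] 0)
      (nhds (szLam Γ a β k - β k * (π / 2))) := by
  have hl : Tendsto (fun ε : ℝ => β k * ((ε - π) / 2)) (𝓝[>] 0)
      (nhds (-(β k * (π / 2)))) := by
    have h : Continuous fun ε : ℝ => β k * ((ε - π) / 2) := by fun_prop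
    convert (h.tendsto 0).mono_left nhdsWithin_le_nhds using 2
    ring
  have hsum := ((S.continuousAt_phase k).tendsto.comp (tendsto_mul_cpt _)).add hl
  rw [← sub_eq_add_neg] at hsum
  refine hsum.congr' ?_
  filter_upwards [Ioo_mem_nhdsGT pi_pos] with ε hε
  have e : 1 - conj (a k) * (a k * cpt ε) = 1 - cpt ε := by
    rw [← mul_assoc, conj_mul_of_norm_one (S.norm_a k), one_mul]
  simp only [Function.comp_apply]
  rw [szH, ← add_sum_erase _ _ (Finset.mem_univ k), e, add_im, add_im,
    add_im, sub_im, hΓ0, im_ofReal_mul, log_im,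
    arg_one_sub_cpt hε.1 hε.2]
  ring

lemma eventually_mul_cpt_ne {κ : Type*} [Finite κ] {b : κ → ℂ} {z : ℂ} (hz : z ≠ 0) :
    ∀ᶠ ε : ℝ in 𝓝[>] 0, ∀ j, z * cpt ε ≠ b j := by
  refine eventually_all.mpr fun j => ?_
  by_cases h : z = b j
  · filter_upwards [Ioo_mem_nhdsGT pi_pos] with ε hε he
    have h1 : cpt ε = 1 := mul_left_cancel₀ hz (by rw [he, mul_one, h])
    have h2 := arg_one_sub_cpt hε.1 hε.2
    rw [h1, sub_self, arg_zero] at h2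
    linarith [hε.2]
  · exact (tendsto_mul_cpt z).eventually_ne h

/-- The value of the continued scattering function at a singularity. -/
theorem IsSzData.scattering_eq (S : IsSzData Γ a β R g) (hΓ0 : (Γ 0).im = 0) (k : ι)
    {Di De Sc : ℂ → ℂ} {s t : Set ℂ} (hDi : ∀ u, ‖u‖ < 1 → Di u = szD Γ a β u)
    (hDe : ∀ u, ‖u‖ < 1 → u ≠ 0 → De (conj u)⁻¹ = (conj (szD Γ a β u))⁻¹)
    (hs : ∀ᶠ ε : ℝ in 𝓝[>] 0, ContinuousWithinAt Di s (a k * cpt ε) ∧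
      ∀ᶠ r : ℝ in 𝓝[<] 1, (r : ℂ) * (a k * cpt ε) ∈ s)
    (ht : ∀ᶠ ε : ℝ in 𝓝[>] 0, ContinuousWithinAt De t (a k * cpt ε) ∧
      ∀ᶠ r : ℝ in 𝓝[<] 1, ((r⁻¹ : ℝ) : ℂ) * (a k * cpt ε) ∈ t)
    (hSc : ContinuousAt Sc (a k))
    (hplus : ∀ᶠ ε : ℝ in 𝓝[>] 0, Sc (a k * cpt ε) =
      exp (((π * β k : ℝ) : ℂ) * I) * (Di (a k * cpt ε) * De (a k * cpt ε))) :
    Sc (a k) = exp (2 * szLam Γ a β k * I) := by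
  have h1 : Tendsto (fun ε : ℝ => Sc (a k * cpt ε)) (𝓝[>] 0) (nhds (Sc (a k))) :=
    hSc.tendsto.comp (tendsto_mul_cpt _)
  have h2 : Tendsto (fun ε : ℝ => exp (((π * β k : ℝ) : ℂ) * I) *
      exp (2 * (szH Γ a β (a k * cpt ε)).im * I)) (𝓝[>] 0)
      (nhds (exp (((π * β k : ℝ) : ℂ) * I) *
        exp (2 * (szLam Γ a β k - β k * (π / 2) : ℝ) * I))) := by
    refine Tendsto.const_mul _ ?_
    have hc : Continuous fun x : ℝ => exp (2 * x * I) := by fun_prop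
    exact (hc.tendsto _).comp (S.tendsto_phase hΓ0 k)
  have e : exp (((π * β k : ℝ) : ℂ) * I) *
      exp (2 * (szLam Γ a β k - β k * (π / 2) : ℝ) * I) =
      exp (2 * szLam Γ a β k * I) := by
    rw [← exp_add]
    congr 1
    push_cast
    ring
  rw [← e]
  refine tendsto_nhds_unique h1 (h2.congr' ?_)
  have hak : a k ≠ 0 := norm_ne_zero_iff.mp (S.norm_a k ▸ one_ne_zero)
  filter_upwards [hs, ht, hplus, eventually_mul_cpt_ne (b := a) hak] with ε e1 e2 e3 hne
  have hn : ‖a k * cpt ε‖ = 1 := by rw [norm_mul, S.norm_a, norm_cpt, one_mul]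
  rw [e3, S.interior_eq hn hne hDi e1.1 e1.2, S.exterior_eq hn hne hDe e2.1 e2.2, szD_div_conj]

end Scattering

section Zeros

lemma tendsto_zero_of_recurrence {x e : ℕ → ℝ} {r : ℝ} (h0 : 0 ≤ r) (h1 : r < 1)
    (hx0 : ∀ n, 0 ≤ x n) (hx : ∀ n, x (n + 1) = r * x n + e n) (he : Tendsto e atTop (nhds 0)) :
    Tendsto x atTop (nhds 0) := by
  refine tendsto_order.mpr ⟨fun c hc => .of_forall fun n => hc.trans_le (hx0 n), fun ε hε => ?_⟩
  have h2 : 0 < ε / 2 * (1 - r) := mul_pos (half_pos hε) (by linarith)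
  obtain ⟨N, hN⟩ := eventually_atTop.mp (he.eventually_lt_const h2)
  have hb : ∀ k, x (N + k) ≤ r ^ k * x N + ε / 2 := by
    intro k
    induction k with
    | zero => simp; linarith
    | succ k ih =>
      have h3 := mul_le_mul_of_nonneg_left ih h0
      have h4 := (hN (N + k) (by omega)).le
      rw [← add_assoc, hx, pow_succ]
      linarith
  have ht : Tendsto (fun k : ℕ => r ^ k * x N + ε / 2) atTop (nhds (0 * x N + ε / 2)) :=
    ((tendsto_pow_atTop_nhds_zero_of_lt_one h0 h1).mul_const _).add_const _
  obtain ⟨K, hK⟩ := eventually_atTop.mp (ht.eventually_lt_const (u := ε) (by linarith))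
  filter_upwards [eventually_ge_atTop (N + K)] with n hn
  obtain ⟨k, rfl⟩ := Nat.exists_eq_add_of_le hn
  rw [add_assoc]
  exact (hb _).trans_lt (hK (K + k) (by omega))

variable {ν : Measure ℝ} [IsFiniteMeasure ν] {Φ : ℕ → ℂ[X]}

lemma norm_sub_conj_le {α u : ℂ} (hα : ‖α‖ ≤ 1) (hu : ‖u‖ ≤ 1) : ‖u - conj α‖ ≤ ‖1 - α * u‖ := by
  have h : ‖1 - α * u‖ ^ 2 - ‖u - conj α‖ ^ 2 = (1 - ‖α‖ ^ 2) * (1 - ‖u‖ ^ 2) := by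
    simp only [← normSq_eq_norm_sq, normSq_apply]
    simp
    ring
  have h2 : 0 ≤ (1 - ‖α‖ ^ 2) * (1 - ‖u‖ ^ 2) :=
    mul_nonneg (by nlinarith [norm_nonneg α]) (by nlinarith [norm_nonneg u])
  exact abs_le_of_sq_le_sq' (by linarith) (norm_nonneg _) |>.2

lemma IsOPUC.schur_bound (H : IsOPUC ν Φ) {z : ℂ} (hz : ‖z‖ < 1) (n : ℕ) :
    (rv Φ n).eval z ≠ 0 ∧ ‖(Φ n).eval z / (rv Φ n).eval z‖ ≤ 1 := by
  induction n with
  | zero => simp [rv, H.phi_zero]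
  | succ n ih =>
    obtain ⟨h1, h2⟩ := ih
    set b := (Φ n).eval z / (rv Φ n).eval z with hb
    have hΦ : (Φ n).eval z = b * (rv Φ n).eval z := (div_mul_cancel₀ _ h1).symm
    have hu : ‖z * b‖ < 1 := by
      rw [norm_mul]
      exact (mul_le_of_le_one_right (norm_nonneg _) h2).trans_lt hz
    have e1 : (rv Φ (n + 1)).eval z = (1 - vb Φ n * (z * b)) * (rv Φ n).eval z := by
      simp only [rv, eval_sub, eval_mul, eval_C, eval_X]
      rw [hΦ]; ring
    have e2 : (Φ (n + 1)).eval z = (z * b - conj (vb Φ n)) * (rv Φ n).eval z := by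
      rw [H.phi_succ]
      simp only [eval_sub, eval_mul, eval_C, eval_X]
      rw [hΦ]; ring
    have hne : 1 - vb Φ n * (z * b) ≠ 0 := by
      refine one_sub_ne_zero_of_norm_lt ?_
      rw [norm_mul]
      exact (mul_le_of_le_one_left (norm_nonneg _) (H.norm_vb_lt n).le).trans_lt hu
    refine ⟨by rw [e1]; exact mul_ne_zero hne h1, ?_⟩
    rw [e1, e2, mul_div_mul_right _ _ h1, norm_div]
    exact div_le_one_of_le₀ (norm_sub_conj_le (H.norm_vb_lt n).le hu.le) (norm_nonneg _)

lemma IsOPUC.schur_succ (H : IsOPUC ν Φ) {z : ℂ} (hz : ‖z‖ < 1) (n : ℕ) :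
    (Φ (n + 1)).eval z / (rv Φ (n + 1)).eval z =
      z * ((Φ n).eval z / (rv Φ n).eval z) - conj (vb Φ n) +
      vb Φ n * z * ((Φ n).eval z / (rv Φ n).eval z) *
        ((Φ (n + 1)).eval z / (rv Φ (n + 1)).eval z) := by
  have h1 := (H.schur_bound hz n).1
  have h2 := (H.schur_bound hz (n + 1)).1
  have e1 : (rv Φ (n + 1)).eval z = (rv Φ n).eval z - vb Φ n * (z * (Φ n).eval z) := by
    simp only [rv, eval_sub, eval_mul, eval_C, eval_X]
  have e2 : (Φ (n + 1)).eval z = z * (Φ n).eval z - conj (vb Φ n) * (rv Φ n).eval z := by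
    rw [H.phi_succ]
    simp only [eval_sub, eval_mul, eval_C, eval_X]
  generalize (rv Φ (n + 1)).eval z = r' at *
  generalize (Φ (n + 1)).eval z = p' at *
  generalize (rv Φ n).eval z = r at *
  field_simp
  linear_combination r' * e2 - p' * e1

/-- Zeros in a compact part of the disc force the leading term to be small. -/
lemma IsOPUC.exists_zero_bound {ι : Type*} [Fintype ι] {a c : ι → ℂ} (H : IsOPUC ν Φ)
    (ha : ∀ k, ‖a k‖ = 1) (hv : Tendsto (fun n : ℕ => ((n : ℂ) + 1) * conj (vb Φ n) +
      ∑ k, c k * a k ^ (n + 1)) atTop (nhds 0)) {r : ℝ} (h0 : 0 ≤ r) (h1 : r < 1) :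
    ∃ x : ℕ → ℝ, Tendsto x atTop (nhds 0) ∧ ∀ n z, ‖z‖ ≤ r → (Φ n).eval z = 0 →
      ‖∑ k, c k * a k ^ (n + 1) / (a k - z)‖ ≤ x n := by
  set δ : ℕ → ℂ := fun n => ((n : ℂ) + 1) * conj (vb Φ n) + ∑ k, c k * a k ^ (n + 1) with hδ
  have hδ' : Tendsto (fun n => ‖δ n‖) atTop (nhds 0) := by simpa using hv.norm
  set C : ℝ := ∑ k, ‖c k‖ with hC
  have hC0 : 0 ≤ C := sum_nonneg fun k _ => norm_nonneg _
  have hsum : ∀ n, ‖∑ k, c k * a k ^ (n + 1)‖ ≤ C := fun n =>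
    (norm_sum_le _ _).trans_eq (sum_congr rfl fun k _ => by
      rw [norm_mul, norm_pow, ha, one_pow, mul_one])
  have hα : ∀ n : ℕ, ((n : ℝ) + 1) * ‖vb Φ n‖ ≤ ‖δ n‖ + C := fun n => by
    have e : ((n : ℂ) + 1) * conj (vb Φ n) = δ n - ∑ k, c k * a k ^ (n + 1) := by simp [hδ]
    have h2 : ‖((n : ℂ) + 1) * conj (vb Φ n)‖ = ((n : ℝ) + 1) * ‖vb Φ n‖ := by
      rw [norm_mul, RCLike.norm_conj, norm_natCast_add_one]
    rw [← h2, e]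
    exact (norm_sub_le _ _).trans (add_le_add le_rfl (hsum n))
  have hα0 : Tendsto (fun n => ‖vb Φ n‖) atTop (nhds 0) := by
    have h2 : Tendsto (fun n : ℕ => (‖δ n‖ + C) * (1 / ((n : ℝ) + 1))) atTop
        (nhds ((0 + C) * 0)) := (hδ'.add_const C).mul tendsto_one_div_add_atTop_nhds_zero_nat
    rw [mul_zero] at h2
    refine squeeze_zero (fun n => norm_nonneg _) (fun n => ?_) h2
    have : (0 : ℝ) < n + 1 := by positivity
    rw [mul_one_div, le_div_iff₀ this, mul_comm]
    exact hα n
  let m : ℕ → ℝ := fun n => Nat.rec 1 (fun n y => r * y + 2 * ‖vb Φ n‖) n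
  have hm : ∀ n, m (n + 1) = r * m n + 2 * ‖vb Φ n‖ := fun n => rfl
  have hm0 : ∀ n, 0 ≤ m n := fun n => by
    induction n with
    | zero => exact zero_le_one
    | succ n ih => rw [hm]; positivity
  have hmt : Tendsto m atTop (nhds 0) :=
    tendsto_zero_of_recurrence h0 h1 hm0 hm (by simpa using hα0.const_mul 2)
  set e : ℕ → ℝ := fun n => m n + ‖δ n‖ + (‖δ n‖ + C) * m n with he
  have het : Tendsto e atTop (nhds 0) := by
    simpa using (hmt.add hδ').add ((hδ'.add_const C).mul hmt)
  let x : ℕ → ℝ := fun n => Nat.rec (C / (1 - r)) (fun n y => r * y + e n) n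
  have hx : ∀ n, x (n + 1) = r * x n + e n := fun n => rfl
  have hx0 : ∀ n, 0 ≤ x n := fun n => by
    induction n with
    | zero => exact div_nonneg hC0 (by linarith)
    | succ n ih =>
      have := hm0 n
      rw [hx]; positivity
  refine ⟨x, tendsto_zero_of_recurrence h0 h1 hx0 hx het, fun n z hz hroot => ?_⟩
  have hz1 : ‖z‖ < 1 := hz.trans_lt h1
  have haz : ∀ k, 1 - r ≤ ‖a k - z‖ := fun k => by
    have := norm_sub_norm_le (a k) z
    rw [ha] at this
    linarith
  have hazne : ∀ k, a k - z ≠ 0 := fun k h => by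
    have := haz k
    rw [h, norm_zero] at this
    linarith
  set b : ℕ → ℂ := fun n => (Φ n).eval z / (rv Φ n).eval z with hb
  have hb1 : ∀ n, ‖b n‖ ≤ 1 := fun n => (H.schur_bound hz1 n).2
  have hbs : ∀ n, b (n + 1) = z * b n - conj (vb Φ n) + vb Φ n * z * b n * b (n + 1) :=
    fun n => H.schur_succ hz1 n
  have hq : ∀ n, ‖vb Φ n * z * b n * b (n + 1)‖ ≤ ‖vb Φ n‖ * ‖b n‖ := fun n => by
    rw [norm_mul, norm_mul, norm_mul]
    have h3 : ‖vb Φ n‖ * ‖z‖ * ‖b n‖ ≤ ‖vb Φ n‖ * ‖b n‖ :=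
      mul_le_mul_of_nonneg_right (mul_le_of_le_one_right (norm_nonneg _) hz1.le) (norm_nonneg _)
    exact (mul_le_of_le_one_right (by positivity) (hb1 _)).trans h3
  have hbm : ∀ n, ‖b n‖ ≤ m n := fun n => by
    induction n with
    | zero => exact hb1 0
    | succ n ih =>
      rw [hbs, hm]
      have h3 := norm_add_le (z * b n - conj (vb Φ n)) (vb Φ n * z * b n * b (n + 1))
      have h4 := norm_sub_le (z * b n) (conj (vb Φ n))
      rw [RCLike.norm_conj, norm_mul] at h4
      have h5 : ‖z‖ * ‖b n‖ ≤ r * m n := mul_le_mul hz ih (norm_nonneg _) h0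
      have h6 : ‖vb Φ n‖ * ‖b n‖ ≤ ‖vb Φ n‖ := mul_le_of_le_one_right (norm_nonneg _) (hb1 n)
      linarith [hq n]
  have hd : ∀ n : ℕ, ‖(n : ℂ) * b n - ∑ k, c k * a k ^ (n + 1) / (a k - z)‖ ≤ x n := fun n => by
    induction n with
    | zero =>
      rw [Nat.cast_zero, zero_mul, zero_sub, norm_neg]
      refine (norm_sum_le _ _).trans ?_
      change _ ≤ C / (1 - r)
      rw [hC, sum_div]
      refine sum_le_sum fun k _ => ?_
      rw [norm_div, norm_mul, norm_pow, ha, one_pow, mul_one]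
      exact div_le_div_of_nonneg_left (norm_nonneg _) (by linarith) (haz k)
    | succ n ih =>
      have hS : ∑ k, c k * a k ^ (n + 1 + 1) / (a k - z) =
          z * ∑ k, c k * a k ^ (n + 1) / (a k - z) + ∑ k, c k * a k ^ (n + 1) := by
        rw [mul_sum, ← sum_add_distrib]
        refine sum_congr rfl fun k _ => ?_
        have := hazne k
        field_simp
        ring
      have e1 : ((n + 1 : ℕ) : ℂ) * b (n + 1) - ∑ k, c k * a k ^ (n + 1 + 1) / (a k - z) =
          z * ((n : ℂ) * b n - ∑ k, c k * a k ^ (n + 1) / (a k - z)) + z * b n - δ n +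
          ((n : ℂ) + 1) * (vb Φ n * z * b n * b (n + 1)) := by
        rw [hS, hδ]
        push_cast
        linear_combination ((n : ℂ) + 1) * hbs n
      rw [e1, hx]
      have h3 : ‖((n : ℂ) + 1) * (vb Φ n * z * b n * b (n + 1))‖ ≤ (‖δ n‖ + C) * m n := by
        rw [norm_mul, norm_natCast_add_one]
        have h5 := mul_le_mul_of_nonneg_left (hq n) (by positivity : (0 : ℝ) ≤ n + 1)
        refine h5.trans ?_
        rw [← mul_assoc]
        exact mul_le_mul (hα n) (hbm n) (norm_nonneg _) (by positivity)
      have h5 : ‖z * b n‖ ≤ m n := by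
        rw [norm_mul]
        exact (mul_le_of_le_one_left (norm_nonneg _) hz1.le).trans (hbm n)
      have h6 : ‖z * ((n : ℂ) * b n - ∑ k, c k * a k ^ (n + 1) / (a k - z))‖ ≤ r * x n := by
        rw [norm_mul]
        exact mul_le_mul hz ih (norm_nonneg _) h0
      have h7 := norm_add_le (z * ((n : ℂ) * b n - ∑ k, c k * a k ^ (n + 1) / (a k - z)) + z * b n -
        δ n) (((n : ℂ) + 1) * (vb Φ n * z * b n * b (n + 1)))
      have h8 := norm_sub_le (z * ((n : ℂ) * b n - ∑ k, c k * a k ^ (n + 1) / (a k - z)) + z * b n)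
        (δ n)
      have h9 := norm_add_le (z * ((n : ℂ) * b n - ∑ k, c k * a k ^ (n + 1) / (a k - z))) (z * b n)
      simp only [he]
      linarith
  have h := hd n
  have hbn : b n = 0 := by simp [hb, hroot]
  rwa [hbn, mul_zero, zero_sub, norm_neg] at h

end Zeros

section Conclusion

lemma exp_two_pi_pow (p q n : ℕ) (hq : 0 < q) :
    exp (2 * (π : ℂ) * I * (((p : ℝ) / (q : ℝ) : ℝ) : ℂ)) ^ n =
      exp (2 * (π : ℂ) * I * ((((n * p % q : ℕ) : ℝ) / (q : ℝ) : ℝ) : ℂ)) := by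
  rw [← exp_nat_mul, exp_eq_exp_iff_exists_int]
  refine ⟨(n * p / q : ℕ), ?_⟩
  have h : ((q : ℂ) * ((n * p / q : ℕ) : ℂ) + ((n * p % q : ℕ) : ℂ)) = (n : ℂ) * p := by
    exact_mod_cast Nat.div_add_mod (n * p) q
  have hq' : (q : ℂ) ≠ 0 := Nat.cast_ne_zero.mpr hq.ne'
  rw [ofReal_div, ofReal_div, ofReal_natCast, ofReal_natCast,
    ofReal_natCast, Int.cast_natCast]
  generalize ((n * p / q : ℕ) : ℂ) = d at h ⊢
  generalize ((n * p % q : ℕ) : ℂ) = s at h ⊢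
  field_simp
  linear_combination -h

/-- Smallness of the leading term along a sequence of zeros forces an exact relation, since only
finitely many phases occur. -/
lemma exists_phase_relation {ι : Type*} [Fintype ι] {a c : ι → ℂ} (ha : ∀ k, ‖a k‖ = 1) {A : ℂ}
    (hA : ‖A‖ = 1) {q p : ι → ℕ} (hq : ∀ k, 0 < q k)
    (hap : ∀ k, a k = A * exp (2 * (π : ℂ) * I * (((p k : ℝ) / (q k : ℝ) : ℝ) : ℂ)))
    {Φ : ℕ → ℂ[X]} {t : ℂ} {r : ℝ} (htr : ‖t‖ < r) (h1 : r < 1) {x : ℕ → ℝ}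
    (hx : Tendsto x atTop (nhds 0))
    (hb : ∀ n z, ‖z‖ ≤ r → (Φ n).eval z = 0 → ‖∑ k, c k * a k ^ (n + 1) / (a k - z)‖ ≤ x n)
    (hZ : ∀ N : ℕ, ∀ ε > 0, ∃ n, N ≤ n ∧ ∃ z, (Φ n).eval z = 0 ∧ ‖z - t‖ < ε) :
    ∃ s : ι → ℕ, (∀ k, s k < q k) ∧ ∑ k, c k / (a k - t) *
      exp (2 * (π : ℂ) * I * (((s k : ℝ) / (q k : ℝ) : ℝ) : ℂ)) = 0 := by
  have : Nonempty (∀ k, Fin (q k)) := ⟨fun k => ⟨0, hq k⟩⟩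
  let V : (∀ k, Fin (q k)) → ℂ := fun s => ∑ k, c k / (a k - t) *
      exp (2 * (π : ℂ) * I * ((((s k : ℕ) : ℝ) / (q k : ℝ) : ℝ) : ℂ))
  obtain ⟨s₀, hs₀⟩ := Finite.exists_min fun s => ‖V s‖
  refine ⟨fun k => s₀ k, fun k => (s₀ k).2, ?_⟩
  by_contra hV
  have hη : 0 < ‖V s₀‖ := norm_pos_iff.mpr hV
  set η := ‖V s₀‖ with hηdef
  set K : ℝ := ∑ k, ‖c k‖ / (1 - r) ^ 2 with hK
  have hr1 : 0 < (1 - r) ^ 2 := pow_pos (by linarith) 2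
  have hK0 : 0 ≤ K := sum_nonneg fun k _ => by positivity
  obtain ⟨N, hN⟩ := eventually_atTop.mp (hx.eventually_lt_const (half_pos hη))
  obtain ⟨n, hn, z, hz, hzt⟩ := hZ N (min (r - ‖t‖) (η / (2 * (K + 1))))
    (lt_min (by linarith) (by positivity))
  have hz1 : ‖z - t‖ < r - ‖t‖ := hzt.trans_le (min_le_left _ _)
  have hz2 : ‖z - t‖ < η / (2 * (K + 1)) := hzt.trans_le (min_le_right _ _)
  have hzr : ‖z‖ ≤ r := by
    have := norm_sub_norm_le z t
    linarith
  have hlow : ∀ u : ℂ, ‖u‖ ≤ r → ∀ k, 1 - r ≤ ‖a k - u‖ := fun u hu k => by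
    have := norm_sub_norm_le (a k) u
    rw [ha] at this
    linarith
  have hne : ∀ u : ℂ, ‖u‖ ≤ r → ∀ k, a k - u ≠ 0 := fun u hu k h => by
    have := hlow u hu k
    rw [h, norm_zero] at this
    linarith
  have e1 : ∑ k, c k * a k ^ (n + 1) / (a k - t) =
      A ^ (n + 1) * V fun k => ⟨(n + 1) * p k % q k, Nat.mod_lt _ (hq k)⟩ := by
    simp only [V]
    rw [mul_sum]
    refine sum_congr rfl fun k _ => ?_
    rw [← exp_two_pi_pow _ _ _ (hq k)]
    nth_rewrite 1 [hap k]
    rw [mul_pow]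
    ring
  have e2 : η ≤ ‖∑ k, c k * a k ^ (n + 1) / (a k - t)‖ := by
    rw [e1, norm_mul, norm_pow, hA, one_pow, one_mul]
    exact hs₀ _
  have e3 : ‖∑ k, c k * a k ^ (n + 1) / (a k - z) - ∑ k, c k * a k ^ (n + 1) / (a k - t)‖ ≤
      K * ‖z - t‖ := by
    rw [← sum_sub_distrib, hK, sum_mul]
    refine (norm_sum_le _ _).trans (sum_le_sum fun k _ => ?_)
    have n1 := hne z hzr k
    have n2 := hne t htr.le k
    have e : c k * a k ^ (n + 1) / (a k - z) - c k * a k ^ (n + 1) / (a k - t) =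
        c k * a k ^ (n + 1) / ((a k - z) * (a k - t)) * (z - t) := by
      field_simp
      ring
    rw [e, norm_mul, norm_div, norm_mul, norm_pow, ha, one_pow, mul_one, norm_mul]
    refine mul_le_mul_of_nonneg_right (div_le_div_of_nonneg_left (norm_nonneg _) hr1 ?_)
      (norm_nonneg _)
    rw [sq]
    exact mul_le_mul (hlow z hzr k) (hlow t htr.le k) (by linarith) (norm_nonneg _)
  have e4 := hb n z hzr hz
  have e5 := hN n hn
  have e6 : K * ‖z - t‖ ≤ η / 2 := by
    have h := mul_le_mul_of_nonneg_left hz2.le (by linarith : 0 ≤ K + 1)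
    have h' : (K + 1) * (η / (2 * (K + 1))) = η / 2 := by
      have : K + 1 ≠ 0 := by linarith
      field_simp
    have h'' : (K + 1) * ‖z - t‖ = K * ‖z - t‖ + ‖z - t‖ := by ring
    linarith [norm_nonneg (z - t)]
  have e7 := norm_sub_norm_le (∑ k, c k * a k ^ (n + 1) / (a k - t))
    (∑ k, c k * a k ^ (n + 1) / (a k - z))
  rw [norm_sub_rev] at e7
  linarith

lemma arg_cpt {ε : ℝ} (h0 : 0 < ε) (h1 : ε < π) : arg (cpt ε) = ε := by
  rw [cpt, exp_mul_I]
  exact arg_cos_add_sin_mul_I ⟨by linarith, h1.le⟩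

end Conclusion

section Assembly

lemma smul_notMem_slits {κ : Type*} {a : κ → ℂ} (ha : ∀ k, ‖a k‖ = 1) {z : ℂ} (hz : ‖z‖ = 1)
    (hne : ∀ j, z ≠ a j) {r : ℝ} (hr : 0 < r) {T : Set ℝ} (hT : ∀ t ∈ T, 0 < t) :
    (r : ℂ) * z ∉ ⋃ k, (fun t : ℝ => (t : ℂ) * a k) '' T := by
  simp only [mem_iUnion, mem_image, not_exists, not_and]
  intro j t ht h
  have h2 := congrArg norm h
  rw [norm_mul, norm_mul, ha, hz, norm_real, norm_real,
    norm_of_nonneg (hT t ht).le, norm_of_nonneg hr.le, mul_one, mul_one] at h2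
  rw [h2] at h
  exact hne j (mul_left_cancel₀ (ofReal_ne_zero.mpr hr.ne') h).symm

/-- A function continuous off radial slits has the radial access required by `scattering_eq`. -/
lemma eventually_radial_mem {κ : Type*} [Finite κ] {a : κ → ℂ} (ha : ∀ k, ‖a k‖ = 1) {D : ℂ → ℂ}
    {U : Set ℝ} {T : Set ℝ} (hT : ∀ t ∈ T, 0 < t) (hU : U ∈ nhds 1)
    (hD : ContinuousOn D ({z : ℂ | ‖z‖ ∈ U} \ ⋃ k, (fun t : ℝ => (t : ℂ) * a k) '' T)) (k : κ)
    {φ : ℝ → ℝ} (hφ : ContinuousAt φ 1) (hφ1 : φ 1 = 1) :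
    ∀ᶠ ε : ℝ in 𝓝[>] 0, ContinuousWithinAt D
        ({z : ℂ | ‖z‖ ∈ U} \ ⋃ k, (fun t : ℝ => (t : ℂ) * a k) '' T) (a k * cpt ε) ∧
      ∀ᶠ r : ℝ in 𝓝[<] 1, ((φ r : ℝ) : ℂ) * (a k * cpt ε) ∈
        {z : ℂ | ‖z‖ ∈ U} \ ⋃ k, (fun t : ℝ => (t : ℂ) * a k) '' T := by
  have hak : a k ≠ 0 := norm_ne_zero_iff.mp (ha k ▸ one_ne_zero)
  filter_upwards [eventually_mul_cpt_ne (b := a) hak] with ε hne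
  have hn : ‖a k * cpt ε‖ = 1 := by rw [norm_mul, ha, norm_cpt, one_mul]
  have key : ∀ r : ℝ, 0 < r → r ∈ U → (r : ℂ) * (a k * cpt ε) ∈
      {z : ℂ | ‖z‖ ∈ U} \ ⋃ k, (fun t : ℝ => (t : ℂ) * a k) '' T := fun r hr hrU => by
    refine ⟨?_, smul_notMem_slits ha hn hne hr hT⟩
    rw [mem_ofPred_eq, norm_mul, hn, Complex.norm_of_nonneg hr.le, mul_one]
    exact hrU
  refine ⟨hD _ ?_, ?_⟩
  · have := key 1 one_pos (mem_of_mem_nhds hU)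
    rwa [ofReal_one, one_mul] at this
  · refine nhdsWithin_le_nhds ?_
    rw [← hφ1] at hU
    filter_upwards [hφ.preimage_mem_nhds hU,
      hφ.eventually (lt_mem_nhds (hφ1.symm ▸ one_pos : (0 : ℝ) < φ 1))] with r h1 h2
    exact key _ h2 h1

lemma wtF_subtype {ι : Type*} [Fintype ι] (g : ℝ → ℝ) (a : ι → ℂ) (β : ι → ℝ) (θ : ℝ) :
    wtF g (fun k : {k // β k ≠ 0} => a k) (fun k => β k) θ =
      g θ * ∏ k, ‖cpt θ - a k‖ ^ (2 * β k) := by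
  classical
  rw [wtF, ← Fintype.prod_subtype_mul_prod_subtype (fun k => β k ≠ 0)
    fun k => ‖cpt θ - a k‖ ^ (2 * β k)]
  have h : ∏ k : {k // ¬ β k ≠ 0}, ‖cpt θ - a k‖ ^ (2 * β k) = 1 :=
    prod_eq_one fun k _ => by
      rw [not_not.mp k.2, mul_zero, Real.rpow_zero]
  rw [h, mul_one]

lemma isOPUC_wtν {ι : Type*} [Fintype ι] {Γ : ℂ → ℂ} {a : ι → ℂ} {β : ι → ℝ} {R : ℝ} {g : ℝ → ℝ}
    (S : IsSzData Γ a β R g) {Φ : ℕ → ℂ[X]} (hm : ∀ n, (Φ n).Monic)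
    (hd : ∀ n, (Φ n).natDegree = n)
    (ho : ∀ n, ∀ j < n, ∫ θ in (0 : ℝ)..(2 * π),
      (Φ n).eval (cpt θ) * conj (cpt θ) ^ j * ((wtF g a β θ : ℝ) : ℂ) = 0) :
    IsOPUC (wtν g a β) Φ where
  nondeg := fun P hP => nondeg_wtν S.continuous_weight S.weight_pos S.norm_a S.inj S.beta P hP
  monic := hm
  natDegree := hd
  orth := fun n j hj => by
    rw [cI, integral_wtν S.continuous_weight S.weight_pos, integral_arcμ]
    have h := ho n j hj
    have e : (fun θ : ℝ => wtF g a β θ • ((Φ n).eval (cpt θ) * conj (cpt θ) ^ j)) =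
        fun θ => (Φ n).eval (cpt θ) * conj (cpt θ) ^ j * ((wtF g a β θ : ℝ) : ℂ) := by
      funext θ
      rw [real_smul, mul_comm]
    rw [e, h, smul_zero]

lemma exists_root_near {Φ : ℕ → ℂ[X]} {t : ℂ}
    (ht : t ∈ ⋂ k : ℕ, closure (⋃ n : ℕ, ⋃ _ : k ≤ n, {z : ℂ | (Φ n).IsRoot z})) (N : ℕ) {ε : ℝ}
    (hε : 0 < ε) : ∃ n, N ≤ n ∧ ∃ z, (Φ n).eval z = 0 ∧ ‖z - t‖ < ε := by
  obtain ⟨z, hz, hzt⟩ := Metric.mem_closure_iff.mp (mem_iInter.mp ht N) ε hε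
  simp only [mem_iUnion, mem_ofPred_eq, exists_prop] at hz
  obtain ⟨n, hn, hr⟩ := hz
  exact ⟨n, hn, z, hr, by rwa [← dist_eq_norm, dist_comm]⟩

lemma eq_mul_exp_of_arg {a A : ℂ} (ha : ‖a‖ = 1) (hA : ‖A‖ = 1) {x y : ℝ}
    (hx : x = (arg a - arg A) / (2 * π)) (hy : ∃ j : ℤ, x - y = j) :
    a = A * exp (2 * (π : ℂ) * I * (y : ℂ)) := by
  obtain ⟨j, hj⟩ := hy
  have e1 := norm_mul_exp_arg_mul_I a
  have e2 := norm_mul_exp_arg_mul_I A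
  rw [ha, ofReal_one, one_mul] at e1
  rw [hA, ofReal_one, one_mul] at e2
  rw [← e1, ← e2, ← exp_add, exp_eq_exp_iff_exists_int]
  refine ⟨j, ?_⟩
  have h : arg a = arg A + (y + j) * (2 * π) := by
    have : y + j = x := by linarith
    rw [this, hx]
    field_simp
    ring
  rw [h]
  push_cast
  ring

end Assembly

theorem stmt9
    (ρ : ℝ) (hρ0 : 0 < ρ) (hρ1 : ρ < 1)
    (m : ℕ) (hm : 0 < m)
    (a : Fin m → ℂ) (ha : ∀ k, ‖a k‖ = 1) (ha' : Function.Injective a)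
    (β : Fin m → ℝ) (hβ : ∀ k, -(1/2 : ℝ) < β k)
    (w : ℂ → ℂ)
    (hw_an : AnalyticOn ℂ w {z : ℂ | ρ < ‖z‖ ∧ ‖z‖ < 1/ρ})
    (hw_ne : ∀ z : ℂ, ρ < ‖z‖ → ‖z‖ < 1/ρ → w z ≠ 0)
    (hw_pos : ∀ z : ℂ, ‖z‖ = 1 → 0 < (w z).re ∧ (w z).im = 0)
    (W : ℂ → ℝ)
    (hW : ∀ z : ℂ, ‖z‖ = 1 → W z = (w z).re * ∏ k, ‖z - a k‖ ^ (2 * β k))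
    (Φ : ℕ → Polynomial ℂ)
    (hΦmonic : ∀ n, (Φ n).Monic) (hΦdeg : ∀ n, (Φ n).natDegree = n)
    (hΦorth : ∀ n : ℕ, ∀ j < n,
      (∫ θ in (0:ℝ)..(2 * π),
        (Φ n).eval (Complex.exp (θ * Complex.I)) *
          (starRingEnd ℂ) (Complex.exp (θ * Complex.I)) ^ j *
          (W (Complex.exp (θ * Complex.I)) : ℂ)) = 0)
    (Di De : ℂ → ℂ)
    (hDi_def : ∀ z : ℂ, ‖z‖ < 1 → Di z =
      Complex.exp (((4 * π : ℝ)⁻¹ : ℂ) * ∫ θ in (0:ℝ)..(2 * π),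
        (Real.log (W (Complex.exp (θ * Complex.I))) : ℂ) *
          ((Complex.exp (θ * Complex.I) + z) / (Complex.exp (θ * Complex.I) - z))))
    (hDe_def : ∀ z : ℂ, 1 < ‖z‖ → De z =
      Complex.exp (((4 * π : ℝ)⁻¹ : ℂ) * ∫ θ in (0:ℝ)..(2 * π),
        (Real.log (W (Complex.exp (θ * Complex.I))) : ℂ) *
          ((Complex.exp (θ * Complex.I) + z) / (Complex.exp (θ * Complex.I) - z))))
    (hDi_an : AnalyticOn ℂ Di
      ({z : ℂ | ‖z‖ < 1/ρ} \ ⋃ k, (fun t : ℝ => (t : ℂ) * a k) '' Set.Ico 1 (1/ρ)))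
    (hDe_an : AnalyticOn ℂ De
      ({z : ℂ | ρ < ‖z‖} \ ⋃ k, (fun t : ℝ => (t : ℂ) * a k) '' Set.Ioc ρ 1))
    (δ : ℝ) (hδ0 : 0 < δ) (hδρ : δ < 1 - ρ)
    (hδa : ∀ i j : Fin m, i ≠ j → 3 * δ < ‖a i - a j‖)
    (Sk : Fin m → ℂ → ℂ)
    (hSk_an : ∀ k, AnalyticOn ℂ (Sk k) (Metric.ball (a k) δ))
    (hSk_plus : ∀ k, ∀ z ∈ Metric.ball (a k) δ, 0 < Complex.arg (z / a k) →
      Sk k z = Complex.exp (((π * β k : ℝ) : ℂ) * Complex.I) * (Di z * De z))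
    (hSk_minus : ∀ k, ∀ z ∈ Metric.ball (a k) δ, Complex.arg (z / a k) < 0 →
      Sk k z = Complex.exp (-((π * β k : ℝ) : ℂ) * Complex.I) * (Di z * De z))
    (ϑ : Fin m → ℂ) (hϑ : ∀ k, ϑ k = Sk k (a k))
    (θv : Fin m → ℝ) (hθ0 : θv ⟨0, hm⟩ = 1)
    (hθk : ∀ k : Fin m, k ≠ ⟨0, hm⟩ →
      θv k = (Complex.arg (a k) - Complex.arg (a ⟨0, hm⟩)) / (2 * π))
    (Z : Set ℂ)
    (hZ : Z = ⋂ k : ℕ, closure (⋃ n : ℕ, ⋃ _ : k ≤ n, {z : ℂ | (Φ n).IsRoot z}))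
    (hrat : ∀ k : Fin m, ∃ r : ℚ, θv k = (r : ℝ))
    (q p : Fin m → ℕ) (hq0 : q ⟨0, hm⟩ = 1) (hqpos : ∀ k, 0 < q k)
    (hpq : ∀ k, p k < q k)
    (hmod : ∀ k, ∃ j : ℤ, θv k - (p k : ℝ) / (q k : ℝ) = (j : ℝ)) :
    ∀ t : ℂ, t ∈ Z ∩ Metric.ball (0 : ℂ) 1 →
      ∃ s : Fin m → ℕ, (∀ k, s k < q k) ∧
        (∑ k, (β k : ℂ) * ϑ k / (a k - t) *
          Complex.exp (2 * (π : ℂ) * Complex.I * (((s k : ℝ) / (q k : ℝ) : ℝ) : ℂ))) = 0 := by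
  classical
  rintro t ⟨htZ, ht1⟩
  rw [mem_ball_zero_iff] at ht1
  obtain ⟨Γ, R, hR, hΓ, hΓ0, hwΓ⟩ := exists_szego_log hρ0 hρ1 hw_an hw_pos
  let b : {k // β k ≠ 0} → ℂ := fun k => a k
  let γ : {k // β k ≠ 0} → ℝ := fun k => β k
  let g : ℝ → ℝ := fun θ => (w (cpt θ)).re
  have S : IsSzData Γ b γ R g :=
    ⟨fun k => ha k, ha'.comp Subtype.val_injective, fun k => hβ k, hR, hΓ,
      fun θ => hwΓ _ (norm_cpt θ)⟩
  have hWF : ∀ θ : ℝ, W (exp (θ * I)) = wtF g b γ θ := fun θ =>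
    (hW _ (norm_cpt θ)).trans (wtF_subtype g a β θ).symm
  simp only [hWF] at hΦorth hDi_def hDe_def
  have H : IsOPUC (wtν g b γ) Φ := isOPUC_wtν S hΦmonic hΦdeg hΦorth
  have hDi : ∀ u, ‖u‖ < 1 → Di u = szD Γ b γ u := fun u hu =>
    (hDi_def u hu).trans (exp_schwarz (S.schwarz_integral hΓ0 hu))
  have hDe : ∀ u, ‖u‖ < 1 → u ≠ 0 → De (conj u)⁻¹ = (conj (szD Γ b γ u))⁻¹ := fun u hu hu0 => by
    have h1 : 1 < ‖(conj u)⁻¹‖ := by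
      rw [norm_inv, RCLike.norm_conj]
      exact (one_lt_inv₀ (norm_pos_iff.mpr hu0)).mpr hu
    have h2 := S.schwarz_integral_exterior hΓ0 hu hu0
    have e : -conj (2 * szH Γ b γ u) = 2 * -conj (szH Γ b γ u) := by
      rw [map_mul, conj_ofNat]; ring
    rw [e] at h2
    rw [szD, ← exp_conj, ← exp_neg]
    exact (hDe_def _ h1).trans (exp_schwarz h2)
  have hϑeq : ∀ k : {k // β k ≠ 0}, ϑ k = exp (2 * szLam Γ b γ k * I) := by
    intro k
    rw [hϑ]
    refine S.scattering_eq hΓ0 k hDi hDe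
      (eventually_radial_mem (U := Iio (1 / ρ)) ha (fun t ht => one_pos.trans_le ht.1)
        (Iio_mem_nhds (one_lt_one_div hρ0 hρ1)) hDi_an.continuousOn (k : Fin m) (φ := id)
        continuousAt_id rfl)
      (eventually_radial_mem (U := Ioi ρ) ha (fun t ht => hρ0.trans ht.1)
        (Ioi_mem_nhds hρ1) hDe_an.continuousOn (k : Fin m) (φ := fun r => r⁻¹)
        (continuousAt_inv₀ one_ne_zero) inv_one)
      ((hSk_an k).continuousOn.continuousAt (ball_mem_nhds _ hδ0)) ?_
    filter_upwards [tendsto_mul_cpt (a k) (ball_mem_nhds (a k) hδ0), Ioo_mem_nhdsGT pi_pos] with ε h1 h2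
    have hak : a k ≠ 0 := norm_ne_zero_iff.mp (ha k ▸ one_ne_zero)
    refine hSk_plus k _ h1 ?_
    rw [mul_div_cancel_left₀ _ hak, arg_cpt h2.1 h2.2]
    exact h2.1
  have hv : Tendsto (fun n : ℕ => ((n : ℂ) + 1) * conj (vb Φ n) +
      ∑ k, ((γ k : ℂ) * ϑ k) * b k ^ (n + 1)) atTop (nhds 0) := by
    simp only [hϑeq]
    exact S.verblunsky (fun k => k.2) H
  have := S.isFiniteMeasure
  obtain ⟨x, hx, hb⟩ := H.exists_zero_bound S.norm_a hv (r := (1 + ‖t‖) / 2) (by positivity)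
    (by linarith)
  have hap : ∀ k, a k = a ⟨0, hm⟩ *
      exp (2 * (π : ℂ) * I * (((p k : ℝ) / (q k : ℝ) : ℝ) : ℂ)) := by
    intro k
    by_cases hk : k = ⟨0, hm⟩
    · have h0 : p k = 0 := by have := hpq k; rw [hk, hq0] at this; rw [hk]; omega
      rw [h0, hk]
      simp
    · exact eq_mul_exp_of_arg (ha k) (ha _) (hθk k hk) (hmod k)
  obtain ⟨s, hs, hsum⟩ := exists_phase_relation S.norm_a (ha ⟨0, hm⟩)
    (q := fun k : {k // β k ≠ 0} => q k) (p := fun k => p k) (fun k => hqpos k)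
    (fun k => hap k) (t := t) (by linarith) (by linarith) hx hb
    fun N ε hε => exists_root_near (hZ ▸ htZ) N hε
  refine ⟨fun k => if h : β k ≠ 0 then s ⟨k, h⟩ else 0, fun k => ?_, ?_⟩
  · by_cases h : β k ≠ 0
    · simpa [h] using hs ⟨k, h⟩
    · simpa [h] using hqpos k
  · rw [← Fintype.sum_subtype_add_sum_subtype (fun k => β k ≠ 0)]
    refine (congrArg₂ (· + ·) ((sum_congr rfl fun k _ => ?_).trans hsum)
      (sum_eq_zero fun k _ => ?_)).trans (add_zero 0)
    · simp only [dif_pos k.2]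
      rfl
    · rw [not_not.mp k.2, ofReal_zero, zero_mul, zero_div, zero_mul]
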